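/- Assume d ≥ 2, k ∈ {1,…,d−1}, 2 < p < 2_s^⋆, and let (g_ε) be (s,γ)-admissible for some s > d/(d+1) and γ > 1. Then there exist constants 0 < c' ≤ C' < ∞ and ε₀ ∈ (0,1), depending only on d, p, k, s, γ and the admissibility constants, such that for all ε ∈ (0, ε₀): c' ε^{1 − min(1,α_k)/γ} ≤ R^k_ε(p) ≤ C' ε^{1 − min(1,α_k)/γ}. -/

import Mathlib

open MeasureTheory Real Filter
open scoped ENNReal FourierTransform RealInnerProductSpace Topology

noncomputable section

/-- Euclidean space `ℝ^d`. -/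
abbrev Rd (d : ℕ) : Type := EuclideanSpace ℝ (Fin d)

/-- `U` is the (distributional, hence `L²`-) Fourier transform of `u`:
it pairs against Schwartz functions the way the Fourier transform of `u` must. -/
def IsFT {d : ℕ} (U u : Rd d → ℂ) : Prop :=
  ∀ φ : SchwartzMap (Rd d) ℂ, ∫ ξ, U ξ * φ ξ = ∫ x, u x * 𝓕 (⇑φ) x

/-- An element of `H^s(ℝ^d)`: an `L²` function `toFun` together with its Fourier
transform `ft`, satisfying the `H^s` integrability condition. -/
structure HsFn (d : ℕ) (s : ℝ) where
  toFun : Rd d → ℂ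
  ft : Rd d → ℂ
  memL2 : MemLp toFun 2 volume
  ft_memL2 : MemLp ft 2 volume
  isFT : IsFT ft toFun
  memHs : Integrable (fun ξ : Rd d => ‖ft ξ‖ ^ 2 * (1 + ‖ξ‖ ^ 2) ^ s) volume

/-- The quadratic form `q_ε(u) = ∫ |û(ξ)|² g(|ξ|) dξ` (for a fixed symbol `g`). -/
def qeps {d : ℕ} {s : ℝ} (g : ℝ → ℝ) (u : HsFn d s) : ℝ :=
  ∫ ξ : Rd d, ‖u.ft ξ‖ ^ 2 * g ‖ξ‖

/-- The `L^p` norm (as a real number). -/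
def LpN {d : ℕ} (p : ℝ) (f : Rd d → ℂ) : ℝ :=
  (eLpNorm f (ENNReal.ofReal p) volume).toReal

/-- The set of values of the Rayleigh quotient `q_ε(u)/‖u‖_p²` over nonzero
`u ∈ H^s` satisfying the symmetry constraint `P`. -/
def RayleighSet (d : ℕ) (s p : ℝ) (g : ℝ → ℝ) (P : (Rd d → ℂ) → Prop) : Set ℝ :=
  {t | ∃ u : HsFn d s, P u.toFun ∧ ¬ u.toFun =ᵐ[volume] (fun _ => (0 : ℂ)) ∧
      MemLp u.toFun (ENNReal.ofReal p) volume ∧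
      t = qeps g u / LpN p u.toFun ^ 2}

/-- The Rayleigh quotient infimum. -/
def Rayleigh (d : ℕ) (s p : ℝ) (g : ℝ → ℝ) (P : (Rd d → ℂ) → Prop) : ℝ :=
  sInf (RayleighSet d s p g P)

/-- The Rayleigh quotient infimum is attained. -/
def Attained (d : ℕ) (s p : ℝ) (g : ℝ → ℝ) (P : (Rd d → ℂ) → Prop) : Prop :=
  ∃ u : HsFn d s, P u.toFun ∧ ¬ u.toFun =ᵐ[volume] (fun _ => (0 : ℂ)) ∧
      MemLp u.toFun (ENNReal.ofReal p) volume ∧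
      qeps g u / LpN p u.toFun ^ 2 = Rayleigh d s p g P

/-- A radial function. -/
def Radial {d : ℕ} (f : Rd d → ℂ) : Prop := ∀ x y : Rd d, ‖x‖ = ‖y‖ → f x = f y

/-- The squared norm of the first block of coordinates (the first `d - k` ones),
under the identification `ℝ^d = ℝ^{d-k} × ℝ^k`. -/
def blockSq (d k : ℕ) (x : Rd d) : ℝ := ∑ i : Fin d, if (i : ℕ) < d - k then x i ^ 2 else 0

/-- A `G_k = O(d-k) × O(k)`-symmetric function: it depends only on the norms of the
two blocks of coordinates. -/
def GkSymmetric (d k : ℕ) (f : Rd d → ℂ) : Prop :=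
  ∀ x y : Rd d, blockSq d k x = blockSq d k y → ‖x‖ = ‖y‖ → f x = f y

/-- An `(s,γ)`-admissible family of symbols, with admissibility constants `c, C`. -/
def IsAdmissible (s γ c C : ℝ) (g : ℝ → ℝ → ℝ) : Prop :=
  (∀ ε ∈ Set.Ioo (0:ℝ) 1, Measurable (g ε)) ∧
  (∀ ε ∈ Set.Ioo (0:ℝ) 1, ∀ r : ℝ, 0 < g ε r) ∧
  (∀ ε ∈ Set.Ioo (0:ℝ) 1, ∀ r : ℝ, 1/2 ≤ |r - 1| →
      c * (1 + |r| ^ (2*s)) ≤ g ε r ∧ g ε r ≤ C * (1 + |r| ^ (2*s))) ∧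
  (∀ ε ∈ Set.Ioo (0:ℝ) 1, ∀ r : ℝ, |r - 1| ≤ 1/2 →
      c * (ε + |r - 1| ^ γ) ≤ g ε r ∧ g ε r ≤ C * (ε + |r - 1| ^ γ))

/-- The `G_k`-symmetric Stein–Tomas exponent `2_⋆^k`. -/
def twoStarK (d k : ℕ) : ℝ :=
  2 * ((d : ℝ) + (min k (d - k) : ℕ)) / ((d : ℝ) - 2 + (min k (d - k) : ℕ))

/-- The interpolation parameter `α_k`. -/
def alphaK (d k : ℕ) (p : ℝ) : ℝ := (1/2 - 1/p) / (1/2 - 1/twoStarK d k)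

/-- The spherical shell `A_{ε,δ}` around the unit sphere (with `I_{ε,δ}` scale `ε^{1/γ}`). -/
def Aset (d : ℕ) (γ ε δ : ℝ) : Set (Rd d) :=
  {ξ | δ * ε ^ (1/γ) ≤ |‖ξ‖ - 1| ∧ |‖ξ‖ - 1| ≤ δ⁻¹ * ε ^ (1/γ)}


open MeasureTheory Real Filter
open scoped ENNReal FourierTransform RealInnerProductSpace Topology

noncomputable section

section Planch
variable {V : Type*} [NormedAddCommGroup V] [InnerProductSpace ℝ V] [FiniteDimensional ℝ V]
  [MeasurableSpace V] [BorelSpace V]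

theorem schwartz_test_unique (U1 U2 : V → ℂ) (h1 : LocallyIntegrable U1) (h2 : LocallyIntegrable U2)
    (h : ∀ φ : SchwartzMap V ℂ, ∫ ξ, U1 ξ * φ ξ = ∫ ξ, U2 ξ * φ ξ) : U1 =ᵐ[volume] U2 := by
  apply ae_eq_of_integral_contDiff_smul_eq h1 h2
  intro g hg hgc
  have hg' : ContDiff ℝ (⊤ : ℕ∞) (fun x => (g x : ℂ)) := by
    have := Complex.ofRealCLM.contDiff (n := ((⊤ : ℕ∞) : WithTop ℕ∞))
    exact this.comp hg
  have hgc' : HasCompactSupport (fun x => (g x : ℂ)) := by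
    exact hgc.comp_left (g := fun r : ℝ => (r : ℂ)) (by simp)
  have := h (hgc'.toSchwartzMap hg')
  simp only [HasCompactSupport.toSchwartzMap_toFun] at this
  simpa [mul_comm] using this

theorem lpFourier_pair (f : V → ℂ) (h2 : MemLp f 2) (φ : SchwartzMap V ℂ) :
    ∫ ξ, (𝓕 (h2.toLp f) : Lp ℂ 2 (volume : Measure V)) ξ * φ ξ = ∫ x, f x * 𝓕 (⇑φ) x := by
  have h := Lp.fourier_toTemperedDistribution_eq (h2.toLp f)
  have h' := DFunLike.congr_fun h φ
  rw [TemperedDistribution.fourier_apply] at h'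
  simp only [Lp.toTemperedDistribution_apply, smul_eq_mul] at h'
  have e1 : ∀ x, (𝓕 φ : SchwartzMap V ℂ) x = 𝓕 (⇑φ) x := fun x => rfl
  simp only [mul_comm _ (φ _)]
  rw [← h']
  apply integral_congr_ae
  filter_upwards [h2.coeFn_toLp] with x hx
  rw [hx, e1, mul_comm]

theorem fourier_pair (f : V → ℂ) (h1 : Integrable f) (φ : SchwartzMap V ℂ) :
    ∫ ξ, 𝓕 f ξ * φ ξ = ∫ x, f x * 𝓕 (⇑φ) x := by
  have := VectorFourier.integral_fourierIntegral_smul_eq_flip (e := Real.fourierChar) (μ := volume)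
    (ν := volume) (L := innerₗ V) (f := f) (g := ⇑φ) Real.continuous_fourierChar
    (by exact continuous_inner) h1 φ.integrable
  simp only [flip_innerₗ, smul_eq_mul] at this
  exact this

theorem memLp_locInt (U : V → ℂ) (h2 : MemLp U 2) : LocallyIntegrable U :=
  h2.locallyIntegrable (by norm_num)

theorem planch_L1L2 (f : V → ℂ) (h1 : Integrable f) (h2 : MemLp f 2) :
    MemLp (𝓕 f) 2 ∧ eLpNorm (𝓕 f) 2 volume = eLpNorm f 2 volume := by
  have hc : Continuous (𝓕 f) := by
    exact VectorFourier.fourierIntegral_continuous Real.continuous_fourierChar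
      (by exact continuous_inner) h1
  have hae : 𝓕 f =ᵐ[volume] (𝓕 (h2.toLp f) : Lp ℂ 2 (volume : Measure V)) := by
    apply schwartz_test_unique _ _ hc.locallyIntegrable (memLp_locInt _ (Lp.memLp _))
    intro φ
    rw [fourier_pair f h1, lpFourier_pair]
  have hn := Lp.norm_fourier_eq (h2.toLp f)
  constructor
  · exact (memLp_congr_ae hae).2 (Lp.memLp _)
  · rw [eLpNorm_congr_ae hae]
    rw [Lp.norm_def, Lp.norm_def] at hn
    rw [ENNReal.toReal_eq_toReal_iff' (Lp.eLpNorm_ne_top _) (Lp.eLpNorm_ne_top _)] at hn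
    rw [hn]
    exact eLpNorm_congr_ae h2.coeFn_toLp

theorem planch_pair (U u : V → ℂ) (hU : MemLp U 2) (hu : MemLp u 2)
    (h : ∀ φ : SchwartzMap V ℂ, ∫ ξ, U ξ * φ ξ = ∫ x, u x * 𝓕 (⇑φ) x) :
    eLpNorm U 2 volume = eLpNorm u 2 volume := by
  have hae : U =ᵐ[volume] (𝓕 (hu.toLp u) : Lp ℂ 2 (volume : Measure V)) := by
    apply schwartz_test_unique _ _ (memLp_locInt _ hU) (memLp_locInt _ (Lp.memLp _))
    intro φ
    rw [h, lpFourier_pair]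
  have hn := Lp.norm_fourier_eq (hu.toLp u)
  rw [eLpNorm_congr_ae hae]
  rw [Lp.norm_def, Lp.norm_def] at hn
  rw [ENNReal.toReal_eq_toReal_iff' (Lp.eLpNorm_ne_top _) (Lp.eLpNorm_ne_top _)] at hn
  rw [hn]
  exact eLpNorm_congr_ae hu.coeFn_toLp

theorem planch_inv_L1L2 (f : V → ℂ) (h1 : Integrable f) (h2 : MemLp f 2) :
    MemLp (𝓕⁻ f) 2 ∧ eLpNorm (𝓕⁻ f) 2 volume = eLpNorm f 2 volume := by
  have e : 𝓕⁻ f = (𝓕 f) ∘ (fun x => -x) := by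
    ext x; rw [Real.fourierInv_eq_fourier_neg]; rfl
  obtain ⟨a, b⟩ := planch_L1L2 f h1 h2
  have mp : MeasurePreserving (fun x : V => -x) volume volume := Measure.measurePreserving_neg _
  rw [e]
  exact ⟨a.comp_measurePreserving mp, by rw [eLpNorm_comp_measurePreserving a.1 mp, b]⟩

/-- the inverse Fourier transform of an `L¹` function pairs as it should -/
theorem fourierInv_pair (f : V → ℂ) (h1 : Integrable f) (φ : SchwartzMap V ℂ) :
    ∫ ξ, f ξ * φ ξ = ∫ x, 𝓕⁻ f x * 𝓕 (⇑φ) x := by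
  have h := fourier_pair f h1 (𝓕⁻ φ)
  have e0 : (⇑(𝓕⁻ φ : SchwartzMap V ℂ)) = 𝓕⁻ (⇑φ) := SchwartzMap.fourierInv_coe φ
  have e1 : 𝓕 (⇑(𝓕⁻ φ : SchwartzMap V ℂ)) = ⇑φ := by
    rw [← SchwartzMap.fourier_coe]; simp
  rw [e1] at h
  rw [← h, ← integral_neg_eq_self]
  congr 1
  ext x
  rw [e0, Real.fourierInv_eq_fourier_neg, Real.fourierInv_eq_fourier_neg]
  simp
end Planch
end


open MeasureTheory Real Filter
open scoped ENNReal FourierTransform RealInnerProductSpace Topology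

noncomputable section

section Osc

/-- majorant for the contour-shifted amplitude -/
def Wk (κ y : ℝ) : ℝ := y ^ κ * (2 + y) ^ |κ|

def mL (κ y : ℝ) : ℂ := Complex.I * ((2 - Complex.I * y) ^ (κ : ℂ) * (Complex.I * y) ^ (κ : ℂ))
def mR (κ y : ℝ) : ℂ := -Complex.I * ((- Complex.I * y) ^ (κ : ℂ) * (2 + Complex.I * y) ^ (κ : ℂ))

def Iosc (κ s : ℝ) : ℂ := ∫ y in (-1:ℝ)..1, Complex.exp (Complex.I * s * y) * (((1 - y^2) ^ κ : ℝ) : ℂ)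

theorem two_norm_rpow (κ y : ℝ) (hy : 0 < y) (z : ℂ) (h1 : 2 ≤ ‖z‖) (h2 : ‖z‖ ≤ 2 + y) :
    ‖z‖ ^ κ ≤ (2 + y) ^ |κ| := by
  rcases le_total 0 κ with h | h
  · rw [abs_of_nonneg h]; exact Real.rpow_le_rpow (norm_nonneg _) h2 h
  · calc ‖z‖ ^ κ ≤ 1 := Real.rpow_le_one_of_one_le_of_nonpos (by linarith) h
      _ ≤ _ := Real.one_le_rpow (by linarith) (abs_nonneg _)

theorem norm_2I (y : ℝ) (hy : 0 < y) : 2 ≤ ‖(2 + Complex.I * y : ℂ)‖ ∧ ‖(2 + Complex.I * y : ℂ)‖ ≤ 2 + y := by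
  constructor
  · have := Complex.abs_re_le_norm (2 + Complex.I * y : ℂ)
    simpa using this
  · refine (norm_add_le _ _).trans ?_
    simp [abs_of_pos hy]

theorem norm_2I' (y : ℝ) (hy : 0 < y) : 2 ≤ ‖(2 - Complex.I * y : ℂ)‖ ∧ ‖(2 - Complex.I * y : ℂ)‖ ≤ 2 + y := by
  constructor
  · have := Complex.abs_re_le_norm (2 - Complex.I * y : ℂ)
    simpa using this
  · refine (norm_sub_le _ _).trans ?_
    simp [abs_of_pos hy]

theorem norm_mL (κ y : ℝ) (hy : 0 < y) : ‖mL κ y‖ ≤ Wk κ y := by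
  unfold mL Wk
  rw [norm_mul, norm_mul, Complex.norm_I, one_mul, mul_comm, Complex.norm_cpow_real, Complex.norm_cpow_real]
  simp only [norm_mul, Complex.norm_I, one_mul, Complex.norm_real, Real.norm_eq_abs, abs_of_pos hy]
  gcongr
  exact two_norm_rpow κ y hy _ (norm_2I' y hy).1 (norm_2I' y hy).2

theorem norm_mR (κ y : ℝ) (hy : 0 < y) : ‖mR κ y‖ ≤ Wk κ y := by
  unfold mR Wk
  rw [norm_mul, norm_mul, norm_neg, Complex.norm_I, one_mul, Complex.norm_cpow_real, Complex.norm_cpow_real]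
  simp only [norm_mul, norm_neg, Complex.norm_I, one_mul, Complex.norm_real, Real.norm_eq_abs, abs_of_pos hy]
  gcongr
  exact two_norm_rpow κ y hy _ (norm_2I y hy).1 (norm_2I y hy).2

theorem mL_meas (κ : ℝ) : Measurable (mL κ) := by unfold mL; fun_prop
theorem mR_meas (κ : ℝ) : Measurable (mR κ) := by unfold mR; fun_prop
theorem Wk_meas (κ : ℝ) : Measurable (Wk κ) := by unfold Wk; fun_prop

theorem Wk_nonneg (κ y : ℝ) (hy : 0 < y) : 0 ≤ Wk κ y := by unfold Wk; positivity

theorem Wk_scale (κ t z : ℝ) (ht : 1 ≤ t) (hz : 0 < z) : t⁻¹ * Wk κ (z / t) ≤ t ^ (-1 - κ) * Wk κ z := by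
  have ht0 : 0 < t := by linarith
  unfold Wk
  rw [Real.div_rpow hz.le ht0.le, Real.rpow_sub ht0, Real.rpow_neg_one]
  have : (2 + z / t) ^ |κ| ≤ (2 + z) ^ |κ| := by
    gcongr
    exact div_le_self hz.le ht
  calc t⁻¹ * (z ^ κ / t ^ κ * (2 + z / t) ^ |κ|) ≤ t⁻¹ * (z ^ κ / t ^ κ * (2 + z) ^ |κ|) := by gcongr
    _ = _ := by ring

theorem Wk_int (κ c : ℝ) (hκ : -1 < κ) (hc : 0 < c) :
    IntegrableOn (fun y => Real.exp (-c * y) * Wk κ y) (Set.Ioi 0) := by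
  have h0 := integrableOn_rpow_mul_exp_neg_mul_rpow (s := κ) (p := 1) (b := c/2) hκ (by norm_num) (by linarith)
  obtain ⟨M, hM⟩ : ∃ M : ℝ, ∀ y : ℝ, 0 < y → (2 + y) ^ |κ| * Real.exp (-(c/2) * y) ≤ M := by
    have ht := tendsto_rpow_mul_exp_neg_mul_atTop_nhds_zero |κ| (c/2) (by linarith)
    have hcont : ContinuousOn (fun x : ℝ => x ^ |κ| * Real.exp (-(c/2) * x)) (Set.Ici 0) := by
      apply ContinuousOn.mul
      · exact (Real.continuous_rpow_const (abs_nonneg _)).continuousOn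
      · fun_prop
    obtain ⟨B, hB⟩ : ∃ B, ∀ x : ℝ, 0 ≤ x → x ^ |κ| * Real.exp (-(c/2) * x) ≤ B := by
      have he := (ht.eventually (gt_mem_nhds (show (0:ℝ) < 1 by norm_num)))
      obtain ⟨N, hN⟩ := eventually_atTop.1 he
      obtain ⟨B, hB⟩ := (isCompact_Icc (a := (0:ℝ)) (b := N)).bddAbove_image (hcont.mono (fun x hx => hx.1))
      refine ⟨max B 1, fun x hx => ?_⟩
      rcases le_total x N with h | h
      · exact le_max_of_le_left (hB ⟨x, ⟨hx, h⟩, rfl⟩)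
      · exact le_max_of_le_right (hN x h).le
    refine ⟨B * Real.exp c, fun y hy => ?_⟩
    have := hB (2 + y) (by linarith)
    calc (2 + y) ^ |κ| * Real.exp (-(c/2) * y) = ((2 + y) ^ |κ| * Real.exp (-(c/2) * (2 + y))) * Real.exp c := by
          rw [mul_assoc, ← Real.exp_add]; congr 2; ring
      _ ≤ _ := by gcongr
  refine Integrable.mono' (h0.const_mul M) ?_ ?_
  · exact (Measurable.aestronglyMeasurable (by have := Wk_meas κ; fun_prop))
  · refine (ae_restrict_mem measurableSet_Ioi).mono (fun y hy => ?_)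
    have hy : 0 < y := hy
    rw [Real.norm_of_nonneg (mul_nonneg (Real.exp_pos _).le (Wk_nonneg κ y hy))]
    unfold Wk
    rw [Real.rpow_one]
    have e : Real.exp (-c * y) = Real.exp (-(c/2) * y) * Real.exp (-(c/2) * y) := by
      rw [← Real.exp_add]; congr 1; ring
    rw [e]
    calc _ = ((2 + y) ^ |κ| * Real.exp (-(c/2) * y)) * (y ^ κ * Real.exp (-(c/2) * y)) := by ring
      _ ≤ M * (y ^ κ * Real.exp (-(c/2) * y)) := by
        gcongr
        exact hM y hy

theorem one_sub_sq_int (κ : ℝ) (hκ : -1 < κ) :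
    IntervalIntegrable (fun y : ℝ => (1 - y^2) ^ κ) volume (-1) 1 := by
  rcases le_total 0 κ with h | h
  · apply Continuous.intervalIntegrable
    exact (Real.continuous_rpow_const h).comp (by fun_prop)
  · have h1 : IntervalIntegrable (fun y : ℝ => (1 - y) ^ κ) volume (-1) 1 := by
      have := (intervalIntegral.intervalIntegrable_rpow' (a := 0) (b := 2) hκ).comp_sub_left 1
      norm_num at this
      exact this.symm
    have h2 : IntervalIntegrable (fun y : ℝ => (1 + y) ^ κ) volume (-1) 1 := by
      have := (intervalIntegral.intervalIntegrable_rpow' (a := 0) (b := 2) hκ).comp_add_left 1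
      norm_num at this
      exact this
    refine (h1.add h2).mono_fun' (Measurable.aestronglyMeasurable (by fun_prop)) ?_
    rw [Set.uIoc_of_le (by norm_num)]
    rw [← restrict_Ioo_eq_restrict_Ioc]
    refine (ae_restrict_mem measurableSet_Ioo).mono (fun y hy => ?_)
    have a1 : 0 < 1 - y := by linarith [hy.2]
    have a2 : 0 < 1 + y := by linarith [hy.1]
    have e : 1 - y^2 = (1 - y) * (1 + y) := by ring
    show ‖(1 - y^2) ^ κ‖ ≤ (1 - y) ^ κ + (1 + y) ^ κ
    rw [Real.norm_of_nonneg (by rw [e]; positivity), e]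
    rcases le_total 0 y with h3 | h3
    · calc ((1 - y) * (1 + y)) ^ κ ≤ (1 - y) ^ κ :=
          Real.rpow_le_rpow_of_nonpos a1 (by nlinarith) h
        _ ≤ _ := by simp; positivity
    · calc ((1 - y) * (1 + y)) ^ κ ≤ (1 + y) ^ κ :=
          Real.rpow_le_rpow_of_nonpos a2 (by nlinarith) h
        _ ≤ _ := by simp; positivity
/-- contour integrand -/
def fosc (κ s : ℝ) (w : ℂ) : ℂ := Complex.exp (Complex.I * s * w) * ((1 - w) ^ (κ : ℂ) * (1 + w) ^ (κ : ℂ))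

theorem fosc_right (κ s y : ℝ) : -Complex.I * fosc κ s (1 + y * Complex.I) =
    Complex.exp (Complex.I * s) * ((Real.exp (-s * y) : ℝ) : ℂ) * mR κ y := by
  unfold fosc mR
  have e1 : Complex.I * s * (1 + y * Complex.I) = Complex.I * s + ((-s * y : ℝ) : ℂ) := by
    push_cast; ring_nf; rw [Complex.I_sq]; ring
  have e2 : (1 - (1 + y * Complex.I) : ℂ) = - Complex.I * y := by ring
  have e3 : (1 + (1 + y * Complex.I) : ℂ) = 2 + Complex.I * y := by ring
  rw [e1, e2, e3, Complex.exp_add, Complex.ofReal_exp]; ring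

theorem fosc_left (κ s y : ℝ) : Complex.I * fosc κ s (-1 + y * Complex.I) =
    Complex.exp (-Complex.I * s) * ((Real.exp (-s * y) : ℝ) : ℂ) * mL κ y := by
  unfold fosc mL
  have e1 : Complex.I * s * (-1 + y * Complex.I) = -Complex.I * s + ((-s * y : ℝ) : ℂ) := by
    push_cast; ring_nf; rw [Complex.I_sq]; ring
  have e2 : (1 - (-1 + y * Complex.I) : ℂ) = 2 - Complex.I * y := by ring
  have e3 : (1 + (-1 + y * Complex.I) : ℂ) = Complex.I * y := by ring
  rw [e1, e2, e3, Complex.exp_add, Complex.ofReal_exp]; ring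

theorem fosc_rect (κ s h Y : ℝ) (hh : 0 < h) (hY : 0 < Y) :
    (∫ x in (-1:ℝ)..1, fosc κ s (x + h * Complex.I)) =
     (∫ x in (-1:ℝ)..1, fosc κ s (x + Y * Complex.I)) +
     ((∫ y in h..Y, Complex.exp (-Complex.I * s) * ((Real.exp (-s * y) : ℝ) : ℂ) * mL κ y) +
      (∫ y in h..Y, Complex.exp (Complex.I * s) * ((Real.exp (-s * y) : ℝ) : ℂ) * mR κ y)) := by
  have H := Complex.integral_boundary_rect_eq_zero_of_differentiableOn (fosc κ s) (⟨-1, h⟩) (⟨1, Y⟩) ?_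
  · simp only at H
    simp_rw [← fosc_left, ← fosc_right]
    rw [intervalIntegral.integral_const_mul, intervalIntegral.integral_const_mul]
    simp only [smul_eq_mul, Complex.ofReal_neg, Complex.ofReal_one] at H
    linear_combination H
  · intro w hw
    have hw2 : 0 < w.im := by
      have := hw.2
      simp only [Set.mem_preimage] at this
      rw [Set.mem_uIcc] at this
      rcases this with h | h <;> linarith [h.1]
    unfold fosc
    apply DifferentiableAt.differentiableWithinAt
    have a1 : (1 - w) ∈ Complex.slitPlane := by
      right; simp; exact hw2.ne'
    have a2 : (1 + w) ∈ Complex.slitPlane := by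
      right; simp; exact hw2.ne'
    apply DifferentiableAt.mul
    · fun_prop
    · exact (DifferentiableAt.cpow (by fun_prop) (by fun_prop) a1).mul
        (DifferentiableAt.cpow (by fun_prop) (by fun_prop) a2)

theorem fosc_meas (κ s : ℝ) : Measurable (fosc κ s) := by unfold fosc; fun_prop

theorem fosc_norm (κ s : ℝ) (w : ℂ) : ‖fosc κ s w‖ = Real.exp (-s * w.im) * (‖1 - w‖ ^ κ * ‖1 + w‖ ^ κ) := by
  unfold fosc
  rw [norm_mul, norm_mul, Complex.norm_cpow_real, Complex.norm_cpow_real, Complex.norm_exp]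
  congr 2
  simp

theorem norm_rpow_abs_le (κ b : ℝ) (z : ℂ) (h1 : 1 ≤ ‖z‖) (h2 : ‖z‖ ≤ b) : ‖z‖ ^ κ ≤ b ^ |κ| := by
  rcases le_total 0 κ with h | h
  · rw [abs_of_nonneg h]; exact Real.rpow_le_rpow (norm_nonneg _) h2 h
  · calc ‖z‖ ^ κ ≤ 1 := Real.rpow_le_one_of_one_le_of_nonpos (by linarith) h
      _ ≤ _ := Real.one_le_rpow (by linarith) (abs_nonneg _)

theorem fosc_top (κ s : ℝ) (hs : 0 < s) :
    Tendsto (fun n : ℕ => ∫ x in (-1:ℝ)..1, fosc κ s (x + ((n:ℝ)+1 : ℝ) * Complex.I)) atTop (𝓝 0) := by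
  have hb : ∀ n : ℕ, ‖∫ x in (-1:ℝ)..1, fosc κ s (x + ((n:ℝ)+1 : ℝ) * Complex.I)‖ ≤
      (Real.exp (-s * ((n:ℝ)+1)) * ((n+3:ℝ) ^ |κ| * (n+3:ℝ)^|κ|)) * |1 - (-1)| := by
    intro n
    apply intervalIntegral.norm_integral_le_of_norm_le_const
    intro x hx
    rw [Set.uIoc_of_le (by norm_num)] at hx
    rw [fosc_norm]
    have hn : (0:ℝ) ≤ n := Nat.cast_nonneg n
    have hx1 : |x| ≤ 1 := abs_le.2 ⟨hx.1.le, hx.2⟩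
    have e : (x + ((n:ℝ)+1 : ℝ) * Complex.I : ℂ).im = n + 1 := by simp
    rw [e]
    have k1 : ∀ z : ℂ, (z = 1 - (x + ((n:ℝ)+1 : ℝ) * Complex.I) ∨ z = 1 + (x + ((n:ℝ)+1 : ℝ) * Complex.I)) → 1 ≤ ‖z‖ ∧ ‖z‖ ≤ n + 3 := by
      intro z hz
      have hI : |z.im| = n + 1 := by
        rcases hz with h | h
        · have : z.im = -(n + 1) := by rw [h]; simp
          rw [this, abs_neg, abs_of_nonneg (by positivity)]
        · have : z.im = n + 1 := by rw [h]; simp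
          rw [this, abs_of_nonneg (by positivity)]
      have hR : |z.re| ≤ 2 := by
        rcases hz with h | h
        · rw [h]; simp; rw [abs_le] at hx1 ⊢; constructor <;> linarith
        · rw [h]; simp; rw [abs_le] at hx1 ⊢; constructor <;> linarith
      constructor
      · have := Complex.abs_im_le_norm z; linarith
      · have := Complex.norm_le_abs_re_add_abs_im z; linarith
    obtain ⟨p1, p2⟩ := k1 _ (Or.inl rfl)
    obtain ⟨p3, p4⟩ := k1 _ (Or.inr rfl)
    gcongr
    · exact norm_rpow_abs_le κ _ _ p1 p2
    · exact norm_rpow_abs_le κ _ _ p3 p4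
  have ht := tendsto_rpow_mul_exp_neg_mul_atTop_nhds_zero (|κ| + |κ|) s hs
  have ht2 : Tendsto (fun n : ℕ => ((n:ℝ) + 3)) atTop atTop :=
    tendsto_atTop_add_const_right _ _ tendsto_natCast_atTop_atTop
  have ht3 := (ht.comp ht2).mul_const (Real.exp (2 * s) * 2)
  rw [zero_mul] at ht3
  refine squeeze_zero_norm (fun n => (hb n).trans (le_of_eq ?_)) ht3
  have : (0:ℝ) < n + 3 := by positivity
  simp only [Function.comp]
  rw [Real.rpow_add this]
  have : Real.exp (-s * ((n:ℝ) + 1)) = Real.exp (-s * (n+3)) * Real.exp (2 * s) := by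
    rw [← Real.exp_add]; congr 1; ring
  rw [this]; norm_num; ring

theorem fosc_bottom (κ s : ℝ) (hκ : -1 < κ) (hs : 0 < s) :
    Tendsto (fun n : ℕ => ∫ x in (-1:ℝ)..1, fosc κ s (x + (1/((n:ℝ)+1) : ℝ) * Complex.I)) atTop
      (𝓝 (Iosc κ s)) := by
  unfold Iosc
  have hh : ∀ n : ℕ, 0 < 1/((n:ℝ)+1) ∧ 1/((n:ℝ)+1) ≤ 1 := by
    intro n
    refine ⟨by positivity, ?_⟩
    rw [div_le_one (by positivity)]
    have : (0:ℝ) ≤ n := Nat.cast_nonneg n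
    linarith
  apply intervalIntegral.tendsto_integral_filter_of_dominated_convergence (fun x => (1 - x^2)^κ + 9 ^ κ)
  · refine Eventually.of_forall (fun n => ?_)
    have := fosc_meas κ s
    exact Measurable.aestronglyMeasurable (by fun_prop)
  · refine Eventually.of_forall (fun n => ?_)
    refine (Measure.ae_ne volume (1:ℝ)).mono (fun x hx1 hx => ?_)
    rw [Set.uIoc_of_le (by norm_num)] at hx
    have b1 : 0 < 1 - x := by
      rcases lt_or_eq_of_le hx.2 with h | h
      · linarith
      · exact absurd h hx1
    have b2 : 0 < 1 + x := by linarith [hx.1]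
    rw [fosc_norm]
    obtain ⟨h1, h2⟩ := hh n
    set h := 1/((n:ℝ)+1)
    have e : (x + (h:ℝ) * Complex.I : ℂ).im = h := by simp
    rw [e]
    have hexp : Real.exp (-s * h) ≤ 1 := Real.exp_le_one_iff.2 (by nlinarith)
    have c1 : (1 - x) ≤ ‖(1 - (x + (h:ℝ) * Complex.I) : ℂ)‖ := by
      have := Complex.abs_re_le_norm (1 - (x + (h:ℝ) * Complex.I) : ℂ)
      simp at this; exact (le_abs_self _).trans this
    have c2 : (1 + x) ≤ ‖(1 + (x + (h:ℝ) * Complex.I) : ℂ)‖ := by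
      have := Complex.abs_re_le_norm (1 + (x + (h:ℝ) * Complex.I) : ℂ)
      simp at this; exact (le_abs_self _).trans this
    have d1 : ‖(1 - (x + (h:ℝ) * Complex.I) : ℂ)‖ ≤ 3 := by
      have := Complex.norm_le_abs_re_add_abs_im (1 - (x + (h:ℝ) * Complex.I) : ℂ)
      simp at this; rw [abs_of_pos b1, abs_of_pos h1] at this; linarith [hx.1]
    have d2 : ‖(1 + (x + (h:ℝ) * Complex.I) : ℂ)‖ ≤ 3 := by
      have := Complex.norm_le_abs_re_add_abs_im (1 + (x + (h:ℝ) * Complex.I) : ℂ)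
      simp at this; rw [abs_of_pos b2, abs_of_pos h1] at this; linarith [hx.2]
    have e2 : 1 - x^2 = (1 - x) * (1 + x) := by ring
    have hmain : ‖(1 - (x + (h:ℝ) * Complex.I) : ℂ)‖ ^ κ * ‖(1 + (x + (h:ℝ) * Complex.I) : ℂ)‖ ^ κ ≤ (1 - x^2)^κ + 9 ^ κ := by
      rcases le_total 0 κ with hk | hk
      · have : (9:ℝ) ^ κ = 3 ^ κ * 3 ^ κ := by rw [← Real.mul_rpow (by norm_num) (by norm_num)]; norm_num
        rw [this]
        have t1 := Real.rpow_le_rpow (norm_nonneg _) d1 hk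
        have t2 := Real.rpow_le_rpow (norm_nonneg _) d2 hk
        have t3 : 0 ≤ (1 - x^2)^κ := by rw [e2]; positivity
        have := mul_le_mul t1 t2 (by positivity) (by positivity)
        linarith
      · have t1 := Real.rpow_le_rpow_of_nonpos b1 c1 hk
        have t2 := Real.rpow_le_rpow_of_nonpos b2 c2 hk
        have := mul_le_mul t1 t2 (by positivity) (by positivity)
        rw [e2, Real.mul_rpow b1.le b2.le]
        have : (0:ℝ) ≤ 9 ^ κ := by positivity
        linarith
    calc _ ≤ 1 * (‖(1 - (x + (h:ℝ) * Complex.I) : ℂ)‖ ^ κ * ‖(1 + (x + (h:ℝ) * Complex.I) : ℂ)‖ ^ κ) := by gcongr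
      _ ≤ _ := by rw [one_mul]; exact hmain
  · exact (one_sub_sq_int κ hκ).add intervalIntegrable_const
  · refine (Measure.ae_ne volume (1:ℝ)).mono (fun x hx1 hx => ?_)
    rw [Set.uIoc_of_le (by norm_num)] at hx
    have b1 : 0 < 1 - x := by
      rcases lt_or_eq_of_le hx.2 with h | h
      · linarith
      · exact absurd h hx1
    have b2 : 0 < 1 + x := by linarith [hx.1]
    have hlim : Tendsto (fun n : ℕ => (x + (1/((n:ℝ)+1) : ℝ) * Complex.I : ℂ)) atTop (𝓝 (x : ℂ)) := by
      have : Tendsto (fun n : ℕ => (1/((n:ℝ)+1) : ℝ)) atTop (𝓝 0) := tendsto_one_div_add_atTop_nhds_zero_nat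
      have := (((Complex.continuous_ofReal.tendsto 0).comp this).mul_const Complex.I).const_add (x:ℂ)
      simpa using this
    have hval : fosc κ s x = Complex.exp (Complex.I * s * x) * (((1 - x^2) ^ κ : ℝ) : ℂ) := by
      unfold fosc
      have e2 : 1 - x^2 = (1 - x) * (1 + x) := by ring
      rw [e2, Real.mul_rpow b1.le b2.le, Complex.ofReal_mul, Complex.ofReal_cpow b1.le, Complex.ofReal_cpow b2.le]
      push_cast; ring
    rw [← hval]
    refine Tendsto.comp (ContinuousAt.tendsto ?_) hlim
    unfold fosc
    have a1 : (1 - x : ℂ) ∈ Complex.slitPlane := by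
      left; simpa using b1
    have a2 : (1 + x : ℂ) ∈ Complex.slitPlane := by
      left; simpa using b2
    apply ContinuousAt.mul
    · fun_prop
    · exact (ContinuousAt.cpow (by fun_prop) (by fun_prop) a1).mul
        (ContinuousAt.cpow (by fun_prop) (by fun_prop) a2)

theorem side_int (κ s : ℝ) (hκ : -1 < κ) (hs : 0 < s) (m : ℝ → ℂ) (hm : Measurable m)
    (hb : ∀ y, 0 < y → ‖m y‖ ≤ Wk κ y) (c : ℂ) (hc : ‖c‖ = 1) :
    IntegrableOn (fun y => c * ((Real.exp (-s * y) : ℝ) : ℂ) * m y) (Set.Ioi 0) := by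
  refine Integrable.mono' (Wk_int κ s hκ hs) (Measurable.aestronglyMeasurable (by fun_prop)) ?_
  refine (ae_restrict_mem measurableSet_Ioi).mono (fun y hy => ?_)
  rw [norm_mul, norm_mul, hc, one_mul, Complex.norm_real, Real.norm_of_nonneg (Real.exp_pos _).le]
  gcongr
  exact hb y hy

theorem side_lim (f : ℝ → ℂ) (hf : IntegrableOn f (Set.Ioi 0)) :
    Tendsto (fun n : ℕ => ∫ y in (1/((n:ℝ)+1))..((n:ℝ)+1), f y) atTop (𝓝 (∫ y in Set.Ioi 0, f y)) := by
  have hU : (⋃ n : ℕ, Set.Ioc (1/((n:ℝ)+1)) ((n:ℝ)+1)) = Set.Ioi 0 := by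
    ext x
    simp only [Set.mem_iUnion, Set.mem_Ioc, Set.mem_Ioi]
    constructor
    · rintro ⟨n, h1, h2⟩
      exact lt_of_le_of_lt (by positivity) h1
    · intro hx
      obtain ⟨n, hn⟩ := exists_nat_one_div_lt hx
      obtain ⟨m, hm⟩ := exists_nat_ge x
      refine ⟨max n m, lt_of_le_of_lt ?_ hn, hm.trans ?_⟩
      · apply one_div_le_one_div_of_le (by positivity)
        have : (n:ℝ) ≤ (max n m : ℕ) := by exact_mod_cast le_max_left n m
        linarith
      · have : (m:ℝ) ≤ (max n m : ℕ) := by exact_mod_cast le_max_right n m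
        linarith
  have hmono : Monotone (fun n : ℕ => Set.Ioc (1/((n:ℝ)+1)) ((n:ℝ)+1)) := by
    intro a b hab
    have : (a:ℝ) ≤ b := by exact_mod_cast hab
    apply Set.Ioc_subset_Ioc
    · exact one_div_le_one_div_of_le (by positivity) (by linarith)
    · linarith
  have := tendsto_setIntegral_of_monotone (μ := volume) (f := f) (fun n => measurableSet_Ioc) hmono (by rw [hU]; exact hf)
  rw [hU] at this
  refine this.congr (fun n => ?_)
  rw [intervalIntegral.integral_of_le]
  have hn : (0:ℝ) ≤ n := Nat.cast_nonneg n
  rw [div_le_iff₀ (by linarith)]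
  nlinarith

theorem norm_eI (s : ℝ) : ‖Complex.exp (Complex.I * s)‖ = 1 := by
  rw [mul_comm]; exact Complex.norm_exp_ofReal_mul_I s
theorem norm_eI' (s : ℝ) : ‖Complex.exp (-Complex.I * s)‖ = 1 := by
  have := norm_eI (-s); simpa using this

theorem Iosc_repr (κ s : ℝ) (hκ : -1 < κ) (hs : 0 < s) :
    Iosc κ s = (∫ y in Set.Ioi 0, Complex.exp (-Complex.I * s) * ((Real.exp (-s * y) : ℝ) : ℂ) * mL κ y) +
      (∫ y in Set.Ioi 0, Complex.exp (Complex.I * s) * ((Real.exp (-s * y) : ℝ) : ℂ) * mR κ y) := by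
  have h1 := side_lim _ (side_int κ s hκ hs (mL κ) (mL_meas κ) (norm_mL κ) _ (norm_eI' s))
  have h2 := side_lim _ (side_int κ s hκ hs (mR κ) (mR_meas κ) (norm_mR κ) _ (norm_eI s))
  have h3 := (fosc_top κ s hs).add (h1.add h2)
  rw [zero_add] at h3
  refine tendsto_nhds_unique (fosc_bottom κ s hκ hs) (h3.congr (fun n => ?_))
  rw [← fosc_rect κ s _ _ (by positivity) (by positivity)]

theorem Iosc_bound (κ : ℝ) (hκ : -1 < κ) : ∃ C : ℝ, 0 < C ∧ ∀ s : ℝ, 0 < s → ‖Iosc κ s‖ ≤ C * s ^ (-1 - κ) := by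
  set C1 := ∫ z in Set.Ioi (0:ℝ), Real.exp (-1 * z) * Wk κ z with hC1
  set C0 := ∫ y in (-1:ℝ)..1, (1 - y^2) ^ κ with hC0
  have hC1n : 0 ≤ C1 := by
    apply setIntegral_nonneg measurableSet_Ioi
    intro z hz; exact mul_nonneg (Real.exp_pos _).le (Wk_nonneg κ z hz)
  have hC0n : 0 ≤ C0 := by
    apply intervalIntegral.integral_nonneg (by norm_num)
    intro y hy; apply Real.rpow_nonneg; nlinarith [hy.1, hy.2]
  refine ⟨C0 + 2 * C1 + 1, by linarith, fun s hs => ?_⟩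
  have hp : 0 < s ^ (-1 - κ) := by positivity
  rcases le_total s 1 with h | h
  · have h1 : 1 ≤ s ^ (-1 - κ) := Real.one_le_rpow_of_pos_of_le_one_of_nonpos hs h (by linarith)
    have : ‖Iosc κ s‖ ≤ C0 := by
      unfold Iosc
      rw [hC0]
      apply intervalIntegral.norm_integral_le_of_norm_le (by norm_num) _ (one_sub_sq_int κ hκ)
      refine Eventually.of_forall (fun y hy => ?_)
      have : ‖Complex.exp (Complex.I * s * y)‖ = 1 := by
        have := norm_eI (s*y); push_cast at this; rw [mul_assoc]; exact this
      rw [norm_mul, this, one_mul, Complex.norm_real, Real.norm_of_nonneg]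
      apply Real.rpow_nonneg; nlinarith [hy.1, hy.2]
    nlinarith
  · rw [Iosc_repr κ s hκ hs]
    have key : ∀ (m : ℝ → ℂ) (hb : ∀ y, 0 < y → ‖m y‖ ≤ Wk κ y) (c : ℂ) (hc : ‖c‖ = 1),
        ‖∫ y in Set.Ioi 0, c * ((Real.exp (-s * y) : ℝ) : ℂ) * m y‖ ≤ s ^ (-1 - κ) * C1 := by
      intro m hb c hc
      have i1 : ‖∫ y in Set.Ioi 0, c * ((Real.exp (-s * y) : ℝ) : ℂ) * m y‖ ≤
          ∫ y in Set.Ioi 0, Real.exp (-s * y) * Wk κ y := by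
        apply norm_integral_le_of_norm_le (Wk_int κ s hκ hs)
        refine (ae_restrict_mem measurableSet_Ioi).mono (fun y hy => ?_)
        rw [norm_mul, norm_mul, hc, one_mul, Complex.norm_real, Real.norm_of_nonneg (Real.exp_pos _).le]
        gcongr
        exact hb y hy
      refine i1.trans ?_
      have i2 := integral_comp_mul_left_Ioi (fun z => Real.exp (-1 * z) * Wk κ (z / s)) 0 hs
      have i3 : (∫ y in Set.Ioi 0, Real.exp (-s * y) * Wk κ y) = ∫ x in Set.Ioi 0, Real.exp (-1 * (s * x)) * Wk κ (s * x / s) := by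
        apply setIntegral_congr_fun measurableSet_Ioi
        intro x hx
        simp only
        rw [mul_div_cancel_left₀ _ hs.ne']; congr 2; ring
      rw [i3, i2, mul_zero, smul_eq_mul, ← integral_const_mul, hC1, ← integral_const_mul]
      apply integral_mono_of_nonneg
      · refine (ae_restrict_mem measurableSet_Ioi).mono (fun y hy => ?_)
        have := Wk_nonneg κ (y/s) (div_pos hy hs)
        show 0 ≤ s⁻¹ * (Real.exp (-1 * y) * Wk κ (y/s))
        positivity
      · exact (Wk_int κ 1 hκ (by norm_num)).const_mul _
      · refine (ae_restrict_mem measurableSet_Ioi).mono (fun y hy => ?_)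
        have := Wk_scale κ s y h hy
        show s⁻¹ * (Real.exp (-1 * y) * Wk κ (y/s)) ≤ s ^ (-1 - κ) * (Real.exp (-1 * y) * Wk κ y)
        have h2 := mul_le_mul_of_nonneg_left this (Real.exp_pos (-1*y)).le
        linarith
    refine (norm_add_le _ _).trans ?_
    have k1 := key (mL κ) (norm_mL κ) _ (norm_eI' s)
    have k2 := key (mR κ) (norm_mR κ) _ (norm_eI s)
    nlinarith
end Osc
end


open MeasureTheory Real Filter
open scoped ENNReal FourierTransform RealInnerProductSpace Topology

noncomputable section

section Polar

theorem lintegral_fun_norm_addHaar' {E : Type*} [NormedAddCommGroup E] [NormedSpace ℝ E] [MeasurableSpace E]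
    [Nontrivial E] (μ : Measure E) [FiniteDimensional ℝ E] [BorelSpace E] [μ.IsAddHaarMeasure]
    (f : ℝ → ℝ≥0∞) (hf : Measurable f) :
    ∫⁻ x, f ‖x‖ ∂μ = μ.toSphere Set.univ * ∫⁻ y in Set.Ioi (0:ℝ), ENNReal.ofReal (y ^ (Module.finrank ℝ E - 1)) * f y := by
  calc
    ∫⁻ x, f (‖x‖) ∂μ = ∫⁻ x : ({(0)}ᶜ : Set E), f (‖x.1‖) ∂(μ.comap (↑)) := by
      rw [lintegral_subtype_comap (measurableSet_singleton _).compl fun x ↦ f (‖x‖),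
        restrict_compl_singleton]
    _ = ∫⁻ x, f x.2 ∂μ.toSphere.prod (.volumeIoiPow (Module.finrank ℝ E - 1)) := by
      simpa using μ.measurePreserving_homeomorphUnitSphereProd.lintegral_comp_emb
        (Homeomorph.measurableEmbedding _) (f ∘ Subtype.val ∘ Prod.snd)
    _ = μ.toSphere Set.univ * ∫⁻ x : Set.Ioi (0 : ℝ), f x ∂.volumeIoiPow (Module.finrank ℝ E - 1) := by
      rw [lintegral_prod _ (Measurable.aemeasurable (by fun_prop))]
      simp [mul_comm]
    _ = _ := by
      simp only [Measure.volumeIoiPow]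
      rw [lintegral_withDensity_eq_lintegral_mul _ (by fun_prop) (by fun_prop)]
      rw [← lintegral_subtype_comap measurableSet_Ioi]
      rfl

/-- splitting off the zeroth coordinate -/
def splitE (n : ℕ) : EuclideanSpace ℝ (Fin (n+1)) ≃ᵐ ℝ × EuclideanSpace ℝ (Fin n) :=
  (MeasurableEquiv.toLp 2 (Fin (n+1) → ℝ)).symm.trans
    ((MeasurableEquiv.piFinSuccAbove (fun _ => ℝ) 0).trans
      (MeasurableEquiv.prodCongr (MeasurableEquiv.refl ℝ) (MeasurableEquiv.toLp 2 (Fin n → ℝ))))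

theorem splitE_mp (n : ℕ) : MeasurePreserving (splitE n) := by
  unfold splitE
  refine (EuclideanSpace.volume_preserving_symm_measurableEquiv_toLp _).trans ?_
  refine (volume_preserving_piFinSuccAbove (fun _ => ℝ) 0).trans ?_
  refine MeasurePreserving.prod (MeasurePreserving.id _) ?_
  exact (EuclideanSpace.volume_preserving_symm_measurableEquiv_toLp _).symm

theorem splitE_fst (n : ℕ) (ξ) : (splitE n ξ).1 = ξ 0 := rfl
theorem splitE_snd (n : ℕ) (ξ) (i : Fin n) : (splitE n ξ).2 i = ξ i.succ := rfl

theorem splitE_norm (n : ℕ) (ξ) : ‖ξ‖ ^ 2 = (splitE n ξ).1 ^ 2 + ‖(splitE n ξ).2‖ ^ 2 := by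
  rw [EuclideanSpace.norm_sq_eq, EuclideanSpace.norm_sq_eq, Fin.sum_univ_succ]
  simp [splitE_fst, splitE_snd]

theorem splitE_inner (n : ℕ) (ξ η) : ⟪ξ, η⟫ = (splitE n ξ).1 * (splitE n η).1 + ⟪(splitE n ξ).2, (splitE n η).2⟫ := by
  simp only [PiLp.inner_apply, Fin.sum_univ_succ, splitE_fst, splitE_snd]
  simp [mul_comm]

theorem lint_cos (κ : ℝ) (n : ℕ) (hκ : κ = ((n:ℝ) - 2)/2) (hn : 1 ≤ n) (h : ℝ → ℝ≥0∞) :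
    ∫⁻ θ in Set.Ioo 0 π, ENNReal.ofReal (Real.sin θ ^ (n-1)) * h (Real.cos θ) =
    ∫⁻ y in Set.Ioo (-1:ℝ) 1, ENNReal.ofReal ((1 - y^2) ^ κ) * h y := by
  have him : Real.cos '' Set.Ioo 0 π = Set.Ioo (-1) 1 := by
    apply Set.Subset.antisymm
    · rintro _ ⟨θ, hθ, rfl⟩
      have h1 : Real.sin θ > 0 := Real.sin_pos_of_mem_Ioo hθ
      have := Real.sin_sq_add_cos_sq θ
      constructor <;> nlinarith
    · intro y hy
      exact ⟨Real.arccos y, ⟨Real.arccos_pos.2 hy.2, lt_of_le_of_ne (Real.arccos_le_pi y)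
        (by intro h; rw [Real.arccos_eq_pi] at h; linarith [hy.1])⟩, Real.cos_arccos hy.1.le hy.2.le⟩
  rw [← him, lintegral_image_eq_lintegral_abs_deriv_mul (f' := fun x => - Real.sin x) measurableSet_Ioo
    (fun x _ => (Real.hasDerivAt_cos x).hasDerivWithinAt)
    (Real.injOn_cos.mono Set.Ioo_subset_Icc_self)]
  apply setLIntegral_congr_fun measurableSet_Ioo
  intro θ hθ
  have h1 : 0 < Real.sin θ := Real.sin_pos_of_mem_Ioo hθ
  simp only
  rw [← mul_assoc, abs_neg, abs_of_pos h1, ← ENNReal.ofReal_mul h1.le]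
  congr 2
  have : 1 - Real.cos θ ^ 2 = Real.sin θ ^ (2:ℝ) := by
    rw [Real.rpow_two]; linarith [Real.sin_sq_add_cos_sq θ]
  rw [this, ← Real.rpow_mul h1.le, ← Real.rpow_natCast]
  nth_rw 2 [← Real.rpow_one (Real.sin θ)]
  rw [← Real.rpow_add h1]
  congr 1
  rw [hκ, Nat.cast_sub hn]; push_cast; ring

/-- the polar lemma (lintegral form) -/
theorem polar_lint (n : ℕ) (hn : 1 ≤ n) : ∃ c : ℝ, 0 < c ∧ ∀ (g : ℝ × ℝ → ℝ≥0∞), Measurable g →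
    ∫⁻ ξ : EuclideanSpace ℝ (Fin (n+1)), g (‖ξ‖, ξ 0) =
     ENNReal.ofReal c * ∫⁻ r in Set.Ioi (0:ℝ), ∫⁻ y in Set.Ioo (-1:ℝ) 1,
      ENNReal.ofReal (r ^ n * (1 - y^2) ^ (((n:ℝ) - 2)/2)) * g (r, r * y) := by
  have : Nonempty (Fin n) := ⟨⟨0, hn⟩⟩
  have : Nontrivial (EuclideanSpace ℝ (Fin n)) := inferInstance
  set S := (volume : Measure (EuclideanSpace ℝ (Fin n))).toSphere Set.univ with hS
  have hSt : S ≠ ⊤ := measure_ne_top _ _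
  have hS0 : S ≠ 0 := by
    rw [hS, Ne, Measure.measure_univ_eq_zero]
    exact Measure.toSphere_ne_zero _
  refine ⟨S.toReal, ENNReal.toReal_pos hS0 hSt, fun g hg => ?_⟩
  rw [ENNReal.ofReal_toReal hSt]
  have e1 : ∫⁻ ξ : EuclideanSpace ℝ (Fin (n+1)), g (‖ξ‖, ξ 0) =
      ∫⁻ q : ℝ × EuclideanSpace ℝ (Fin n), g (√(q.1^2 + ‖q.2‖^2), q.1) := by
    rw [← (splitE_mp n).lintegral_comp (by fun_prop)]
    apply lintegral_congr
    intro ξ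
    rw [← splitE_norm, Real.sqrt_sq (norm_nonneg _), splitE_fst]
  rw [e1, Measure.volume_eq_prod, lintegral_prod _ (Measurable.aemeasurable (by fun_prop))]
  have e2 : ∀ x : ℝ, ∫⁻ y : EuclideanSpace ℝ (Fin n), g (√(x^2 + ‖y‖^2), x) =
      S * ∫⁻ σ in Set.Ioi (0:ℝ), ENNReal.ofReal (σ ^ (n-1)) * g (√(x^2 + σ^2), x) := by
    intro x
    have := lintegral_fun_norm_addHaar' (volume : Measure (EuclideanSpace ℝ (Fin n)))
      (fun σ => g (√(x^2 + σ^2), x)) (by fun_prop)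
    rw [this]; simp [hS]
  simp only [e2]
  rw [lintegral_const_mul' _ _ hSt]
  congr 1
  -- to the plane
  have e3 : ∫⁻ x : ℝ, ∫⁻ σ in Set.Ioi (0:ℝ), ENNReal.ofReal (σ ^ (n-1)) * g (√(x^2 + σ^2), x) =
      ∫⁻ q : ℝ × ℝ, (Set.Ioi (0:ℝ)).indicator (fun _ => ENNReal.ofReal (q.2 ^ (n-1)) * g (√(q.1^2 + q.2^2), q.1)) q.2 := by
    rw [Measure.volume_eq_prod, lintegral_prod]
    · apply lintegral_congr; intro x
      rw [← lintegral_indicator measurableSet_Ioi]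
      rfl
    · apply Measurable.aemeasurable
      have : (fun q : ℝ × ℝ => (Set.Ioi (0:ℝ)).indicator (fun _ => ENNReal.ofReal (q.2 ^ (n-1)) * g (√(q.1^2 + q.2^2), q.1)) q.2) =
        (Prod.snd ⁻¹' Set.Ioi (0:ℝ)).indicator (fun q : ℝ × ℝ => ENNReal.ofReal (q.2 ^ (n-1)) * g (√(q.1^2 + q.2^2), q.1)) := by
        ext q; simp [Set.indicator]
      rw [this]
      exact Measurable.indicator (by fun_prop) (measurable_snd measurableSet_Ioi)
  rw [e3, ← lintegral_comp_polarCoord_symm]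
  have ht : polarCoord.target = Set.Ioi (0:ℝ) ×ˢ Set.Ioo (-π) π := rfl
  rw [ht, Measure.volume_eq_prod, ← Measure.prod_restrict, lintegral_prod]
  · apply setLIntegral_congr_fun measurableSet_Ioi
    intro r hr
    have hr : 0 < r := hr
    have : ∫⁻ y in Set.Ioo (-1:ℝ) 1, ENNReal.ofReal (r ^ n * (1 - y^2) ^ (((n:ℝ) - 2)/2)) * g (r, r * y) =
      ENNReal.ofReal (r^n) * ∫⁻ y in Set.Ioo (-1:ℝ) 1, ENNReal.ofReal ((1 - y^2) ^ (((n:ℝ) - 2)/2)) * g (r, r * y) := by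
      rw [← lintegral_const_mul' _ _ ENNReal.ofReal_ne_top]
      apply lintegral_congr; intro y
      rw [ENNReal.ofReal_mul (by positivity), mul_assoc]
    simp only
    rw [this, ← lint_cos _ n rfl hn (fun y => g (r, r * y)), ← lintegral_const_mul' _ _ ENNReal.ofReal_ne_top]
    rw [← lintegral_indicator measurableSet_Ioo, ← lintegral_indicator measurableSet_Ioo]
    apply lintegral_congr; intro θ
    simp only [polarCoord_symm_apply, Set.indicator, Set.mem_Ioi, Set.mem_Ioo]
    by_cases h1 : 0 < θ ∧ θ < π
    · have hs : 0 < Real.sin θ := Real.sin_pos_of_mem_Ioo h1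
      rw [if_pos ⟨by linarith [Real.pi_pos], h1.2⟩, if_pos h1, if_pos (by positivity)]
      have : √((r * Real.cos θ)^2 + (r * Real.sin θ)^2) = r := by
        rw [show (r * Real.cos θ)^2 + (r * Real.sin θ)^2 = r^2 by nlinarith [Real.sin_sq_add_cos_sq θ]]
        exact Real.sqrt_sq hr.le
      rw [this, smul_eq_mul, ← mul_assoc, ← mul_assoc, ← ENNReal.ofReal_mul hr.le, ← ENNReal.ofReal_mul (by positivity)]
      congr 2
      rw [mul_pow, ← mul_assoc, ← pow_succ', Nat.sub_add_cancel hn]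
    · rw [if_neg h1]
      split_ifs with h2 h3
      · exfalso
        have : θ ≤ 0 := by by_contra h; exact h1 ⟨by linarith, h2.2⟩
        have := Real.sin_nonpos_of_nonpos_of_neg_pi_le this h2.1.le
        nlinarith
      · simp
      · rfl
  · apply Measurable.aemeasurable
    have : (fun q : ℝ × ℝ => (Set.Ioi (0:ℝ)).indicator (fun _ => ENNReal.ofReal (q.2 ^ (n-1)) * g (√(q.1^2 + q.2^2), q.1)) q.2) =
        (Prod.snd ⁻¹' Set.Ioi (0:ℝ)).indicator (fun q : ℝ × ℝ => ENNReal.ofReal (q.2 ^ (n-1)) * g (√(q.1^2 + q.2^2), q.1)) := by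
        ext q; simp [Set.indicator]
    have hm : Measurable (fun q : ℝ × ℝ => (Set.Ioi (0:ℝ)).indicator (fun _ => ENNReal.ofReal (q.2 ^ (n-1)) * g (√(q.1^2 + q.2^2), q.1)) q.2) := by
      rw [this]
      exact Measurable.indicator (by fun_prop) (measurable_snd measurableSet_Ioi)
    simp only [smul_eq_mul]
    exact (by fun_prop : Measurable fun p : ℝ × ℝ => ENNReal.ofReal p.1).mul (hm.comp (continuous_polarCoord_symm.measurable))

/-- the polar lemma (Bochner form) -/
theorem polar_int (n : ℕ) (hn : 1 ≤ n) : ∃ c : ℝ, 0 < c ∧ ∀ (f : ℝ × ℝ → ℂ), Measurable f →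
    Integrable (fun ξ : EuclideanSpace ℝ (Fin (n+1)) => f (‖ξ‖, ξ 0)) →
    ∫ ξ : EuclideanSpace ℝ (Fin (n+1)), f (‖ξ‖, ξ 0) =
     c * ∫ r in Set.Ioi (0:ℝ), ∫ y in Set.Ioo (-1:ℝ) 1,
      ((r ^ n * (1 - y^2) ^ (((n:ℝ) - 2)/2) : ℝ) : ℂ) * f (r, r * y) := by
  obtain ⟨c, hc, H⟩ := polar_lint n hn
  refine ⟨c, hc, fun f hf hi => ?_⟩
  set w : ℝ × ℝ → ℝ := fun q => c * (q.1 ^ n * (1 - q.2^2) ^ (((n:ℝ) - 2)/2)) with hw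
  have hwm : Measurable w := by fun_prop
  set ν : Measure (ℝ × ℝ) := ((volume.restrict (Set.Ioi (0:ℝ))).prod (volume.restrict (Set.Ioo (-1:ℝ) 1))) with hν
  set μ2 : Measure (ℝ × ℝ) := (ν.withDensity (fun q => ENNReal.ofReal (w q))).map (fun q => (q.1, q.1 * q.2)) with hμ2
  set μ1 : Measure (ℝ × ℝ) := (volume : Measure (EuclideanSpace ℝ (Fin (n+1)))).map (fun ξ => (‖ξ‖, ξ 0)) with hμ1
  have m1 : Measurable (fun ξ : EuclideanSpace ℝ (Fin (n+1)) => (‖ξ‖, ξ 0)) := by fun_prop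
  have m2 : Measurable (fun q : ℝ × ℝ => (q.1, q.1 * q.2)) := by fun_prop
  have heq : μ1 = μ2 := by
    apply Measure.ext_of_lintegral
    intro g hg
    rw [hμ1, hμ2, lintegral_map hg m1, lintegral_map hg m2, H g hg,
      lintegral_withDensity_eq_lintegral_mul _ (by fun_prop) (by fun_prop), hν, lintegral_prod _ (Measurable.aemeasurable (by fun_prop)),
      ← lintegral_const_mul' _ _ ENNReal.ofReal_ne_top]
    apply lintegral_congr; intro r
    rw [← lintegral_const_mul' _ _ ENNReal.ofReal_ne_top]
    apply lintegral_congr; intro y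
    simp only [Pi.mul_apply, hw]
    rw [ENNReal.ofReal_mul hc.le, mul_assoc]
  have hnn : ∀ᵐ q ∂ν, 0 ≤ w q := by
    rw [hν, Measure.prod_restrict]
    refine (ae_restrict_mem (measurableSet_Ioi.prod measurableSet_Ioo)).mono (fun q hq => ?_)
    have h1 : 0 < q.1 := hq.1
    have h2 : 0 ≤ 1 - q.2^2 := by nlinarith [hq.2.1, hq.2.2]
    simp only [hw]; positivity
  have hi1 : Integrable f μ1 := (integrable_map_measure hf.aestronglyMeasurable m1.aemeasurable).2 hi
  have hi2 : Integrable (fun q : ℝ × ℝ => f (q.1, q.1 * q.2)) (ν.withDensity (fun q => ENNReal.ofReal (w q))) := by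
    rw [heq] at hi1
    exact (integrable_map_measure hf.aestronglyMeasurable m2.aemeasurable).1 hi1
  have hi3 : Integrable (fun q : ℝ × ℝ => (w q : ℂ) * f (q.1, q.1 * q.2)) ν := by
    rw [integrable_withDensity_iff_integrable_smul' (by fun_prop) (Eventually.of_forall (fun _ => ENNReal.ofReal_lt_top))] at hi2
    refine hi2.congr (hnn.mono (fun q hq => ?_))
    simp only [ENNReal.toReal_ofReal hq, Complex.real_smul]
  have e1 : ∫ ξ : EuclideanSpace ℝ (Fin (n+1)), f (‖ξ‖, ξ 0) = ∫ q, f q ∂μ1 :=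
    (integral_map m1.aemeasurable hf.aestronglyMeasurable).symm
  rw [e1, heq, integral_map m2.aemeasurable hf.aestronglyMeasurable,
    integral_withDensity_eq_integral_toReal_smul (by fun_prop) (Eventually.of_forall (fun _ => ENNReal.ofReal_lt_top))]
  have e2 : ∫ q, (ENNReal.ofReal (w q)).toReal • f (q.1, q.1 * q.2) ∂ν = ∫ q, (w q : ℂ) * f (q.1, q.1 * q.2) ∂ν := by
    refine integral_congr_ae (hnn.mono (fun q hq => ?_))
    simp only [ENNReal.toReal_ofReal hq, Complex.real_smul]
  rw [e2, integral_prod _ hi3, ← integral_const_mul]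
  congr 1; ext r
  rw [← integral_const_mul]
  congr 1; ext y
  simp only [hw]; push_cast; ring

end Polar
end


open MeasureTheory Real Filter
open scoped ENNReal FourierTransform RealInnerProductSpace Topology

noncomputable section

section Kernel

/-- shell cutoff -/
def sh (δ r : ℝ) : ℝ := if |r - 1| ≤ δ then 1 else 0

theorem sh_meas (δ : ℝ) : Measurable (sh δ) := by
  unfold sh
  apply Measurable.ite
  · exact measurableSet_le (by fun_prop) measurable_const
  · fun_prop
  · fun_prop

theorem sh_nonneg (δ r : ℝ) : 0 ≤ sh δ r := by unfold sh; split_ifs <;> norm_num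
theorem sh_le_one (δ r : ℝ) : sh δ r ≤ 1 := by unfold sh; split_ifs <;> norm_num

theorem exists_isometry_map {V : Type*} [NormedAddCommGroup V] [InnerProductSpace ℝ V] (x y : V) (h : ‖x‖ = ‖y‖) :
    ∃ R : V ≃ₗᵢ[ℝ] V, R x = y := by
  exact ⟨(ℝ ∙ (x - y))ᗮ.reflection, Submodule.reflection_sub h⟩

theorem Iosc_bound' (κ κ' : ℝ) (hκ : -1 < κ) (hκ' : κ ≤ κ') : ∃ C : ℝ, 0 < C ∧ ∀ s : ℝ, 0 < s → ‖Iosc κ' s‖ ≤ C * s ^ (-1 - κ) := by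
  obtain ⟨C1, hC1, H1⟩ := Iosc_bound κ' (by linarith)
  set C0 := ∫ y in (-1:ℝ)..1, (1 - y^2) ^ κ' with hC0
  have hC0n : 0 ≤ C0 := by
    apply intervalIntegral.integral_nonneg (by norm_num)
    intro y hy; apply Real.rpow_nonneg; nlinarith [hy.1, hy.2]
  refine ⟨C0 + C1, by linarith, fun s hs => ?_⟩
  have hp : 0 < s ^ (-1 - κ) := by positivity
  rcases le_total s 1 with h | h
  · have h1 : 1 ≤ s ^ (-1 - κ) := Real.one_le_rpow_of_pos_of_le_one_of_nonpos hs h (by linarith)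
    have : ‖Iosc κ' s‖ ≤ C0 := by
      unfold Iosc
      rw [hC0]
      apply intervalIntegral.norm_integral_le_of_norm_le (by norm_num) _ (one_sub_sq_int κ' (by linarith))
      refine Eventually.of_forall (fun y hy => ?_)
      have : ‖Complex.exp (Complex.I * s * y)‖ = 1 := by
        have := norm_eI (s*y); push_cast at this; rw [mul_assoc]; exact this
      rw [norm_mul, this, one_mul, Complex.norm_real, Real.norm_of_nonneg]
      apply Real.rpow_nonneg; nlinarith [hy.1, hy.2]
    nlinarith
  · have h1 : s ^ (-1 - κ') ≤ s ^ (-1 - κ) := Real.rpow_le_rpow_of_exponent_le h (by linarith)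
    have := H1 s hs
    nlinarith

theorem Iosc_eq_Ioo (κ s : ℝ) : Iosc κ s = ∫ y in Set.Ioo (-1:ℝ) 1, Complex.exp (Complex.I * s * y) * (((1 - y^2) ^ κ : ℝ) : ℂ) := by
  unfold Iosc
  rw [intervalIntegral.integral_of_le (by norm_num), integral_Ioc_eq_integral_Ioo]

theorem shell_r_bound (b : ℕ) (hb : 1 ≤ b) (κ' : ℝ) (hκ' : ((b:ℝ) - 2)/2 ≤ κ') :
    ∃ C : ℝ, 0 < C ∧ ∀ δ s : ℝ, 0 < δ → δ ≤ 1/2 → 0 < s →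
    ‖∫ r in Set.Ioi (0:ℝ), ((sh δ r * r^(b+2) : ℝ) : ℂ) * Iosc κ' (2 * π * s * r)‖ ≤ C * δ * s ^ (-(b:ℝ)/2) := by
  have hb' : (1:ℝ) ≤ b := by exact_mod_cast hb
  obtain ⟨C1, hC1, H1⟩ := Iosc_bound' (((b:ℝ) - 2)/2) κ' (by linarith) hκ'
  refine ⟨(3/2)^(b+2) * C1 * 2, by positivity, fun δ s hδ hδ2 hs => ?_⟩
  set M := (3/2:ℝ)^(b+2) * (C1 * s ^ (-(b:ℝ)/2)) with hM
  have hMn : 0 ≤ M := by positivity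
  set g : ℝ → ℝ := (Set.Icc (1-δ) (1+δ)).indicator (fun _ => M) with hg
  have hgi : Integrable g := by
    rw [hg, integrable_indicator_iff measurableSet_Icc]
    exact integrableOn_const (by simp)
  have hpi := Real.pi_gt_three
  have h1 : ‖∫ r in Set.Ioi (0:ℝ), ((sh δ r * r^(b+2) : ℝ) : ℂ) * Iosc κ' (2 * π * s * r)‖ ≤ ∫ r in Set.Ioi (0:ℝ), g r := by
    apply norm_integral_le_of_norm_le hgi.integrableOn
    refine (ae_restrict_mem measurableSet_Ioi).mono (fun r hr => ?_)
    have hr : 0 < r := hr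
    rw [norm_mul, Complex.norm_real]
    by_cases h : |r - 1| ≤ δ
    · have hm : r ∈ Set.Icc (1-δ) (1+δ) := by rw [abs_le] at h; constructor <;> linarith [h.1, h.2]
      rw [hg, Set.indicator_of_mem hm]
      unfold sh
      rw [if_pos h, one_mul, Real.norm_of_nonneg (by positivity), hM]
      have := H1 (2 * π * s * r) (by positivity)
      have h3 : (2 * π * s * r) ^ (-1 - ((b:ℝ) - 2)/2) ≤ s ^ (-(b:ℝ)/2) := by
        rw [show (-1 - ((b:ℝ) - 2)/2) = -(b:ℝ)/2 by ring]
        apply Real.rpow_le_rpow_of_nonpos hs _ (by linarith)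
        have : 1 ≤ 2 * π * r := by nlinarith [hm.1]
        nlinarith
      have hr2 : r ≤ 3/2 := by linarith [hm.2]
      gcongr
      exact this.trans (by gcongr)
    · have hm : r ∉ Set.Icc (1-δ) (1+δ) := by
        intro hm; apply h; rw [abs_le]; constructor <;> linarith [hm.1, hm.2]
      rw [hg, Set.indicator_of_notMem hm]
      unfold sh; rw [if_neg h]; simp
  refine h1.trans ?_
  have h2 : ∫ r in Set.Ioi (0:ℝ), g r ≤ ∫ r, g r := by
    apply setIntegral_le_integral hgi
    refine Eventually.of_forall (fun r => ?_)
    exact Set.indicator_nonneg (fun _ _ => hMn) r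
  refine h2.trans ?_
  rw [hg, integral_indicator measurableSet_Icc, setIntegral_const]
  simp only [smul_eq_mul, Measure.real, Real.volume_Icc]
  rw [ENNReal.toReal_ofReal (by linarith), hM]
  apply le_of_eq; ring

/-- bounded measurable function on the shell is integrable -/
theorem shell_integrable {V : Type*} [NormedAddCommGroup V] [InnerProductSpace ℝ V] [FiniteDimensional ℝ V]
    [MeasurableSpace V] [BorelSpace V] (δ : ℝ) (hδ : δ ≤ 1/2) (f : V → ℂ) (hf : Measurable f)
    (M : ℝ) (hM : ∀ ξ, ‖ξ‖ ≤ 2 → ‖f ξ‖ ≤ M) : Integrable (fun ξ : V => (sh δ ‖ξ‖ : ℂ) * f ξ) := by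
  have hi : Integrable ((Metric.closedBall (0:V) 2).indicator (fun _ => M)) := by
    rw [integrable_indicator_iff measurableSet_closedBall]
    exact integrableOn_const measure_closedBall_lt_top.ne
  have := sh_meas δ
  refine hi.mono' (Measurable.aestronglyMeasurable (by fun_prop)) (Eventually.of_forall (fun ξ => ?_))
  rw [norm_mul, Complex.norm_real]
  by_cases h : |‖ξ‖ - 1| ≤ δ
  · have h2 : ‖ξ‖ ≤ 2 := by rw [abs_le] at h; linarith [h.2]
    rw [Set.indicator_of_mem (by simpa using h2)]
    unfold sh; rw [if_pos h]; simpa using hM ξ h2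
  · unfold sh; rw [if_neg h]
    simp only [norm_zero, zero_mul]
    apply Set.indicator_nonneg
    intro ξ hξ
    exact (norm_nonneg _).trans (hM ξ (by simpa using hξ))

/-- unimodular character -/
theorem norm_cexp2 (x : ℝ) : ‖Complex.exp (2 * π * Complex.I * x)‖ = 1 := by
  rw [Complex.norm_exp]; simp

theorem shell_T0 (b : ℕ) (hb : 1 ≤ b) : ∃ C : ℝ, 0 < C ∧ ∀ δ s : ℝ, 0 < δ → δ ≤ 1/2 → 0 < s →
    ‖∫ ξ : EuclideanSpace ℝ (Fin (b+1)), (sh δ ‖ξ‖ : ℂ) * (((‖ξ‖^2 : ℝ) : ℂ) * Complex.exp (2 * π * Complex.I * (s * ξ 0 : ℝ)))‖ ≤ C * δ * s ^ (-(b:ℝ)/2) ∧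
    ‖∫ ξ : EuclideanSpace ℝ (Fin (b+1)), (sh δ ‖ξ‖ : ℂ) * (((‖ξ‖^2 - (ξ 0)^2 : ℝ) : ℂ) * Complex.exp (2 * π * Complex.I * (s * ξ 0 : ℝ)))‖ ≤ C * δ * s ^ (-(b:ℝ)/2) := by
  obtain ⟨c, hc, P⟩ := polar_int b hb
  obtain ⟨C1, hC1, H1⟩ := shell_r_bound b hb (((b:ℝ) - 2)/2) le_rfl
  obtain ⟨C2, hC2, H2⟩ := shell_r_bound b hb (((b:ℝ) - 2)/2 + 1) (by linarith)
  refine ⟨c * (C1 + C2), by positivity, fun δ s hδ hδ2 hs => ?_⟩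
  have hsh := sh_meas δ
  have hx0 : ∀ ξ : EuclideanSpace ℝ (Fin (b+1)), (ξ 0)^2 ≤ ‖ξ‖^2 := by
    intro ξ; rw [splitE_norm, splitE_fst]; nlinarith [sq_nonneg ‖(splitE b ξ).2‖]
  have hsp : 0 < s ^ (-(b:ℝ)/2) := by positivity
  have hn2 : ∀ ξ : EuclideanSpace ℝ (Fin (b+1)), ‖ξ‖ ≤ 2 → ‖ξ‖^2 ≤ 4 := by
    intro ξ h; nlinarith [norm_nonneg ξ]
  constructor
  · have e := P (fun q => (sh δ q.1 : ℂ) * (((q.1^2 : ℝ) : ℂ) * Complex.exp (2 * π * Complex.I * (s * q.2 : ℝ)))) (by fun_prop) ?_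
    · simp only at e
      rw [e]
      have e2 : (∫ r in Set.Ioi (0:ℝ), ∫ y in Set.Ioo (-1:ℝ) 1,
        ((r ^ b * (1 - y^2) ^ (((b:ℝ) - 2)/2) : ℝ) : ℂ) * ((sh δ r : ℂ) * (((r^2 : ℝ) : ℂ) * Complex.exp (2 * π * Complex.I * (s * (r * y) : ℝ))))) =
        ∫ r in Set.Ioi (0:ℝ), ((sh δ r * r^(b+2) : ℝ) : ℂ) * Iosc (((b:ℝ) - 2)/2) (2 * π * s * r) := by
        congr 1; ext r
        rw [Iosc_eq_Ioo, ← integral_const_mul]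
        congr 1; ext y
        have : (2 * π * Complex.I * (s * (r * y) : ℝ) : ℂ) = Complex.I * (2 * π * s * r : ℝ) * y := by push_cast; ring
        rw [this]; push_cast; ring
      rw [e2, norm_mul, Complex.norm_real, Real.norm_of_nonneg hc.le]
      have := H1 δ s hδ hδ2 hs
      calc _ ≤ c * (C1 * δ * s ^ (-(b:ℝ)/2)) := by gcongr
        _ ≤ c * ((C1 + C2) * δ * s ^ (-(b:ℝ)/2)) := by gcongr; linarith
        _ = _ := by ring
    · apply shell_integrable δ hδ2 _ (by fun_prop) 4
      intro ξ h
      rw [norm_mul, norm_cexp2, mul_one, Complex.norm_real, Real.norm_of_nonneg (by positivity)]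
      exact hn2 ξ h
  · have e := P (fun q => (sh δ q.1 : ℂ) * (((q.1^2 - q.2^2 : ℝ) : ℂ) * Complex.exp (2 * π * Complex.I * (s * q.2 : ℝ)))) (by fun_prop) ?_
    · simp only at e
      rw [e]
      have e2 : (∫ r in Set.Ioi (0:ℝ), ∫ y in Set.Ioo (-1:ℝ) 1,
        ((r ^ b * (1 - y^2) ^ (((b:ℝ) - 2)/2) : ℝ) : ℂ) * ((sh δ r : ℂ) * (((r^2 - (r * y)^2 : ℝ) : ℂ) * Complex.exp (2 * π * Complex.I * (s * (r * y) : ℝ))))) =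
        ∫ r in Set.Ioi (0:ℝ), ((sh δ r * r^(b+2) : ℝ) : ℂ) * Iosc (((b:ℝ) - 2)/2 + 1) (2 * π * s * r) := by
        congr 1; ext r
        rw [Iosc_eq_Ioo, ← integral_const_mul]
        apply setIntegral_congr_fun measurableSet_Ioo
        intro y hy
        have hy1 : 0 < 1 - y^2 := by nlinarith [hy.1, hy.2]
        have : (2 * π * Complex.I * (s * (r * y) : ℝ) : ℂ) = Complex.I * (2 * π * s * r : ℝ) * y := by push_cast; ring
        simp only
        rw [this, Real.rpow_add_one hy1.ne']; push_cast; ring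
      rw [e2, norm_mul, Complex.norm_real, Real.norm_of_nonneg hc.le]
      have := H2 δ s hδ hδ2 hs
      calc _ ≤ c * (C2 * δ * s ^ (-(b:ℝ)/2)) := by gcongr
        _ ≤ c * ((C1 + C2) * δ * s ^ (-(b:ℝ)/2)) := by gcongr; linarith
        _ = _ := by ring
    · apply shell_integrable δ hδ2 _ (by fun_prop) 4
      intro ξ h
      rw [norm_mul, norm_cexp2, mul_one, Complex.norm_real, Real.norm_of_nonneg (by linarith [hx0 ξ])]
      linarith [hn2 ξ h, sq_nonneg (ξ 0)]

end Kernel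

section KernelQ
variable {b : ℕ}

/-- quadratic moments of the shell character integral -/
def Qsh (b : ℕ) (δ s : ℝ) (i j : Fin (b+1)) : ℂ :=
  ∫ ξ : EuclideanSpace ℝ (Fin (b+1)), (sh δ ‖ξ‖ : ℂ) * (((ξ i * ξ j : ℝ) : ℂ) * Complex.exp (2 * π * Complex.I * (s * ξ 0 : ℝ)))

theorem coord_le_norm (ξ : EuclideanSpace ℝ (Fin (b+1))) (i) : |ξ i| ≤ ‖ξ‖ := by
  have := PiLp.norm_apply_le ξ i
  simpa using this

theorem Qsh_integrable (δ s : ℝ) (hδ : δ ≤ 1/2) (i j : Fin (b+1)) :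
    Integrable (fun ξ : EuclideanSpace ℝ (Fin (b+1)) => (sh δ ‖ξ‖ : ℂ) * (((ξ i * ξ j : ℝ) : ℂ) * Complex.exp (2 * π * Complex.I * (s * ξ 0 : ℝ)))) := by
  apply shell_integrable δ hδ _ (by fun_prop) 4
  intro ξ h
  rw [norm_mul, norm_cexp2, mul_one, Complex.norm_real, Real.norm_eq_abs, abs_mul]
  have h1 := coord_le_norm ξ i
  have h2 := coord_le_norm ξ j
  calc |ξ i| * |ξ j| ≤ 2 * 2 := by gcongr <;> linarith
    _ = 4 := by norm_num

theorem Qsh_rot (δ s : ℝ) (i j : Fin (b+1)) (R : EuclideanSpace ℝ (Fin (b+1)) ≃ₗᵢ[ℝ] EuclideanSpace ℝ (Fin (b+1)))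
    (h0 : ∀ ξ, (R ξ) 0 = ξ 0) : Qsh b δ s i j = ∫ ξ : EuclideanSpace ℝ (Fin (b+1)), (sh δ ‖ξ‖ : ℂ) * (((R ξ i * R ξ j : ℝ) : ℂ) * Complex.exp (2 * π * Complex.I * (s * ξ 0 : ℝ))) := by
  unfold Qsh
  rw [← R.measurePreserving.integral_comp R.toHomeomorph.measurableEmbedding]
  congr 1; ext ξ
  rw [R.norm_map, h0]

theorem Qsh_zero (δ s : ℝ) (i j : Fin (b+1)) (hj : j ≠ 0) (hij : i ≠ j) : Qsh b δ s i j = 0 := by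
  set R : EuclideanSpace ℝ (Fin (b+1)) ≃ₗᵢ[ℝ] EuclideanSpace ℝ (Fin (b+1)) :=
    LinearIsometryEquiv.piLpCongrRight 2 (fun k => if k = j then LinearIsometryEquiv.neg ℝ else LinearIsometryEquiv.refl ℝ ℝ) with hR
  have hRv : ∀ ξ k, (R ξ) k = if k = j then - ξ k else ξ k := by
    intro ξ k
    rw [hR]
    simp only [LinearIsometryEquiv.piLpCongrRight_apply]
    split_ifs <;> simp
  have h := Qsh_rot δ s i j R (fun ξ => by rw [hRv, if_neg hj.symm])
  simp only [hRv, if_neg hij, if_true] at h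
  have h2 : Qsh b δ s i j = - Qsh b δ s i j := by
    nth_rw 1 [h]
    unfold Qsh
    rw [← integral_neg]
    congr 1; ext ξ; push_cast; ring
  exact self_eq_neg.1 h2

theorem Qsh_symm (δ s : ℝ) (i j : Fin (b+1)) : Qsh b δ s i j = Qsh b δ s j i := by
  unfold Qsh; congr 1; ext ξ; rw [mul_comm (ξ i)]

theorem Qsh_diag (δ s : ℝ) (i j : Fin (b+1)) (hi : i ≠ 0) (hj : j ≠ 0) : Qsh b δ s i i = Qsh b δ s j j := by
  set R : EuclideanSpace ℝ (Fin (b+1)) ≃ₗᵢ[ℝ] EuclideanSpace ℝ (Fin (b+1)) :=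
    LinearIsometryEquiv.piLpCongrLeft 2 ℝ ℝ (Equiv.swap i j) with hR
  have hRv : ∀ ξ k, (R ξ) k = ξ (Equiv.swap i j k) := by
    intro ξ k
    rw [hR]
    simp [LinearIsometryEquiv.piLpCongrLeft_apply, Equiv.piCongrLeft'_apply]
  have h := Qsh_rot δ s i i R (fun ξ => by rw [hRv, Equiv.swap_apply_of_ne_of_ne hi.symm hj.symm])
  simp only [hRv, Equiv.swap_apply_left] at h
  exact h

theorem shell_kernel (b : ℕ) (hb : 1 ≤ b) : ∃ C : ℝ, 0 < C ∧ ∀ δ : ℝ, 0 < δ → δ ≤ 1/2 →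
    ∀ X : EuclideanSpace ℝ (Fin (b+1)), X ≠ 0 →
    ‖∫ ξ : EuclideanSpace ℝ (Fin (b+1)), (sh δ ‖ξ‖ : ℂ) * ((((ξ 0)^2 : ℝ) : ℂ) * Complex.exp (2 * π * Complex.I * (⟪X, ξ⟫ : ℝ)))‖
      ≤ C * δ * ‖X‖ ^ (-(b:ℝ)/2) := by
  obtain ⟨C, hC, H⟩ := shell_T0 b hb
  refine ⟨3 * C, by positivity, fun δ hδ hδ2 X hX => ?_⟩
  set s := ‖X‖ with hs
  have hs0 : 0 < s := norm_pos_iff.2 hX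
  obtain ⟨H1, H2⟩ := H δ s hδ hδ2 hs0
  set e0 : EuclideanSpace ℝ (Fin (b+1)) := EuclideanSpace.single 0 (1:ℝ) with he0
  have he0i : ∀ ξ : EuclideanSpace ℝ (Fin (b+1)), ξ 0 = ⟪e0, ξ⟫ := by
    intro ξ; rw [he0, EuclideanSpace.inner_single_left]; simp
  have he0n : ‖e0‖ = 1 := by rw [he0]; simp
  obtain ⟨R, hR⟩ := exists_isometry_map (s • e0) X (by rw [norm_smul, he0n, mul_one, Real.norm_of_nonneg hs0.le])
  set v := R.symm e0 with hv
  have hvn : ‖v‖ = 1 := by rw [hv, R.symm.norm_map, he0n]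
  have e1 : ∫ ξ : EuclideanSpace ℝ (Fin (b+1)), (sh δ ‖ξ‖ : ℂ) * ((((ξ 0)^2 : ℝ) : ℂ) * Complex.exp (2 * π * Complex.I * (⟪X, ξ⟫ : ℝ))) =
     ∫ ξ : EuclideanSpace ℝ (Fin (b+1)), ∑ i, ∑ j, (v i * v j : ℂ) * ((sh δ ‖ξ‖ : ℂ) * (((ξ i * ξ j : ℝ) : ℂ) * Complex.exp (2 * π * Complex.I * (s * ξ 0 : ℝ)))) := by
    rw [← R.measurePreserving.integral_comp R.toHomeomorph.measurableEmbedding]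
    congr 1; ext ξ
    have a1 : (R ξ) 0 = ∑ i, v i * ξ i := by
      rw [he0i, hv, ← R.symm.inner_map_map, R.symm_apply_apply, PiLp.inner_apply]
      simp [mul_comm]
    have a2 : ⟪X, R ξ⟫ = s * ξ 0 := by
      rw [← hR, R.inner_map_map, inner_smul_left, ← he0i]; simp
    rw [R.norm_map, a1, a2, sq, Finset.sum_mul_sum]
    push_cast
    rw [Finset.sum_mul, Finset.mul_sum]
    refine Finset.sum_congr rfl (fun i _ => ?_)
    rw [Finset.sum_mul, Finset.mul_sum]
    refine Finset.sum_congr rfl (fun j _ => ?_)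
    ring
  rw [e1]
  have e2 : ∫ ξ : EuclideanSpace ℝ (Fin (b+1)), ∑ i, ∑ j, (v i * v j : ℂ) * ((sh δ ‖ξ‖ : ℂ) * (((ξ i * ξ j : ℝ) : ℂ) * Complex.exp (2 * π * Complex.I * (s * ξ 0 : ℝ)))) =
      ∑ i, ∑ j, (v i * v j : ℂ) * Qsh b δ s i j := by
    rw [integral_finsetSum _ (fun i _ => integrable_finsetSum _ (fun j _ => (Qsh_integrable δ s hδ2 i j).const_mul _))]
    refine Finset.sum_congr rfl (fun i _ => ?_)
    rw [integral_finsetSum _ (fun j _ => (Qsh_integrable δ s hδ2 i j).const_mul _)]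
    refine Finset.sum_congr rfl (fun j _ => ?_)
    rw [integral_const_mul, Qsh]
  have e3 : ∑ i, ∑ j, (v i * v j : ℂ) * Qsh b δ s i j = ∑ i, ((v i)^2 : ℂ) * Qsh b δ s i i := by
    refine Finset.sum_congr rfl (fun i _ => ?_)
    rw [Finset.sum_eq_single i]
    · ring
    · intro j _ hji
      by_cases hj : j = 0
      · have hi : i ≠ 0 := by rw [hj] at hji; exact hji.symm
        rw [Qsh_symm, Qsh_zero δ s j i hi hji, mul_zero]
      · rw [Qsh_zero δ s i j hj hji.symm, mul_zero]
    · simp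
  rw [e2, e3, Fin.sum_univ_succ]
  -- diagonal
  set T := ∫ ξ : EuclideanSpace ℝ (Fin (b+1)), (sh δ ‖ξ‖ : ℂ) * (((‖ξ‖^2 - (ξ 0)^2 : ℝ) : ℂ) * Complex.exp (2 * π * Complex.I * (s * ξ 0 : ℝ))) with hT
  set T0 := ∫ ξ : EuclideanSpace ℝ (Fin (b+1)), (sh δ ‖ξ‖ : ℂ) * (((‖ξ‖^2 : ℝ) : ℂ) * Complex.exp (2 * π * Complex.I * (s * ξ 0 : ℝ))) with hT0
  have d1 : T = ∑ i : Fin b, Qsh b δ s i.succ i.succ := by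
    unfold Qsh
    rw [← integral_finsetSum _ (fun i _ => Qsh_integrable δ s hδ2 _ _), hT]
    congr 1; ext ξ
    rw [← Finset.mul_sum, ← Finset.sum_mul]
    congr 2
    rw [EuclideanSpace.norm_sq_eq, Fin.sum_univ_succ]
    push_cast
    simp [sq, ← Complex.ofReal_mul]
  have d2 : T0 = Qsh b δ s 0 0 + T := by
    rw [d1, ← Fin.sum_univ_succ (fun i => Qsh b δ s i i)]
    unfold Qsh
    rw [← integral_finsetSum _ (fun i _ => Qsh_integrable δ s hδ2 _ _), hT0]
    congr 1; ext ξ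
    rw [← Finset.mul_sum, ← Finset.sum_mul]
    congr 2
    rw [EuclideanSpace.norm_sq_eq]
    push_cast
    simp [sq, ← Complex.ofReal_mul]
  have hD : ∀ i : Fin b, ‖Qsh b δ s i.succ i.succ‖ ≤ C * δ * s ^ (-(b:ℝ)/2) := by
    intro i
    have : T = b * Qsh b δ s i.succ i.succ := by
      rw [d1, Finset.sum_congr rfl (fun j _ => Qsh_diag δ s j.succ i.succ (Fin.succ_ne_zero j) (Fin.succ_ne_zero i))]
      simp
    rw [this, norm_mul, Complex.norm_natCast] at H2
    have hb' : (1:ℝ) ≤ b := by exact_mod_cast hb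
    nlinarith [norm_nonneg (Qsh b δ s i.succ i.succ)]
  have h00 : ‖Qsh b δ s 0 0‖ ≤ 2 * (C * δ * s ^ (-(b:ℝ)/2)) := by
    have : Qsh b δ s 0 0 = T0 - T := by rw [d2]; ring
    rw [this]
    refine (norm_sub_le _ _).trans ?_
    linarith
  have hvv : (v 0)^2 + ∑ i : Fin b, (v i.succ)^2 = 1 := by
    rw [← Fin.sum_univ_succ (fun i => (v i)^2)]
    have := EuclideanSpace.norm_sq_eq v
    rw [hvn] at this
    simpa using this.symm
  set D := C * δ * s ^ (-(b:ℝ)/2) with hDd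
  have hDn : 0 ≤ D := by positivity
  have hsum0 : 0 ≤ ∑ i : Fin b, (v i.succ)^2 := Finset.sum_nonneg (fun i _ => sq_nonneg _)
  calc _ ≤ ‖((v 0)^2 : ℂ) * Qsh b δ s 0 0‖ + ∑ i : Fin b, ‖((v i.succ)^2 : ℂ) * Qsh b δ s i.succ i.succ‖ :=
        (norm_add_le _ _).trans (by gcongr; exact norm_sum_le _ _)
    _ ≤ (v 0)^2 * (2 * D) + ∑ i : Fin b, (v i.succ)^2 * D := by
        gcongr with i
        · rw [norm_mul, norm_pow, Complex.norm_real, Real.norm_eq_abs, sq_abs]; gcongr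
        · rw [norm_mul, norm_pow, Complex.norm_real, Real.norm_eq_abs, sq_abs]; gcongr; exact hD i
    _ = (v 0)^2 * (2 * D) + (∑ i : Fin b, (v i.succ)^2) * D := by rw [Finset.sum_mul]
    _ ≤ 3 * C * δ * s ^ (-(b:ℝ)/2) := by
        have : 3 * C * δ * s ^ (-(b:ℝ)/2) = 3 * D := by rw [hDd]; ring
        rw [this]
        have h1 : (v 0)^2 ≤ 1 := by linarith
        have h2 : ∑ i : Fin b, (v i.succ)^2 ≤ 1 := by linarith [sq_nonneg (v 0)]
        nlinarith

end KernelQ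
end


open MeasureTheory Real Filter
open scoped ENNReal FourierTransform RealInnerProductSpace Topology

noncomputable section

section RT
variable {X : Type*} [MeasurableSpace X] (μ : Measure X) [SigmaFinite μ]

theorem norm_le_exp_of_log (f : X → ℂ) (Λ : ℝ) (h : ∀ x, |Real.log ‖f x‖| ≤ Λ) (x : X) : ‖f x‖ ≤ Real.exp Λ := by
  by_cases h0 : f x = 0
  · rw [h0, norm_zero]; positivity
  · have := Real.exp_log (norm_pos_iff.2 h0)
    rw [← this]
    exact Real.exp_le_exp.2 ((le_abs_self _).trans (h x))

theorem entire_exp_integral {Y : Type*} [MeasurableSpace Y] (ν : Measure Y) (c : Y → ℂ) (L : Y → ℝ) (hc : Integrable c ν)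
    (hL : Measurable L) (Λ : ℝ) (hΛ : ∀ y, |L y| ≤ Λ) (a b : ℂ) :
    Differentiable ℂ (fun z : ℂ => ∫ y, c y * Complex.exp ((a + b * z) * L y) ∂ν) := by
  intro z0
  set R := Real.exp ((‖a‖ + ‖b‖ * (‖z0‖ + 1)) * Λ) with hR
  have hIntg : ∀ z : ℂ, ‖z‖ ≤ ‖z0‖ + 1 → ∀ y, ‖Complex.exp ((a + b * z) * L y)‖ ≤ R := by
    intro z hz y
    rw [Complex.norm_exp, hR]
    apply Real.exp_le_exp.2
    refine (Complex.re_le_norm _).trans ?_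
    rw [norm_mul, Complex.norm_real, Real.norm_eq_abs]
    have h1 : ‖a + b * z‖ ≤ ‖a‖ + ‖b‖ * (‖z0‖ + 1) := by
      refine (norm_add_le _ _).trans ?_
      rw [norm_mul]; gcongr
    have h2 := hΛ y
    exact mul_le_mul h1 h2 (abs_nonneg _) (by positivity)
  have hmeas : ∀ z : ℂ, AEStronglyMeasurable (fun y => c y * Complex.exp ((a + b * z) * L y)) ν := by
    intro z
    exact hc.aestronglyMeasurable.mul (Measurable.aestronglyMeasurable (by fun_prop))
  have := hasDerivAt_integral_of_dominated_loc_of_deriv_le (μ := ν) (𝕜 := ℂ)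
    (F := fun z y => c y * Complex.exp ((a + b * z) * L y))
    (F' := fun z y => c y * (Complex.exp ((a + b * z) * L y) * (b * L y)))
    (bound := fun y => ‖c y‖ * (R * (‖b‖ * Λ))) (x₀ := z0) (s := Metric.ball z0 1) (Metric.ball_mem_nhds _ one_pos)
    (Eventually.of_forall hmeas) ?_ ?_ ?_ ?_ ?_
  · exact this.2.differentiableAt
  · refine (hc.norm.mul_const R).mono' (hmeas z0) (Eventually.of_forall (fun y => ?_))
    rw [norm_mul]; gcongr; exact hIntg z0 (by linarith) y
  · exact hc.aestronglyMeasurable.mul (Measurable.aestronglyMeasurable (by fun_prop))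
  · refine Eventually.of_forall (fun y z hz => ?_)
    have hz' : ‖z‖ ≤ ‖z0‖ + 1 := by
      have h1 : ‖z - z0‖ < 1 := by simpa [dist_eq_norm] using hz
      have := norm_add_le (z - z0) z0
      rw [sub_add_cancel] at this; linarith
    rw [norm_mul, norm_mul, norm_mul b, Complex.norm_real, Real.norm_eq_abs]
    gcongr
    · exact hIntg z hz' y
    · exact hΛ y
  · exact hc.norm.mul_const _
  · refine Eventually.of_forall (fun y z hz => ?_)
    have h1 : HasDerivAt (fun z : ℂ => (a + b * z) * L y) (b * L y) z := by
      have := ((hasDerivAt_id z).const_mul b).const_add a |>.mul_const (L y : ℂ)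
      simpa using this
    exact (h1.cexp).const_mul (c y)

theorem norm_fz (f : ℂ) (w : ℂ) (h : w.re ≠ 0) : ‖f * Complex.exp ((w - 1) * Real.log ‖f‖)‖ = ‖f‖ ^ w.re := by
  by_cases h0 : f = 0
  · rw [h0]; simp [Real.zero_rpow h]
  · have hp : 0 < ‖f‖ := norm_pos_iff.2 h0
    rw [norm_mul, Complex.norm_exp]
    have : ((w - 1) * Real.log ‖f‖ : ℂ).re = (w.re - 1) * Real.log ‖f‖ := by
      simp
    rw [this, mul_comm (w.re - 1), ← Real.rpow_def_of_pos hp, Real.rpow_sub_one hp.ne']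
    field_simp

theorem riesz_thorin (A : Set X) (hA : MeasurableSet A) (hAf : μ A ≠ ⊤) (k : X × X → ℂ) (hk : Measurable k)
    (M1 M2 : ℝ) (hM1 : 0 ≤ M1) (hM2 : 0 ≤ M2) (hk1 : ∀ q, ‖k q‖ ≤ M1)
    (hk2 : ∀ h1 h2 : X → ℂ, Measurable h1 → Measurable h2 → (∃ M, ∀ x, ‖h1 x‖ ≤ M) → (∃ M, ∀ x, ‖h2 x‖ ≤ M) →
      (∀ x ∉ A, h1 x = 0) → (∀ x ∉ A, h2 x = 0) →
      ‖∫ q : X × X, h1 q.1 * h2 q.2 * k q ∂(μ.prod μ)‖ ≤ M2 * (∫ x, ‖h1 x‖^2 ∂μ)^(1/2:ℝ) * (∫ x, ‖h2 x‖^2 ∂μ)^(1/2:ℝ))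
    (p q : ℝ) (hp : 2 < p) (hpq : 1/p + 1/q = 1)
    (f g : X → ℂ) (hf : Measurable f) (hg : Measurable g) (Λ : ℝ) (hfΛ : ∀ x, |Real.log ‖f x‖| ≤ Λ)
    (hgΛ : ∀ x, |Real.log ‖g x‖| ≤ Λ) (hfA : ∀ x ∉ A, f x = 0) (hgA : ∀ x ∉ A, g x = 0) :
    ‖∫ z : X × X, f z.1 * g z.2 * k z ∂(μ.prod μ)‖ ≤
      M1 ^ (1 - 2/p) * M2 ^ (2/p) * (∫ x, ‖f x‖^q ∂μ)^(1/q) * (∫ x, ‖g x‖^q ∂μ)^(1/q) := by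
  have hp0 : 0 < p := by linarith
  have hq0 : 0 < q := by
    by_contra h
    push Not at h
    have h1 : 1/q ≤ 0 := by rw [one_div]; exact inv_nonpos.2 h
    have h2 : 1/p < 1 := by rw [div_lt_one hp0]; linarith
    linarith
  set E := Real.exp Λ with hE
  have hfE := norm_le_exp_of_log f Λ hfΛ
  have hgE := norm_le_exp_of_log g Λ hgΛ
  -- amplitudes
  set fz : ℂ → X → ℂ := fun z x => f x * Complex.exp (((q * (1 - z/2)) - 1) * Real.log ‖f x‖) with hfz
  set gz : ℂ → X → ℂ := fun z x => g x * Complex.exp (((q * (1 - z/2)) - 1) * Real.log ‖g x‖) with hgz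
  have hmf : ∀ z, Measurable (fz z) := by intro z; simp only [hfz]; fun_prop
  have hmg : ∀ z, Measurable (gz z) := by intro z; simp only [hgz]; fun_prop
  have hre : ∀ z : ℂ, (q * (1 - z/2) : ℂ).re = q * (1 - z.re/2) := by
    intro z
    have : (q * (1 - z/2) : ℂ) = ((q:ℝ):ℂ) * (1 - z/2) := rfl
    rw [Complex.re_ofReal_mul]; simp
  have hnf : ∀ z : ℂ, z.re ≤ 1 → ∀ x, ‖fz z x‖ = ‖f x‖ ^ (q * (1 - z.re/2)) := by
    intro z hz x
    rw [← hre z]; apply norm_fz; rw [hre]; apply ne_of_gt; apply mul_pos hq0; linarith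
  have hng : ∀ z : ℂ, z.re ≤ 1 → ∀ x, ‖gz z x‖ = ‖g x‖ ^ (q * (1 - z.re/2)) := by
    intro z hz x
    rw [← hre z]; apply norm_fz; rw [hre]; apply ne_of_gt; apply mul_pos hq0; linarith
  set If := ∫ x, ‖f x‖^q ∂μ with hIf
  set Ig := ∫ x, ‖g x‖^q ∂μ with hIg
  have hIf0 : 0 ≤ If := integral_nonneg (fun x => by positivity)
  have hIg0 : 0 ≤ Ig := integral_nonneg (fun x => by positivity)
  have bint : ∀ (h : X → ℂ) (hh : Measurable h) (hb : ∀ x, ‖h x‖ ≤ E) (hz : ∀ x ∉ A, h x = 0) (r : ℝ) (hr : 0 < r),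
      Integrable (fun x => ‖h x‖^r) μ := by
    intro h hh hb hz r hr
    have hi : Integrable (A.indicator (fun _ => E ^ r)) μ := by
      rw [integrable_indicator_iff hA]; exact integrableOn_const hAf
    refine hi.mono' (Measurable.aestronglyMeasurable (by fun_prop)) (Eventually.of_forall (fun x => ?_))
    rw [Real.norm_of_nonneg (by positivity)]
    by_cases hx : x ∈ A
    · rw [Set.indicator_of_mem hx]; exact Real.rpow_le_rpow (norm_nonneg _) (hb x) hr.le
    · rw [Set.indicator_of_notMem hx, hz x hx, norm_zero, Real.zero_rpow hr.ne']
  set Φ : ℂ → ℂ := fun z => ∫ y : X × X, fz z y.1 * gz z y.2 * k y ∂(μ.prod μ) with hΦ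
  have hΦ2 : Φ = fun z : ℂ => ∫ y : X × X, (f y.1 * g y.2 * k y) * Complex.exp (((q - 1) + (-q/2) * z) * ((Real.log ‖f y.1‖ + Real.log ‖g y.2‖ : ℝ) : ℂ)) ∂(μ.prod μ) := by
    ext z
    simp only [hΦ, hfz, hgz]
    congr 1; ext y
    have : Complex.exp (((q - 1) + (-q/2) * z) * ((Real.log ‖f y.1‖ + Real.log ‖g y.2‖ : ℝ) : ℂ)) =
      Complex.exp (((q * (1 - z/2)) - 1) * Real.log ‖f y.1‖) * Complex.exp (((q * (1 - z/2)) - 1) * Real.log ‖g y.2‖) := by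
      rw [← Complex.exp_add]; congr 1; push_cast; ring
    rw [this]; ring
  have hcint : Integrable (fun y : X × X => f y.1 * g y.2 * k y) (μ.prod μ) := by
    have hi : Integrable (fun y : X × X => ‖f y.1‖ ^ (1:ℝ) * ‖g y.2‖^(1:ℝ) * M1) (μ.prod μ) :=
      ((bint f hf hfE hfA 1 one_pos).mul_prod (bint g hg hgE hgA 1 one_pos)).mul_const M1
    refine hi.mono' (Measurable.aestronglyMeasurable (by fun_prop)) (Eventually.of_forall (fun y => ?_))
    rw [norm_mul, norm_mul, Real.rpow_one, Real.rpow_one]; gcongr; exact hk1 y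
  have hdiff : Differentiable ℂ Φ := by
    rw [hΦ2]
    apply entire_exp_integral (μ.prod μ) _ (fun y => Real.log ‖f y.1‖ + Real.log ‖g y.2‖) hcint (by fun_prop) (Λ + Λ)
    intro y
    exact (abs_add_le _ _).trans (add_le_add (hfΛ _) (hgΛ _))
  -- general bound on the strip
  have hgen : ∀ z : ℂ, 0 ≤ z.re → z.re ≤ 1 → ‖Φ z‖ ≤ M1 * (∫ x, ‖f x‖^(q * (1 - z.re/2)) ∂μ) * (∫ x, ‖g x‖^(q * (1 - z.re/2)) ∂μ) := by
    intro z hz0 hz1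
    have hr : 0 < q * (1 - z.re/2) := mul_pos hq0 (by linarith)
    have := norm_integral_le_of_norm_le (μ := μ.prod μ) (f := fun y : X × X => fz z y.1 * gz z y.2 * k y)
      (((bint f hf hfE hfA _ hr).mul_prod (bint g hg hgE hgA _ hr)).mul_const M1)
      (Eventually.of_forall (fun y => by
        rw [norm_mul, norm_mul, hnf z hz1, hng z hz1]; gcongr; exact hk1 y))
    refine this.trans (le_of_eq ?_)
    rw [integral_mul_const, integral_prod_mul (fun x => ‖f x‖ ^ (q * (1 - z.re/2))) (fun x => ‖g x‖ ^ (q * (1 - z.re/2)))]; ring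
  have hE1 : 1 ≤ max E 1 := le_max_right _ _
  have hbr : ∀ (h : X → ℂ) (hh : Measurable h) (hb : ∀ x, ‖h x‖ ≤ E) (hz : ∀ x ∉ A, h x = 0) (r : ℝ) (hr : 0 < r) (hrq : r ≤ q),
      ∫ x, ‖h x‖^r ∂μ ≤ μ.real A * (max E 1)^q := by
    intro h hh hb hz r hr hrq
    have hi : Integrable (A.indicator (fun _ => (max E 1) ^ q)) μ := by
      rw [integrable_indicator_iff hA]; exact integrableOn_const hAf
    have := integral_mono (bint h hh hb hz r hr) hi (fun x => by
      by_cases hx : x ∈ A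
      · rw [Set.indicator_of_mem hx]
        exact (Real.rpow_le_rpow (norm_nonneg _) ((hb x).trans (le_max_left _ _)) hr.le).trans
          (Real.rpow_le_rpow_of_exponent_le hE1 hrq)
      · rw [Set.indicator_of_notMem hx, hz x hx, norm_zero, Real.zero_rpow hr.ne'])
    refine this.trans (le_of_eq ?_)
    rw [integral_indicator hA, setIntegral_const, smul_eq_mul]
  have hbdd : BddAbove ((norm ∘ Φ) '' Complex.HadamardThreeLines.verticalClosedStrip 0 1) := by
    refine ⟨M1 * (μ.real A * (max E 1)^q) * (μ.real A * (max E 1)^q), ?_⟩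
    rintro _ ⟨z, hz, rfl⟩
    have hz0 : 0 ≤ z.re := hz.1
    have hz1 : z.re ≤ 1 := hz.2
    have hr : 0 < q * (1 - z.re/2) := mul_pos hq0 (by linarith)
    have hr2 : q * (1 - z.re/2) ≤ q := by nlinarith
    refine (hgen z hz0 hz1).trans ?_
    gcongr
    · exact hbr f hf hfE hfA _ hr hr2
    · exact hbr g hg hgE hgA _ hr hr2
  have hth0 : 0 < 2/p := by positivity
  have hth1 : 2/p < 1 := by rw [div_lt_one hp0]; exact hp
  have hmain := Complex.HadamardThreeLines.norm_le_interp_of_mem_verticalClosedStrip' (f := Φ) (z := ((2/p : ℝ) : ℂ))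
    (a := M1 * If * Ig) (b := M2 * If^(1/2:ℝ) * Ig^(1/2:ℝ)) (l := 0) (u := 1) one_pos ?_ hdiff.diffContOnCl hbdd ?_ ?_
  · have hval : Φ ((2/p : ℝ) : ℂ) = ∫ z : X × X, f z.1 * g z.2 * k z ∂(μ.prod μ) := by
      simp only [hΦ, hfz, hgz]
      have : (q * (1 - (((2/p : ℝ) : ℂ))/2) - 1 : ℂ) = 0 := by
        have h1 : q * (1 - (2/p)/2) - 1 = 0 := by
          have : 1/q = 1 - 1/p := by linarith
          have h3 : 1 - (2/p)/2 = 1/q := by rw [this]; ring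
          rw [h3]; field_simp; ring
        exact_mod_cast h1
      simp only [this, zero_mul, Complex.exp_zero, mul_one]
    rw [hval] at hmain
    refine hmain.trans (le_of_eq ?_)
    simp only [Complex.ofReal_re, sub_zero, div_one]
    have hqe : 1/q = (1 - 2/p) + (1/2) * (2/p) := by
      have : 1/q = 1 - 1/p := by linarith
      rw [this]; ring
    have key : ∀ I : ℝ, 0 ≤ I → I ^ (1/q) = I ^ (1 - 2/p) * (I ^ (1/2:ℝ)) ^ (2/p) := by
      intro I hI
      rw [← Real.rpow_mul hI, ← Real.rpow_add_of_nonneg hI (by linarith) (by positivity), hqe]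
    rw [key If hIf0, key Ig hIg0, Real.mul_rpow (by positivity) hIg0, Real.mul_rpow hM1 hIf0,
      Real.mul_rpow (by positivity) (by positivity), Real.mul_rpow hM2 (by positivity)]
    ring
  · constructor <;> simp <;> linarith
  · intro z hz
    have hz : z.re = 0 := hz
    have := hgen z (by linarith) (by linarith)
    simpa [hz] using this
  · intro z hz
    have hz : z.re = 1 := hz
    have h := hk2 (fz z) (gz z) (hmf z) (hmg z) ?_ ?_ ?_ ?_
    · refine h.trans (le_of_eq ?_)
      have e1 : ∫ x, ‖fz z x‖^2 ∂μ = If := by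
        rw [hIf]; congr 1; ext x
        rw [hnf z hz.le, hz, ← Real.rpow_natCast, ← Real.rpow_mul (norm_nonneg _)]
        congr 1; push_cast; ring
      have e2 : ∫ x, ‖gz z x‖^2 ∂μ = Ig := by
        rw [hIg]; congr 1; ext x
        rw [hng z hz.le, hz, ← Real.rpow_natCast, ← Real.rpow_mul (norm_nonneg _)]
        congr 1; push_cast; ring
      rw [e1, e2]
    · refine ⟨E ^ (q * (1 - z.re/2)), fun x => ?_⟩
      rw [hnf z hz.le]; apply Real.rpow_le_rpow (norm_nonneg _) (hfE x); rw [hz]; nlinarith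
    · refine ⟨E ^ (q * (1 - z.re/2)), fun x => ?_⟩
      rw [hng z hz.le]; apply Real.rpow_le_rpow (norm_nonneg _) (hgE x); rw [hz]; nlinarith
    · intro x hx; simp only [hfz]; rw [hfA x hx, zero_mul]
    · intro x hx; simp only [hgz]; rw [hgA x hx, zero_mul]

end RT
end


open MeasureTheory Real Filter
open scoped ENNReal FourierTransform RealInnerProductSpace Topology

noncomputable section

section HLS
variable {T : Type*} [MeasurableSpace T] (μ : Measure T) [SFinite μ]

theorem young3 (L L' : T × T → ℝ≥0∞) (hL : Measurable L) (hL' : Measurable L') (M : ℝ≥0∞)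
    (h1 : ∀ t, ∫⁻ t', L (t, t') ∂μ ≤ M) (h2 : ∀ t', ∫⁻ t, L' (t, t') ∂μ ≤ M)
    (p q : ℝ) (hp : 2 < p) (hpq : 1/p + 1/q = 1) (f g : T → ℝ≥0∞) (hf : Measurable f) (hg : Measurable g) :
    ∫⁻ z : T × T, f z.1 * g z.2 * (L z ^ (1/p) * L' z ^ (1/p)) ∂(μ.prod μ) ≤
      M ^ (2/p) * (∫⁻ t, f t ^ q ∂μ) ^ (1/q) * (∫⁻ t, g t ^ q ∂μ) ^ (1/q) := by
  have hp0 : 0 < p := by linarith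
  have hp1 : 1/p < 1 := by rw [div_lt_one hp0]; linarith
  have hp2 : 2/p < 1 := by rw [div_lt_one hp0]; linarith
  have hp3 : 0 < 1/p := by positivity
  have hq1 : 1/q = 1 - 1/p := by linarith
  have hq0 : 0 < q := one_div_pos.1 (by rw [hq1]; linarith)
  have hq2 : q * (1/p + (1 - 2/p)) = 1 := by
    have : 1/p + (1 - 2/p) = 1/q := by rw [hq1]; ring
    rw [this]; field_simp
  set w : Fin 3 → ℝ := ![1/p, 1/p, 1 - 2/p] with hw
  set Fn : Fin 3 → T × T → ℝ≥0∞ := ![fun z => f z.1 ^ q * L z, fun z => g z.2 ^ q * L' z, fun z => f z.1 ^ q * g z.2 ^ q] with hFn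
  have key := ENNReal.lintegral_prod_norm_pow_le (μ := μ.prod μ) (Finset.univ : Finset (Fin 3)) (f := Fn) (p := w) ?_ ?_ ?_
  · simp only [Fin.prod_univ_three, hFn, hw, Matrix.cons_val_zero, Matrix.cons_val_one, Matrix.cons_val_two, Matrix.head_cons, Matrix.tail_cons, Matrix.cons_val] at key
    have e1 : ∫⁻ z : T × T, f z.1 ^ q * L z ∂(μ.prod μ) ≤ M * ∫⁻ t, f t ^ q ∂μ := by
      rw [lintegral_prod _ (by fun_prop)]
      rw [← lintegral_const_mul _ (by fun_prop)]
      apply lintegral_mono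
      intro t
      simp only
      rw [lintegral_const_mul _ (by fun_prop), mul_comm]
      gcongr; exact h1 t
    have e2 : ∫⁻ z : T × T, g z.2 ^ q * L' z ∂(μ.prod μ) ≤ M * ∫⁻ t, g t ^ q ∂μ := by
      rw [lintegral_prod_symm _ (by fun_prop)]
      rw [← lintegral_const_mul _ (by fun_prop)]
      apply lintegral_mono
      intro t
      simp only
      rw [lintegral_const_mul _ (by fun_prop), mul_comm]
      gcongr; exact h2 t
    have e3 : ∫⁻ z : T × T, f z.1 ^ q * g z.2 ^ q ∂(μ.prod μ) = (∫⁻ t, f t ^ q ∂μ) * ∫⁻ t, g t ^ q ∂μ := by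
      exact lintegral_prod_mul (f := fun t => f t ^ q) (g := fun t => g t ^ q) (by fun_prop) (by fun_prop)
    have hl : ∀ z : T × T, f z.1 * g z.2 * (L z ^ (1/p) * L' z ^ (1/p)) =
        (f z.1 ^ q * L z) ^ (1/p) * (g z.2 ^ q * L' z) ^ (1/p) * (f z.1 ^ q * g z.2 ^ q) ^ (1 - 2/p) := by
      intro z
      rw [ENNReal.mul_rpow_of_nonneg _ _ hp3.le, ENNReal.mul_rpow_of_nonneg _ _ hp3.le, ENNReal.mul_rpow_of_nonneg _ _ (by linarith)]
      have hh : ∀ x : ℝ≥0∞, x = (x ^ q) ^ (1/p) * (x ^ q) ^ (1 - 2/p) := by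
        intro x
        rw [← ENNReal.rpow_add_of_nonneg _ _ hp3.le (by linarith), ← ENNReal.rpow_mul, hq2, ENNReal.rpow_one]
      nth_rewrite 1 [hh (f z.1), hh (g z.2)]
      ring
    rw [lintegral_congr hl]
    refine key.trans ?_
    rw [e3]
    set If := ∫⁻ t, f t ^ q ∂μ
    set Ig := ∫⁻ t, g t ^ q ∂μ
    calc _ ≤ (M * If) ^ (1/p) * (M * Ig)^(1/p) * (If * Ig) ^ (1 - 2/p) := by gcongr
      _ = _ := by
        rw [ENNReal.mul_rpow_of_nonneg _ _ hp3.le, ENNReal.mul_rpow_of_nonneg _ _ hp3.le, ENNReal.mul_rpow_of_nonneg _ _ (by linarith)]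
        have hM : M ^ (2/p) = M ^ (1/p) * M ^ (1/p) := by
          rw [← ENNReal.rpow_add_of_nonneg _ _ hp3.le hp3.le]; congr 1; ring
        have hh : ∀ x : ℝ≥0∞, x ^ (1/q) = x ^ (1/p) * x ^ (1 - 2/p) := by
          intro x
          rw [← ENNReal.rpow_add_of_nonneg _ _ hp3.le (by linarith), hq1]; congr 1; ring
        rw [hM, hh If, hh Ig]; ring
  · intro i _
    fin_cases i <;> simp [hFn] <;> fun_prop
  · simp [Fin.sum_univ_three, hw]; ring
  · intro i _
    fin_cases i <;> simp [hw] <;> first | positivity | skip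
    linarith

end HLS
end


open MeasureTheory Real Filter
open scoped ENNReal FourierTransform RealInnerProductSpace Topology

noncomputable section

theorem sw_int (σ : ℝ) (h0 : 0 < σ) (h1 : σ < 1) :
    IntegrableOn (fun s : ℝ => s ^ (σ/2 - 1) * |1 - s| ^ (-σ)) (Set.Ioi 0) := by
  have hm : Measurable (fun s : ℝ => s ^ (σ/2 - 1) * |1 - s| ^ (-σ)) := by fun_prop
  have hsplit : Set.Ioi (0:ℝ) = Set.Ioc 0 (1/2) ∪ (Set.Ioc (1/2) 2 ∪ Set.Ioi 2) := by
    rw [Set.Ioc_union_Ioi_eq_Ioi (by norm_num), Set.Ioc_union_Ioi_eq_Ioi (by norm_num)]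
  rw [hsplit]
  refine IntegrableOn.union ?_ (IntegrableOn.union ?_ ?_)
  · have h : IntegrableOn (fun s : ℝ => s ^ (σ/2 - 1) * (1/2) ^ (-σ)) (Set.Ioc 0 (1/2)) := by
      apply Integrable.mul_const
      exact (intervalIntegral.intervalIntegrable_rpow' (by linarith) : IntervalIntegrable _ _ 0 (1/2)).1
    refine h.mono' hm.aestronglyMeasurable ((ae_restrict_iff' measurableSet_Ioc).2 (Eventually.of_forall fun s hs => ?_))
    have := hs.1
    rw [Real.norm_of_nonneg (by positivity)]
    gcongr ?_ * ?_
    apply Real.rpow_le_rpow_of_nonpos (by norm_num) _ (by linarith)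
    rw [abs_of_nonneg (by linarith [hs.2])]; linarith [hs.2]
  · have h : IntegrableOn (fun s : ℝ => (1/2) ^ (σ/2 - 1) * |1 - s| ^ (-σ)) (Set.Ioc (1/2) 2) := by
      apply Integrable.const_mul
      have h3 : IntervalIntegrable (fun x : ℝ => |x| ^ (-σ)) volume (-1) 1 := by
        have hp : IntervalIntegrable (fun x : ℝ => |x| ^ (-σ)) volume 0 1 := by
          refine (intervalIntegral.intervalIntegrable_rpow' (r := -σ) (by linarith)).congr ?_
          intro x hx; simp only
          rw [abs_of_nonneg]
          rw [Set.uIoc_of_le zero_le_one] at hx; exact hx.1.le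
        have hn : IntervalIntegrable (fun x : ℝ => |x| ^ (-σ)) volume (-1) 0 := by
          have := hp.comp_mul_left (c := -1)
          simp at this
          exact this.symm
        exact hn.trans hp
      have h4 := (h3.comp_sub_left 1)
      simp at h4
      have h5 : IntegrableOn (fun s : ℝ => |1 - s| ^ (-σ)) (Set.Ioc 0 2) := by
        norm_num at h4
        exact h4.symm.1
      exact h5.mono_set (Set.Ioc_subset_Ioc_left (by norm_num))
    refine h.mono' hm.aestronglyMeasurable ((ae_restrict_iff' measurableSet_Ioc).2 (Eventually.of_forall fun s hs => ?_))
    have hs1 := hs.1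
    have : 0 < s := by linarith
    rw [Real.norm_of_nonneg (by positivity)]
    gcongr ?_ * ?_
    exact Real.rpow_le_rpow_of_nonpos (by norm_num) hs1.le (by linarith)
  · have h : IntegrableOn (fun s : ℝ => (1/2) ^ (-σ) * s ^ (-(σ/2) - 1)) (Set.Ioi 2) := by
      apply Integrable.const_mul
      exact integrableOn_Ioi_rpow_of_lt (by linarith) (by norm_num)
    refine h.mono' hm.aestronglyMeasurable ((ae_restrict_iff' measurableSet_Ioi).2 (Eventually.of_forall fun s hs => ?_))
    have hs1 : 2 < s := hs
    have hs0 : 0 < s := by linarith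
    rw [Real.norm_of_nonneg (by positivity)]
    have h2 : |1 - s| ^ (-σ) ≤ (1/2 * s) ^ (-σ) := by
      apply Real.rpow_le_rpow_of_nonpos (by positivity) _ (by linarith)
      rw [abs_of_nonpos (by linarith)]; linarith
    calc _ ≤ s ^ (σ/2 - 1) * (1/2 * s) ^ (-σ) := by gcongr
      _ = _ := by
        rw [Real.mul_rpow (by norm_num) hs0.le, mul_left_comm, ← Real.rpow_add hs0]; congr 2; ring

theorem sw_bound (σ : ℝ) (h0 : 0 < σ) (h1 : σ < 1) : ∃ M : ℝ≥0∞, M ≠ ⊤ ∧ ∀ t : ℝ, 0 < t →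
    ∫⁻ t' in Set.Ioi (0:ℝ), ENNReal.ofReal ((t * t') ^ (σ/2) * |t - t'| ^ (-σ) / t') ≤ M := by
  refine ⟨ENNReal.ofReal (∫ s in Set.Ioi (0:ℝ), s ^ (σ/2 - 1) * |1 - s| ^ (-σ)), ENNReal.ofReal_ne_top, ?_⟩
  intro t ht
  have hI := sw_int σ h0 h1
  have e : Set.EqOn (fun t' : ℝ => (t * t') ^ (σ/2) * |t - t'| ^ (-σ) / t') (fun t' => t⁻¹ * (fun s : ℝ => s ^ (σ/2 - 1) * |1 - s| ^ (-σ)) (t⁻¹ * t')) (Set.Ioi 0) := by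
    intro t' ht'
    have ht' : 0 < t' := ht'
    simp only
    have e1 : |1 - t⁻¹ * t'| = t⁻¹ * |t - t'| := by
      rw [show (1 - t⁻¹ * t') = t⁻¹ * (t - t') by field_simp, abs_mul, abs_of_pos (inv_pos.2 ht)]
    rw [e1, Real.mul_rpow ht.le ht'.le, Real.mul_rpow (by positivity) ht'.le, Real.mul_rpow (by positivity) (abs_nonneg _),
      Real.inv_rpow ht.le, Real.inv_rpow ht.le, Real.rpow_sub_one ht.ne', Real.rpow_sub_one ht'.ne', Real.rpow_neg ht.le]
    have h3 : t ^ σ = t ^ (σ/2) * t ^ (σ/2) := by rw [← Real.rpow_add ht]; congr 1; ring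
    rw [h3]
    have : t ^ (σ/2) ≠ 0 := (Real.rpow_pos_of_pos ht _).ne'
    field_simp
  have hI2 : IntegrableOn (fun t' : ℝ => t⁻¹ * (fun s : ℝ => s ^ (σ/2 - 1) * |1 - s| ^ (-σ)) (t⁻¹ * t')) (Set.Ioi 0) := by
    apply Integrable.const_mul
    have := (integrableOn_Ioi_comp_mul_left_iff (fun s : ℝ => s ^ (σ/2 - 1) * |1 - s| ^ (-σ)) 0 (inv_pos.2 ht)).2 (by simpa using hI)
    exact this
  rw [setLIntegral_congr_fun measurableSet_Ioi (fun x hx => congrArg ENNReal.ofReal (e hx))]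
  rw [← ofReal_integral_eq_lintegral_ofReal hI2]
  · apply ENNReal.ofReal_le_ofReal
    rw [integral_const_mul, integral_comp_mul_left_Ioi (fun s : ℝ => s ^ (σ/2 - 1) * |1 - s| ^ (-σ)) 0 (inv_pos.2 ht)]
    simp [ht.ne']
  · refine (ae_restrict_iff' measurableSet_Ioi).2 (Eventually.of_forall fun s hs => ?_)
    have hs : 0 < s := hs
    simp only [Pi.zero_apply]
    positivity

theorem sup_set_int (l : ℝ) (h0 : 0 < l) (h1 : l < 1) (E : Set ℝ) (hE : MeasurableSet E) (x : ℝ) :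
    ∫⁻ y in E, ENNReal.ofReal (|x - y| ^ (-l)) ≤ ENNReal.ofReal (2 / (1 - l) + 1) * (volume E) ^ (1 - l) := by
  by_cases hz : volume E = 0
  · rw [setLIntegral_measure_zero _ _ hz]; exact zero_le
  by_cases ht : volume E = ⊤
  · rw [ht, ENNReal.top_rpow_of_pos (by linarith), ENNReal.mul_top]
    · exact le_top
    · rw [ne_eq, ENNReal.ofReal_eq_zero, not_le]
      have : 0 < 1 - l := by linarith
      positivity
  obtain ⟨R, hR⟩ : ∃ R : ℝ, R = (volume E).toReal := ⟨_, rfl⟩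
  have hRE : volume E = ENNReal.ofReal R := by rw [hR, ENNReal.ofReal_toReal ht]
  have hRp : 0 < R := by rw [hR]; exact ENNReal.toReal_pos hz ht
  have hle : ∀ y, ENNReal.ofReal (|x - y| ^ (-l)) ≤ (Set.Icc (x - R) (x + R)).indicator (fun y => ENNReal.ofReal (|x - y| ^ (-l))) y + ENNReal.ofReal (R ^ (-l)) := by
    intro y
    by_cases hy : y ∈ Set.Icc (x - R) (x + R)
    · rw [Set.indicator_of_mem hy]; exact le_self_add
    · rw [Set.indicator_of_notMem hy, zero_add]
      apply ENNReal.ofReal_le_ofReal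
      apply Real.rpow_le_rpow_of_nonpos hRp _ (by linarith)
      by_contra hc
      push Not at hc
      rw [abs_lt] at hc
      exact hy ⟨by linarith, by linarith⟩
  have hloc : ∫⁻ y in Set.Icc (x - R) (x + R), ENNReal.ofReal (|x - y| ^ (-l)) ≤ ENNReal.ofReal (2 / (1 - l) * R ^ (1 - l)) := by
    have hp : IntervalIntegrable (fun x : ℝ => |x| ^ (-l)) volume 0 R := by
      refine (intervalIntegral.intervalIntegrable_rpow' (r := -l) (by linarith)).congr ?_
      intro x hx; simp only
      rw [abs_of_nonneg]
      rw [Set.uIoc_of_le hRp.le] at hx; exact hx.1.le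
    have hn : IntervalIntegrable (fun x : ℝ => |x| ^ (-l)) volume (-R) 0 := by
      have := hp.comp_mul_left (c := -1)
      simp only [neg_mul, one_mul, abs_neg, div_neg, div_one, neg_zero] at this
      exact this.symm
    have hv : ∫ y in (0:ℝ)..R, |y| ^ (-l) = R ^ (1 - l) / (1 - l) := by
      have : ∫ y in (0:ℝ)..R, |y| ^ (-l) = ∫ y in (0:ℝ)..R, y ^ (-l) := by
        apply intervalIntegral.integral_congr
        intro y hy; simp only
        rw [Set.uIcc_of_le hRp.le] at hy
        rw [abs_of_nonneg hy.1]
      rw [this, integral_rpow (Or.inl (by linarith))]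
      rw [Real.zero_rpow (by linarith)]
      rw [show -l + 1 = 1 - l by ring]; ring
    have hv2 : ∫ y in (-R)..0, |y| ^ (-l) = R ^ (1 - l) / (1 - l) := by
      have := intervalIntegral.integral_comp_neg (a := 0) (b := R) (fun y : ℝ => |y| ^ (-l))
      simp at this
      rw [← this, hv]
    have hii := (hn.trans hp).comp_sub_left x
    simp at hii
    have hio : IntegrableOn (fun y => |x - y| ^ (-l)) (Set.Icc (x - R) (x + R)) := by
      rw [integrableOn_Icc_iff_integrableOn_Ioc]
      exact hii.symm.1
    rw [← ofReal_integral_eq_lintegral_ofReal hio (Eventually.of_forall fun y => by simp only [Pi.zero_apply]; positivity)]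
    apply ENNReal.ofReal_le_ofReal
    rw [integral_Icc_eq_integral_Ioc, ← intervalIntegral.integral_of_le (by linarith)]
    rw [intervalIntegral.integral_comp_sub_left (fun y : ℝ => |y| ^ (-l)) x]
    rw [show x - (x + R) = -R by ring, show x - (x - R) = R by ring, ← intervalIntegral.integral_add_adjacent_intervals hn hp, hv, hv2]
    apply le_of_eq; ring
  calc _ ≤ ∫⁻ y in E, ((Set.Icc (x - R) (x + R)).indicator (fun y => ENNReal.ofReal (|x - y| ^ (-l))) y + ENNReal.ofReal (R ^ (-l))) := lintegral_mono hle
    _ = (∫⁻ y in E, (Set.Icc (x - R) (x + R)).indicator (fun y => ENNReal.ofReal (|x - y| ^ (-l))) y) + ENNReal.ofReal (R ^ (-l)) * ENNReal.ofReal R := by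
      rw [lintegral_add_right _ measurable_const, setLIntegral_const, hRE]
    _ ≤ ENNReal.ofReal (2 / (1 - l) * R ^ (1 - l)) + ENNReal.ofReal (R ^ (-l)) * ENNReal.ofReal R := by
      gcongr
      refine (setLIntegral_le_lintegral _ _).trans ?_
      rw [lintegral_indicator measurableSet_Icc]; exact hloc
    _ = _ := by
      have : 0 < 1 - l := by linarith
      rw [hRE, ENNReal.ofReal_rpow_of_pos hRp, ← ENNReal.ofReal_mul (by positivity), ← ENNReal.ofReal_mul (by positivity), ← ENNReal.ofReal_add (by positivity) (by positivity)]
      congr 1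
      rw [show (1 - l) = (-l) + 1 by ring, Real.rpow_add_one hRp.ne']; ring

/-- one-sided layer estimate -/
theorem hls_layer (l q : ℝ) (h0 : 0 < l) (h1 : l < 1) (hq : q = 2/(2 - l)) : ∃ C : ℝ≥0∞, C ≠ ⊤ ∧ ∀ (G : ℝ → ℝ≥0∞), Measurable G →
    ∀ a : ℝ, 0 < a → ∫⁻ b in Set.Ioc 0 a, (G b) ^ (1 - l) ≤ C * ENNReal.ofReal (a ^ (q - 1)) * (∫⁻ b in Set.Ioi (0:ℝ), G b * ENNReal.ofReal (b ^ (q-1))) ^ (1 - l) := by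
  have hl2 : 0 < 2 - l := by linarith
  have hl1 : 0 < 1 - l := by linarith
  have hq1 : q - 1 = l / (2 - l) := by rw [hq]; field_simp; ring
  set κ := (1 - l) / (2 - l) with hκ
  have hκ0 : 0 < κ := by positivity
  have hκ1 : κ < 1 := by rw [hκ, div_lt_one hl2]; linarith
  refine ⟨ENNReal.ofReal ((1/(1-κ)) ^ l), ENNReal.ofReal_ne_top, ?_⟩
  intro G hG a ha
  have hv : ∫⁻ b in Set.Ioc 0 a, ENNReal.ofReal (b ^ (-κ)) = ENNReal.ofReal (1/(1-κ) * a ^ (1 - κ)) := by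
    have hii : IntegrableOn (fun b : ℝ => b ^ (-κ)) (Set.Ioc 0 a) := (intervalIntegral.intervalIntegrable_rpow' (r := -κ) (a := 0) (b := a) (by linarith)).1
    rw [← ofReal_integral_eq_lintegral_ofReal hii ((ae_restrict_iff' measurableSet_Ioc).2 (Eventually.of_forall fun y hy => by
      have := hy.1; simp only [Pi.zero_apply]; positivity))]
    rw [← intervalIntegral.integral_of_le ha.le, integral_rpow (Or.inl (by linarith)), Real.zero_rpow (by linarith)]
    congr 1; rw [show -κ + 1 = 1 - κ by ring]; ring
  have hH := ENNReal.lintegral_mul_le_Lp_mul_Lq (μ := volume.restrict (Set.Ioc 0 a)) (p := 1/(1-l)) (q := 1/l)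
    (f := fun b => (G b * ENNReal.ofReal (b ^ (q-1))) ^ (1 - l)) (g := fun b => ENNReal.ofReal (b ^ (-κ)) ^ l) ?_ ?_ ?_
  · have e : Set.EqOn (fun b => (G b) ^ (1 - l)) ((fun b => (G b * ENNReal.ofReal (b ^ (q-1))) ^ (1 - l)) * (fun b => ENNReal.ofReal (b ^ (-κ)) ^ l)) (Set.Ioc 0 a) := by
      intro b hb
      have hb0 : 0 < b := hb.1
      simp only [Pi.mul_apply]
      rw [ENNReal.mul_rpow_of_nonneg _ _ hl1.le, ENNReal.ofReal_rpow_of_pos (by positivity), ENNReal.ofReal_rpow_of_pos (by positivity), mul_assoc, ← ENNReal.ofReal_mul (by positivity), ← Real.rpow_mul hb0.le, ← Real.rpow_mul hb0.le, ← Real.rpow_add hb0]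
      have : (q - 1) * (1 - l) + -κ * l = 0 := by rw [hq1, hκ]; ring
      rw [this]; simp
    rw [setLIntegral_congr_fun measurableSet_Ioc e]
    refine hH.trans ?_
    have e2 : ∀ x : ℝ≥0∞, (x ^ (1 - l)) ^ (1/(1-l)) = x := by
      intro x; rw [← ENNReal.rpow_mul, mul_one_div_cancel hl1.ne', ENNReal.rpow_one]
    have e3 : ∀ x : ℝ≥0∞, (x ^ l) ^ (1/l) = x := by
      intro x; rw [← ENNReal.rpow_mul, mul_one_div_cancel h0.ne', ENNReal.rpow_one]
    simp only [e2, e3, one_div_one_div]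
    rw [hv, ENNReal.ofReal_rpow_of_nonneg (by have : 0 < 1 - κ := by linarith
                                              positivity) h0.le, Real.mul_rpow (by have : 0 < 1 - κ := by linarith
                                                                                   positivity) (by positivity), ← Real.rpow_mul ha.le]
    have : (1 - κ) * l = q - 1 := by rw [hq1, hκ]; field_simp; ring
    rw [this, ENNReal.ofReal_mul (by have : 0 < 1 - κ := by linarith
                                     positivity), mul_comm]
    gcongr
    exact Set.Ioc_subset_Ioi_self
  · constructor
    · simp
    · positivity
    · positivity
  · fun_prop
  · fun_prop
end


open MeasureTheory Real Filter
open scoped ENNReal FourierTransform RealInnerProductSpace Topology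

noncomputable section

theorem layer_one (r : ℝ) (hr : 0 ≤ r) : ENNReal.ofReal r = ∫⁻ a in Set.Ioi (0:ℝ), (Set.Iio r).indicator (fun _ => (1:ℝ≥0∞)) a := by
  rw [lintegral_indicator measurableSet_Iio, Measure.restrict_restrict measurableSet_Iio, lintegral_one, Measure.restrict_apply_univ,
    Set.inter_comm, Set.Ioi_inter_Iio, Real.volume_Ioo, sub_zero]

theorem hls_raw (l q : ℝ) (h0 : 0 < l) (h1 : l < 1) (hq : q = 2/(2 - l)) : ∃ C : ℝ≥0∞, C ≠ ⊤ ∧ ∀ f g : ℝ → ℝ, Measurable f → Measurable g →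
    (∀ x, 0 ≤ f x) → (∀ x, 0 ≤ g x) →
    ∫⁻ z : ℝ × ℝ, ENNReal.ofReal (f z.1) * ENNReal.ofReal (g z.2) * ENNReal.ofReal (|z.1 - z.2| ^ (-l)) ≤
     C * ((∫⁻ x, ENNReal.ofReal (f x ^ q)) * (∫⁻ x, ENNReal.ofReal (g x ^ q)) ^ (1 - l) + (∫⁻ x, ENNReal.ofReal (g x ^ q)) * (∫⁻ x, ENNReal.ofReal (f x ^ q)) ^ (1 - l)) := by
  obtain ⟨C1, hC1, H⟩ := hls_layer l q h0 h1 hq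
  have hl2 : 0 < 2 - l := by linarith
  have hl1 : 0 < 1 - l := by linarith
  have hq1 : q - 1 = l / (2 - l) := by rw [hq]; field_simp; ring
  have hqm : 0 < q - 1 := by rw [hq1]; positivity
  set C2 := ENNReal.ofReal (2 / (1 - l) + 1) with hC2
  -- both distribution function facts
  have hlay : ∀ f : ℝ → ℝ, Measurable f → (∀ x, 0 ≤ f x) → ∫⁻ b in Set.Ioi (0:ℝ), volume {x | b < f x} * ENNReal.ofReal (b ^ (q-1)) ≤ ∫⁻ x, ENNReal.ofReal (f x ^ q) := by
    intro f hf hf0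
    rw [lintegral_rpow_eq_lintegral_meas_lt_mul volume (Eventually.of_forall hf0) hf.aemeasurable (by linarith)]
    have : (1:ℝ≥0∞) ≤ ENNReal.ofReal q := by rw [← ENNReal.ofReal_one]; exact ENNReal.ofReal_le_ofReal (by linarith)
    exact le_mul_of_one_le_left zero_le this
  have hmeasG : ∀ f : ℝ → ℝ, Measurable (fun b : ℝ => volume {x | b < f x}) := by
    intro f
    exact Antitone.measurable (fun a b hab => measure_mono (fun x hx => lt_of_le_of_lt hab hx))
  have hJ : ∀ f g : ℝ → ℝ, Measurable f → Measurable g → ∀ a b : ℝ, ∫⁻ z : ℝ × ℝ, ((Set.Iio (f z.1)).indicator (fun _ => (1:ℝ≥0∞)) a * (Set.Iio (g z.2)).indicator (fun _ => (1:ℝ≥0∞)) b * ENNReal.ofReal (|z.1 - z.2| ^ (-l))) ≤ C2 * (volume {x | a < f x} * (volume {x | b < g x})^(1-l)) := by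
    intro f g hf hg a b
    have hmf : MeasurableSet {x | a < f x} := measurableSet_lt measurable_const hf
    have hmg : MeasurableSet {x | b < g x} := measurableSet_lt measurable_const hg
    have e : ∀ z : ℝ × ℝ, ((Set.Iio (f z.1)).indicator (fun _ => (1:ℝ≥0∞)) a * (Set.Iio (g z.2)).indicator (fun _ => (1:ℝ≥0∞)) b * ENNReal.ofReal (|z.1 - z.2| ^ (-l))) =
        {x | a < f x}.indicator (fun _ => (1:ℝ≥0∞)) z.1 * ({x | b < g x}.indicator (fun _ => (1:ℝ≥0∞)) z.2 * ENNReal.ofReal (|z.1 - z.2| ^ (-l))) := by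
      intro z
      simp only [Set.indicator, Set.mem_Iio, Set.mem_ofPred_eq, mul_assoc]
    simp_rw [e]
    have hm2 : Measurable ({x | b < g x}.indicator (fun _ => (1:ℝ≥0∞))) := measurable_const.indicator hmg
    have hm1 : Measurable ({x | a < f x}.indicator (fun _ => (1:ℝ≥0∞))) := measurable_const.indicator hmf
    rw [Measure.volume_eq_prod, lintegral_prod _ (by fun_prop)]
    calc _ ≤ ∫⁻ x, {x | a < f x}.indicator (fun _ => (1:ℝ≥0∞)) x * (C2 * (volume {x | b < g x})^(1-l)) := by
          apply lintegral_mono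
          intro x
          simp only
          rw [lintegral_const_mul _ (by fun_prop)]
          gcongr
          have : ∀ y, {x | b < g x}.indicator (fun _ => (1:ℝ≥0∞)) y * ENNReal.ofReal (|x - y| ^ (-l)) = {x | b < g x}.indicator (fun y => ENNReal.ofReal (|x - y| ^ (-l))) y := by
            intro y
            by_cases hy : y ∈ {x | b < g x}
            · rw [Set.indicator_of_mem hy, Set.indicator_of_mem hy, one_mul]
            · rw [Set.indicator_of_notMem hy, Set.indicator_of_notMem hy, zero_mul]
          simp_rw [this]
          rw [lintegral_indicator hmg]
          exact sup_set_int l h0 h1 _ hmg x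
      _ = _ := by
        rw [lintegral_mul_const _ hm1, lintegral_indicator hmf, lintegral_one, Measure.restrict_apply_univ]; ring
  have hside : ∀ f g : ℝ → ℝ, Measurable f → Measurable g → (∀ x, 0 ≤ f x) → (∀ x, 0 ≤ g x) →
     ∫⁻ a in Set.Ioi (0:ℝ), ∫⁻ b in Set.Ioc 0 a, C2 * (volume {x | a < f x} * (volume {x | b < g x})^(1-l)) ≤ C2 * C1 * ((∫⁻ x, ENNReal.ofReal (f x ^ q)) * (∫⁻ x, ENNReal.ofReal (g x ^ q)) ^ (1 - l)) := by
    intro f g hf hg hf0 hg0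
    have m1 := hmeasG f
    have m2 := hmeasG g
    calc _ ≤ ∫⁻ a in Set.Ioi (0:ℝ), (volume {x | a < f x} * ENNReal.ofReal (a ^ (q-1))) * (C2 * C1 * (∫⁻ x, ENNReal.ofReal (g x ^ q)) ^ (1 - l)) := by
          apply setLIntegral_mono (by fun_prop)
          intro a ha
          rw [lintegral_const_mul _ (by fun_prop), lintegral_const_mul _ (by fun_prop)]
          have h3 := H _ m2 a ha
          calc _ ≤ C2 * (volume {x | a < f x} * (C1 * ENNReal.ofReal (a ^ (q-1)) * (∫⁻ x, ENNReal.ofReal (g x ^ q)) ^ (1 - l))) := by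
                refine mul_le_mul' le_rfl (mul_le_mul' le_rfl (h3.trans ?_))
                exact mul_le_mul' le_rfl (ENNReal.rpow_le_rpow (hlay g hg hg0) hl1.le)
            _ = _ := by ring
      _ = (∫⁻ a in Set.Ioi (0:ℝ), (volume {x | a < f x} * ENNReal.ofReal (a ^ (q-1)))) * (C2 * C1 * (∫⁻ x, ENNReal.ofReal (g x ^ q)) ^ (1 - l)) := by
          rw [lintegral_mul_const _ (by fun_prop)]
      _ ≤ (∫⁻ x, ENNReal.ofReal (f x ^ q)) * (C2 * C1 * (∫⁻ x, ENNReal.ofReal (g x ^ q)) ^ (1 - l)) := by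
          exact mul_le_mul' (hlay f hf hf0) le_rfl
      _ = _ := by ring
  refine ⟨C2 * C1, ENNReal.mul_ne_top ENNReal.ofReal_ne_top hC1, ?_⟩
  intro f g hf hg hf0 hg0
  set μ := (volume.restrict (Set.Ioi (0:ℝ))) with hμ
  have hind : ∀ f : ℝ → ℝ, Measurable f → Measurable (fun q : ℝ × ℝ => (Set.Iio (f q.1)).indicator (fun _ => (1:ℝ≥0∞)) q.2) := by
    intro f hf
    have : (fun q : ℝ × ℝ => (Set.Iio (f q.1)).indicator (fun _ => (1:ℝ≥0∞)) q.2) = {q : ℝ × ℝ | q.2 < f q.1}.indicator (fun _ => 1) := by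
      ext q; simp [Set.indicator]
    rw [this]
    exact measurable_const.indicator (measurableSet_lt measurable_snd (hf.comp measurable_fst))
  have hI : Measurable (fun w : (ℝ × ℝ) × (ℝ × ℝ) => ((Set.Iio (f w.1.1)).indicator (fun _ => (1:ℝ≥0∞)) w.2.1 * (Set.Iio (g w.1.2)).indicator (fun _ => (1:ℝ≥0∞)) w.2.2 * ENNReal.ofReal (|w.1.1 - w.1.2| ^ (-l)))) := by
    apply Measurable.mul
    · apply Measurable.mul
      · exact (hind f hf).comp (g := fun q : ℝ × ℝ => (Set.Iio (f q.1)).indicator (fun _ => (1:ℝ≥0∞)) q.2) (f := fun w : (ℝ × ℝ) × (ℝ × ℝ) => (w.1.1, w.2.1)) (by fun_prop)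
      · exact (hind g hg).comp (g := fun q : ℝ × ℝ => (Set.Iio (g q.1)).indicator (fun _ => (1:ℝ≥0∞)) q.2) (f := fun w : (ℝ × ℝ) × (ℝ × ℝ) => (w.1.2, w.2.2)) (by fun_prop)
    · fun_prop
  calc _ = ∫⁻ z : ℝ × ℝ, ∫⁻ c : ℝ × ℝ, ((Set.Iio (f z.1)).indicator (fun _ => (1:ℝ≥0∞)) c.1 * (Set.Iio (g z.2)).indicator (fun _ => (1:ℝ≥0∞)) c.2 * ENNReal.ofReal (|z.1 - z.2| ^ (-l))) ∂(μ.prod μ) := by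
        apply lintegral_congr
        intro z
        rw [layer_one _ (hf0 z.1), layer_one _ (hg0 z.2)]
        rw [lintegral_mul_const _ (by
          apply Measurable.mul
          · exact (measurable_const.indicator measurableSet_Iio).comp measurable_fst
          · exact (measurable_const.indicator measurableSet_Iio).comp measurable_snd)]
        congr 1
        exact (lintegral_prod_mul (measurable_const.indicator measurableSet_Iio).aemeasurable (measurable_const.indicator measurableSet_Iio).aemeasurable).symm
    _ = ∫⁻ c : ℝ × ℝ, (∫⁻ z : ℝ × ℝ, ((Set.Iio (f z.1)).indicator (fun _ => (1:ℝ≥0∞)) c.1 * (Set.Iio (g z.2)).indicator (fun _ => (1:ℝ≥0∞)) c.2 * ENNReal.ofReal (|z.1 - z.2| ^ (-l)))) ∂(μ.prod μ) := by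
        rw [lintegral_lintegral_swap]
        exact hI.aemeasurable
    _ ≤ ∫⁻ c : ℝ × ℝ, ({c : ℝ × ℝ | c.2 ≤ c.1}.indicator (fun c => C2 * (volume {x | c.1 < f x} * (volume {x | c.2 < g x})^(1-l))) c +
          {c : ℝ × ℝ | c.1 ≤ c.2}.indicator (fun c => C2 * (volume {x | c.2 < g x} * (volume {x | c.1 < f x})^(1-l))) c) ∂(μ.prod μ) := by
        apply lintegral_mono
        intro c
        rcases le_total c.2 c.1 with h | h
        · refine le_trans ?_ le_self_add
          rw [Set.indicator_of_mem (by exact h)]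
          exact hJ f g hf hg c.1 c.2
        · refine le_trans ?_ le_add_self
          rw [Set.indicator_of_mem (by exact h)]
          refine le_trans (le_of_eq ?_) (hJ g f hg hf c.2 c.1)
          simp only
          have := lintegral_map_equiv (μ := (volume : Measure (ℝ × ℝ))) (fun z : ℝ × ℝ => ((Set.Iio (f z.1)).indicator (fun _ => (1:ℝ≥0∞)) c.1 * (Set.Iio (g z.2)).indicator (fun _ => (1:ℝ≥0∞)) c.2 * ENNReal.ofReal (|z.1 - z.2| ^ (-l)))) (MeasurableEquiv.prodComm : ℝ × ℝ ≃ᵐ ℝ × ℝ)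
          have hsw : Measure.map (MeasurableEquiv.prodComm : ℝ × ℝ ≃ᵐ ℝ × ℝ) volume = volume := by
            exact Measure.prod_swap
          rw [hsw] at this
          rw [this]
          apply lintegral_congr
          intro z
          change (Set.Iio (f z.2)).indicator (fun _ => (1:ℝ≥0∞)) c.1 * (Set.Iio (g z.1)).indicator (fun _ => (1:ℝ≥0∞)) c.2 * ENNReal.ofReal (|z.2 - z.1| ^ (-l)) = _
          rw [abs_sub_comm, mul_comm ((Set.Iio (f z.2)).indicator (fun _ => (1:ℝ≥0∞)) c.1)]
    _ ≤ C2 * C1 * ((∫⁻ x, ENNReal.ofReal (f x ^ q)) * (∫⁻ x, ENNReal.ofReal (g x ^ q)) ^ (1 - l)) + C2 * C1 * ((∫⁻ x, ENNReal.ofReal (g x ^ q)) * (∫⁻ x, ENNReal.ofReal (f x ^ q)) ^ (1 - l)) := by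
        have m1 := hmeasG f
        have m2 := hmeasG g
        have hs1 : MeasurableSet {c : ℝ × ℝ | c.2 ≤ c.1} := measurableSet_le measurable_snd measurable_fst
        have hs2 : MeasurableSet {c : ℝ × ℝ | c.1 ≤ c.2} := measurableSet_le measurable_fst measurable_snd
        have n1 : Measurable ({c : ℝ × ℝ | c.2 ≤ c.1}.indicator (fun c => C2 * (volume {x | c.1 < f x} * (volume {x | c.2 < g x})^(1-l)))) := by
          apply Measurable.indicator _ hs1
          exact ((m1.comp measurable_fst).mul ((m2.comp measurable_snd).pow_const _)).const_mul _
        have n2 : Measurable ({c : ℝ × ℝ | c.1 ≤ c.2}.indicator (fun c => C2 * (volume {x | c.2 < g x} * (volume {x | c.1 < f x})^(1-l)))) := by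
          apply Measurable.indicator _ hs2
          exact ((m2.comp measurable_snd).mul ((m1.comp measurable_fst).pow_const _)).const_mul _
        rw [lintegral_add_left n1]
        have hrr : ∀ (φ : ℝ → ℝ≥0∞) (a : ℝ), ∫⁻ b, (Set.Iic a).indicator φ b ∂μ = ∫⁻ b in Set.Ioc 0 a, φ b := by
          intro φ a
          rw [lintegral_indicator measurableSet_Iic, hμ, Measure.restrict_restrict measurableSet_Iic, Set.inter_comm, Set.Ioi_inter_Iic]
        refine add_le_add ?_ ?_
        · rw [lintegral_prod _ n1.aemeasurable]
          refine le_trans (le_of_eq ?_) (hside f g hf hg hf0 hg0)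
          apply lintegral_congr
          intro a
          rw [← hrr]
          apply lintegral_congr
          intro b
          simp [Set.indicator]
        · rw [lintegral_prod_symm _ n2.aemeasurable]
          refine le_trans (le_of_eq ?_) (hside g f hg hf hg0 hf0)
          apply lintegral_congr
          intro a
          rw [← hrr]
          apply lintegral_congr
          intro b
          simp [Set.indicator]
    _ = _ := by ring

theorem hls0 (p q : ℝ) (hp : 2 < p) (hpq : 1/p + 1/q = 1) : ∃ C : ℝ≥0∞, C ≠ ⊤ ∧ ∀ f g : ℝ → ℝ, Measurable f → Measurable g →
    (∀ x, 0 ≤ f x) → (∀ x, 0 ≤ g x) →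
    ∫⁻ z : ℝ × ℝ, ENNReal.ofReal (f z.1) * ENNReal.ofReal (g z.2) * ENNReal.ofReal (|z.1 - z.2| ^ (-(2/p))) ≤
     C * (∫⁻ x, ENNReal.ofReal (f x ^ q)) ^ (1/q) * (∫⁻ x, ENNReal.ofReal (g x ^ q)) ^ (1/q) := by
  have hp0 : 0 < p := by linarith
  have hl0 : 0 < 2/p := by positivity
  have hl1 : 2/p < 1 := by rw [div_lt_one hp0]; linarith
  have hq1 : 1/q = 1 - 1/p := by linarith
  have hq0 : 0 < q := one_div_pos.1 (by rw [hq1]; have : 1/p < 1 := by rw [div_lt_one hp0]; linarith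
                                        linarith)
  have hq : q = 2/(2 - 2/p) := by
    have : 2 - 2/p = 2 * (1/q) := by rw [hq1]; ring
    rw [this]; field_simp
  obtain ⟨C, hC, H⟩ := hls_raw (2/p) q hl0 hl1 hq
  refine ⟨C * 2 + 1, ENNReal.add_ne_top.2 ⟨ENNReal.mul_ne_top hC (by norm_num), by norm_num⟩, ?_⟩
  intro f g hf hg hf0 hg0
  have hz : ∀ f : ℝ → ℝ, Measurable f → (∀ x, 0 ≤ f x) → (∫⁻ x, ENNReal.ofReal (f x ^ q)) = 0 → ∀ᵐ x, f x = 0 := by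
    intro f hf hf0 h
    rw [lintegral_eq_zero_iff (by fun_prop)] at h
    filter_upwards [h] with x hx
    simp only [Pi.zero_apply, ENNReal.ofReal_eq_zero] at hx
    have := le_antisymm hx (Real.rpow_nonneg (hf0 x) q)
    exact (Real.rpow_eq_zero (hf0 x) hq0.ne').1 this
  by_cases hfz : (∫⁻ x, ENNReal.ofReal (f x ^ q)) = 0
  · have := hz f hf hf0 hfz
    have h2 : ∀ᵐ z : ℝ × ℝ, f z.1 = 0 := Measure.quasiMeasurePreserving_fst.ae this
    rw [lintegral_congr_ae (g := fun _ => 0) (by filter_upwards [h2] with z hz; rw [hz]; simp)]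
    simp
  by_cases hgz : (∫⁻ x, ENNReal.ofReal (g x ^ q)) = 0
  · have := hz g hg hg0 hgz
    have h2 : ∀ᵐ z : ℝ × ℝ, g z.2 = 0 := Measure.quasiMeasurePreserving_snd.ae this
    rw [lintegral_congr_ae (g := fun _ => 0) (by filter_upwards [h2] with z hz; rw [hz]; simp)]
    simp
  have hC0 : C * 2 + 1 ≠ 0 := by simp
  have hqi : 0 < 1/q := by positivity
  by_cases hft : (∫⁻ x, ENNReal.ofReal (f x ^ q)) = ⊤
  · rw [hft, ENNReal.top_rpow_of_pos hqi, ENNReal.mul_top hC0, ENNReal.top_mul]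
    · exact le_top
    · rw [ne_eq, ENNReal.rpow_eq_zero_iff]; push Not
      exact ⟨fun h => absurd h hgz, fun _ => hqi.le⟩
  by_cases hgt : (∫⁻ x, ENNReal.ofReal (g x ^ q)) = ⊤
  · rw [hgt, ENNReal.top_rpow_of_pos hqi, ENNReal.mul_top]
    · exact le_top
    · apply mul_ne_zero hC0
      rw [ne_eq, ENNReal.rpow_eq_zero_iff]; push Not
      exact ⟨fun h => absurd h hfz, fun _ => hqi.le⟩
  obtain ⟨A, hA⟩ : ∃ A : ℝ, A = (∫⁻ x, ENNReal.ofReal (f x ^ q)).toReal := ⟨_, rfl⟩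
  obtain ⟨B, hB⟩ : ∃ B : ℝ, B = (∫⁻ x, ENNReal.ofReal (g x ^ q)).toReal := ⟨_, rfl⟩
  have hAe : (∫⁻ x, ENNReal.ofReal (f x ^ q)) = ENNReal.ofReal A := by rw [hA, ENNReal.ofReal_toReal hft]
  have hBe : (∫⁻ x, ENNReal.ofReal (g x ^ q)) = ENNReal.ofReal B := by rw [hB, ENNReal.ofReal_toReal hgt]
  have hA0 : 0 < A := by rw [hA]; exact ENNReal.toReal_pos hfz hft
  have hB0 : 0 < B := by rw [hB]; exact ENNReal.toReal_pos hgz hgt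
  have hnorm : ∀ (f : ℝ → ℝ) (A : ℝ), Measurable f → (∀ x, 0 ≤ f x) → 0 < A → (∫⁻ x, ENNReal.ofReal (f x ^ q)) = ENNReal.ofReal A →
      ∫⁻ x, ENNReal.ofReal ((A^(-(1/q)) * f x) ^ q) = 1 := by
    intro f A hf hf0 hA0 h
    have : ∀ x, ENNReal.ofReal ((A^(-(1/q)) * f x) ^ q) = ENNReal.ofReal (A⁻¹) * ENNReal.ofReal (f x ^ q) := by
      intro x
      rw [← ENNReal.ofReal_mul (by positivity), Real.mul_rpow (by positivity) (hf0 x), ← Real.rpow_mul hA0.le]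
      congr 2
      rw [show -(1/q) * q = -1 by field_simp, Real.rpow_neg_one]
    simp_rw [this]
    rw [lintegral_const_mul _ (by fun_prop), h, ← ENNReal.ofReal_mul (by positivity), inv_mul_cancel₀ hA0.ne', ENNReal.ofReal_one]
  have key := H (fun x => A^(-(1/q)) * f x) (fun x => B^(-(1/q)) * g x) (by fun_prop) (by fun_prop)
    (fun x => mul_nonneg (by positivity) (hf0 x)) (fun x => mul_nonneg (by positivity) (hg0 x))
  rw [hnorm f A hf hf0 hA0 hAe, hnorm g B hg hg0 hB0 hBe] at key
  simp only [ENNReal.one_rpow, mul_one, one_add_one_eq_two] at key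
  have e : ∀ z : ℝ × ℝ, ENNReal.ofReal (f z.1) * ENNReal.ofReal (g z.2) * ENNReal.ofReal (|z.1 - z.2| ^ (-(2/p))) =
      ENNReal.ofReal (A^(1/q) * B^(1/q)) * (ENNReal.ofReal (A^(-(1/q)) * f z.1) * ENNReal.ofReal (B^(-(1/q)) * g z.2) * ENNReal.ofReal (|z.1 - z.2| ^ (-(2/p)))) := by
    intro z
    have h1 := hf0 z.1
    have h2 := hg0 z.2
    rw [← ENNReal.ofReal_mul (by positivity), ← ENNReal.ofReal_mul (by positivity), ← ENNReal.ofReal_mul (by positivity), ← ENNReal.ofReal_mul (by positivity), ← ENNReal.ofReal_mul (by positivity)]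
    congr 1
    rw [Real.rpow_neg hA0.le, Real.rpow_neg hB0.le]
    have : A ^ (1/q) ≠ 0 := (Real.rpow_pos_of_pos hA0 _).ne'
    have : B ^ (1/q) ≠ 0 := (Real.rpow_pos_of_pos hB0 _).ne'
    field_simp
  simp_rw [e]
  rw [lintegral_const_mul _ (by fun_prop), hAe, hBe, ENNReal.ofReal_rpow_of_pos hA0, ENNReal.ofReal_rpow_of_pos hB0, mul_assoc, ← ENNReal.ofReal_mul (by positivity), mul_comm]
  gcongr
  exact key.trans le_self_add

theorem hls (p q ν β : ℝ) (hp : 2 < p) (hpq : 1/p + 1/q = 1) (hν : 0 ≤ ν) (hβ : 0 < β) (hs : 2*ν + β = 2/p) :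
    ∃ C : ℝ≥0∞, C ≠ ⊤ ∧ ∀ f g : ℝ → ℝ, Measurable f → Measurable g →
    (∀ x, 0 ≤ f x) → (∀ x, 0 ≤ g x) → (∀ x, x ≤ 0 → f x = 0) → (∀ x, x ≤ 0 → g x = 0) →
    ∫⁻ z : ℝ × ℝ, ENNReal.ofReal (f z.1) * ENNReal.ofReal (g z.2) * ENNReal.ofReal ((z.1 * z.2)^(-ν) * |z.1 - z.2| ^ (-β)) ≤
     C * (∫⁻ x, ENNReal.ofReal (f x ^ q)) ^ (1/q) * (∫⁻ x, ENNReal.ofReal (g x ^ q)) ^ (1/q) := by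
  have hp0 : 0 < p := by linarith
  have hq1 : 1/q = 1 - 1/p := by linarith
  have hq0 : 0 < q := one_div_pos.1 (by rw [hq1]; have : 1/p < 1 := by rw [div_lt_one hp0]; linarith
                                        linarith)
  rcases hν.eq_or_lt with h | h
  · obtain ⟨C, hC, H⟩ := hls0 p q hp hpq
    refine ⟨C, hC, fun f g hf hg hf0 hg0 _ _ => ?_⟩
    have hb : β = 2/p := by linarith
    rw [← h, hb]
    simp only [neg_zero, Real.rpow_zero, one_mul]
    exact H f g hf hg hf0 hg0
  · set σ := β * (p/2) with hσ
    have hσ0 : 0 < σ := by positivity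
    have hσ1 : σ < 1 := by
      have h3 : β < 2/p := by linarith
      calc σ < 2/p * (p/2) := by rw [hσ]; gcongr
        _ = 1 := by field_simp
    obtain ⟨M, hM, HM⟩ := sw_bound σ hσ0 hσ1
    refine ⟨M ^ (2/p), ENNReal.rpow_ne_top_of_nonneg (by positivity) hM, fun f g hf hg hf0 hg0 hfn hgn => ?_⟩
    set μ := volume.restrict (Set.Ioi (0:ℝ)) with hμ
    set L : ℝ × ℝ → ℝ≥0∞ := fun z => if 0 < z.1 then ENNReal.ofReal ((z.1 * z.2) ^ (σ/2) * |z.1 - z.2| ^ (-σ) / z.2) else 0 with hL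
    set L' : ℝ × ℝ → ℝ≥0∞ := fun z => if 0 < z.2 then ENNReal.ofReal ((z.1 * z.2) ^ (σ/2) * |z.1 - z.2| ^ (-σ) / z.1) else 0 with hL'
    have hLm : Measurable L := Measurable.ite (measurableSet_lt measurable_const measurable_fst) (by fun_prop) measurable_const
    have hLm' : Measurable L' := Measurable.ite (measurableSet_lt measurable_const measurable_snd) (by fun_prop) measurable_const
    have key := young3 μ L L' hLm hLm' M ?_ ?_ p q hp hpq (fun t => ENNReal.ofReal (f t)) (fun t => ENNReal.ofReal (g t)) (by fun_prop) (by fun_prop)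
    · have hcong : ∀ f : ℝ → ℝ, (∀ x, 0 ≤ f x) → ∫⁻ t, ENNReal.ofReal (f t) ^ q ∂μ ≤ ∫⁻ x, ENNReal.ofReal (f x ^ q) := by
        intro f hf0
        have : ∀ t, ENNReal.ofReal (f t) ^ q = ENNReal.ofReal (f t ^ q) := fun t => ENNReal.ofReal_rpow_of_nonneg (hf0 t) hq0.le
        simp_rw [this]
        exact setLIntegral_le_lintegral _ _
      calc _ = ∫⁻ z : ℝ × ℝ, ENNReal.ofReal (f z.1) * ENNReal.ofReal (g z.2) * (L z ^ (1/p) * L' z ^ (1/p)) ∂(μ.prod μ) := by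
            rw [hμ, Measure.prod_restrict, ← Measure.volume_eq_prod, ← lintegral_indicator (measurableSet_Ioi.prod measurableSet_Ioi)]
            apply lintegral_congr
            intro z
            by_cases hz : z ∈ Set.Ioi (0:ℝ) ×ˢ Set.Ioi (0:ℝ)
            · rw [Set.indicator_of_mem hz]
              have h1 : 0 < z.1 := hz.1
              have h2 : 0 < z.2 := hz.2
              congr 1
              simp only [hL, hL', if_pos h1, if_pos h2]
              rw [ENNReal.ofReal_rpow_of_nonneg (by positivity) (by positivity), ENNReal.ofReal_rpow_of_nonneg (by positivity) (by positivity), ← ENNReal.ofReal_mul (by positivity)]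
              congr 1
              rw [← Real.mul_rpow (by positivity) (by positivity)]
              have e1 : (z.1 * z.2) ^ (σ/2) * |z.1 - z.2| ^ (-σ) / z.2 * ((z.1 * z.2) ^ (σ/2) * |z.1 - z.2| ^ (-σ) / z.1) = ((z.1 * z.2) ^ (σ/2) * (z.1 * z.2) ^ (σ/2) * (z.1*z.2)⁻¹) * (|z.1 - z.2| ^ (-σ) * |z.1 - z.2| ^ (-σ)) := by
                field_simp
              have e2 : |z.1 - z.2| ^ (-σ) * |z.1 - z.2| ^ (-σ) = |z.1 - z.2| ^ (-σ * 2) := by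
                rw [Real.rpow_mul (abs_nonneg _)]; norm_cast; ring
              have e3 : -σ * 2 * (1/p) = -β := by rw [hσ]; field_simp
              have e4 : (σ / 2 + σ / 2 + -1) * (1/p) = -ν := by
                have : ν = (2/p - β)/2 := by linarith
                rw [hσ, this]; field_simp; ring
              rw [e1, e2, ← Real.rpow_add (by positivity), ← Real.rpow_neg_one, ← Real.rpow_add (by positivity), Real.mul_rpow (x := (z.1 * z.2) ^ (σ / 2 + σ / 2 + -1)) (by positivity) (by positivity), ← Real.rpow_mul (by positivity), ← Real.rpow_mul (by positivity), e3, e4]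
            · rw [Set.indicator_of_notMem hz]
              rw [Set.mem_prod, not_and_or, Set.mem_Ioi, Set.mem_Ioi, not_lt, not_lt] at hz
              rcases hz with hz | hz
              · rw [hfn _ hz]; simp
              · rw [hgn _ hz]; simp
        _ ≤ _ := key
        _ ≤ _ := mul_le_mul' (mul_le_mul' le_rfl (ENNReal.rpow_le_rpow (hcong f hf0) (by positivity))) (ENNReal.rpow_le_rpow (hcong g hg0) (by positivity))
    · intro t
      simp only [hL]
      by_cases ht : 0 < t
      · simp only [if_pos ht]; exact HM t ht
      · simp only [if_neg ht]; simp
    · intro t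
      simp only [hL']
      by_cases ht : 0 < t
      · simp only [if_pos ht]
        refine le_trans (le_of_eq ?_) (HM t ht)
        apply lintegral_congr
        intro s
        rw [mul_comm s t, abs_sub_comm]
      · simp only [if_neg ht]; simp
end


open MeasureTheory Real Filter
open scoped ENNReal FourierTransform RealInnerProductSpace Topology

noncomputable section

abbrev EB (b : ℕ) : Type := EuclideanSpace ℝ (Fin b)

def ee (x : ℝ) : ℂ := Complex.exp (2 * π * Complex.I * x)
theorem ee_add (x y : ℝ) : ee (x + y) = ee x * ee y := by
  unfold ee; rw [← Complex.exp_add]; congr 1; push_cast; ring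
theorem norm_ee (x : ℝ) : ‖ee x‖ = 1 := norm_cexp2 x
theorem conj_ee (x : ℝ) : (starRingEnd ℂ) (ee x) = ee (-x) := by
  unfold ee; rw [← Complex.exp_conj]; congr 1
  simp only [map_mul, Complex.conj_ofReal, Complex.conj_I, Complex.conj_ofNat]
  push_cast; ring
theorem ee_cont : Continuous ee := by unfold ee; fun_prop
theorem ee_meas : Measurable ee := ee_cont.measurable
theorem ee_zero : ee 0 = 1 := by simp [ee]

def wt {b : ℕ} (δ : ℝ) (z : ℝ × EB b) : ℝ := sh δ (√(z.1^2 + ‖z.2‖^2)) * z.1^2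

theorem wt_meas {b : ℕ} (δ : ℝ) : Measurable (wt (b := b) δ) := by
  unfold wt
  exact ((sh_meas δ).comp (by fun_prop)).mul (by fun_prop)
theorem wt_nonneg {b : ℕ} (δ : ℝ) (z : ℝ × EB b) : 0 ≤ wt δ z := mul_nonneg (sh_nonneg _ _) (sq_nonneg _)

theorem wt_split {b : ℕ} (δ : ℝ) (ξ : EB (b+1)) : wt δ (splitE b ξ) = sh δ ‖ξ‖ * (ξ 0)^2 := by
  unfold wt
  rw [← splitE_norm, Real.sqrt_sq (norm_nonneg _), splitE_fst]

def Kc {b : ℕ} (δ τ : ℝ) (x : EB b) : ℂ := ∫ z : ℝ × EB b, (wt δ z : ℂ) * ee (τ * z.1 + ⟪x, z.2⟫)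

theorem Kc_bound (b : ℕ) (hb : 1 ≤ b) : ∃ C : ℝ, 0 < C ∧ ∀ δ, 0 < δ → δ ≤ 1/2 → ∀ (τ : ℝ) (x : EB b), τ ≠ 0 →
    ‖Kc δ τ x‖ ≤ C * δ * |τ| ^ (-(b:ℝ)/2) := by
  obtain ⟨C, hC, H⟩ := shell_kernel b hb
  refine ⟨C, hC, fun δ h0 h1 τ x hτ => ?_⟩
  set X := (splitE b).symm (τ, x) with hX
  have hXs : splitE b X = (τ, x) := by rw [hX, MeasurableEquiv.apply_symm_apply]
  have hn := splitE_norm b X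
  rw [hXs] at hn
  simp only at hn
  have hge : |τ| ≤ ‖X‖ := by
    exact abs_le_of_sq_le_sq (by nlinarith [sq_nonneg ‖x‖]) (norm_nonneg _)
  have hτ' : 0 < |τ| := abs_pos.2 hτ
  have hX0 : X ≠ 0 := by
    intro h; rw [h, norm_zero] at hge; linarith
  have h := H δ h0 h1 X hX0
  have e : Kc δ τ x = ∫ ξ : EB (b+1), (sh δ ‖ξ‖ : ℂ) * ((((ξ 0)^2 : ℝ) : ℂ) * Complex.exp (2 * π * Complex.I * (⟪X, ξ⟫ : ℝ))) := by
    unfold Kc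
    rw [← (splitE_mp b).integral_comp (splitE b).measurableEmbedding]
    congr 1; ext ξ
    rw [wt_split, splitE_inner, hXs]
    unfold ee
    push_cast
    rw [mul_assoc]
  rw [e]
  refine h.trans ?_
  gcongr ?_ * ?_
  exact Real.rpow_le_rpow_of_nonpos hτ' hge (by
    have : (0:ℝ) ≤ b := by positivity
    linarith)

theorem wt_int {b : ℕ} (δ : ℝ) (h1 : δ ≤ 1/2) : Integrable (fun z : ℝ × EB b => (wt δ z : ℂ)) := by
  rw [← (splitE_mp b).integrable_comp_emb (splitE b).measurableEmbedding]
  have := shell_integrable (V := EB (b+1)) δ h1 (fun ξ => (((ξ 0)^2 : ℝ) : ℂ)) (by fun_prop) 4 (by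
    intro ξ h
    have h3 := coord_le_norm ξ 0
    rw [Complex.norm_real, Real.norm_eq_abs, abs_pow]
    nlinarith [abs_nonneg (ξ 0)])
  refine this.congr (Eventually.of_forall fun ξ => ?_)
  simp only [Function.comp]
  rw [wt_split]; push_cast; rfl

theorem wt_intR {b : ℕ} (δ : ℝ) (h1 : δ ≤ 1/2) : Integrable (fun z : ℝ × EB b => wt δ z) := by
  have := (wt_int (b := b) δ h1).norm
  refine this.congr (Eventually.of_forall fun z => ?_)
  simp only
  rw [Complex.norm_real, Real.norm_of_nonneg (wt_nonneg _ _)]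

theorem wt_slice {b : ℕ} (δ : ℝ) (h0 : 0 < δ) (h1 : δ ≤ 1/2) (ξ : EB b) :
    ∫⁻ ρ : ℝ, ENNReal.ofReal (wt δ (ρ, ξ)) ≤ ENNReal.ofReal (12 * δ) := by
  set n := ‖ξ‖^2 with hn
  have hn0 : 0 ≤ n := by positivity
  set u := √((1+δ)^2 - n) with hu
  set l := √((1-δ)^2 - n) with hl
  have hu0 : 0 ≤ u := Real.sqrt_nonneg _
  have hl0 : 0 ≤ l := Real.sqrt_nonneg _
  have hlu : l ≤ u := Real.sqrt_le_sqrt (by nlinarith)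
  have hu2 : u ≤ 3/2 := by
    rw [hu]; apply Real.sqrt_le_iff.2; constructor <;> nlinarith
  have hkey : u * (u - l) ≤ 4 * δ := by
    by_cases hA : (1+δ)^2 - n ≤ 0
    · rw [hu, Real.sqrt_eq_zero_of_nonpos hA]; simp; linarith
    push Not at hA
    have hus : u^2 = (1+δ)^2 - n := Real.sq_sqrt hA.le
    by_cases hB : (1-δ)^2 - n ≤ 0
    · nlinarith
    · push Not at hB
      have hls : l^2 = (1-δ)^2 - n := Real.sq_sqrt hB.le
      nlinarith
  have hsub : ∀ ρ : ℝ, ENNReal.ofReal (wt δ (ρ, ξ)) ≤ (Set.Icc l u ∪ Set.Icc (-u) (-l)).indicator (fun _ => ENNReal.ofReal (3/2 * u)) ρ := by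
    intro ρ
    unfold wt sh
    simp only
    split_ifs with h
    · have hpos : 0 ≤ ρ^2 + n := by positivity
      rw [abs_le] at h
      have hs := Real.sq_sqrt hpos
      have hs0 := Real.sqrt_nonneg (ρ^2+n)
      have a1 : ρ^2 ≤ (1+δ)^2 - n := by nlinarith
      have a2 : (1-δ)^2 - n ≤ ρ^2 := by nlinarith
      have b1 : |ρ| ≤ u := by rw [← Real.sqrt_sq_eq_abs]; exact Real.sqrt_le_sqrt a1
      have b2 : l ≤ |ρ| := by rw [← Real.sqrt_sq_eq_abs]; exact Real.sqrt_le_sqrt a2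
      have hmem : ρ ∈ Set.Icc l u ∪ Set.Icc (-u) (-l) := by
        rcases abs_cases ρ with ⟨e, _⟩ | ⟨e, _⟩
        · left; exact ⟨by linarith, by linarith⟩
        · right; exact ⟨by linarith, by linarith⟩
      rw [Set.indicator_of_mem hmem]
      apply ENNReal.ofReal_le_ofReal
      rw [one_mul, ← sq_abs]
      nlinarith [abs_nonneg ρ]
    · simp
  calc _ ≤ _ := lintegral_mono hsub
    _ = ENNReal.ofReal (3/2*u) * volume (Set.Icc l u ∪ Set.Icc (-u) (-l)) := by
      rw [lintegral_indicator (measurableSet_Icc.union measurableSet_Icc), setLIntegral_const]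
    _ ≤ ENNReal.ofReal (3/2*u) * (ENNReal.ofReal (u - l) + ENNReal.ofReal (u - l)) := by
      gcongr
      refine (measure_union_le _ _).trans ?_
      rw [Real.volume_Icc, Real.volume_Icc]
      rw [show -l - -u = u - l by ring]
    _ = ENNReal.ofReal (3 * (u * (u - l))) := by
      rw [← ENNReal.ofReal_add (by linarith) (by linarith), ← ENNReal.ofReal_mul (by positivity)]; congr 1; ring
    _ ≤ _ := ENNReal.ofReal_le_ofReal (by linarith)

theorem fourierInv_ee {V : Type*} [NormedAddCommGroup V] [InnerProductSpace ℝ V] [FiniteDimensional ℝ V]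
    [MeasurableSpace V] [BorelSpace V] (h : V → ℂ) (ξ : V) : 𝓕⁻ h ξ = ∫ x, h x * ee ⟪x, ξ⟫ := by
  rw [Real.fourierInv_eq']
  congr 1; ext x
  rw [smul_eq_mul, mul_comm]; unfold ee; congr 2; push_cast; ring
theorem fourier_ee {V : Type*} [NormedAddCommGroup V] [InnerProductSpace ℝ V] [FiniteDimensional ℝ V]
    [MeasurableSpace V] [BorelSpace V] (h : V → ℂ) (ξ : V) : 𝓕 h ξ = ∫ x, h x * ee (-⟪x, ξ⟫) := by
  rw [Real.fourier_eq']
  congr 1; ext x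
  rw [smul_eq_mul, mul_comm]; unfold ee; congr 2; push_cast; ring
end


open MeasureTheory Real Filter
open scoped ENNReal FourierTransform RealInnerProductSpace Topology

noncomputable section

theorem slice_form {b : ℕ} (δ τ : ℝ) (h1 : δ ≤ 1/2) (f g : EB b → ℂ) (hf : Integrable f) (hg : Integrable g) :
    ∫ x : EB b × EB b, f x.1 * g x.2 * Kc δ τ (x.1 - x.2)
      = ∫ z : ℝ × EB b, (wt δ z : ℂ) * ee (τ * z.1) * (𝓕⁻ f z.2 * 𝓕 g z.2) := by
  have hIntg : Integrable (Function.uncurry fun (x : EB b × EB b) (z : ℝ × EB b) =>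
      f x.1 * g x.2 * ((wt δ z : ℂ) * ee (τ * z.1 + ⟪x.1 - x.2, z.2⟫))) (volume.prod volume) := by
    have h0 := (hf.mul_prod hg).mul_prod (wt_int (b := b) δ h1)
    have : (Function.uncurry fun (x : EB b × EB b) (z : ℝ × EB b) =>
      f x.1 * g x.2 * ((wt δ z : ℂ) * ee (τ * z.1 + ⟪x.1 - x.2, z.2⟫))) =
      fun w : (EB b × EB b) × (ℝ × EB b) => (f w.1.1 * g w.1.2 * (wt δ w.2 : ℂ)) * ee (τ * w.2.1 + ⟪w.1.1 - w.1.2, w.2.2⟫) := by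
      ext w; simp only [Function.uncurry]; ring
    rw [this]
    refine h0.mul_bdd (c := 1) ?_ (Eventually.of_forall fun w => (norm_ee _).le)
    exact (ee_cont.comp (by fun_prop)).aestronglyMeasurable
  calc _ = ∫ x : EB b × EB b, ∫ z : ℝ × EB b, f x.1 * g x.2 * ((wt δ z : ℂ) * ee (τ * z.1 + ⟪x.1 - x.2, z.2⟫)) := by
        congr 1; ext x; rw [integral_const_mul]; rfl
    _ = ∫ z : ℝ × EB b, ∫ x : EB b × EB b, f x.1 * g x.2 * ((wt δ z : ℂ) * ee (τ * z.1 + ⟪x.1 - x.2, z.2⟫)) :=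
        integral_integral_swap hIntg
    _ = _ := by
        congr 1; ext z
        rw [fourierInv_ee, fourier_ee, ← integral_prod_mul (fun x => f x * ee ⟪x, z.2⟫) (fun x => g x * ee (-⟪x, z.2⟫)),
          ← integral_const_mul]
        congr 1; ext x
        rw [inner_sub_left, sub_eq_add_neg, ee_add, ee_add]; ring

theorem slice_L2 {b : ℕ} (δ τ : ℝ) (h0 : 0 < δ) (h1 : δ ≤ 1/2) (f g : EB b → ℂ) (hf : Integrable f) (hg : Integrable g)
    (hf2 : MemLp f 2 volume) (hg2 : MemLp g 2 volume) :
    ‖∫ x : EB b × EB b, f x.1 * g x.2 * Kc δ τ (x.1 - x.2)‖ ≤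
      12 * δ * (∫ x, ‖f x‖^2)^(1/2:ℝ) * (∫ x, ‖g x‖^2)^(1/2:ℝ) := by
  have key : ∀ h : EB b → ℂ, MemLp h 2 volume → (∫⁻ x, ‖h x‖ₑ^(2:ℝ))^(1/2:ℝ) = ENNReal.ofReal ((∫ x, ‖h x‖^2)^(1/2:ℝ)) := by
    intro h hh
    rw [← ENNReal.ofReal_rpow_of_nonneg (by positivity) (by positivity), ofReal_integral_eq_lintegral_ofReal]
    · congr 1; apply lintegral_congr; intro x
      rw [← ofReal_norm, ENNReal.ofReal_rpow_of_nonneg (norm_nonneg _) (by positivity)]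
      norm_cast
    · have := hh.integrable_norm_pow (by norm_num); simpa using this
    · exact Eventually.of_forall fun x => by positivity
  have e2 : ∀ h : EB b → ℂ, eLpNorm h 2 volume = (∫⁻ x, ‖h x‖ₑ^(2:ℝ))^(1/2:ℝ) := by
    intro h; rw [eLpNorm_eq_lintegral_rpow_enorm_toReal (by norm_num) (by norm_num)]; simp
  obtain ⟨A1, A1'⟩ := planch_inv_L1L2 f hf hf2
  obtain ⟨A2, A2'⟩ := planch_L1L2 g hg hg2
  rw [slice_form δ τ h1 f g hf hg]
  have hnn : 0 ≤ 12 * δ * (∫ x, ‖f x‖^2)^(1/2:ℝ) * (∫ x, ‖g x‖^2)^(1/2:ℝ) := by positivity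
  rw [← ENNReal.ofReal_le_ofReal_iff hnn, ofReal_norm]
  have hm1 : AEMeasurable (fun x => ‖𝓕⁻ f x‖ₑ) := A1.1.enorm
  have hm2 : AEMeasurable (fun x => ‖𝓕 g x‖ₑ) := A2.1.enorm
  calc _ ≤ ∫⁻ z : ℝ × EB b, ‖(wt δ z : ℂ) * ee (τ * z.1) * (𝓕⁻ f z.2 * 𝓕 g z.2)‖ₑ := enorm_integral_le_lintegral_enorm _
    _ = ∫⁻ z : ℝ × EB b, ENNReal.ofReal (wt δ z) * (‖𝓕⁻ f z.2‖ₑ * ‖𝓕 g z.2‖ₑ) := by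
      apply lintegral_congr; intro z
      rw [enorm_mul, enorm_mul, enorm_mul, ← ofReal_norm (ee _), norm_ee, ← ofReal_norm (wt δ z : ℂ),
        Complex.norm_real, Real.norm_of_nonneg (wt_nonneg _ _)]; simp
    _ = ∫⁻ ξ : EB b, ∫⁻ ρ : ℝ, ENNReal.ofReal (wt δ (ρ, ξ)) * (‖𝓕⁻ f ξ‖ₑ * ‖𝓕 g ξ‖ₑ) := by
      rw [Measure.volume_eq_prod, lintegral_prod_symm _ ?_]
      exact ((wt_meas δ).ennreal_ofReal.aemeasurable).mul
        ((hm1.comp_quasiMeasurePreserving Measure.quasiMeasurePreserving_snd).mul (hm2.comp_quasiMeasurePreserving Measure.quasiMeasurePreserving_snd))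
    _ ≤ ∫⁻ ξ : EB b, ENNReal.ofReal (12 * δ) * (‖𝓕⁻ f ξ‖ₑ * ‖𝓕 g ξ‖ₑ) := by
      apply lintegral_mono; intro ξ
      dsimp only
      have hmm : Measurable (fun ρ : ℝ => ENNReal.ofReal (wt δ (ρ, ξ))) := ((wt_meas δ).comp (by fun_prop : Measurable fun ρ : ℝ => (ρ, ξ))).ennreal_ofReal
      rw [lintegral_mul_const _ hmm]
      exact mul_le_mul' (wt_slice δ h0 h1 ξ) le_rfl
    _ = ENNReal.ofReal (12 * δ) * ∫⁻ ξ : EB b, (‖𝓕⁻ f ξ‖ₑ * ‖𝓕 g ξ‖ₑ) := lintegral_const_mul'' _ (hm1.mul hm2)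
    _ ≤ ENNReal.ofReal (12 * δ) * (eLpNorm (𝓕⁻ f) 2 volume * eLpNorm (𝓕 g) 2 volume) := by
      refine mul_le_mul' le_rfl ?_
      rw [e2, e2]
      exact ENNReal.lintegral_mul_le_Lp_mul_Lq _ Real.HolderConjugate.two_two hm1 hm2
    _ = _ := by
      rw [A1', A2', e2, e2, key f hf2, key g hg2, ← ENNReal.ofReal_mul (by positivity), ← ENNReal.ofReal_mul (by positivity), mul_assoc (12 * δ)]

theorem Kc_cont {b : ℕ} (δ τ : ℝ) (h1 : δ ≤ 1/2) : Continuous (Kc (b := b) δ τ) := by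
  unfold Kc
  apply continuous_of_dominated (bound := fun z => ‖(wt δ z : ℂ)‖)
  · intro x
    exact ((wt_int δ h1).1.mul (ee_cont.comp (by fun_prop)).aestronglyMeasurable)
  · intro x; refine Eventually.of_forall fun z => ?_
    rw [norm_mul, norm_ee, mul_one]
  · exact (wt_int δ h1).norm
  · refine Eventually.of_forall fun z => ?_
    exact continuous_const.mul (ee_cont.comp (by fun_prop))

theorem bdd_mem {b : ℕ} (f : EB b → ℂ) (hf : Measurable f) (n M : ℝ) (hM : ∀ x, ‖f x‖ ≤ M) (hs : ∀ x, n < ‖x‖ → f x = 0)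
   (p : ℝ≥0∞) : MemLp f p volume := by
  have h : MemLp f p (volume.restrict (Metric.closedBall (0 : EB b) n)) :=
    haveI : IsFiniteMeasure (volume.restrict (Metric.closedBall (0 : EB b) n)) := ⟨by
      rw [Measure.restrict_apply_univ]; exact measure_closedBall_lt_top⟩
    MemLp.of_bound hf.aestronglyMeasurable M (Eventually.of_forall hM)
  rw [← memLp_indicator_iff_restrict Metric.isClosed_closedBall.measurableSet] at h
  convert h using 1
  ext x
  by_cases hx : x ∈ Metric.closedBall (0 : EB b) n
  · rw [Set.indicator_of_mem hx]
  · rw [Set.indicator_of_notMem hx]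
    apply hs; simpa using hx

theorem log_bdd (w : ℂ) (Λ : ℝ) (h : |Real.log ‖w‖| ≤ Λ) : ‖w‖ ≤ Real.exp Λ := by
  by_cases hw : w = 0
  · simp [hw, Real.exp_nonneg]
  · rw [← Real.log_le_iff_le_exp (norm_pos_iff.2 hw)]; exact (le_abs_self _).trans h

theorem slice_bound (b : ℕ) (hb : 1 ≤ b) (p q : ℝ) (hp : 2 < p) (hpq : 1/p + 1/q = 1) : ∃ C : ℝ, 0 < C ∧ ∀ δ, 0 < δ → δ ≤ 1/2 → ∀ (τ : ℝ), τ ≠ 0 →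
    ∀ (f g : EB b → ℂ), Measurable f → Measurable g → ∀ (Λ n : ℝ), (∀ x, |Real.log ‖f x‖| ≤ Λ) → (∀ x, |Real.log ‖g x‖| ≤ Λ) →
    (∀ x, n < ‖x‖ → f x = 0) → (∀ x, n < ‖x‖ → g x = 0) → 
    ‖∫ x : EB b × EB b, f x.1 * g x.2 * Kc δ τ (x.1 - x.2)‖ ≤ C * δ * |τ| ^ (-(b * (1/2 - 1/p))) * (∫ x, ‖f x‖^q)^(1/q) * (∫ x, ‖g x‖^q)^(1/q) := by
  obtain ⟨C, hC, HC⟩ := Kc_bound b hb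
  refine ⟨C^(1-2/p) * 12^(2/p), by positivity, ?_⟩
  intro δ h0 h1 τ hτ f g hf hg Λ n hfΛ hgΛ hfn hgn
  have hτ' : 0 < |τ| := abs_pos.2 hτ
  have := riesz_thorin (volume : Measure (EB b)) (Metric.closedBall 0 n) Metric.isClosed_closedBall.measurableSet measure_closedBall_lt_top.ne
    (fun z => Kc δ τ (z.1 - z.2)) ((Kc_cont δ τ h1).comp (by fun_prop)).measurable (C * δ * |τ| ^ (-(b:ℝ)/2)) (12 * δ)
    (by positivity) (by positivity) (fun z => HC δ h0 h1 τ _ hτ) ?_ p q hp hpq f g hf hg Λ hfΛ hgΛ ?_ ?_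
  · refine this.trans (le_of_eq ?_)
    congr 2
    have e : (C * δ * |τ| ^ (-(b:ℝ)/2))^(1-2/p) = C^(1-2/p) * δ^(1-2/p) * |τ| ^ (-(b * (1/2 - 1/p))) := by
      rw [Real.mul_rpow (by positivity) (by positivity), Real.mul_rpow (by positivity) (by positivity), ← Real.rpow_mul (by positivity)]
      congr 2; ring
    rw [e, Real.mul_rpow (by positivity) (by positivity)]
    have : δ = δ^(1-2/p) * δ^(2/p) := by rw [← Real.rpow_add h0]; simp
    calc _ = C^(1-2/p) * 12^(2/p) * (δ^(1-2/p) * δ^(2/p)) * |τ| ^ (-(b * (1/2 - 1/p))) := by ring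
      _ = _ := by rw [← this]
  · intro h1' h2' m1 m2 ⟨M1, hM1⟩ ⟨M2, hM2⟩ z1 z2
    have z1' : ∀ x, n < ‖x‖ → h1' x = 0 := fun x hx => z1 x (by simpa using hx)
    have z2' : ∀ x, n < ‖x‖ → h2' x = 0 := fun x hx => z2 x (by simpa using hx)
    exact slice_L2 δ τ h0 h1 h1' h2' (memLp_one_iff_integrable.1 (bdd_mem h1' m1 n M1 hM1 z1' 1))
      (memLp_one_iff_integrable.1 (bdd_mem h2' m2 n M2 hM2 z2' 1)) (bdd_mem h1' m1 n M1 hM1 z1' 2) (bdd_mem h2' m2 n M2 hM2 z2' 2)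
  · intro x hx; exact hfn x (by simpa using hx)
  · intro x hx; exact hgn x (by simpa using hx)
end


open MeasureTheory Real Filter
open scoped ENNReal FourierTransform RealInnerProductSpace Topology

noncomputable section

theorem mp_comm4 {A B : Type*} [MeasureSpace A] [MeasureSpace B] [SigmaFinite (volume : Measure A)] [SigmaFinite (volume : Measure B)] :
    MeasurePreserving (fun w : (A × A) × (B × B) => ((w.1.1, w.2.1), (w.1.2, w.2.2))) (volume : Measure ((A × A) × (B × B)))
      (volume : Measure ((A × B) × (A × B))) := by
  have h1 : MeasurePreserving (MeasurableEquiv.prodAssoc : (A × A) × (B × B) ≃ᵐ A × (A × (B × B))) volume volume := measurePreserving_prodAssoc _ _ _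
  have h2 : MeasurePreserving (MeasurableEquiv.prodAssoc : (A × B) × B ≃ᵐ A × (B × B)) volume volume := measurePreserving_prodAssoc _ _ _
  have h2' := h2.symm
  have h3 : MeasurePreserving (Prod.swap : A × B → B × A) volume volume := Measure.measurePreserving_swap
  have h4 := h3.prod (MeasurePreserving.id (volume : Measure B))
  have h5 : MeasurePreserving (MeasurableEquiv.prodAssoc : (B × A) × B ≃ᵐ B × (A × B)) volume volume := measurePreserving_prodAssoc _ _ _
  have h6 := h5.comp (h4.comp h2')
  have h7 := (MeasurePreserving.id (volume : Measure A)).prod h6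
  have h8 : MeasurePreserving (MeasurableEquiv.prodAssoc : (A × B) × (A × B) ≃ᵐ A × (B × (A × B))) volume volume := measurePreserving_prodAssoc _ _ _
  exact h8.symm.comp (h7.comp h1)

theorem mp_comm4_int {A B : Type*} [MeasureSpace A] [MeasureSpace B] [SigmaFinite (volume : Measure A)] [SigmaFinite (volume : Measure B)]
    (f : (A × B) × (A × B) → ℂ) (hf : Integrable f) :
    ∫ w, f w = ∫ t : A × A, ∫ x : B × B, f ((t.1, x.1), (t.2, x.2)) := by
  have h := mp_comm4 (A := A) (B := B)
  have hi := h.integrable_comp_of_integrable hf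
  rw [← h.map_eq, integral_map h.aemeasurable (by rw [h.map_eq]; exact hf.1)]
  exact integral_prod _ hi

/-- pairing -/
def pr {b : ℕ} (w z : ℝ × EB b) : ℝ := w.1 * z.1 + ⟪w.2, z.2⟫
theorem pr_cont {b : ℕ} : Continuous (fun q : (ℝ × EB b) × (ℝ × EB b) => pr q.1 q.2) := by unfold pr; fun_prop
theorem pr_sub {b : ℕ} (w w' z : ℝ × EB b) : pr (w - w') z = pr w z - pr w' z := by
  unfold pr; simp only [Prod.fst_sub, Prod.snd_sub, inner_sub_left]; ring
def Vx {b : ℕ} (F : ℝ × EB b → ℂ) (w : ℝ × EB b) : ℂ := ∫ z, F z * ee (pr w z)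
theorem pr_comm {b : ℕ} (w z : ℝ × EB b) : pr w z = pr z w := by unfold pr; rw [real_inner_comm]; ring

theorem TT_form {b : ℕ} (δ : ℝ) (h1 : δ ≤ 1/2) (a : ℝ × EB b → ℂ) (ha : Integrable a) :
    ((∫ z, wt δ z * ‖Vx a z‖^2 : ℝ) : ℂ) = ∫ t : ℝ × ℝ, ∫ x : EB b × EB b,
      a (t.1, x.1) * (starRingEnd ℂ) (a (t.2, x.2)) * Kc δ (t.1 - t.2) (x.1 - x.2) := by
  have hac : Integrable (fun w => (starRingEnd ℂ) (a w)) := ha.mono (Complex.continuous_conj.comp_aestronglyMeasurable ha.1) (Eventually.of_forall fun w => by simp)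
  have hIntg : Integrable (Function.uncurry fun (x : (ℝ × EB b) × (ℝ × EB b)) (z : ℝ × EB b) =>
      a x.1 * (starRingEnd ℂ) (a x.2) * ((wt δ z : ℂ) * ee (pr (x.1 - x.2) z))) (volume.prod volume) := by
    have h0 := (ha.mul_prod hac).mul_prod (wt_int (b := b) δ h1)
    have : (Function.uncurry fun (x : (ℝ × EB b) × (ℝ × EB b)) (z : ℝ × EB b) =>
      a x.1 * (starRingEnd ℂ) (a x.2) * ((wt δ z : ℂ) * ee (pr (x.1 - x.2) z))) =
      fun w : ((ℝ × EB b) × (ℝ × EB b)) × (ℝ × EB b) => (a w.1.1 * (starRingEnd ℂ) (a w.1.2) * (wt δ w.2 : ℂ)) * ee (pr (w.1.1 - w.1.2) w.2) := by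
      ext w; simp only [Function.uncurry]; ring
    rw [this]
    refine h0.mul_bdd (c := 1) ?_ (Eventually.of_forall fun w => (norm_ee _).le)
    exact (ee_cont.comp (pr_cont.comp (by fun_prop : Continuous fun w : ((ℝ × EB b) × (ℝ × EB b)) × (ℝ × EB b) => (w.1.1 - w.1.2, w.2)))).aestronglyMeasurable
  have e1 : ∀ x : (ℝ × EB b) × (ℝ × EB b), ∫ z, a x.1 * (starRingEnd ℂ) (a x.2) * ((wt δ z : ℂ) * ee (pr (x.1 - x.2) z)) =
      a x.1 * (starRingEnd ℂ) (a x.2) * Kc δ (x.1.1 - x.2.1) (x.1.2 - x.2.2) := by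
    intro x; rw [integral_const_mul]; rfl
  have hint2 : Integrable (fun x : (ℝ × EB b) × (ℝ × EB b) => a x.1 * (starRingEnd ℂ) (a x.2) * Kc δ (x.1.1 - x.2.1) (x.1.2 - x.2.2)) := by
    have := hIntg.integral_prod_left
    refine this.congr (Eventually.of_forall fun x => ?_)
    exact e1 x
  rw [← mp_comm4_int (fun x => a x.1 * (starRingEnd ℂ) (a x.2) * Kc δ (x.1.1 - x.2.1) (x.1.2 - x.2.2)) hint2]
  simp_rw [← e1]
  rw [integral_integral_swap hIntg, ← integral_complex_ofReal]
  congr 1; ext z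
  have : ∀ x : (ℝ × EB b) × (ℝ × EB b), a x.1 * (starRingEnd ℂ) (a x.2) * ((wt δ z : ℂ) * ee (pr (x.1 - x.2) z)) =
     (wt δ z : ℂ) * ((a x.1 * ee (pr z x.1)) * (starRingEnd ℂ) (a x.2 * ee (pr z x.2))) := by
    intro x
    rw [pr_sub, sub_eq_add_neg, ee_add, map_mul, conj_ee, pr_comm z, pr_comm z]; ring
  simp_rw [this]
  rw [integral_const_mul, Measure.volume_eq_prod (ℝ × EB b), integral_prod_mul (fun x => a x * ee (pr z x)) (fun x => (starRingEnd ℂ) (a x * ee (pr z x))), integral_conj]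
  push_cast
  congr 1
  exact (RCLike.mul_conj (Vx a z)).symm

theorem bdd_mem' {b : ℕ} (f : ℝ × EB b → ℂ) (hf : Measurable f) (n M : ℝ) (hM : ∀ x, ‖f x‖ ≤ M) (hs : ∀ x, n < ‖x‖ → f x = 0)
   (p : ℝ≥0∞) : MemLp f p volume := by
  have h : MemLp f p (volume.restrict (Metric.closedBall (0 : ℝ × EB b) n)) :=
    haveI : IsFiniteMeasure (volume.restrict (Metric.closedBall (0 : ℝ × EB b) n)) := ⟨by
      rw [Measure.restrict_apply_univ]; exact measure_closedBall_lt_top⟩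
    MemLp.of_bound hf.aestronglyMeasurable M (Eventually.of_forall hM)
  rw [← memLp_indicator_iff_restrict Metric.isClosed_closedBall.measurableSet] at h
  convert h using 1
  ext x
  by_cases hx : x ∈ Metric.closedBall (0 : ℝ × EB b) n
  · rw [Set.indicator_of_mem hx]
  · rw [Set.indicator_of_notMem hx]
    apply hs; simpa using hx

set_option maxHeartbeats 1000000 in
theorem TT_bound (b : ℕ) (hb : 1 ≤ b) (p q ν : ℝ) (hp : 2 < p) (hpq : 1/p + 1/q = 1) (hν : 0 ≤ ν)
    (hs : 2*ν + b * (1/2 - 1/p) = 2/p) : ∃ C : ℝ, 0 < C ∧ ∀ δ, 0 < δ → δ ≤ 1/2 →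
    ∀ (G : ℝ × EB b → ℂ), Measurable G → ∀ (Λ n : ℝ), (∀ w, |Real.log ‖G w‖| ≤ Λ) → 0 < n →
    (∀ w, G w ≠ 0 → 1/n ≤ w.1 ∧ w.1 ≤ n ∧ ‖w.2‖ ≤ n) → 
    ∫ z, wt δ z * ‖Vx (fun w => ((w.1^(-ν) : ℝ) : ℂ) * G w) z‖^2 ≤ C * δ * (∫ w, ‖G w‖^q)^(2/q) := by
  have hp0 : 0 < p := by linarith
  have hq1 : 1/q = 1 - 1/p := by linarith
  have hpinv : 1/p < 1/2 := by rw [div_lt_div_iff₀ hp0 (by norm_num)]; linarith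
  have hq0 : 0 < q := one_div_pos.1 (by rw [hq1]; linarith)
  obtain ⟨C1, hC1, H1⟩ := slice_bound b hb p q hp hpq
  have hβ : 0 < b * (1/2 - 1/p) := by
    have : (1:ℝ) ≤ b := by exact_mod_cast hb
    apply mul_pos <;> linarith
  obtain ⟨C2, hC2, H2⟩ := hls p q ν _ hp hpq hν hβ hs
  refine ⟨C1 * (C2.toReal + 1), by positivity, ?_⟩
  intro δ h0 h1 G hG Λ n hΛ hn hsupp
  set a : ℝ × EB b → ℂ := fun w => ((w.1^(-ν) : ℝ) : ℂ) * G w with ha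
  have hGE : ∀ w, ‖G w‖ ≤ Real.exp Λ := fun w => log_bdd _ _ (hΛ w)
  have hGn : ∀ w, n < ‖w‖ → G w = 0 := by
    intro w hw
    by_contra h
    obtain ⟨a1, a2, a3⟩ := hsupp w h
    have : ‖w‖ ≤ n := by
      rw [Prod.norm_def]; apply max_le _ a3
      rw [Real.norm_eq_abs, abs_le]; constructor
      · have : 0 < 1/n := by positivity
        linarith
      · exact a2
    linarith
  have ham : Measurable a := by rw [ha]; fun_prop
  have hab : ∀ w, ‖a w‖ ≤ n^ν * Real.exp Λ := by
    intro w
    by_cases h : G w = 0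
    · simp only [ha, h, mul_zero, norm_zero]; positivity
    · obtain ⟨a1, a2, a3⟩ := hsupp w h
      have hw : 0 < w.1 := lt_of_lt_of_le (by positivity) a1
      simp only [ha, norm_mul, Complex.norm_real]
      rw [Real.norm_of_nonneg (by positivity)]
      refine mul_le_mul ?_ (hGE w) (norm_nonneg _) (by positivity)
      calc w.1^(-ν) ≤ (1/n)^(-ν) := Real.rpow_le_rpow_of_nonpos (by positivity) a1 (by linarith)
        _ = n^ν := by rw [one_div, Real.inv_rpow hn.le, ← Real.rpow_neg hn.le, neg_neg]
  have han : ∀ w, n < ‖w‖ → a w = 0 := fun w hw => by simp [ha, hGn w hw]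
  have haI : Integrable a := memLp_one_iff_integrable.1 (bdd_mem' a ham n _ hab han 1)
  have hGqI : Integrable (fun w => ‖G w‖^q) := by
    have := (bdd_mem' G hG n _ hGE hGn (ENNReal.ofReal q)).integrable_norm_rpow (by simpa using hq0) (by simp)
    rwa [ENNReal.toReal_ofReal hq0.le] at this
  set f : ℝ → ℝ := fun t => (∫ x, ‖G (t, x)‖^q)^(1/q) with hf
  have hfm : Measurable f := by
    have : StronglyMeasurable (fun t => ∫ x, ‖G (t, x)‖^q) := by
      apply StronglyMeasurable.integral_prod_right' (f := fun w : ℝ × EB b => ‖G w‖^q)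
      exact (hG.norm.pow_const q).stronglyMeasurable
    exact this.measurable.pow_const _
  have hf0 : ∀ t, 0 ≤ f t := fun t => by simp only [hf]; positivity
  have hGt : ∀ t x, t ≤ 0 → G (t, x) = 0 := by
    intro t x ht
    by_contra h
    obtain ⟨a1, a2, a3⟩ := hsupp _ h
    have : 0 < 1/n := by positivity
    simp only at a1; linarith
  have hfz : ∀ t, t ≤ 0 → f t = 0 := by
    intro t ht
    simp only [hf, hGt t _ ht, norm_zero, Real.zero_rpow hq0.ne', integral_zero]
    rw [Real.zero_rpow (by positivity)]
  have hfq : ∫⁻ t, ENNReal.ofReal (f t ^ q) = ENNReal.ofReal (∫ w, ‖G w‖^q) := by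
    rw [ofReal_integral_eq_lintegral_ofReal hGqI (Eventually.of_forall fun w => by positivity),
      Measure.volume_eq_prod, lintegral_prod _ ((hG.norm.pow_const q).ennreal_ofReal.aemeasurable)]
    have hGqI' := hGqI
    rw [Measure.volume_eq_prod] at hGqI'
    apply lintegral_congr_ae
    filter_upwards [hGqI'.prod_right_ae] with t ht
    simp only [hf]
    rw [← Real.rpow_mul (by positivity), one_div_mul_cancel hq0.ne', Real.rpow_one,
      ofReal_integral_eq_lintegral_ofReal ht (Eventually.of_forall fun w => by positivity)]
  have hne : ∀ᵐ t : ℝ × ℝ, t.1 ≠ t.2 := by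
    rw [Measure.volume_eq_prod]
    have : MeasurableSet {t : ℝ × ℝ | t.1 ≠ t.2} := (measurableSet_eq_fun measurable_fst measurable_snd).compl
    rw [Measure.ae_prod_iff_ae_ae this]
    refine Eventually.of_forall fun x => ?_
    have : ∀ᵐ y : ℝ, y ≠ x := by simp [ae_iff]
    filter_upwards [this] with y hy using hy.symm
  have hinner : ∀ t : ℝ × ℝ, t.1 ≠ t.2 → ‖∫ x : EB b × EB b,
      a (t.1, x.1) * (starRingEnd ℂ) (a (t.2, x.2)) * Kc δ (t.1 - t.2) (x.1 - x.2)‖ₑ ≤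
      ENNReal.ofReal (C1 * δ) * (ENNReal.ofReal (f t.1) * ENNReal.ofReal (f t.2) * ENNReal.ofReal ((t.1 * t.2)^(-ν) * |t.1 - t.2| ^ (-(b * (1/2 - 1/p))))) := by
    intro t ht
    by_cases hpos : t.1 ≤ 0 ∨ t.2 ≤ 0
    · have : ∀ x : EB b × EB b, a (t.1, x.1) * (starRingEnd ℂ) (a (t.2, x.2)) * Kc δ (t.1 - t.2) (x.1 - x.2) = 0 := by
        intro x
        rcases hpos with h | h
        · simp [ha, hGt _ _ h]
        · simp [ha, hGt _ _ h]
      simp [this]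
    push Not at hpos
    have hS := H1 δ h0 h1 (t.1 - t.2) (sub_ne_zero.2 ht) (fun x => G (t.1, x)) (fun x => (starRingEnd ℂ) (G (t.2, x)))
      (by fun_prop) (Complex.continuous_conj.measurable.comp (by fun_prop)) Λ n (fun x => hΛ (t.1, x)) (fun x => by rw [RCLike.norm_conj]; exact hΛ (t.2, x))
      (fun x hx => hGn (t.1, x) (lt_of_lt_of_le hx (le_max_right _ _))) (fun x hx => by
        rw [hGn (t.2, x) (lt_of_lt_of_le hx (le_max_right _ _)), map_zero])
    have e : ∫ x : EB b × EB b, a (t.1, x.1) * (starRingEnd ℂ) (a (t.2, x.2)) * Kc δ (t.1 - t.2) (x.1 - x.2) =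
       (((t.1^(-ν) * t.2^(-ν) : ℝ)) : ℂ) * ∫ x : EB b × EB b, G (t.1, x.1) * (starRingEnd ℂ) (G (t.2, x.2)) * Kc δ (t.1 - t.2) (x.1 - x.2) := by
      rw [← integral_const_mul]; congr 1; ext x
      simp only [ha, map_mul, Complex.conj_ofReal]; push_cast; ring
    rw [e, ← ofReal_norm, ← ENNReal.ofReal_mul (hf0 _), ← ENNReal.ofReal_mul (mul_nonneg (hf0 _) (hf0 _)), ← ENNReal.ofReal_mul (by positivity)]
    apply ENNReal.ofReal_le_ofReal
    rw [norm_mul, Complex.norm_real, Real.norm_of_nonneg (by have := hpos.1; have := hpos.2; positivity), Real.mul_rpow hpos.1.le hpos.2.le]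
    have hnn : 0 ≤ t.1^(-ν) * t.2^(-ν) := by have := hpos.1; have := hpos.2; positivity
    refine (mul_le_mul_of_nonneg_left hS hnn).trans (le_of_eq ?_)
    simp only [hf, RCLike.norm_conj]
    ring
  have hres : 0 ≤ ∫ z, wt δ z * ‖Vx a z‖^2 := integral_nonneg fun z => mul_nonneg (wt_nonneg _ _) (by positivity)
  have hGnn : 0 ≤ ∫ w, ‖G w‖^q := integral_nonneg fun z => by positivity
  rw [← ENNReal.ofReal_le_ofReal_iff (by positivity)]
  calc ENNReal.ofReal (∫ z, wt δ z * ‖Vx a z‖^2) = ‖((∫ z, wt δ z * ‖Vx a z‖^2 : ℝ) : ℂ)‖ₑ := by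
        rw [← ofReal_norm, Complex.norm_real, Real.norm_of_nonneg hres]
    _ ≤ ∫⁻ t : ℝ × ℝ, ‖∫ x : EB b × EB b, a (t.1, x.1) * (starRingEnd ℂ) (a (t.2, x.2)) * Kc δ (t.1 - t.2) (x.1 - x.2)‖ₑ := by
        rw [TT_form δ h1 a haI]; exact enorm_integral_le_lintegral_enorm _
    _ ≤ ∫⁻ t : ℝ × ℝ, ENNReal.ofReal (C1 * δ) * (ENNReal.ofReal (f t.1) * ENNReal.ofReal (f t.2) * ENNReal.ofReal ((t.1 * t.2)^(-ν) * |t.1 - t.2| ^ (-(b * (1/2 - 1/p))))) :=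
        lintegral_mono_ae (by filter_upwards [hne] with t ht using hinner t ht)
    _ = ENNReal.ofReal (C1 * δ) * ∫⁻ t : ℝ × ℝ, (ENNReal.ofReal (f t.1) * ENNReal.ofReal (f t.2) * ENNReal.ofReal ((t.1 * t.2)^(-ν) * |t.1 - t.2| ^ (-(b * (1/2 - 1/p))))) := by
        rw [lintegral_const_mul]; fun_prop
    _ ≤ ENNReal.ofReal (C1 * δ) * (C2 * (∫⁻ x, ENNReal.ofReal (f x ^ q)) ^ (1/q) * (∫⁻ x, ENNReal.ofReal (f x ^ q)) ^ (1/q)) :=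
        mul_le_mul' le_rfl (H2 f f hfm hfm hf0 hf0 hfz hfz)
    _ ≤ ENNReal.ofReal (C1 * δ) * (ENNReal.ofReal (C2.toReal + 1) * ENNReal.ofReal ((∫ w, ‖G w‖^q) ^ (1/q)) * ENNReal.ofReal ((∫ w, ‖G w‖^q) ^ (1/q))) := by
        rw [hfq, ENNReal.ofReal_rpow_of_nonneg hGnn (by positivity)]
        refine mul_le_mul' le_rfl (mul_le_mul' (mul_le_mul' ?_ le_rfl) le_rfl)
        rw [← ENNReal.ofReal_toReal hC2]; apply ENNReal.ofReal_le_ofReal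
        rw [ENNReal.toReal_ofReal (by positivity)]; linarith
    _ = _ := by
        rw [← ENNReal.ofReal_mul (by positivity), ← ENNReal.ofReal_mul (by positivity), ← ENNReal.ofReal_mul (by positivity)]
        congr 1
        have : (∫ w, ‖G w‖^q)^(2/q) = (∫ w, ‖G w‖^q)^(1/q) * (∫ w, ‖G w‖^q)^(1/q) := by
          rw [← Real.rpow_add_of_nonneg hGnn (by positivity) (by positivity)]; congr 1; ring
        rw [this]; ring
end


open MeasureTheory Real Filter
open scoped ENNReal FourierTransform RealInnerProductSpace Topology

noncomputable section

theorem Vx_cont {b : ℕ} (F : ℝ × EB b → ℂ) (hF : Integrable F) : Continuous (Vx F) := by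
  unfold Vx
  apply continuous_of_dominated (bound := fun z => ‖F z‖)
  · intro x
    exact (hF.1.mul (ee_cont.comp (pr_cont.comp (by fun_prop : Continuous fun z : ℝ × EB b => (x, z)))).aestronglyMeasurable)
  · intro x; refine Eventually.of_forall fun z => ?_
    rw [norm_mul, norm_ee, mul_one]
  · exact hF.norm
  · refine Eventually.of_forall fun z => ?_
    exact continuous_const.mul (ee_cont.comp (pr_cont.comp (by fun_prop : Continuous fun w : ℝ × EB b => (w, z))))

theorem Vx_le {b : ℕ} (F : ℝ × EB b → ℂ) (w : ℝ × EB b) : ‖Vx F w‖ ≤ ∫ z, ‖F z‖ := by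
  unfold Vx
  refine (norm_integral_le_integral_norm _).trans (le_of_eq ?_)
  congr 1; ext z; rw [norm_mul, norm_ee, mul_one]

theorem Vx_dual {b : ℕ} (F a : ℝ × EB b → ℂ) (hF : Integrable F) (ha : Integrable a) :
    ∫ w, a w * Vx F w = ∫ z, F z * Vx a z := by
  unfold Vx
  simp_rw [← integral_const_mul]
  rw [integral_integral_swap]
  · congr 1; ext z; congr 1; ext w; rw [pr_comm]; ring
  · have h0 := ha.mul_prod hF
    have : (Function.uncurry fun (w z : ℝ × EB b) => a w * (F z * ee (pr w z))) = fun q : (ℝ × EB b) × (ℝ × EB b) => (a q.1 * F q.2) * ee (pr q.1 q.2) := by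
      ext q; simp only [Function.uncurry]; ring
    rw [this]
    exact h0.mul_bdd (c := 1) (ee_cont.comp pr_cont).aestronglyMeasurable (Eventually.of_forall fun w => (norm_ee _).le)

set_option maxHeartbeats 1000000 in
theorem SSL_trunc (b : ℕ) (hb : 1 ≤ b) (p ν : ℝ) (hp : 2 < p) (hν : 0 ≤ ν)
    (hs : 2*ν + b * (1/2 - 1/p) = 2/p) : ∃ C : ℝ, 0 < C ∧ ∀ δ, 0 < δ → δ ≤ 1/2 →
    ∀ (F : ℝ × EB b → ℂ), Integrable F → MemLp F 2 volume → (∀ z, F z ≠ 0 → 1/16 ≤ wt δ z) →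
    ∀ (S : Set (ℝ × EB b)) (n : ℝ), MeasurableSet S → 0 < n →
      (∀ w ∈ S, 1/n ≤ w.1 ∧ w.1 ≤ n ∧ ‖w.2‖ ≤ n ∧ |Real.log (w.1^(-ν) * ‖Vx F w‖)| ≤ n) →
    ∫⁻ w in S, ENNReal.ofReal ((w.1^(-ν) * ‖Vx F w‖)^p) ≤ ENNReal.ofReal ((C * √δ * (∫ z, ‖F z‖^2)^(1/2:ℝ))^p) := by
  have hp0 : 0 < p := by linarith
  have hpinv : 1/p < 1/2 := by rw [div_lt_div_iff₀ hp0 (by norm_num)]; linarith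
  have hpi : 0 < 1/p := by positivity
  obtain ⟨q, hq⟩ : ∃ q, q = p/(p-1) := ⟨_, rfl⟩
  have hpq : 1/p + 1/q = 1 := by rw [hq]; field_simp; ring
  have hq0 : 0 < q := by rw [hq]; apply div_pos <;> linarith
  have hpq2 : (p-1)*q = p := by rw [hq]; exact mul_div_cancel₀ p (by linarith)
  obtain ⟨C, hC, H⟩ := TT_bound b hb p q ν hp hpq hν hs
  refine ⟨4 * √C, by positivity, ?_⟩
  intro δ h0 h1 F hF hF2 hFs S n hS hn hSp
  have hVm : Measurable (Vx F) := (Vx_cont F hF).measurable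
  set W : ℝ × EB b → ℂ := fun w => ((w.1^(-ν) : ℝ) : ℂ) * Vx F w with hW
  have hWm : Measurable W := by rw [hW]; fun_prop
  have hWn : ∀ w, 0 < w.1 → ‖W w‖ = w.1^(-ν) * ‖Vx F w‖ := by
    intro w hw; simp only [hW, norm_mul, Complex.norm_real]; rw [Real.norm_of_nonneg (by positivity)]
  have hSpos : ∀ w ∈ S, 0 < w.1 := fun w hw => lt_of_lt_of_le (by positivity) (hSp w hw).1
  set G : ℝ × EB b → ℂ := S.indicator (fun w => (starRingEnd ℂ) (W w) * ((‖W w‖^(p-2) : ℝ) : ℂ)) with hG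
  have hGm : Measurable G := by
    rw [hG]; refine Measurable.indicator ?_ hS
    exact (Complex.continuous_conj.measurable.comp hWm).mul (Complex.measurable_ofReal.comp (hWm.norm.pow_const _))
  have hGS : ∀ w ∈ S, G w = (starRingEnd ℂ) (W w) * ((‖W w‖^(p-2) : ℝ) : ℂ) := fun w hw => by rw [hG, Set.indicator_of_mem hw]
  have hG0 : ∀ w, w ∉ S → G w = 0 := fun w hw => by rw [hG, Set.indicator_of_notMem hw]
  have hGn : ∀ w ∈ S, ‖G w‖ = ‖W w‖^(p-1) := by
    intro w hw
    rw [hGS w hw, norm_mul, RCLike.norm_conj, Complex.norm_real, Real.norm_of_nonneg (by positivity)]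
    have : ‖W w‖ * ‖W w‖^(p-2) = ‖W w‖^(1:ℝ) * ‖W w‖^(p-2) := by rw [Real.rpow_one]
    rw [this, ← Real.rpow_add_of_nonneg (norm_nonneg _) (by norm_num) (by linarith)]; congr 1; ring
  have hGq : ∀ w ∈ S, ‖G w‖^q = ‖W w‖^p := by
    intro w hw; rw [hGn w hw, ← Real.rpow_mul (norm_nonneg _), hpq2]
  have hΛ : ∀ w, |Real.log ‖G w‖| ≤ (p-1)*n := by
    intro w
    by_cases hw : w ∈ S
    · rw [hGn w hw]
      rcases (norm_nonneg (W w)).eq_or_lt with h | h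
      · rw [← h, Real.zero_rpow (by linarith)]; simp; nlinarith
      · rw [Real.log_rpow h, abs_mul, abs_of_pos (by linarith : 0 < p-1)]
        have := (hSp w hw).2.2.2
        rw [hWn w (hSpos w hw)]
        exact mul_le_mul_of_nonneg_left this (by linarith)
    · rw [hG0 w hw]; simp; nlinarith
  have hsupp : ∀ w, G w ≠ 0 → 1/n ≤ w.1 ∧ w.1 ≤ n ∧ ‖w.2‖ ≤ n := by
    intro w hw
    have : w ∈ S := by by_contra h; exact hw (hG0 w h)
    obtain ⟨a, b, c, _⟩ := hSp w this
    exact ⟨a, b, c⟩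
  have hTT := H δ h0 h1 G hGm _ n hΛ hn hsupp
  set a : ℝ × EB b → ℂ := fun w => ((w.1^(-ν) : ℝ) : ℂ) * G w with ha
  have ham : Measurable a := by rw [ha]; fun_prop
  have hGE : ∀ w, ‖G w‖ ≤ Real.exp ((p-1)*n) := fun w => log_bdd _ _ (hΛ w)
  have hGnn : ∀ w, n < ‖w‖ → G w = 0 := by
    intro w hw
    by_contra h
    obtain ⟨a1, a2, a3⟩ := hsupp w h
    have : ‖w‖ ≤ n := by
      rw [Prod.norm_def]; apply max_le _ a3
      rw [Real.norm_eq_abs, abs_le]; constructor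
      · have : 0 < 1/n := by positivity
        linarith
      · exact a2
    linarith
  have hab : ∀ w, ‖a w‖ ≤ n^ν * Real.exp ((p-1)*n) := by
    intro w
    by_cases h : G w = 0
    · simp only [ha, h, mul_zero, norm_zero]; positivity
    · obtain ⟨a1, a2, a3⟩ := hsupp w h
      have hw : 0 < w.1 := lt_of_lt_of_le (by positivity) a1
      simp only [ha, norm_mul, Complex.norm_real]
      rw [Real.norm_of_nonneg (by positivity)]
      refine mul_le_mul ?_ (hGE w) (norm_nonneg _) (by positivity)
      calc w.1^(-ν) ≤ (1/n)^(-ν) := Real.rpow_le_rpow_of_nonpos (by positivity) a1 (by linarith)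
        _ = n^ν := by rw [one_div, Real.inv_rpow hn.le, ← Real.rpow_neg hn.le, neg_neg]
  have haI : Integrable a := memLp_one_iff_integrable.1 (bdd_mem' a ham n _ hab (fun w hw => by simp [ha, hGnn w hw]) 1)
  have hGqI : Integrable (fun w => ‖G w‖^q) := by
    have := (bdd_mem' G hGm n _ hGE hGnn (ENNReal.ofReal q)).integrable_norm_rpow (by simpa using hq0) (by simp)
    rwa [ENNReal.toReal_ofReal hq0.le] at this
  set J := ∫ w, ‖G w‖^q with hJ
  have hJ0 : 0 ≤ J := integral_nonneg fun w => by positivity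
  -- identify J
  have hJl : ∫⁻ w in S, ENNReal.ofReal ((w.1^(-ν) * ‖Vx F w‖)^p) = ENNReal.ofReal J := by
    rw [hJ, ofReal_integral_eq_lintegral_ofReal hGqI (Eventually.of_forall fun w => by positivity), ← lintegral_indicator hS]
    apply lintegral_congr; intro w
    by_cases hw : w ∈ S
    · rw [Set.indicator_of_mem hw, hGq w hw, hWn w (hSpos w hw)]
    · rw [Set.indicator_of_notMem hw, hG0 w hw, norm_zero, Real.zero_rpow hq0.ne', ENNReal.ofReal_zero]
  have hJc : (J : ℂ) = ∫ z, F z * Vx a z := by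
    rw [← Vx_dual F a hF haI, hJ, ← integral_complex_ofReal]
    congr 1; ext w
    by_cases hw : w ∈ S
    · rw [hGq w hw]; simp only [ha]
      have : ((w.1^(-ν) : ℝ) : ℂ) * G w * Vx F w = W w * G w := by simp only [hW]; ring
      rw [this, hGS w hw, ← mul_assoc, RCLike.mul_conj]
      have e : ‖W w‖^p = ‖W w‖^2 * ‖W w‖^(p-2) := by
        rw [← Real.rpow_natCast, ← Real.rpow_add_of_nonneg (norm_nonneg _) (by norm_num) (by linarith)]; congr 1; push_cast; ring
      rw [e]; push_cast; rfl
    · simp [ha, hG0 w hw, Real.zero_rpow hq0.ne']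
  have hVaB := Vx_le a
  set B := ∫ z, ‖a z‖
  have hVac := Vx_cont a haI
  have hsqI : Integrable (fun z => wt δ z * ‖Vx a z‖^2) := by
    refine (wt_intR δ h1).mul_bdd (c := B^2) (by fun_prop) (Eventually.of_forall fun z => ?_)
    rw [Real.norm_of_nonneg (by positivity)]
    exact pow_le_pow_left₀ (norm_nonneg _) (hVaB z) 2
  have hm2 : MemLp (fun z => √(wt δ z) * ‖Vx a z‖) (ENNReal.ofReal 2) volume := by
    rw [show ENNReal.ofReal 2 = 2 by norm_num]
    rw [memLp_two_iff_integrable_sq (by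
      exact ((wt_meas δ).sqrt.mul hVac.measurable.norm).aestronglyMeasurable)]
    refine hsqI.congr (Eventually.of_forall fun z => ?_)
    simp only; rw [mul_pow, Real.sq_sqrt (wt_nonneg _ _)]
  have hm1 : MemLp (fun z => ‖F z‖) (ENNReal.ofReal 2) volume := by
    rw [show ENNReal.ofReal 2 = 2 by norm_num]; exact hF2.norm
  have hCS := integral_mul_le_Lp_mul_Lq_of_nonneg Real.HolderConjugate.two_two (Eventually.of_forall fun z => norm_nonneg (F z))
    (Eventually.of_forall fun z => (by positivity : 0 ≤ √(wt δ z) * ‖Vx a z‖)) hm1 hm2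
  set N := (∫ z, ‖F z‖^2)^(1/2:ℝ) with hN
  have hN0 : 0 ≤ N := by positivity
  have hint1 : Integrable (fun z => ‖F z‖ * (√(wt δ z) * ‖Vx a z‖)) := by
    have hm2' := hm2
    rw [show ENNReal.ofReal 2 = 2 by norm_num] at hm2'
    exact MemLp.integrable_mul hF2.norm hm2'
  have hJ1 : J ≤ 4 * (N * (∫ z, wt δ z * ‖Vx a z‖^2)^(1/2:ℝ)) := by
    calc J = ‖(J:ℂ)‖ := by rw [Complex.norm_real, Real.norm_of_nonneg hJ0]
      _ ≤ ∫ z, ‖F z * Vx a z‖ := by rw [hJc]; exact norm_integral_le_integral_norm _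
      _ ≤ ∫ z, 4 * (‖F z‖ * (√(wt δ z) * ‖Vx a z‖)) := by
        apply integral_mono_of_nonneg (Eventually.of_forall fun z => norm_nonneg _) (hint1.const_mul 4) (Eventually.of_forall fun z => ?_)
        simp only
        rw [norm_mul]
        by_cases hz : F z = 0
        · simp [hz]
        · have h16 := hFs z hz
          have : 1/4 ≤ √(wt δ z) := Real.le_sqrt_of_sq_le (by linarith)
          have hp1 : 0 ≤ ‖F z‖ * ‖Vx a z‖ := by positivity
          nlinarith
      _ = 4 * ∫ z, ‖F z‖ * (√(wt δ z) * ‖Vx a z‖) := integral_const_mul _ _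
      _ ≤ _ := by
        refine mul_le_mul_of_nonneg_left (hCS.trans (le_of_eq ?_)) (by norm_num)
        simp only [hN]
        congr 2
        · congr 1; ext z; norm_cast
        · congr 1; ext z
          have : (√(wt δ z) * ‖Vx a z‖)^(2:ℝ) = (√(wt δ z) * ‖Vx a z‖)^2 := by norm_cast
          rw [this, mul_pow, Real.sq_sqrt (wt_nonneg _ _)]
  have hJ2 : J ≤ 4 * √C * √δ * N * J^(1/q) := by
    refine hJ1.trans ?_
    have : (∫ z, wt δ z * ‖Vx a z‖^2)^(1/2:ℝ) ≤ (C * δ * J^(2/q))^(1/2:ℝ) :=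
      Real.rpow_le_rpow (integral_nonneg fun z => mul_nonneg (wt_nonneg _ _) (by positivity)) hTT (by norm_num)
    rw [Real.mul_rpow (by positivity) (by positivity), Real.mul_rpow (by positivity) (by positivity), ← Real.rpow_mul hJ0,
      ← Real.sqrt_eq_rpow C, ← Real.sqrt_eq_rpow δ, show 2/q*(1/2) = 1/q by ring] at this
    calc _ ≤ 4 * (N * (√C * √δ * J^(1/q))) := by gcongr
      _ = _ := by ring
  rw [hJl]
  apply ENNReal.ofReal_le_ofReal
  rcases hJ0.eq_or_lt with h | h
  · rw [← h]; positivity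
  · have h3 : J^(1/p) ≤ 4 * √C * √δ * N := by
      have e : J = J^(1/p) * J^(1/q) := by rw [← Real.rpow_add h, hpq, Real.rpow_one]
      have hpos : 0 < J^(1/q) := by positivity
      have := hJ2
      nth_rw 1 [e] at this
      exact le_of_mul_le_mul_right this hpos
    calc J = (J^(1/p))^p := by rw [← Real.rpow_mul hJ0, one_div_mul_cancel hp0.ne', Real.rpow_one]
      _ ≤ _ := Real.rpow_le_rpow (by positivity) h3 hp0.le

theorem SSL (b : ℕ) (hb : 1 ≤ b) (p ν : ℝ) (hp : 2 < p) (hν : 0 ≤ ν)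
    (hs : 2*ν + b * (1/2 - 1/p) = 2/p) : ∃ C : ℝ, 0 < C ∧ ∀ δ, 0 < δ → δ ≤ 1/2 →
    ∀ (F : ℝ × EB b → ℂ), Integrable F → MemLp F 2 volume → (∀ z, F z ≠ 0 → 1/16 ≤ wt δ z) →
    ∫⁻ w in {w : ℝ × EB b | 0 < w.1}, ENNReal.ofReal ((w.1^(-ν) * ‖Vx F w‖)^p) ≤ ENNReal.ofReal ((C * √δ * (∫ z, ‖F z‖^2)^(1/2:ℝ))^p) := by
  obtain ⟨C, hC, H⟩ := SSL_trunc b hb p ν hp hν hs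
  refine ⟨C, hC, fun δ h0 h1 F hF hF2 hFs => ?_⟩
  have hVm : Measurable (Vx F) := (Vx_cont F hF).measurable
  set S : ℕ → Set (ℝ × EB b) := fun n => {w | 1/((n:ℝ)+1) ≤ w.1 ∧ w.1 ≤ (n:ℝ)+1 ∧ ‖w.2‖ ≤ (n:ℝ)+1 ∧ |Real.log (w.1^(-ν) * ‖Vx F w‖)| ≤ (n:ℝ)+1} with hS
  have hSm : ∀ n, MeasurableSet (S n) := by
    intro n
    have hl : Measurable fun w : ℝ × EB b => |Real.log (w.1^(-ν) * ‖Vx F w‖)| := by fun_prop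
    have q1 : Measurable fun w : ℝ × EB b => w.1 := measurable_fst
    have q2 : Measurable fun w : ℝ × EB b => ‖w.2‖ := measurable_snd.norm
    exact ((measurableSet_le measurable_const q1).inter ((measurableSet_le q1 measurable_const).inter
      ((measurableSet_le q2 measurable_const).inter (measurableSet_le hl measurable_const))))
  have hmono : Monotone S := by
    intro m n hmn w ⟨a, b, c, d⟩
    have h : (m:ℝ) ≤ n := by exact_mod_cast hmn
    refine ⟨le_trans ?_ a, by linarith, by linarith, by linarith⟩
    apply one_div_le_one_div_of_le (by positivity); linarith
  have hsub : {w : ℝ × EB b | 0 < w.1} ⊆ ⋃ n, S n := by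
    intro w hw
    have hw : 0 < w.1 := hw
    obtain ⟨n, hn⟩ := exists_nat_ge (max (max (1/w.1) w.1) (max ‖w.2‖ |Real.log (w.1^(-ν) * ‖Vx F w‖)|))
    simp only [max_le_iff] at hn
    rw [Set.mem_iUnion]
    refine ⟨n, ?_, by linarith, by linarith, by linarith⟩
    rw [one_div_le (by positivity) hw]; linarith
  calc _ ≤ ∫⁻ w in ⋃ n, S n, ENNReal.ofReal ((w.1^(-ν) * ‖Vx F w‖)^p) := lintegral_mono_set hsub
    _ = ⨆ n, ∫⁻ w in S n, ENNReal.ofReal ((w.1^(-ν) * ‖Vx F w‖)^p) := setLIntegral_iUnion_of_directed _ hmono.directed_le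
    _ ≤ _ := iSup_le fun n => H δ h0 h1 F hF hF2 hFs (S n) (n+1) (hSm n) (by positivity) (fun w hw => hw)
end


open MeasureTheory Real Filter
open scoped ENNReal FourierTransform RealInnerProductSpace Topology

noncomputable section

def Supp {b : ℕ} (δ : ℝ) (U : ℝ × EB b → ℂ) : Prop := ∀ z, U z ≠ 0 → 1/4 ≤ z.1 ∧ |√(z.1^2 + ‖z.2‖^2) - 1| ≤ δ

theorem Supp_wt {b : ℕ} {δ : ℝ} {U : ℝ × EB b → ℂ} (h : Supp δ U) (z) (hz : U z ≠ 0) : 1/16 ≤ wt δ z := by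
  obtain ⟨h1, h2⟩ := h z hz
  unfold wt sh; rw [if_pos h2]; nlinarith

theorem Supp_le {b : ℕ} {δ : ℝ} (hδ : δ ≤ 1/2) {U : ℝ × EB b → ℂ} (h : Supp δ U) (z) (hz : U z ≠ 0) : z.1 ≤ 3/2 ∧ ‖z.2‖ ≤ 3/2 := by
  obtain ⟨h1, h2⟩ := h z hz
  rw [abs_le] at h2
  have hpos : 0 ≤ z.1^2 + ‖z.2‖^2 := by positivity
  have hs := Real.sq_sqrt hpos
  have hs0 := Real.sqrt_nonneg (z.1^2 + ‖z.2‖^2)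
  constructor
  · nlinarith [sq_nonneg ‖z.2‖]
  · nlinarith [norm_nonneg z.2]

theorem l2_real {X : Type*} [MeasurableSpace X] {μ : Measure X} (f : X → ℂ) (hf : MemLp f 2 μ) :
    ∫⁻ x, ‖f x‖ₑ^(2:ℝ) ∂μ = ENNReal.ofReal (((∫ x, ‖f x‖^2 ∂μ)^(1/2:ℝ))^(2:ℝ)) := by
  rw [← Real.rpow_mul (integral_nonneg fun x => by positivity), show (1/2:ℝ)*2 = 1 by norm_num, Real.rpow_one,
    ofReal_integral_eq_lintegral_ofReal]
  · apply lintegral_congr; intro x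
    rw [← ofReal_norm, ENNReal.ofReal_rpow_of_nonneg (norm_nonneg _) (by positivity)]
    norm_cast
  · have := hf.integrable_norm_pow (by norm_num); simpa using this
  · exact Eventually.of_forall fun x => by positivity

/-- slice Cauchy-Schwarz -/
theorem slice_cs {b : ℕ} {δ : ℝ} (h0 : 0 < δ) (h1 : δ ≤ 1/2) (U : ℝ × EB b → ℂ) (hUm : Measurable U) (hS : Supp δ U) (η : EB b) :
    ∫⁻ ρ, ‖U (ρ, η)‖ₑ ≤ ENNReal.ofReal (192 * δ)^(1/2:ℝ) * (∫⁻ ρ, ‖U (ρ, η)‖ₑ^(2:ℝ))^(1/2:ℝ) := by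
  have hm : Measurable fun ρ : ℝ => wt δ (ρ, η) := (wt_meas δ).comp (by fun_prop)
  calc ∫⁻ ρ, ‖U (ρ, η)‖ₑ ≤ ∫⁻ ρ, ((fun ρ => ENNReal.ofReal (√(16 * wt δ (ρ, η)))) * (fun ρ => ‖U (ρ, η)‖ₑ)) ρ := by
        apply lintegral_mono; intro ρ
        simp only [Pi.mul_apply]
        by_cases hz : U (ρ, η) = 0
        · simp [hz]
        · have := Supp_wt hS _ hz
          have h3 : 1 ≤ √(16 * wt δ (ρ, η)) := Real.le_sqrt_of_sq_le (by linarith)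
          calc ‖U (ρ, η)‖ₑ = 1 * ‖U (ρ, η)‖ₑ := (one_mul _).symm
            _ ≤ _ := mul_le_mul' (by rw [← ENNReal.ofReal_one]; exact ENNReal.ofReal_le_ofReal h3) le_rfl
    _ ≤ (∫⁻ ρ, (ENNReal.ofReal (√(16 * wt δ (ρ, η))))^(2:ℝ))^(1/2:ℝ) * (∫⁻ ρ, ‖U (ρ, η)‖ₑ^(2:ℝ))^(1/2:ℝ) :=
        ENNReal.lintegral_mul_le_Lp_mul_Lq _ Real.HolderConjugate.two_two ((hm.const_mul 16).sqrt.ennreal_ofReal.aemeasurable) (by fun_prop)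
    _ ≤ _ := by
        refine mul_le_mul' (ENNReal.rpow_le_rpow ?_ (by norm_num)) le_rfl
        calc _ = ∫⁻ ρ, ENNReal.ofReal 16 * ENNReal.ofReal (wt δ (ρ, η)) := by
              apply lintegral_congr; intro ρ
              have hw := wt_nonneg δ (ρ, η)
              rw [ENNReal.ofReal_rpow_of_nonneg (Real.sqrt_nonneg _) (by norm_num), ← ENNReal.ofReal_mul (by norm_num)]
              congr 1
              have := Real.sq_sqrt (by positivity : 0 ≤ 16 * wt δ (ρ, η))
              exact_mod_cast this
          _ = ENNReal.ofReal 16 * ∫⁻ ρ, ENNReal.ofReal (wt δ (ρ, η)) := lintegral_const_mul _ hm.ennreal_ofReal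
          _ ≤ ENNReal.ofReal 16 * ENNReal.ofReal (12 * δ) := mul_le_mul' le_rfl (wt_slice δ h0 h1 η)
          _ = _ := by rw [← ENNReal.ofReal_mul (by norm_num)]; congr 1; ring

theorem slice_sq {b : ℕ} {δ : ℝ} (h0 : 0 < δ) (h1 : δ ≤ 1/2) (U : ℝ × EB b → ℂ) (hUm : Measurable U) (hS : Supp δ U) :
    ∫⁻ η, (∫⁻ ρ, ‖U (ρ, η)‖ₑ)^(2:ℝ) ≤ ENNReal.ofReal (192 * δ) * ∫⁻ z, ‖U z‖ₑ^(2:ℝ) := by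
  rw [Measure.volume_eq_prod, lintegral_prod_symm _ (by fun_prop), ← lintegral_const_mul _ (by fun_prop)]
  apply lintegral_mono; intro η
  refine (ENNReal.rpow_le_rpow (slice_cs h0 h1 U hUm hS η) (by norm_num)).trans (le_of_eq ?_)
  rw [ENNReal.mul_rpow_of_nonneg _ _ (by norm_num), ← ENNReal.rpow_mul, ← ENNReal.rpow_mul]
  norm_num

/-- L1 bound -/
theorem supp_L1 (b : ℕ) : ∃ C : ℝ, 0 < C ∧ ∀ δ, 0 < δ → δ ≤ 1/2 → ∀ U : ℝ × EB b → ℂ, Measurable U → MemLp U 2 volume → Supp δ U →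
    Integrable U ∧ ∫ z, ‖U z‖ ≤ C * √δ * (∫ z, ‖U z‖^2)^(1/2:ℝ) := by
  set v := (volume (Metric.closedBall (0 : EB b) (3/2))) with hv
  have hvf : v ≠ ⊤ := measure_closedBall_lt_top.ne
  refine ⟨√(v.toReal * 192) + 1, by positivity, ?_⟩
  intro δ h0 h1 U hUm hU2 hS
  have key : ∫⁻ z, ‖U z‖ₑ ≤ ENNReal.ofReal ((√(v.toReal * 192) + 1) * √δ * (∫ z, ‖U z‖^2)^(1/2:ℝ)) := by
    set B := Metric.closedBall (0 : EB b) (3/2)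
    have hB : MeasurableSet B := Metric.isClosed_closedBall.measurableSet
    calc ∫⁻ z, ‖U z‖ₑ = ∫⁻ η, ∫⁻ ρ, ‖U (ρ, η)‖ₑ := by
          rw [Measure.volume_eq_prod, lintegral_prod_symm _ (by fun_prop)]
      _ = ∫⁻ η, ((B.indicator (fun _ => (1:ℝ≥0∞))) * (fun η => ∫⁻ ρ, ‖U (ρ, η)‖ₑ)) η := by
          apply lintegral_congr; intro η
          simp only [Pi.mul_apply]
          by_cases hη : η ∈ B
          · rw [Set.indicator_of_mem hη, one_mul]
          · rw [Set.indicator_of_notMem hη, zero_mul]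
            have : ∀ ρ, U (ρ, η) = 0 := by
              intro ρ
              by_contra hc
              have := (Supp_le h1 hS _ hc).2
              exact hη (by simpa [B] using this)
            simp [this]
      _ ≤ (∫⁻ η, (B.indicator (fun _ => (1:ℝ≥0∞)) η)^(2:ℝ))^(1/2:ℝ) * (∫⁻ η, (∫⁻ ρ, ‖U (ρ, η)‖ₑ)^(2:ℝ))^(1/2:ℝ) :=
          ENNReal.lintegral_mul_le_Lp_mul_Lq _ Real.HolderConjugate.two_two ((measurable_const.indicator hB).aemeasurable) (by fun_prop)
      _ ≤ v^(1/2:ℝ) * (ENNReal.ofReal (192 * δ) * ∫⁻ z, ‖U z‖ₑ^(2:ℝ))^(1/2:ℝ) := by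
          refine mul_le_mul' (ENNReal.rpow_le_rpow (le_of_eq ?_) (by norm_num)) (ENNReal.rpow_le_rpow (slice_sq h0 h1 U hUm hS) (by norm_num))
          have : ∀ η, (B.indicator (fun _ => (1:ℝ≥0∞)) η)^(2:ℝ) = B.indicator (fun _ => (1:ℝ≥0∞)) η := by
            intro η; by_cases hη : η ∈ B
            · rw [Set.indicator_of_mem hη]; simp
            · rw [Set.indicator_of_notMem hη]; simp
          simp_rw [this]
          rw [lintegral_indicator hB]; simp [hv, B]
      _ = ENNReal.ofReal (√(v.toReal * 192) * √δ * (∫ z, ‖U z‖^2)^(1/2:ℝ)) := by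
          rw [l2_real U hU2, ← ENNReal.ofReal_toReal hvf, ← ENNReal.ofReal_mul (by positivity), ENNReal.ofReal_rpow_of_nonneg (by positivity) (by norm_num),
            ENNReal.ofReal_rpow_of_nonneg (by positivity) (by norm_num), ← ENNReal.ofReal_mul (by positivity), ENNReal.toReal_ofReal (by positivity)]
          congr 1
          rw [Real.mul_rpow (by positivity) (by positivity), ← Real.rpow_mul (by positivity), Real.mul_rpow (by positivity) (by positivity),
            Real.sqrt_mul (by positivity), Real.sqrt_eq_rpow, Real.sqrt_eq_rpow, Real.sqrt_eq_rpow]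
          norm_num; ring
      _ ≤ _ := by
          apply ENNReal.ofReal_le_ofReal; gcongr; linarith
  have hI : Integrable U := ⟨hUm.aestronglyMeasurable, lt_of_le_of_lt key ENNReal.ofReal_lt_top⟩
  refine ⟨hI, ?_⟩
  rw [← ENNReal.ofReal_le_ofReal_iff (by positivity), ofReal_integral_eq_lintegral_ofReal hI.norm (Eventually.of_forall fun _ => norm_nonneg _)]
  refine le_trans (le_of_eq ?_) key
  apply lintegral_congr; intro z; exact ofReal_norm _

def Ured {b : ℕ} (k : ℝ → ℂ) (U : ℝ × EB b → ℂ) (t : ℝ) (y : EB b) : ℂ := ∫ z, U z * k (t * z.1) * ee ⟪y, z.2⟫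

theorem Ured_int {b : ℕ} (k : ℝ → ℂ) (hk : Measurable k) (K : ℝ) (hK : ∀ s, ‖k s‖ ≤ K) (U : ℝ × EB b → ℂ) (hU : Integrable U) (t : ℝ) :
    Integrable fun z => U z * k (t * z.1) :=
  hU.mul_bdd (c := K) (hk.comp (by fun_prop)).aestronglyMeasurable (Eventually.of_forall fun z => hK _)

theorem Ured_le {b : ℕ} (k : ℝ → ℂ) (K : ℝ) (hK : ∀ s, ‖k s‖ ≤ K) (U : ℝ × EB b → ℂ) (hU : Integrable U) (t : ℝ) (y) :
    ‖Ured k U t y‖ ≤ K * ∫ z, ‖U z‖ := by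
  unfold Ured
  rw [← integral_const_mul]
  refine norm_integral_le_of_norm_le (hU.norm.const_mul K) (Eventually.of_forall fun z => ?_)
  rw [norm_mul, norm_ee, mul_one, norm_mul, mul_comm]
  exact mul_le_mul_of_nonneg_right (hK _) (norm_nonneg _)

theorem small_t (b : ℕ) (p : ℝ) (hp : 2 < p) (k : ℝ → ℂ) (hk : Measurable k) (K : ℝ) (hK : ∀ s, ‖k s‖ ≤ K) :
    ∃ C : ℝ, 0 < C ∧ ∀ δ, 0 < δ → δ ≤ 1/2 → ∀ U : ℝ × EB b → ℂ, Measurable U → MemLp U 2 volume → Supp δ U → ∀ t,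
    ∫⁻ y, ‖Ured k U t y‖ₑ^p ≤ ENNReal.ofReal ((C * √δ * (∫ z, ‖U z‖^2)^(1/2:ℝ))^p) := by
  have hK0 : 0 ≤ K := (norm_nonneg _).trans (hK 0)
  obtain ⟨C, hC, H⟩ := supp_L1 b
  set D := max (K * C) (K * √192) + 1 with hD
  have hD1 : K * C ≤ D := by rw [hD]; linarith [le_max_left (K * C) (K * √192)]
  have hD2 : K * √192 ≤ D := by rw [hD]; linarith [le_max_right (K * C) (K * √192)]
  have hDp : 0 < D := by
    have : 0 ≤ K * C := by positivity
    rw [hD]; linarith [le_max_left (K * C) (K * √192)]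
  refine ⟨D, hDp, ?_⟩
  intro δ h0 h1 U hUm hU2 hS t
  obtain ⟨hUI, hUb⟩ := H δ h0 h1 U hUm hU2 hS
  set N := (∫ z, ‖U z‖^2)^(1/2:ℝ) with hN
  have hN0 : 0 ≤ N := by positivity
  set m : EB b → ℂ := fun η => ∫ ρ, U (ρ, η) * k (t * ρ) with hm
  have hki := Ured_int k hk K hK U hUI t
  have hki' := hki
  rw [Measure.volume_eq_prod] at hki'
  have hmI : Integrable m := hki'.integral_prod_right
  have hmb : ∀ η, ‖m η‖ₑ ≤ ENNReal.ofReal K * ∫⁻ ρ, ‖U (ρ, η)‖ₑ := by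
    intro η
    refine (enorm_integral_le_lintegral_enorm _).trans ?_
    rw [← lintegral_const_mul _ (by fun_prop)]
    apply lintegral_mono; intro ρ
    simp only
    rw [enorm_mul, mul_comm, ← ofReal_norm (k _)]
    exact mul_le_mul' (ENNReal.ofReal_le_ofReal (hK _)) le_rfl
  have hm2b : ∫⁻ η, ‖m η‖ₑ^(2:ℝ) ≤ ENNReal.ofReal ((D * √δ * N)^(2:ℝ)) := by
    calc _ ≤ ∫⁻ η, ENNReal.ofReal K^(2:ℝ) * (∫⁻ ρ, ‖U (ρ, η)‖ₑ)^(2:ℝ) := by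
          apply lintegral_mono; intro η
          simp only
          rw [← ENNReal.mul_rpow_of_nonneg _ _ (by norm_num)]
          exact ENNReal.rpow_le_rpow (hmb η) (by norm_num)
      _ = ENNReal.ofReal K^(2:ℝ) * ∫⁻ η, (∫⁻ ρ, ‖U (ρ, η)‖ₑ)^(2:ℝ) := lintegral_const_mul _ (by fun_prop)
      _ ≤ ENNReal.ofReal K^(2:ℝ) * (ENNReal.ofReal (192 * δ) * ∫⁻ z, ‖U z‖ₑ^(2:ℝ)) := mul_le_mul' le_rfl (slice_sq h0 h1 U hUm hS)
      _ = ENNReal.ofReal ((K * √192 * √δ * N)^(2:ℝ)) := by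
          rw [l2_real U hU2, ENNReal.ofReal_rpow_of_nonneg hK0 (by norm_num), ← ENNReal.ofReal_mul (by positivity), ← ENNReal.ofReal_mul (by positivity)]
          congr 1
          rw [Real.mul_rpow (by positivity) hN0, Real.mul_rpow (by positivity) (by positivity), Real.mul_rpow (by positivity) (by positivity)]
          have e1 : (√192)^(2:ℝ) = 192 := by have := Real.sq_sqrt (by norm_num : (0:ℝ) ≤ 192); exact_mod_cast this
          have e2 : (√δ)^(2:ℝ) = δ := by have := Real.sq_sqrt h0.le; exact_mod_cast this
          rw [e1, e2]; ring
      _ ≤ _ := by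
          apply ENNReal.ofReal_le_ofReal
          apply Real.rpow_le_rpow (by positivity) _ (by norm_num)
          gcongr
  have e2 : ∀ h : EB b → ℂ, eLpNorm h 2 volume = (∫⁻ x, ‖h x‖ₑ^(2:ℝ))^(1/2:ℝ) := by
    intro h; rw [eLpNorm_eq_lintegral_rpow_enorm_toReal (by norm_num) (by norm_num)]; simp
  have hm2 : MemLp m 2 volume := by
    refine ⟨hmI.1, ?_⟩
    rw [e2]
    exact ENNReal.rpow_lt_top_of_nonneg (by norm_num) (lt_of_le_of_lt hm2b ENNReal.ofReal_lt_top).ne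
  obtain ⟨P1, P2⟩ := planch_inv_L1L2 m hmI hm2
  have hUr : ∀ y, Ured k U t y = 𝓕⁻ m y := by
    intro y
    rw [fourierInv_ee]
    unfold Ured
    have hi : Integrable (fun z : ℝ × EB b => U z * k (t * z.1) * ee ⟪y, z.2⟫) (volume.prod volume) :=
      hki'.mul_bdd (c := 1) (ee_cont.comp (by fun_prop)).aestronglyMeasurable (Eventually.of_forall fun w => (norm_ee _).le)
    rw [Measure.volume_eq_prod, integral_prod_symm _ hi]
    congr 1; ext η
    simp only [hm]
    rw [integral_mul_const, real_inner_comm]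
  have hP : ∫⁻ y, ‖Ured k U t y‖ₑ^(2:ℝ) ≤ ENNReal.ofReal ((D * √δ * N)^(2:ℝ)) := by
    refine le_trans (le_of_eq ?_) hm2b
    rw [e2, e2] at P2
    simp_rw [hUr]
    have := congrArg (fun x => x^(2:ℝ)) P2
    simp only [← ENNReal.rpow_mul] at this
    norm_num at this
    exact_mod_cast this
  have hsup : ∀ y, ‖Ured k U t y‖ₑ ≤ ENNReal.ofReal (D * √δ * N) := by
    intro y
    rw [← ofReal_norm]; apply ENNReal.ofReal_le_ofReal
    calc _ ≤ K * ∫ z, ‖U z‖ := Ured_le k K hK U hUI t y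
      _ ≤ K * (C * √δ * N) := by gcongr
      _ = (K * C) * √δ * N := by ring
      _ ≤ _ := by gcongr
  calc ∫⁻ y, ‖Ured k U t y‖ₑ^p ≤ ∫⁻ y, ENNReal.ofReal (D * √δ * N)^(p-2) * ‖Ured k U t y‖ₑ^(2:ℝ) := by
        apply lintegral_mono; intro y
        simp only
        calc _ = ‖Ured k U t y‖ₑ^(p-2) * ‖Ured k U t y‖ₑ^(2:ℝ) := by
              rw [← ENNReal.rpow_add_of_nonneg _ _ (by linarith) (by norm_num)]; congr 1; ring
          _ ≤ _ := mul_le_mul' (ENNReal.rpow_le_rpow (hsup y) (by linarith)) le_rfl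
    _ = ENNReal.ofReal (D * √δ * N)^(p-2) * ∫⁻ y, ‖Ured k U t y‖ₑ^(2:ℝ) := by
        rw [lintegral_const_mul'']
        simp_rw [hUr]
        exact P1.1.enorm.pow_const _
    _ ≤ ENNReal.ofReal (D * √δ * N)^(p-2) * ENNReal.ofReal ((D * √δ * N)^(2:ℝ)) := mul_le_mul' le_rfl hP
    _ = _ := by
        rw [ENNReal.ofReal_rpow_of_nonneg (by positivity) (by linarith), ← ENNReal.ofReal_mul (by positivity),
          ← Real.rpow_add_of_nonneg (by positivity) (by linarith) (by norm_num)]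
        congr 2; ring
end


open MeasureTheory Real Filter
open scoped ENNReal FourierTransform RealInnerProductSpace Topology

noncomputable section

/-- reflection in the first variable -/
def refl1 {b : ℕ} (σ : ℝ) (z : ℝ × EB b) : ℝ × EB b := (σ * z.1, z.2)

theorem refl1_meas {b : ℕ} (σ : ℝ) : Measurable (refl1 (b := b) σ) := by unfold refl1; fun_prop

theorem refl1_refl1 {b : ℕ} {σ : ℝ} (hσ : σ = 1 ∨ σ = -1) (z : ℝ × EB b) : refl1 σ (refl1 σ z) = z := by
  have : σ * (σ * z.1) = z.1 := by rcases hσ with h | h <;> rw [h] <;> ring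
  simp [refl1, this]

def reflE {b : ℕ} {σ : ℝ} (hσ : σ = 1 ∨ σ = -1) : (ℝ × EB b) ≃ᵐ (ℝ × EB b) where
  toFun := refl1 σ
  invFun := refl1 σ
  left_inv := refl1_refl1 hσ
  right_inv := refl1_refl1 hσ
  measurable_toFun := refl1_meas σ
  measurable_invFun := refl1_meas σ

theorem reflE_mp {b : ℕ} {σ : ℝ} (hσ : σ = 1 ∨ σ = -1) : MeasurePreserving (reflE (b := b) hσ) volume volume := by
  have h1 : MeasurePreserving (fun x : ℝ => σ * x) volume volume := by
    rcases hσ with h | h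
    · subst h; simp only [one_mul]; exact MeasurePreserving.id (volume : Measure ℝ)
    · subst h; simpa using Measure.measurePreserving_neg (volume : Measure ℝ)
  have := h1.prod (MeasurePreserving.id (volume : Measure (EB b)))
  exact this

/-- frequency function after contour shift -/
def FF {b : ℕ} (σ x : ℝ) (U : ℝ × EB b → ℂ) (z : ℝ × EB b) : ℂ := U (refl1 σ z) * ((Real.exp (-(2*π*(refl1 σ z).1*x)) : ℝ) : ℂ)

theorem FF_Vx {b : ℕ} {σ : ℝ} (hσ : σ = 1 ∨ σ = -1) (x : ℝ) (U : ℝ × EB b → ℂ) (t : ℝ) (y : EB b) :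
    Vx (FF σ x U) (t, y) = ∫ z, U z * ((Real.exp (-(2*π*z.1*x)) : ℝ) : ℂ) * ee (σ * (t * z.1)) * ee ⟪y, z.2⟫ := by
  unfold Vx
  rw [← (reflE_mp hσ).integral_comp (reflE hσ).measurableEmbedding]
  apply integral_congr_ae; refine Eventually.of_forall fun z => ?_
  change FF σ x U (refl1 σ z) * ee (pr (t, y) (refl1 σ z)) = _
  unfold FF
  beta_reduce
  rw [refl1_refl1 hσ, mul_assoc (_ * _) (ee _) (ee _), ← ee_add]
  congr 2
  simp only [pr, refl1]; ring

theorem FF_norm_le {b : ℕ} {σ : ℝ} {x : ℝ} (hx : 0 ≤ x) (U : ℝ × EB b → ℂ) (hS : ∀ z, U z ≠ 0 → 1/4 ≤ z.1) (z) :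
    ‖FF σ x U z‖ ≤ Real.exp (-(π/2*x)) * ‖U (refl1 σ z)‖ := by
  unfold FF
  by_cases h : U (refl1 σ z) = 0
  · simp [h]
  · have := hS _ h
    rw [norm_mul, mul_comm, Complex.norm_real, Real.norm_of_nonneg (Real.exp_pos _).le]
    refine mul_le_mul_of_nonneg_right (Real.exp_le_exp.mpr ?_) (norm_nonneg _)
    have := mul_le_mul_of_nonneg_right this (by positivity : 0 ≤ 2 * π * x)
    nlinarith

theorem ptA {b : ℕ} (κ : ℝ) (hκ : -1 < κ) (M : ℝ → ℂ) (hM : Measurable M) (A : ℝ) (hA : 0 ≤ A) (hMb : ∀ x, 0 < x → ‖M x‖ ≤ A * Wk κ x)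
    {σ : ℝ} (hσ : σ = 1 ∨ σ = -1) (U : ℝ × EB b → ℂ) (hUm : Measurable U) (hU : Integrable U) (hS : ∀ z, U z ≠ 0 → 1/4 ≤ z.1) (t : ℝ) (y : EB b) :
    Integrable (fun z : ℝ × EB b => U z * (∫ x in Set.Ioi (0:ℝ), ee (σ * (t * z.1)) * ((Real.exp (-(2*π*z.1*x)) : ℝ) : ℂ) * M x) * ee ⟪y, z.2⟫) ∧
    ‖∫ z, U z * (∫ x in Set.Ioi (0:ℝ), ee (σ * (t * z.1)) * ((Real.exp (-(2*π*z.1*x)) : ℝ) : ℂ) * M x) * ee ⟪y, z.2⟫‖ₑ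
      ≤ ENNReal.ofReal A * ∫⁻ x in Set.Ioi (0:ℝ), ENNReal.ofReal (Wk κ x) * ‖Vx (FF σ x U) (t, y)‖ₑ := by
  have hee := ee_meas
  set G : ℝ × EB b → ℝ → ℂ := fun z x => U z * (ee (σ * (t * z.1)) * ((Real.exp (-(2*π*z.1*x)) : ℝ) : ℂ) * M x) * ee ⟪y, z.2⟫ with hG
  have hGi : Integrable (Function.uncurry G) ((volume : Measure (ℝ × EB b)).prod (volume.restrict (Set.Ioi (0:ℝ)))) := by
    have hW : Integrable (fun x => A * (Real.exp (-(π/2)*x) * Wk κ x)) (volume.restrict (Set.Ioi (0:ℝ))) :=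
      (Wk_int κ (π/2) hκ (by positivity)).const_mul A
    refine (hU.norm.mul_prod hW).mono' ?_ ?_
    · apply Measurable.aestronglyMeasurable
      have e1 : Measurable fun q : (ℝ × EB b) × ℝ => ee (σ * (t * q.1.1)) := hee.comp (by fun_prop)
      have e2 : Measurable fun q : (ℝ × EB b) × ℝ => ee ⟪y, q.1.2⟫ := hee.comp (by fun_prop)
      have e3 : Measurable fun q : (ℝ × EB b) × ℝ => ((Real.exp (-(2*π*q.1.1*q.2)) : ℝ) : ℂ) := by fun_prop
      exact ((hUm.comp measurable_fst).mul ((e1.mul e3).mul (hM.comp measurable_snd))).mul e2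
    · have : ∀ᵐ q ∂((volume : Measure (ℝ × EB b)).prod (volume.restrict (Set.Ioi (0:ℝ)))), q.2 ∈ Set.Ioi (0:ℝ) :=
        Measure.quasiMeasurePreserving_snd.ae (ae_restrict_mem measurableSet_Ioi)
      filter_upwards [this] with q hq
      have hq : 0 < q.2 := hq
      simp only [Function.uncurry, hG, norm_mul, norm_ee, mul_one, one_mul, Complex.norm_real, Real.norm_of_nonneg (Real.exp_pos _).le]
      by_cases h : U q.1 = 0
      · simp [h]
      · have h1 := hS _ h
        refine mul_le_mul_of_nonneg_left ?_ (norm_nonneg _)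
        have h2 := mul_le_mul_of_nonneg_right h1 (by positivity : 0 ≤ 2 * π * q.2)
        calc Real.exp (-(2*π*q.1.1*q.2)) * ‖M q.2‖ ≤ Real.exp (-(π/2)*q.2) * (A * Wk κ q.2) := by
              refine mul_le_mul (Real.exp_le_exp.mpr ?_) (hMb _ hq) (norm_nonneg _) (Real.exp_pos _).le
              nlinarith
          _ = _ := by ring
  have e1 : ∀ z : ℝ × EB b, U z * (∫ x in Set.Ioi (0:ℝ), ee (σ * (t * z.1)) * ((Real.exp (-(2*π*z.1*x)) : ℝ) : ℂ) * M x) * ee ⟪y, z.2⟫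
      = ∫ x in Set.Ioi (0:ℝ), G z x := by
    intro z
    rw [← integral_const_mul, ← integral_mul_const]
  simp_rw [e1]
  refine ⟨hGi.integral_prod_left, ?_⟩
  rw [integral_integral_swap hGi]
  refine (enorm_integral_le_lintegral_enorm _).trans ?_
  rw [← lintegral_const_mul' _ _ ENNReal.ofReal_ne_top]
  apply setLIntegral_mono' measurableSet_Ioi
  intro x hx
  have e2 : ∫ z, G z x = M x * Vx (FF σ x U) (t, y) := by
    rw [FF_Vx hσ, ← integral_const_mul]
    apply integral_congr_ae; refine Eventually.of_forall fun z => ?_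
    simp only [hG]; ring
  rw [e2, enorm_mul, ← mul_assoc, ← ENNReal.ofReal_mul hA, ← ofReal_norm (M x)]
  exact mul_le_mul' (ENNReal.ofReal_le_ofReal (hMb _ hx)) le_rfl

theorem ptB {b : ℕ} (κ : ℝ) (hκ : -1 < κ) (m : ℝ → ℂ) (hm : Measurable m) (hmb : ∀ x, 0 < x → ‖m x‖ ≤ Wk κ x)
    {σ : ℝ} (hσ : σ = 1 ∨ σ = -1) (U : ℝ × EB b → ℂ) (hUm : Measurable U) (hU : Integrable U) (hS : ∀ z, U z ≠ 0 → 1/4 ≤ z.1) (t : ℝ) (ht : 1 ≤ t) (y : EB b) :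
    Integrable (fun z : ℝ × EB b => U z * (∫ x in Set.Ioi (0:ℝ), ee (σ * (t * z.1)) * ((Real.exp (-(2*π*(t*z.1))*x) : ℝ) : ℂ) * m x) * ee ⟪y, z.2⟫) ∧
    ‖∫ z, U z * (∫ x in Set.Ioi (0:ℝ), ee (σ * (t * z.1)) * ((Real.exp (-(2*π*(t*z.1))*x) : ℝ) : ℂ) * m x) * ee ⟪y, z.2⟫‖ₑ
      ≤ ENNReal.ofReal (t^(-1-κ)) * ∫⁻ x in Set.Ioi (0:ℝ), ENNReal.ofReal (Wk κ x) * ‖Vx (FF σ x U) (t, y)‖ₑ := by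
  have ht0 : 0 < t := by linarith
  have := ptA κ hκ (fun x => (t⁻¹:ℝ) * m (x/t)) (by fun_prop) (t^(-1-κ)) (by positivity) (by
    intro x hx
    rw [norm_mul, Complex.norm_real, Real.norm_of_nonneg (by positivity)]
    exact (mul_le_mul_of_nonneg_left (hmb _ (by positivity)) (by positivity)).trans (Wk_scale κ t x ht hx)) hσ U hUm hU hS t y
  suffices hEq : ∀ z : ℝ × EB b, U z * (∫ x in Set.Ioi (0:ℝ), ee (σ * (t * z.1)) * ((Real.exp (-(2*π*(t*z.1))*x) : ℝ) : ℂ) * m x) * ee ⟪y, z.2⟫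
      = U z * (∫ x in Set.Ioi (0:ℝ), ee (σ * (t * z.1)) * ((Real.exp (-(2*π*z.1*x)) : ℝ) : ℂ) * ((t⁻¹:ℝ) * m (x/t))) * ee ⟪y, z.2⟫ by
    simp_rw [hEq]; exact this
  intro z
  congr 2
  have h := integral_comp_mul_left_Ioi (fun x => ee (σ * (t * z.1)) * ((Real.exp (-(2*π*z.1*x)) : ℝ) : ℂ) * m (x/t)) 0 ht0
  rw [mul_zero, ← integral_smul] at h
  rw [show (∫ x in Set.Ioi (0:ℝ), ee (σ * (t * z.1)) * ((Real.exp (-(2*π*z.1*x)) : ℝ) : ℂ) * ((t⁻¹:ℝ) * m (x/t))) = ∫ x in Set.Ioi (0:ℝ), t⁻¹ • (ee (σ * (t * z.1)) * ((Real.exp (-(2*π*z.1*x)) : ℝ) : ℂ) * m (x/t)) from ?_, ← h]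
  · apply integral_congr_ae; refine Eventually.of_forall fun x => ?_
    simp only
    rw [mul_div_cancel_left₀ _ ht0.ne']
    congr 5; ring
  · apply integral_congr_ae; refine Eventually.of_forall fun x => ?_
    simp only [Complex.real_smul]; ring
end


open MeasureTheory Real Filter
open scoped ENNReal FourierTransform RealInnerProductSpace Topology

noncomputable section

theorem jensen_w {X : Type*} [MeasurableSpace X] (μ : Measure X) (p : ℝ) (hp : 1 < p) (w H : X → ℝ≥0∞) (hw : Measurable w) (hH : Measurable H) :
    (∫⁻ x, w x * H x ∂μ)^p ≤ (∫⁻ x, w x ∂μ)^(p-1) * ∫⁻ x, w x * (H x)^p ∂μ := by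
  have hp0 : 0 < p := by linarith
  set q := p / (p - 1) with hq
  have hpq : q.HolderConjugate p := (Real.HolderConjugate.conjExponent hp).symm
  have hq0 : 0 < q := hpq.pos
  have h := ENNReal.lintegral_mul_le_Lp_mul_Lq μ hpq (f := fun x => (w x)^(1/q)) (g := fun x => (w x)^(1/p) * H x) (by fun_prop) (by fun_prop)
  have e0 : 1/q + 1/p = 1 := by simpa using hpq.inv_add_inv_eq_one
  have e1 : ∀ x, ((fun x => (w x)^(1/q)) * (fun x => (w x)^(1/p) * H x)) x = w x * H x := by
    intro x
    simp only [Pi.mul_apply]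
    rw [← mul_assoc, ← ENNReal.rpow_add_of_nonneg _ _ (by positivity) (by positivity), e0, ENNReal.rpow_one]
  simp_rw [e1] at h
  have e2 : ∀ x, ((w x)^(1/q))^q = w x := by
    intro x; rw [← ENNReal.rpow_mul, one_div_mul_cancel hq0.ne', ENNReal.rpow_one]
  have e3 : ∀ x, ((w x)^(1/p) * H x)^p = w x * (H x)^p := by
    intro x; rw [ENNReal.mul_rpow_of_nonneg _ _ hp0.le, ← ENNReal.rpow_mul, one_div_mul_cancel hp0.ne', ENNReal.rpow_one]
  simp_rw [e2, e3] at h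
  refine (ENNReal.rpow_le_rpow h hp0.le).trans (le_of_eq ?_)
  rw [ENNReal.mul_rpow_of_nonneg _ _ hp0.le, ← ENNReal.rpow_mul, ← ENNReal.rpow_mul, one_div_mul_cancel hp0.ne', ENNReal.rpow_one]
  congr 2
  have : p - 1 ≠ 0 := by linarith
  rw [hq]; field_simp

theorem wt_refl {b : ℕ} (δ : ℝ) {σ : ℝ} (hσ : σ = 1 ∨ σ = -1) (z : ℝ × EB b) : wt δ (refl1 σ z) = wt δ z := by
  have : (σ * z.1)^2 = z.1^2 := by rcases hσ with h | h <;> rw [h] <;> ring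
  simp [wt, refl1, this]

theorem FF_meas2 {b : ℕ} (σ : ℝ) (U : ℝ × EB b → ℂ) (hUm : Measurable U) : Measurable fun q : ℝ × (ℝ × EB b) => FF σ q.1 U q.2 := by
  have h1 : Measurable fun q : ℝ × (ℝ × EB b) => refl1 σ q.2 := (refl1_meas σ).comp measurable_snd
  have h2 : Measurable fun q : ℝ × (ℝ × EB b) => (refl1 σ q.2).1 := measurable_fst.comp h1
  unfold FF
  exact (hUm.comp h1).mul (by fun_prop)

theorem FF_props {b : ℕ} {σ : ℝ} (hσ : σ = 1 ∨ σ = -1) (x : ℝ) (hx : 0 ≤ x) (U : ℝ × EB b → ℂ) (hUm : Measurable U) (hU : Integrable U) (hU2 : MemLp U 2 volume)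
    {δ : ℝ} (hS : Supp δ U) : Integrable (FF σ x U) ∧ MemLp (FF σ x U) 2 volume ∧ (∀ z, FF σ x U z ≠ 0 → 1/16 ≤ wt δ z) ∧
      (∫ z, ‖FF σ x U z‖^2)^(1/2:ℝ) ≤ Real.exp (-(π/2*x)) * (∫ z, ‖U z‖^2)^(1/2:ℝ) := by
  have hm : Measurable (FF σ x U) := (FF_meas2 σ U hUm).comp (by fun_prop : Measurable fun z : ℝ × EB b => (x, z))
  have hle := FF_norm_le (σ := σ) hx U (fun z hz => (hS z hz).1)
  have hUr : Integrable (U ∘ reflE hσ) := (reflE_mp hσ).integrable_comp_emb (reflE hσ).measurableEmbedding |>.mpr hU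
  have hUr2 : MemLp (U ∘ reflE hσ) 2 volume := hU2.comp_measurePreserving (reflE_mp hσ)
  have i1 : Integrable (fun z => ‖U z‖^2) := by simpa using hU2.integrable_norm_pow (by norm_num)
  have i2 : Integrable (fun z => ‖(U ∘ reflE hσ) z‖^2) := by simpa using hUr2.integrable_norm_pow (by norm_num)
  refine ⟨?_, ?_, ?_, ?_⟩
  · exact (hUr.norm.const_mul (Real.exp (-(π/2*x)))).mono' hm.aestronglyMeasurable (Eventually.of_forall hle)
  · refine (hUr2.norm.const_mul (Real.exp (-(π/2*x)))).mono' hm.aestronglyMeasurable (Eventually.of_forall hle)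
  · intro z hz
    have h0 : U (refl1 σ z) ≠ 0 := by intro h; apply hz; simp [FF, h]
    rw [← wt_refl δ hσ]
    exact Supp_wt hS _ h0
  · have h1 : ∫ z, ‖FF σ x U z‖^2 ≤ ∫ z, (Real.exp (-(π/2*x)))^2 * ‖(U ∘ reflE hσ) z‖^2 := by
      refine integral_mono_of_nonneg (Eventually.of_forall fun z => by positivity) (i2.const_mul _) (Eventually.of_forall fun z => ?_)
      have := pow_le_pow_left₀ (norm_nonneg _) (hle z) 2
      rw [mul_pow] at this; exact this
    rw [integral_const_mul] at h1
    have h2 : ∫ z, ‖(U ∘ reflE hσ) z‖^2 = ∫ z, ‖U z‖^2 := 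
      (reflE_mp hσ).integral_comp (reflE hσ).measurableEmbedding (fun z => ‖U z‖^2)
    rw [h2] at h1
    refine (Real.rpow_le_rpow (integral_nonneg fun z => by positivity) h1 (by norm_num)).trans (le_of_eq ?_)
    rw [Real.mul_rpow (by positivity) (integral_nonneg fun z => by positivity), ← Real.sqrt_eq_rpow, Real.sqrt_sq (Real.exp_pos _).le]

theorem FF_Vx_meas {b : ℕ} (σ : ℝ) (U : ℝ × EB b → ℂ) (hUm : Measurable U) :
    Measurable fun q : (ℝ × EB b) × ℝ => Vx (FF σ q.2 U) q.1 := by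
  unfold Vx
  have hpr : Measurable fun q : ((ℝ × EB b) × ℝ) × (ℝ × EB b) => ee (pr q.1.1 q.2) := by
    apply ee_meas.comp
    unfold pr
    fun_prop
  have hf : Measurable fun q : ((ℝ × EB b) × ℝ) × (ℝ × EB b) => FF σ q.1.2 U q.2 * ee (pr q.1.1 q.2) :=
    ((FF_meas2 σ U hUm).comp (by fun_prop : Measurable fun q : ((ℝ × EB b) × ℝ) × (ℝ × EB b) => (q.1.2, q.2))).mul hpr
  exact (hf.stronglyMeasurable.integral_prod_right' (ν := volume)).measurable

set_option maxHeartbeats 1000000 in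
theorem large_side (b : ℕ) (hb : 1 ≤ b) (p ν : ℝ) (n : ℕ) (hn : 1 ≤ n) (hp : 2 < p) (hν : ν = n * (1/2 - 1/p)) (hs : 2*ν + b*(1/2-1/p) = 2/p)
    {σ : ℝ} (hσ : σ = 1 ∨ σ = -1) : ∃ C : ℝ, 0 < C ∧ ∀ δ, 0 < δ → δ ≤ 1/2 → ∀ U : ℝ × EB b → ℂ, Measurable U → MemLp U 2 volume → Supp δ U →
    ∫⁻ w in {w : ℝ × EB b | 1 ≤ w.1}, ENNReal.ofReal (w.1^n) * (ENNReal.ofReal (w.1^(-1-((n:ℝ)-2)/2)) *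
      ∫⁻ x in Set.Ioi (0:ℝ), ENNReal.ofReal (Wk (((n:ℝ)-2)/2) x) * ‖Vx (FF σ x U) w‖ₑ)^p ≤ ENNReal.ofReal ((C * √δ * (∫ z, ‖U z‖^2)^(1/2:ℝ))^p) := by
  have hp0 : 0 < p := by linarith
  have hn' : (1:ℝ) ≤ n := by exact_mod_cast hn
  have hν0 : 0 ≤ ν := by
    rw [hν]
    have : 1/p ≤ 1/2 := one_div_le_one_div_of_le (by norm_num) hp.le
    have : 0 ≤ 1/2 - 1/p := by linarith
    positivity
  obtain ⟨C, hC, H⟩ := SSL b hb p ν hp hν0 hs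
  obtain ⟨C1, hC1, H1⟩ := supp_L1 b
  set κ := ((n:ℝ)-2)/2 with hκd
  have hκ : -1 < κ := by rw [hκd]; linarith
  set W : ℝ → ℝ≥0∞ := fun x => ENNReal.ofReal (Real.exp (-(π/2)*x) * Wk κ x) with hW
  have hWm : Measurable W := by
    have := Wk_meas κ
    simp only [hW]; fun_prop
  set J := ∫⁻ x in Set.Ioi (0:ℝ), W x with hJ
  have hJf : J ≠ ⊤ := by
    have hi := Wk_int κ (π/2) hκ (by positivity)
    have := hi.lintegral_lt_top
    exact this.ne
  refine ⟨C * (J.toReal + 1), by positivity, ?_⟩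
  intro δ h0 h1 U hUm hU2 hS
  obtain ⟨hUI, -⟩ := H1 δ h0 h1 U hUm hU2 hS
  set N := (∫ z, ‖U z‖^2)^(1/2:ℝ) with hN
  have hN0 : 0 ≤ N := by positivity
  have hVm := FF_Vx_meas σ U hUm
  set E : ℝ → ℝ≥0∞ := fun x => ENNReal.ofReal (Real.exp (π/2*x)) with hE
  have hEm : Measurable E := by simp only [hE]; fun_prop
  have hms : MeasurableSet {w : ℝ × EB b | 1 ≤ w.1} := measurableSet_le measurable_const measurable_fst
  -- pointwise bound
  have step1 : ∀ w ∈ {w : ℝ × EB b | 1 ≤ w.1}, ENNReal.ofReal (w.1^n) * (ENNReal.ofReal (w.1^(-1-κ)) *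
      ∫⁻ x in Set.Ioi (0:ℝ), ENNReal.ofReal (Wk κ x) * ‖Vx (FF σ x U) w‖ₑ)^p ≤
      J^(p-1) * ∫⁻ x in Set.Ioi (0:ℝ), W x * (E x)^p * ENNReal.ofReal ((w.1^(-ν) * ‖Vx (FF σ x U) w‖)^p) := by
    intro w hw
    have hw : 1 ≤ w.1 := hw
    have hw0 : 0 < w.1 := by linarith
    have hV1 : Measurable fun x : ℝ => Vx (FF σ x U) w := hVm.comp (by fun_prop : Measurable fun x : ℝ => (w, x))
    have a1 : ∫⁻ x in Set.Ioi (0:ℝ), ENNReal.ofReal (Wk κ x) * ‖Vx (FF σ x U) w‖ₑ = ∫⁻ x in Set.Ioi (0:ℝ), W x * (E x * ‖Vx (FF σ x U) w‖ₑ) := by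
      apply setLIntegral_congr_fun measurableSet_Ioi
      intro x hx
      simp only [hW, hE]
      rw [← mul_assoc, ← ENNReal.ofReal_mul (mul_nonneg (Real.exp_pos _).le (Wk_nonneg κ x hx))]
      congr 2
      rw [mul_assoc, mul_comm (Wk κ x), ← mul_assoc, ← Real.exp_add]; simp
    rw [a1, ENNReal.mul_rpow_of_nonneg _ _ hp0.le]
    have a2 := jensen_w (volume.restrict (Set.Ioi (0:ℝ))) p (by linarith) W (fun x => E x * ‖Vx (FF σ x U) w‖ₑ) hWm (by fun_prop)
    calc _ ≤ ENNReal.ofReal (w.1^n) * (ENNReal.ofReal (w.1^(-1-κ))^p * (J^(p-1) * ∫⁻ x in Set.Ioi (0:ℝ), W x * (E x * ‖Vx (FF σ x U) w‖ₑ)^p)) :=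
          mul_le_mul' le_rfl (mul_le_mul' le_rfl a2)
      _ = J^(p-1) * (ENNReal.ofReal (w.1^n) * ENNReal.ofReal (w.1^(-1-κ))^p * ∫⁻ x in Set.Ioi (0:ℝ), W x * (E x * ‖Vx (FF σ x U) w‖ₑ)^p) := by ring
      _ = _ := by
        congr 1
        rw [← lintegral_const_mul _ (by fun_prop)]
        apply lintegral_congr; intro x
        rw [ENNReal.mul_rpow_of_nonneg _ _ hp0.le, Real.mul_rpow (by positivity) (norm_nonneg _), ENNReal.ofReal_mul (by positivity),
          ← ENNReal.ofReal_rpow_of_nonneg (norm_nonneg _) hp0.le, ofReal_norm, ENNReal.ofReal_rpow_of_nonneg (by positivity) hp0.le,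
          ← ENNReal.ofReal_mul (by positivity)]
        have : w.1^n * (w.1^(-1-κ))^p = (w.1^(-ν))^p := by
          rw [← Real.rpow_natCast, ← Real.rpow_mul hw0.le, ← Real.rpow_mul hw0.le, ← Real.rpow_add hw0]
          congr 1
          rw [hν, hκd]; field_simp; ring
        rw [this]; ring
  refine (setLIntegral_mono' hms step1).trans ?_
  rw [lintegral_const_mul' _ _ (ENNReal.rpow_ne_top_of_nonneg (by linarith) hJf), lintegral_lintegral_swap]
  swap
  · apply Measurable.aemeasurable
    unfold Function.uncurry
    have : Measurable fun q : (ℝ × EB b) × ℝ => ENNReal.ofReal ((q.1.1^(-ν) * ‖Vx (FF σ q.2 U) q.1‖)^p) := by fun_prop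
    exact (((hWm.comp measurable_snd).mul ((hEm.comp measurable_snd).pow_const p))).mul this
  have step2 : ∀ x ∈ Set.Ioi (0:ℝ), ∫⁻ w in {w : ℝ × EB b | 1 ≤ w.1}, W x * (E x)^p * ENNReal.ofReal ((w.1^(-ν) * ‖Vx (FF σ x U) w‖)^p) ≤ W x * ENNReal.ofReal ((C * √δ * N)^p) := by
    intro x hx
    have hx : 0 < x := hx
    have hV2 : Measurable fun w : ℝ × EB b => Vx (FF σ x U) w := hVm.comp (by fun_prop : Measurable fun w : ℝ × EB b => (w, x))
    obtain ⟨f1, f2, f3, f4⟩ := FF_props hσ x hx.le U hUm hUI hU2 hS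
    rw [lintegral_const_mul _ (by fun_prop), mul_assoc]
    refine mul_le_mul' le_rfl ?_
    calc _ ≤ (E x)^p * ENNReal.ofReal ((C * √δ * (∫ z, ‖FF σ x U z‖^2)^(1/2:ℝ))^p) := by
          refine mul_le_mul' le_rfl (le_trans (lintegral_mono_set ?_) (H δ h0 h1 _ f1 f2 f3))
          intro w hw
          have hw : 1 ≤ w.1 := hw
          exact lt_of_lt_of_le one_pos hw
      _ ≤ (E x)^p * ENNReal.ofReal ((C * √δ * (Real.exp (-(π/2*x)) * N))^p) := by
          gcongr
      _ = _ := by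
          simp only [hE]
          rw [ENNReal.ofReal_rpow_of_nonneg (Real.exp_pos _).le hp0.le, ← ENNReal.ofReal_mul (by positivity), ← Real.mul_rpow (Real.exp_pos _).le (by positivity)]
          congr 2
          have : Real.exp (π/2*x) * Real.exp (-(π/2*x)) = 1 := by rw [← Real.exp_add]; simp
          linear_combination C * √δ * N * this
  refine (mul_le_mul' le_rfl (setLIntegral_mono' measurableSet_Ioi step2)).trans ?_
  rw [lintegral_mul_const _ hWm, ← hJ, ← mul_assoc]
  have hJp : J^(p-1) * J = J^p := by
    nth_rewrite 2 [← ENNReal.rpow_one J]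
    rw [← ENNReal.rpow_add_of_nonneg _ _ (by linarith) (by norm_num)]; congr 1; ring
  rw [hJp, ← ENNReal.ofReal_toReal hJf, ENNReal.ofReal_rpow_of_nonneg (by positivity) hp0.le, ← ENNReal.ofReal_mul (by positivity),
    ← Real.mul_rpow (by positivity) (by positivity)]
  apply ENNReal.ofReal_le_ofReal
  apply Real.rpow_le_rpow (by positivity) _ hp0.le
  rw [ENNReal.toReal_ofReal (by positivity)]
  have : 0 ≤ C * √δ * N := by positivity
  nlinarith
end


open MeasureTheory Real Filter
open scoped ENNReal FourierTransform RealInnerProductSpace Topology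

noncomputable section

theorem comb_pow (p K C1 C2 : ℝ) (hp : 0 < p) (hK : 0 < K) (h1 : 0 < C1) (h2 : 0 < C2) : ∃ C : ℝ, 0 < C ∧ ∀ X : ℝ, 0 ≤ X →
    ENNReal.ofReal K * (ENNReal.ofReal ((C1 * X)^p) + ENNReal.ofReal ((C2 * X)^p)) ≤ ENNReal.ofReal ((C * X)^p) := by
  refine ⟨(K * (C1^p + C2^p))^(1/p), by positivity, fun X hX => ?_⟩
  rw [← ENNReal.ofReal_add (by positivity) (by positivity), ← ENNReal.ofReal_mul hK.le]
  apply ENNReal.ofReal_le_ofReal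
  rw [Real.mul_rpow (by positivity) hX, Real.mul_rpow (by positivity) hX, Real.mul_rpow (by positivity) hX, ← Real.rpow_mul (by positivity), one_div_mul_cancel hp.ne', Real.rpow_one]
  apply le_of_eq; ring

def kA : ℕ → ℝ → ℂ
  | 0, s => ee s + ee (-s)
  | (n+1), s => Iosc ((((n+1:ℕ):ℝ)-2)/2) (2*π*s)

theorem kA_succ (n : ℕ) (s : ℝ) : kA (n+1) s = Iosc ((((n+1:ℕ):ℝ)-2)/2) (2*π*s) := rfl

theorem kA_meas (n : ℕ) : Measurable (kA n) := by
  cases n with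
  | zero =>
    have := ee_meas
    exact (this.comp (by fun_prop : Measurable fun s : ℝ => s)).add (this.comp measurable_neg)
  | succ n =>
    unfold kA
    simp_rw [Iosc_eq_Ioo]
    have hf : Measurable fun q : ℝ × ℝ => Complex.exp (Complex.I * ((2*π*q.1 : ℝ):ℂ) * q.2) * (((1 - q.2^2) ^ ((((n+1:ℕ):ℝ)-2)/2) : ℝ) : ℂ) := by fun_prop
    exact (hf.stronglyMeasurable.integral_prod_right' (ν := volume.restrict (Set.Ioo (-1:ℝ) 1))).measurable

theorem kA_bdd (n : ℕ) : ∃ K : ℝ, ∀ s, ‖kA n s‖ ≤ K := by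
  cases n with
  | zero =>
    refine ⟨2, fun s => ?_⟩
    refine (norm_add_le _ _).trans ?_
    rw [norm_ee, norm_ee]; norm_num
  | succ n =>
    refine ⟨∫ y in Set.Ioo (-1:ℝ) 1, (1 - y^2) ^ ((((n+1:ℕ):ℝ)-2)/2), fun s => ?_⟩
    rw [kA_succ, Iosc_eq_Ioo]
    have hi := one_sub_sq_int ((((n+1:ℕ):ℝ)-2)/2) (by push_cast; have : (0:ℝ) ≤ n := n.cast_nonneg; linarith)
    rw [intervalIntegrable_iff_integrableOn_Ioo_of_le (by norm_num)] at hi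
    refine norm_integral_le_of_norm_le hi ?_
    filter_upwards [ae_restrict_mem measurableSet_Ioo] with y hy
    have h0 : 0 ≤ 1 - y^2 := by nlinarith [hy.1, hy.2]
    rw [norm_mul, Complex.norm_real, Real.norm_of_nonneg (Real.rpow_nonneg h0 _), show Complex.I * ((2*π*s : ℝ):ℂ) * y = ((2*π*s*y : ℝ):ℂ) * Complex.I by push_cast; ring,
      Complex.norm_exp_ofReal_mul_I, one_mul]

set_option maxHeartbeats 1000000 in
theorem large_t0 (b : ℕ) (hb : 1 ≤ b) (p : ℝ) (hp : 2 < p) (hs : b*(1/2-1/p) = 2/p) :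
    ∃ C : ℝ, 0 < C ∧ ∀ δ, 0 < δ → δ ≤ 1/2 → ∀ U : ℝ × EB b → ℂ, Measurable U → MemLp U 2 volume → Supp δ U →
    ∫⁻ w in {w : ℝ × EB b | 1 ≤ w.1}, ENNReal.ofReal (w.1^0) * ‖Ured (kA 0) U w.1 w.2‖ₑ^p ≤ ENNReal.ofReal ((C * √δ * (∫ z, ‖U z‖^2)^(1/2:ℝ))^p) := by
  have hp0 : 0 < p := by linarith
  obtain ⟨C, hC, H⟩ := SSL b hb p 0 hp le_rfl (by linarith)
  obtain ⟨C1, hC1, H1⟩ := supp_L1 b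
  obtain ⟨D, hD, HD⟩ := comb_pow p (2^(p-1)) C C hp0 (by positivity) hC hC
  refine ⟨D, hD, fun δ h0 h1 U hUm hU2 hS => ?_⟩
  obtain ⟨hUI, -⟩ := H1 δ h0 h1 U hUm hU2 hS
  have hside : ∀ σ : ℝ, (σ = 1 ∨ σ = -1) → Integrable (FF σ 0 U) ∧ ∫⁻ w in {w : ℝ × EB b | 1 ≤ w.1}, ‖Vx (FF σ 0 U) w‖ₑ^p ≤ ENNReal.ofReal ((C * (√δ * (∫ z, ‖U z‖^2)^(1/2:ℝ)))^p) := by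
    intro σ hσ
    obtain ⟨f1, f2, f3, f4⟩ := FF_props hσ 0 le_rfl U hUm hUI hU2 hS
    refine ⟨f1, ?_⟩
    have h := H δ h0 h1 _ f1 f2 f3
    calc _ ≤ ∫⁻ w in {w : ℝ × EB b | 0 < w.1}, ‖Vx (FF σ 0 U) w‖ₑ^p := by
          apply lintegral_mono_set
          intro w hw
          have hw : 1 ≤ w.1 := hw
          exact lt_of_lt_of_le one_pos hw
      _ = ∫⁻ w in {w : ℝ × EB b | 0 < w.1}, ENNReal.ofReal ((w.1^(-0:ℝ) * ‖Vx (FF σ 0 U) w‖)^p) := by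
          apply lintegral_congr; intro w
          rw [neg_zero, Real.rpow_zero, one_mul, ← ENNReal.ofReal_rpow_of_nonneg (norm_nonneg _) hp0.le, ofReal_norm]
      _ ≤ _ := h.trans (by
          apply ENNReal.ofReal_le_ofReal
          apply Real.rpow_le_rpow (by positivity) _ hp0.le
          rw [mul_zero, neg_zero, Real.exp_zero, one_mul] at f4
          rw [← mul_assoc]
          exact mul_le_mul_of_nonneg_left f4 (by positivity))
  obtain ⟨i1, b1⟩ := hside 1 (Or.inl rfl)
  obtain ⟨i2, b2⟩ := hside (-1) (Or.inr rfl)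
  have hpt : ∀ w : ℝ × EB b, Ured (kA 0) U w.1 w.2 = Vx (FF 1 0 U) w + Vx (FF (-1) 0 U) w := by
    intro w
    have j : ∀ σ : ℝ, Integrable fun z : ℝ × EB b => U z * ((Real.exp (-(2*π*z.1*0)) : ℝ) : ℂ) * ee (σ * (w.1 * z.1)) * ee ⟪w.2, z.2⟫ := by
      intro σ
      simp only [mul_zero, neg_zero, Real.exp_zero, Complex.ofReal_one, mul_one]
      refine (hUI.mul_bdd (c := 1) (ee_meas.comp (by fun_prop)).aestronglyMeasurable (Eventually.of_forall fun z => (norm_ee _).le)).mul_bdd (c := 1) (ee_meas.comp (by fun_prop)).aestronglyMeasurable (Eventually.of_forall fun z => (norm_ee _).le)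
    rw [show w = (w.1, w.2) from rfl, FF_Vx (Or.inl rfl), FF_Vx (Or.inr rfl), ← integral_add (j 1) (j (-1))]
    unfold Ured
    apply integral_congr_ae; refine Eventually.of_forall fun z => ?_
    simp [kA]; ring
  have hVm : Measurable fun w => Vx (FF 1 0 U) w := (Vx_cont _ i1).measurable
  calc _ ≤ ∫⁻ w in {w : ℝ × EB b | 1 ≤ w.1}, ENNReal.ofReal (2^(p-1)) * (‖Vx (FF 1 0 U) w‖ₑ^p + ‖Vx (FF (-1) 0 U) w‖ₑ^p) := by
        apply lintegral_mono; intro w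
        simp only
        rw [pow_zero, ENNReal.ofReal_one, one_mul, hpt, ← ENNReal.ofReal_rpow_of_pos (by norm_num)]
        refine (ENNReal.rpow_le_rpow (enorm_add_le _ _) hp0.le).trans ?_
        have := ENNReal.rpow_add_le_mul_rpow_add_rpow ‖Vx (FF 1 0 U) w‖ₑ ‖Vx (FF (-1) 0 U) w‖ₑ (by linarith : 1 ≤ p)
        simpa using this
    _ = ENNReal.ofReal (2^(p-1)) * ((∫⁻ w in {w : ℝ × EB b | 1 ≤ w.1}, ‖Vx (FF 1 0 U) w‖ₑ^p) + ∫⁻ w in {w : ℝ × EB b | 1 ≤ w.1}, ‖Vx (FF (-1) 0 U) w‖ₑ^p) := by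
        rw [lintegral_const_mul' _ _ ENNReal.ofReal_ne_top, lintegral_add_left (by fun_prop)]
    _ ≤ _ := by
        rw [mul_assoc D]
        exact (mul_le_mul' le_rfl (add_le_add b1 b2)).trans (HD _ (by positivity))

set_option maxHeartbeats 1000000 in
theorem large_t1 (b : ℕ) (hb : 1 ≤ b) (p : ℝ) (n : ℕ) (hp : 2 < p) (hs : 2*((n+1:ℕ) * (1/2 - 1/p)) + b*(1/2-1/p) = 2/p) :
    ∃ C : ℝ, 0 < C ∧ ∀ δ, 0 < δ → δ ≤ 1/2 → ∀ U : ℝ × EB b → ℂ, Measurable U → MemLp U 2 volume → Supp δ U →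
    ∫⁻ w in {w : ℝ × EB b | 1 ≤ w.1}, ENNReal.ofReal (w.1^(n+1)) * ‖Ured (kA (n+1)) U w.1 w.2‖ₑ^p ≤ ENNReal.ofReal ((C * √δ * (∫ z, ‖U z‖^2)^(1/2:ℝ))^p) := by
  have hp0 : 0 < p := by linarith
  obtain ⟨C1, hC1, H1⟩ := supp_L1 b
  obtain ⟨Ca, hCa, Ha⟩ := large_side b hb p _ (n+1) (by omega) hp rfl hs (σ := 1) (Or.inl rfl)
  obtain ⟨Cb, hCb, Hb⟩ := large_side b hb p _ (n+1) (by omega) hp rfl hs (σ := -1) (Or.inr rfl)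
  obtain ⟨D, hD, HD⟩ := comb_pow p (2^(p-1)) Ca Cb hp0 (by positivity) hCa hCb
  refine ⟨D, hD, fun δ h0 h1 U hUm hU2 hS => ?_⟩
  obtain ⟨hUI, -⟩ := H1 δ h0 h1 U hUm hU2 hS
  have b1 := Ha δ h0 h1 U hUm hU2 hS
  have b2 := Hb δ h0 h1 U hUm hU2 hS
  set κ := (((n+1:ℕ):ℝ)-2)/2 with hκd
  have hκ : -1 < κ := by rw [hκd]; push_cast; have : (0:ℝ) ≤ n := n.cast_nonneg; linarith
  set A : ℝ → ℝ × EB b → ℝ≥0∞ := fun σ w => ENNReal.ofReal (w.1^(-1-κ)) * ∫⁻ x in Set.Ioi (0:ℝ), ENNReal.ofReal (Wk κ x) * ‖Vx (FF σ x U) w‖ₑ with hA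
  have hS1 : ∀ z, U z ≠ 0 → 1/4 ≤ z.1 := fun z hz => (hS z hz).1
  have hpt : ∀ w : ℝ × EB b, 1 ≤ w.1 → ‖Ured (kA (n+1)) U w.1 w.2‖ₑ ≤ A 1 w + A (-1) w := by
    intro w hw
    obtain ⟨i1, c1⟩ := ptB κ hκ (mR κ) (mR_meas κ) (fun x hx => norm_mR κ x hx) (σ := 1) (Or.inl rfl) U hUm hUI hS1 w.1 hw w.2
    obtain ⟨i2, c2⟩ := ptB κ hκ (mL κ) (mL_meas κ) (fun x hx => norm_mL κ x hx) (σ := -1) (Or.inr rfl) U hUm hUI hS1 w.1 hw w.2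
    have : Ured (kA (n+1)) U w.1 w.2 = _ := (?_ : _ = _).trans (integral_add i1 i2)
    · rw [this]
      exact (enorm_add_le _ _).trans (add_le_add c1 c2)
    · unfold Ured
      apply integral_congr_ae; refine Eventually.of_forall fun z => ?_
      simp only
      by_cases hz : U z = 0
      · simp [hz]
      have hz1 := hS1 z hz
      have hpos : 0 < 2*π*(w.1*z.1) := by
        have : 0 < z.1 := by linarith
        have : 0 < w.1 := by linarith
        positivity
      rw [← add_mul, ← mul_add]
      congr 2
      rw [kA_succ, ← hκd, Iosc_repr κ _ hκ hpos, add_comm]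
      congr 1
      · apply integral_congr_ae; refine Eventually.of_forall fun x => ?_
        simp only [ee]
        congr 3; push_cast; ring
      · apply integral_congr_ae; refine Eventually.of_forall fun x => ?_
        simp only [ee]
        congr 3; push_cast; ring
  have hAm : Measurable fun w : ℝ × EB b => A 1 w := by
    have h1 := FF_Vx_meas 1 U hUm
    have h2 : Measurable fun q : (ℝ × EB b) × ℝ => ENNReal.ofReal (Wk κ q.2) * ‖Vx (FF 1 q.2 U) q.1‖ₑ :=
      (((Wk_meas κ).comp measurable_snd).ennreal_ofReal).mul h1.enorm
    have h3 := h2.lintegral_prod_right' (ν := volume.restrict (Set.Ioi (0:ℝ)))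
    simp only [hA]
    exact Measurable.mul (by fun_prop) h3
  have hms : MeasurableSet {w : ℝ × EB b | 1 ≤ w.1} := measurableSet_le measurable_const measurable_fst
  calc _ ≤ ∫⁻ w in {w : ℝ × EB b | 1 ≤ w.1}, ENNReal.ofReal (2^(p-1)) * (ENNReal.ofReal (w.1^(n+1)) * (A 1 w)^p + ENNReal.ofReal (w.1^(n+1)) * (A (-1) w)^p) := by
        apply setLIntegral_mono' hms; intro w hw
        rw [← mul_add, mul_left_comm]
        refine mul_le_mul' le_rfl ?_
        rw [← ENNReal.ofReal_rpow_of_pos (by norm_num)]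
        refine (ENNReal.rpow_le_rpow (hpt w hw) hp0.le).trans ?_
        have := ENNReal.rpow_add_le_mul_rpow_add_rpow (A 1 w) (A (-1) w) (by linarith : 1 ≤ p)
        simpa using this
    _ = ENNReal.ofReal (2^(p-1)) * ((∫⁻ w in {w : ℝ × EB b | 1 ≤ w.1}, ENNReal.ofReal (w.1^(n+1)) * (A 1 w)^p) + ∫⁻ w in {w : ℝ × EB b | 1 ≤ w.1}, ENNReal.ofReal (w.1^(n+1)) * (A (-1) w)^p) := by
        rw [lintegral_const_mul' _ _ ENNReal.ofReal_ne_top, lintegral_add_left (by fun_prop)]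
    _ ≤ _ := by
        rw [mul_assoc D]
        rw [mul_assoc] at b1 b2
        exact (mul_le_mul' le_rfl (add_le_add b1 b2)).trans (HD _ (by positivity))

theorem Ured_meas {b : ℕ} (n : ℕ) (U : ℝ × EB b → ℂ) (hUm : Measurable U) : Measurable fun w : ℝ × EB b => Ured (kA n) U w.1 w.2 := by
  unfold Ured
  have hf : Measurable fun q : (ℝ × EB b) × (ℝ × EB b) => U q.2 * kA n (q.1.1 * q.2.1) * ee ⟪q.1.2, q.2.2⟫ :=
    ((hUm.comp measurable_snd).mul ((kA_meas n).comp (by fun_prop))).mul (ee_meas.comp (by fun_prop))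
  exact (hf.stronglyMeasurable.integral_prod_right' (ν := volume)).measurable

set_option maxHeartbeats 1000000 in
theorem red_bound (b : ℕ) (hb : 1 ≤ b) (p : ℝ) (n : ℕ) (hp : 2 < p) (hs : 2*(n * (1/2 - 1/p)) + b*(1/2-1/p) = 2/p) :
    ∃ C : ℝ, 0 < C ∧ ∀ δ, 0 < δ → δ ≤ 1/2 → ∀ U : ℝ × EB b → ℂ, Measurable U → MemLp U 2 volume → Supp δ U →
    ∫⁻ w in {w : ℝ × EB b | 0 < w.1}, ENNReal.ofReal (w.1^n) * ‖Ured (kA n) U w.1 w.2‖ₑ^p ≤ ENNReal.ofReal ((C * √δ * (∫ z, ‖U z‖^2)^(1/2:ℝ))^p) := by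
  have hp0 : 0 < p := by linarith
  have hL : ∃ C : ℝ, 0 < C ∧ ∀ δ, 0 < δ → δ ≤ 1/2 → ∀ U : ℝ × EB b → ℂ, Measurable U → MemLp U 2 volume → Supp δ U →
    ∫⁻ w in {w : ℝ × EB b | 1 ≤ w.1}, ENNReal.ofReal (w.1^n) * ‖Ured (kA n) U w.1 w.2‖ₑ^p ≤ ENNReal.ofReal ((C * √δ * (∫ z, ‖U z‖^2)^(1/2:ℝ))^p) := by
    cases n with
    | zero => exact large_t0 b hb p hp (by simpa using hs)
    | succ n => exact large_t1 b hb p n hp hs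
  obtain ⟨C1, hC1, H1⟩ := hL
  obtain ⟨K, hK⟩ := kA_bdd n
  obtain ⟨C2, hC2, H2⟩ := small_t b p hp (kA n) (kA_meas n) K hK
  obtain ⟨D, hD, HD⟩ := comb_pow p 1 C1 C2 hp0 one_pos hC1 hC2
  refine ⟨D, hD, fun δ h0 h1 U hUm hU2 hS => ?_⟩
  have b1 := H1 δ h0 h1 U hUm hU2 hS
  have b2 := H2 δ h0 h1 U hUm hU2 hS
  have hm := Ured_meas n U hUm
  have hsub : {w : ℝ × EB b | 0 < w.1} ⊆ {w : ℝ × EB b | 1 ≤ w.1} ∪ (Set.Ioo (0:ℝ) 1) ×ˢ Set.univ := by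
    intro w hw
    have hw : 0 < w.1 := hw
    rcases le_or_gt 1 w.1 with h | h
    · exact Or.inl h
    · exact Or.inr ⟨⟨hw, h⟩, trivial⟩
  have hs2 : ∫⁻ w in (Set.Ioo (0:ℝ) 1) ×ˢ (Set.univ : Set (EB b)), ENNReal.ofReal (w.1^n) * ‖Ured (kA n) U w.1 w.2‖ₑ^p ≤ ENNReal.ofReal ((C2 * √δ * (∫ z, ‖U z‖^2)^(1/2:ℝ))^p) := by
    rw [Measure.volume_eq_prod, ← Measure.prod_restrict, Measure.restrict_univ, lintegral_prod _ (by fun_prop)]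
    calc _ ≤ ∫⁻ t in Set.Ioo (0:ℝ) 1, ENNReal.ofReal ((C2 * √δ * (∫ z, ‖U z‖^2)^(1/2:ℝ))^p) := by
          apply setLIntegral_mono' measurableSet_Ioo
          intro t ht
          refine le_trans (lintegral_mono fun y => ?_) (b2 t)
          simp only
          calc _ ≤ 1 * ‖Ured (kA n) U t y‖ₑ^p := by
                refine mul_le_mul' ?_ le_rfl
                rw [← ENNReal.ofReal_one]
                exact ENNReal.ofReal_le_ofReal (pow_le_one₀ ht.1.le ht.2.le)
            _ = _ := one_mul _
      _ = _ := by simp; rfl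
  refine (lintegral_mono_set hsub).trans ((lintegral_union_le _ _ _).trans ((add_le_add b1 hs2).trans ?_))
  have := HD (√δ * (∫ z, ‖U z‖^2)^(1/2:ℝ)) (by positivity)
  simpa [mul_assoc] using this
end


open MeasureTheory Real Filter
open scoped ENNReal FourierTransform RealInnerProductSpace Topology

noncomputable section

def eb1 : EB 1 ≃ᵐ ℝ := (MeasurableEquiv.toLp 2 (Fin 1 → ℝ)).symm.trans (MeasurableEquiv.funUnique (Fin 1) ℝ)

theorem eb1_mp : MeasurePreserving eb1 volume volume := 
  (volume_preserving_funUnique (Fin 1) ℝ).comp (EuclideanSpace.volume_preserving_symm_measurableEquiv_toLp (Fin 1))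

theorem eb1_apply (x : EB 1) : eb1 x = x 0 := rfl

theorem rad_int0 (f : ℝ → ℂ) (hi : Integrable (fun ξ : EB 1 => f ‖ξ‖)) (x : EB 1) :
    ∫ ξ : EB 1, f ‖ξ‖ * ee ⟪x, ξ⟫ = ∫ ρ in Set.Ioi (0:ℝ), f ρ * kA 0 (‖x‖ * ρ) := by
  have hn : ∀ ξ : EB 1, ‖ξ‖ = |eb1 ξ| := by
    intro ξ; rw [EuclideanSpace.norm_eq]; simp [eb1_apply, Real.sqrt_sq_eq_abs]
  have hin : ∀ ξ : EB 1, ⟪x, ξ⟫ = eb1 x * eb1 ξ := by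
    intro ξ; simp [eb1_apply, PiLp.inner_apply, mul_comm]
  set t := eb1 x with ht
  have hi' : Integrable (fun r : ℝ => f |r|) := by
    rw [← eb1_mp.integrable_comp_emb eb1.measurableEmbedding]
    refine hi.congr (Eventually.of_forall fun ξ => ?_)
    simp [hn]
  have hg : Integrable (fun r : ℝ => f |r| * ee (t * r)) :=
    hi'.mul_bdd (c := 1) (ee_meas.comp (by fun_prop)).aestronglyMeasurable (Eventually.of_forall fun z => (norm_ee _).le)
  have e1 : ∫ ξ : EB 1, f ‖ξ‖ * ee ⟪x, ξ⟫ = ∫ r : ℝ, f |r| * ee (t * r) := by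
    rw [← eb1_mp.integral_comp eb1.measurableEmbedding]
    apply integral_congr_ae; refine Eventually.of_forall fun ξ => ?_
    simp only [hn, hin]
  rw [e1, ← intervalIntegral.integral_Iic_add_Ioi (b := 0) hg.integrableOn hg.integrableOn]
  have e2 := integral_comp_neg_Ioi (0:ℝ) (fun r : ℝ => f |r| * ee (t * r))
  rw [neg_zero] at e2
  rw [← e2, ← integral_add]
  · apply setIntegral_congr_fun measurableSet_Ioi
    intro ρ hρ
    have hρ : 0 < ρ := hρ
    simp only [abs_neg, abs_of_pos hρ, kA]
    rw [← mul_add]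
    congr 1
    rw [hn x]
    rcases abs_choice (eb1 x) with h | h <;> rw [h, ← ht]
    · rw [add_comm]; congr 2; ring
    · congr 2 <;> ring
  · exact (hg.comp_neg).integrableOn
  · exact hg.integrableOn

theorem rad_int1 (n : ℕ) : ∃ c : ℝ, 0 < c ∧ ∀ f : ℝ → ℂ, Measurable f → Integrable (fun ξ : EB (n+1+1) => f ‖ξ‖) → ∀ x : EB (n+1+1),
    ∫ ξ : EB (n+1+1), f ‖ξ‖ * ee ⟪x, ξ⟫ = c * ∫ ρ in Set.Ioi (0:ℝ), ((ρ^(n+1):ℝ):ℂ) * f ρ * kA (n+1) (‖x‖ * ρ) := by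
  obtain ⟨c, hc, H⟩ := polar_int (n+1) (by omega)
  refine ⟨c, hc, fun f hf hi x => ?_⟩
  set e0 : EB (n+1+1) := EuclideanSpace.single 0 ‖x‖ with he0
  obtain ⟨R, hR⟩ := exists_isometry_map x e0 (by simp [he0])
  have e1 : ∫ ξ : EB (n+1+1), f ‖ξ‖ * ee ⟪x, ξ⟫ = ∫ ξ : EB (n+1+1), f ‖ξ‖ * ee (‖x‖ * ξ 0) := by
    rw [← R.measurePreserving.integral_comp R.toMeasurableEquiv.measurableEmbedding (fun ξ => f ‖ξ‖ * ee (‖x‖ * ξ 0))]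
    apply integral_congr_ae; refine Eventually.of_forall fun ξ => ?_
    simp only [LinearIsometryEquiv.norm_map]
    rw [← R.inner_map_map x ξ, hR, he0, EuclideanSpace.inner_single_left]
    simp
  rw [e1]
  have h := H (fun q => f q.1 * ee (‖x‖ * q.2)) ((hf.comp measurable_fst).mul (ee_meas.comp (by fun_prop)))
    (hi.mul_bdd (c := 1) (ee_meas.comp (by fun_prop)).aestronglyMeasurable (Eventually.of_forall fun z => (norm_ee _).le))
  rw [h]
  congr 1
  apply integral_congr_ae; refine Eventually.of_forall fun r => ?_
  simp only
  rw [kA_succ, Iosc_eq_Ioo, ← integral_const_mul]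
  apply integral_congr_ae; refine Eventually.of_forall fun y => ?_
  simp only [ee]
  rw [show (2 * π * Complex.I * ((‖x‖ * (r * y) : ℝ):ℂ) : ℂ) = Complex.I * ((2 * π * (‖x‖ * r) : ℝ):ℂ) * y by push_cast; ring]
  push_cast; ring

theorem rad_int (n : ℕ) : ∃ c : ℝ, 0 < c ∧ ∀ f : ℝ → ℂ, Measurable f → Integrable (fun ξ : EB (n+1) => f ‖ξ‖) → ∀ x : EB (n+1),
    ∫ ξ : EB (n+1), f ‖ξ‖ * ee ⟪x, ξ⟫ = c * ∫ ρ in Set.Ioi (0:ℝ), ((ρ^n:ℝ):ℂ) * f ρ * kA n (‖x‖ * ρ) := by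
  cases n with
  | zero => exact ⟨1, one_pos, fun f hf hi x => by simpa using rad_int0 f hi x⟩
  | succ n => exact rad_int1 n

theorem polar_prod (n b : ℕ) : ∃ c : ℝ, 0 < c ∧ ∀ G : ℝ × EB b → ℝ≥0∞, Measurable G →
    ∫⁻ z : EB (n+1) × EB b, G (‖z.1‖, z.2) = ENNReal.ofReal c * ∫⁻ w in {w : ℝ × EB b | 0 < w.1}, ENNReal.ofReal (w.1^n) * G w := by
  set c := (volume : Measure (EB (n+1))).toSphere Set.univ with hc
  have hc0 : c ≠ 0 := by
    rw [hc]; intro h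
    rw [Measure.measure_univ_eq_zero, Measure.toSphere_eq_zero_iff] at h
    exact not_subsingleton _ h
  have hcf : c ≠ ⊤ := measure_ne_top _ _
  refine ⟨c.toReal, ENNReal.toReal_pos hc0 hcf, fun G hG => ?_⟩
  rw [ENNReal.ofReal_toReal hcf]
  have hs : {w : ℝ × EB b | 0 < w.1} = Set.Ioi (0:ℝ) ×ˢ Set.univ := by ext w; simp
  rw [hs, Measure.volume_eq_prod, Measure.volume_eq_prod, ← Measure.prod_restrict, Measure.restrict_univ,
    lintegral_prod_symm (fun z : EB (n+1) × EB b => G (‖z.1‖, z.2)) (hG.comp (by fun_prop)).aemeasurable, lintegral_prod_symm _ (by fun_prop), ← lintegral_const_mul' _ _ hcf]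
  apply lintegral_congr; intro η
  have := lintegral_fun_norm_addHaar' (volume : Measure (EB (n+1))) (fun r => G (r, η)) (by fun_prop)
  simp only [finrank_euclideanSpace, Fintype.card_fin, Nat.add_sub_cancel] at this
  exact this

def lft {a b : ℕ} (U0 : ℝ × EB b → ℂ) (z : EB a × EB b) : ℂ := U0 (‖z.1‖, z.2)

def uAB {a b : ℕ} (U : EB a × EB b → ℂ) (x : EB a × EB b) : ℂ := ∫ z, U z * ee (⟪x.1, z.1⟫ + ⟪x.2, z.2⟫)

theorem N_eq {X : Type*} [MeasurableSpace X] {μ : Measure X} (f : X → ℂ) (hf : MemLp f 2 μ) :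
    ENNReal.ofReal ((∫ x, ‖f x‖^2 ∂μ)^(1/2:ℝ)) = eLpNorm f 2 μ := by
  have h := l2_real f hf
  rw [eLpNorm_eq_lintegral_rpow_enorm_toReal (by norm_num) (by norm_num)]
  simp only [ENNReal.toReal_ofNat]
  rw [h, ENNReal.ofReal_rpow_of_nonneg (by positivity) (by norm_num), ← Real.rpow_mul (by positivity)]
  norm_num

theorem e2_eq {X : Type*} [MeasurableSpace X] {μ : Measure X} (f : X → ℂ) : eLpNorm f 2 μ = (∫⁻ x, ‖f x‖ₑ^(2:ℝ) ∂μ)^(1/2:ℝ) := by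
  rw [eLpNorm_eq_lintegral_rpow_enorm_toReal (by norm_num) (by norm_num)]
  simp only [ENNReal.toReal_ofNat]

theorem ep_eq {X : Type*} [MeasurableSpace X] {μ : Measure X} (f : X → ℂ) (p : ℝ) (hp : 0 < p) : eLpNorm f (ENNReal.ofReal p) μ = (∫⁻ x, ‖f x‖ₑ^p ∂μ)^(1/p) := by
  rw [eLpNorm_eq_lintegral_rpow_enorm_toReal (by simpa using hp) (by simp), ENNReal.toReal_ofReal hp.le]

theorem lft_meas {a b : ℕ} (U0 : ℝ × EB b → ℂ) (h : Measurable U0) : Measurable (lft (a := a) U0) := by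
  unfold lft; exact h.comp (by fun_prop)

set_option maxHeartbeats 1000000 in
theorem CT (n b : ℕ) (hb : 1 ≤ b) (p : ℝ) (hp : 2 < p) (hs : 2*(n * (1/2 - 1/p)) + b*(1/2-1/p) = 2/p) :
    ∃ C : ℝ, 0 < C ∧ ∀ δ, 0 < δ → δ ≤ 1/2 → ∀ U0 : ℝ × EB b → ℂ, Measurable U0 → Supp δ U0 → MemLp (lft (a := n+1) U0) 2 volume →
    Integrable (lft (a := n+1) U0) ∧ eLpNorm (uAB (lft (a := n+1) U0)) (ENNReal.ofReal p) volume ≤ ENNReal.ofReal (C * √δ) * eLpNorm (lft (a := n+1) U0) 2 volume := by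
  have hp0 : 0 < p := by linarith
  obtain ⟨c1, hc1, H1⟩ := polar_prod n b
  obtain ⟨c, hc, Hr⟩ := rad_int n
  obtain ⟨C, hC, H⟩ := red_bound b hb p n hp hs
  obtain ⟨C2, hC2, H2⟩ := supp_L1 b
  set K := ((3/2)^n / c1 : ℝ) with hK
  have hK0 : 0 < K := by positivity
  refine ⟨c1^(1/p) * c * C * K^(1/2:ℝ), by positivity, fun δ h0 h1 U0 hUm hS hU2 => ?_⟩
  set U : EB (n+1) × EB b → ℂ := lft U0 with hU
  set U1 : ℝ × EB b → ℂ := fun w => ((w.1^n : ℝ):ℂ) * U0 w with hU1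
  have hU1m : Measurable U1 := by simp only [hU1]; fun_prop
  have hS1 : Supp δ U1 := by
    intro z hz; apply hS z; intro h; apply hz; simp [hU1, h]
  have hpos : ∀ w : ℝ × EB b, ¬ 0 < w.1 → U1 w = 0 := by
    intro w hw; by_contra h
    have := (hS1 w h).1
    apply hw; linarith
  have hms : MeasurableSet {w : ℝ × EB b | 0 < w.1} := measurableSet_lt measurable_const measurable_fst
  -- L2
  have hE : ∫⁻ w, ‖U1 w‖ₑ^(2:ℝ) ≤ ENNReal.ofReal K * ∫⁻ z, ‖U z‖ₑ^(2:ℝ) := by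
    have e := H1 (fun w => ‖U0 w‖ₑ^(2:ℝ)) (by fun_prop)
    have e' : ∫⁻ z, ‖U z‖ₑ^(2:ℝ) = _ := e
    rw [e', ← mul_assoc, ← ENNReal.ofReal_mul hK0.le, hK, div_mul_cancel₀ _ hc1.ne', ← lintegral_const_mul _ (by fun_prop), ← lintegral_indicator hms]
    apply lintegral_mono; intro w
    by_cases hw : 0 < w.1
    · rw [Set.indicator_of_mem (by exact hw)]
      by_cases hz : U0 w = 0
      · simp [hU1, hz]
      have hle := (Supp_le h1 hS w hz).1
      simp only [hU1]
      rw [enorm_mul, ENNReal.mul_rpow_of_nonneg _ _ (by norm_num), ← mul_assoc]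
      refine mul_le_mul' ?_ le_rfl
      rw [← ofReal_norm, Complex.norm_real, Real.norm_of_nonneg (by positivity), ENNReal.ofReal_rpow_of_nonneg (by positivity) (by norm_num), ← ENNReal.ofReal_mul (by positivity)]
      apply ENNReal.ofReal_le_ofReal
      have : (w.1^n)^(2:ℝ) = w.1^n * w.1^n := by norm_cast; ring
      rw [this]
      exact mul_le_mul_of_nonneg_right (pow_le_pow_left₀ hw.le hle n) (by positivity)
    · simp [hpos w hw]
  have hU1L : eLpNorm U1 2 volume ≤ ENNReal.ofReal (K^(1/2:ℝ)) * eLpNorm U 2 volume := by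
    rw [e2_eq, e2_eq, ← ENNReal.ofReal_rpow_of_nonneg hK0.le (by norm_num), ← ENNReal.mul_rpow_of_nonneg _ _ (by norm_num)]
    exact ENNReal.rpow_le_rpow hE (by norm_num)
  have hU12 : MemLp U1 2 volume := ⟨hU1m.aestronglyMeasurable, lt_of_le_of_lt hU1L (ENNReal.mul_lt_top ENNReal.ofReal_lt_top hU2.2)⟩
  obtain ⟨hU1I, -⟩ := H2 δ h0 h1 U1 hU1m hU12 hS1
  have hb1 := H δ h0 h1 U1 hU1m hU12 hS1
  have hUmeas : Measurable U := lft_meas U0 hUm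
  have hUI : Integrable U := by
    refine ⟨hUmeas.aestronglyMeasurable, ?_⟩
    have e := H1 (fun w => ‖U0 w‖ₑ) (by fun_prop)
    have e' : ∫⁻ z, ‖U z‖ₑ = _ := e
    unfold HasFiniteIntegral
    rw [e']
    refine ENNReal.mul_lt_top ENNReal.ofReal_lt_top (lt_of_le_of_lt ?_ hU1I.2)
    refine le_trans (setLIntegral_mono' (g := fun w => ‖U1 w‖ₑ) hms fun w hw => ?_) (setLIntegral_le_lintegral _ _)
    have hw : 0 < w.1 := hw
    simp only [hU1]
    rw [enorm_mul, ← ofReal_norm ((w.1^n:ℝ):ℂ), Complex.norm_real, Real.norm_of_nonneg (by positivity)]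
  refine ⟨hUI, ?_⟩
  obtain ⟨Kk, hKk⟩ := kA_bdd n
  have hform : ∀ x : EB (n+1) × EB b, uAB U x = c * Ured (kA n) U1 ‖x.1‖ x.2 := by
    intro x
    unfold uAB Ured
    have i1 : Integrable fun z : EB (n+1) × EB b => U z * ee (⟪x.1, z.1⟫ + ⟪x.2, z.2⟫) :=
      hUI.mul_bdd (c := 1) (ee_meas.comp (by fun_prop)).aestronglyMeasurable (Eventually.of_forall fun z => (norm_ee _).le)
    have i2 : Integrable fun z : ℝ × EB b => U1 z * kA n (‖x.1‖ * z.1) * ee ⟪x.2, z.2⟫ :=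
      (Ured_int (kA n) (kA_meas n) Kk hKk U1 hU1I ‖x.1‖).mul_bdd (c := 1) (ee_meas.comp (by fun_prop)).aestronglyMeasurable (Eventually.of_forall fun z => (norm_ee _).le)
    rw [Measure.volume_eq_prod] at i1 i2 hUI
    rw [Measure.volume_eq_prod, Measure.volume_eq_prod, integral_prod_symm _ i1, integral_prod_symm _ i2, ← integral_const_mul]
    apply integral_congr_ae
    filter_upwards [hUI.prod_left_ae] with η hη
    have hη' : Integrable fun ξ : EB (n+1) => (fun r => U0 (r, η)) ‖ξ‖ := hη
    have h := Hr (fun r => U0 (r, η)) (by fun_prop) hη' x.1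
    calc ∫ ξ : EB (n+1), U (ξ, η) * ee (⟪x.1, ξ⟫ + ⟪x.2, η⟫) = (∫ ξ : EB (n+1), (fun r => U0 (r, η)) ‖ξ‖ * ee ⟪x.1, ξ⟫) * ee ⟪x.2, η⟫ := by
          rw [← integral_mul_const]
          apply integral_congr_ae; refine Eventually.of_forall fun ξ => ?_
          simp only [hU, lft, ee_add]; ring
      _ = _ := by
          rw [h, mul_assoc, ← integral_mul_const]
          congr 1
          refine setIntegral_eq_integral_of_forall_compl_eq_zero (s := Set.Ioi (0:ℝ)) (f := fun ρ => U1 (ρ, η) * kA n (‖x.1‖ * ρ) * ee ⟪x.2, η⟫) ?_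
          intro ρ hρ
          rw [hpos (ρ, η) hρ]; simp
  have hpw : ∫⁻ x, ‖uAB U x‖ₑ^p ≤ ENNReal.ofReal c1 * (ENNReal.ofReal c^p * ENNReal.ofReal ((C * √δ * (∫ z, ‖U1 z‖^2)^(1/2:ℝ))^p)) := by
    have hm := Ured_meas n U1 hU1m
    have e := H1 (fun w => ENNReal.ofReal c^p * ‖Ured (kA n) U1 w.1 w.2‖ₑ^p) (by fun_prop)
    simp only at e
    calc ∫⁻ x, ‖uAB U x‖ₑ^p = ∫⁻ x : EB (n+1) × EB b, ENNReal.ofReal c^p * ‖Ured (kA n) U1 ‖x.1‖ x.2‖ₑ^p := by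
          apply lintegral_congr; intro x
          rw [hform, enorm_mul, ENNReal.mul_rpow_of_nonneg _ _ hp0.le, ← ofReal_norm (c:ℂ), Complex.norm_real, Real.norm_of_nonneg hc.le]
      _ ≤ _ := by
          rw [e]
          refine mul_le_mul' le_rfl ?_
          simp_rw [mul_left_comm]
          rw [lintegral_const_mul _ (by fun_prop)]
          exact mul_le_mul' le_rfl hb1
  rw [ep_eq _ p hp0]
  refine (ENNReal.rpow_le_rpow hpw (by positivity)).trans ?_
  rw [ENNReal.ofReal_rpow_of_nonneg hc.le hp0.le, ← ENNReal.ofReal_mul (by positivity), ← ENNReal.ofReal_mul hc1.le, ENNReal.ofReal_rpow_of_nonneg (by positivity) (by positivity),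
    Real.mul_rpow hc1.le (by positivity), ← Real.mul_rpow hc.le (by positivity), ← Real.rpow_mul (by positivity), mul_one_div_cancel hp0.ne', Real.rpow_one]
  calc ENNReal.ofReal (c1^(1/p) * (c * (C * √δ * (∫ z, ‖U1 z‖^2)^(1/2:ℝ)))) = ENNReal.ofReal (c1^(1/p) * c * C * √δ) * ENNReal.ofReal ((∫ z, ‖U1 z‖^2)^(1/2:ℝ)) := by
        rw [← ENNReal.ofReal_mul (by positivity)]; congr 1; ring
    _ ≤ ENNReal.ofReal (c1^(1/p) * c * C * √δ) * (ENNReal.ofReal (K^(1/2:ℝ)) * eLpNorm U 2 volume) := by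
        rw [N_eq U1 hU12]; exact mul_le_mul' le_rfl hU1L
    _ = _ := by
        rw [← mul_assoc, ← ENNReal.ofReal_mul (by positivity)]; congr 2; ring
end


open MeasureTheory Real Filter
open scoped ENNReal FourierTransform RealInnerProductSpace Topology

noncomputable section

structure Blk (d a b : ℕ) where
  e : Rd d ≃ᵐ EB a × EB b
  mp : MeasurePreserving e volume volume
  inn : ∀ x y, ⟪x, y⟫ = ⟪(e x).1, (e y).1⟫ + ⟪(e x).2, (e y).2⟫

theorem Blk.nsq {d a b : ℕ} (B : Blk d a b) (x : Rd d) : ‖x‖^2 = ‖(B.e x).1‖^2 + ‖(B.e x).2‖^2 := by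
  have := B.inn x x
  simpa [real_inner_self_eq_norm_sq] using this

def Blk.swap {d a b : ℕ} (B : Blk d a b) : Blk d b a where
  e := B.e.trans MeasurableEquiv.prodComm
  mp := by
    have : MeasurePreserving (MeasurableEquiv.prodComm : EB a × EB b ≃ᵐ EB b × EB a) volume volume := Measure.measurePreserving_swap
    exact this.comp B.mp
  inn := by
    intro x y; rw [B.inn x y, add_comm]; rfl

def BSym {d a b : ℕ} (B : Blk d a b) (f : Rd d → ℂ) : Prop := ∀ x y, ‖(B.e x).1‖ = ‖(B.e y).1‖ → ‖(B.e x).2‖ = ‖(B.e y).2‖ → f x = f y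

theorem BSym.swap {d a b : ℕ} {B : Blk d a b} {f : Rd d → ℂ} (h : BSym B f) : BSym B.swap f :=
  fun x y h1 h2 => h x y h2 h1

/-- the standard splitting -/
def stdE (d k : ℕ) (hk : k ≤ d) : Rd d ≃ᵐ EB (d-k) × EB k :=
  (MeasurableEquiv.toLp 2 (Fin d → ℝ)).symm.trans
    ((MeasurableEquiv.piCongrLeft (fun _ : Fin d => ℝ) (finSumFinEquiv.trans (finCongr (by omega : (d-k)+k = d)))).symm.trans
    ((MeasurableEquiv.sumPiEquivProdPi (fun _ : Fin (d-k) ⊕ Fin k => ℝ)).trans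
      (MeasurableEquiv.prodCongr (MeasurableEquiv.toLp 2 (Fin (d-k) → ℝ)) (MeasurableEquiv.toLp 2 (Fin k → ℝ)))))

theorem stdE_fst (d k : ℕ) (hk : k ≤ d) (x : Rd d) (i : Fin (d-k)) : ((stdE d k hk x).1) i = x ⟨i, by omega⟩ := rfl

theorem stdE_snd (d k : ℕ) (hk : k ≤ d) (x : Rd d) (i : Fin k) : ((stdE d k hk x).2) i = x ⟨(d-k)+i, by omega⟩ := rfl

theorem stdE_mp (d k : ℕ) (hk : k ≤ d) : MeasurePreserving (stdE d k hk) volume volume := by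
  unfold stdE
  refine (EuclideanSpace.volume_preserving_symm_measurableEquiv_toLp _).trans ?_
  refine (volume_measurePreserving_piCongrLeft (fun _ : Fin d => ℝ) _).symm.trans ?_
  refine (volume_measurePreserving_sumPiEquivProdPi (fun _ : Fin (d-k) ⊕ Fin k => ℝ)).trans ?_
  exact MeasurePreserving.prod (EuclideanSpace.volume_preserving_symm_measurableEquiv_toLp _).symm (EuclideanSpace.volume_preserving_symm_measurableEquiv_toLp _).symm

theorem sum_split (d k : ℕ) (hk : k ≤ d) (f : Fin d → ℝ) : ∑ i, f i = (∑ i : Fin (d-k), f ⟨i, by omega⟩) + ∑ i : Fin k, f ⟨(d-k)+i, by omega⟩ := by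
  rw [← (finCongr (by omega : (d-k)+k = d)).sum_comp, Fin.sum_univ_add]
  rfl

def stdB (d k : ℕ) (hk : k ≤ d) : Blk d (d-k) k where
  e := stdE d k hk
  mp := stdE_mp d k hk
  inn := by
    intro x y
    simp only [PiLp.inner_apply, stdE_fst, stdE_snd]
    exact sum_split d k hk _

theorem stdB_blockSq (d k : ℕ) (hk : k ≤ d) (x : Rd d) : blockSq d k x = ‖((stdB d k hk).e x).1‖^2 := by
  rw [EuclideanSpace.norm_sq_eq]
  unfold blockSq
  rw [sum_split d k hk]
  have : ∀ i : Fin k, ¬ ((d-k)+(i:ℕ) < d - k) := by intro i; omega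
  simp [this]
  apply Finset.sum_congr rfl; intro i _
  rfl

theorem gk_iff (d k : ℕ) (hk : k ≤ d) (f : Rd d → ℂ) : GkSymmetric d k f ↔ BSym (stdB d k hk) f := by
  constructor
  · intro h x y h1 h2
    apply h x y
    · rw [stdB_blockSq d k hk, stdB_blockSq d k hk, h1]
    · rw [← sq_eq_sq₀ (norm_nonneg _) (norm_nonneg _), (stdB d k hk).nsq x, (stdB d k hk).nsq y, h1, h2]
  · intro h x y h1 h2
    rw [stdB_blockSq d k hk, stdB_blockSq d k hk] at h1
    have h3 := (stdB d k hk).nsq x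
    rw [h2, (stdB d k hk).nsq y, h1] at h3
    apply h x y
    · rwa [← sq_eq_sq₀ (norm_nonneg _) (norm_nonneg _)]
    · rw [← sq_eq_sq₀ (norm_nonneg _) (norm_nonneg _)]; linarith

/-- `L^∞`-`L^q` interpolation -/
theorem interp_inf {X : Type*} [MeasurableSpace X] {μ : Measure X} (f : X → ℂ) (p q : ℝ) (hq : 0 < q) (hqp : q ≤ p) (M : ℝ≥0∞) (hM : M ≠ ⊤)
    (h1 : ∀ x, ‖f x‖ₑ ≤ M) (h2 : eLpNorm f (ENNReal.ofReal q) μ ≤ M) : eLpNorm f (ENNReal.ofReal p) μ ≤ M := by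
  have hp : 0 < p := by linarith
  rw [ep_eq f q hq] at h2
  rw [ep_eq f p hp]
  have h3 : ∫⁻ x, ‖f x‖ₑ^q ∂μ ≤ M^q := by
    have := ENNReal.rpow_le_rpow h2 hq.le
    rwa [← ENNReal.rpow_mul, one_div_mul_cancel hq.ne', ENNReal.rpow_one] at this
  have h4 : ∫⁻ x, ‖f x‖ₑ^p ∂μ ≤ M^p := by
    calc ∫⁻ x, ‖f x‖ₑ^p ∂μ ≤ ∫⁻ x, M^(p-q) * ‖f x‖ₑ^q ∂μ := by
          apply lintegral_mono; intro x
          have : ‖f x‖ₑ^p = ‖f x‖ₑ^(p-q) * ‖f x‖ₑ^q := by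
            rw [← ENNReal.rpow_add_of_nonneg _ _ (by linarith) hq.le]; congr 1; ring
          simp only
          rw [this]
          exact mul_le_mul' (ENNReal.rpow_le_rpow (h1 x) (by linarith)) le_rfl
      _ = M^(p-q) * ∫⁻ x, ‖f x‖ₑ^q ∂μ := lintegral_const_mul' _ _ (ENNReal.rpow_ne_top_of_nonneg (by linarith) hM)
      _ ≤ M^(p-q) * M^q := mul_le_mul' le_rfl h3
      _ = M^p := by rw [← ENNReal.rpow_add_of_nonneg _ _ (by linarith) hq.le]; congr 1; ring
  have := ENNReal.rpow_le_rpow h4 (by positivity : 0 ≤ 1/p)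
  rwa [← ENNReal.rpow_mul, mul_one_div_cancel hp.ne', ENNReal.rpow_one] at this

/-- `L^2`-`L^q` interpolation -/
theorem interp_two {X : Type*} [MeasurableSpace X] {μ : Measure X} (f : X → ℂ) (hf : AEMeasurable f μ) (p q θ : ℝ) (hp : 0 < p) (hq : 0 < q) (h0 : 0 ≤ θ) (h1 : θ ≤ 1)
    (hθ : 1/p = (1-θ)/2 + θ/q) : eLpNorm f (ENNReal.ofReal p) μ ≤ eLpNorm f 2 μ^(1-θ) * eLpNorm f (ENNReal.ofReal q) μ^θ := by
  rw [ep_eq f p hp, ep_eq f q hq, e2_eq]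
  have hsum : p*(1-θ)/2 + p*θ/q = 1 := by
    have : p * (1/p) = 1 := mul_one_div_cancel hp.ne'
    linear_combination p * (-hθ) + this
  have n1 : 0 ≤ p*(1-θ)/2 := by have : 0 ≤ 1-θ := by linarith
                                positivity
  have n2 : 0 ≤ p*θ/q := by positivity
  have h := ENNReal.lintegral_mul_norm_pow_le (μ := μ) (f := fun x => ‖f x‖ₑ^(2:ℝ)) (g := fun x => ‖f x‖ₑ^q) (by fun_prop) (by fun_prop) n1 n2 hsum
  have e : ∀ x, (‖f x‖ₑ^(2:ℝ))^(p*(1-θ)/2) * (‖f x‖ₑ^q)^(p*θ/q) = ‖f x‖ₑ^p := by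
    intro x
    rw [← ENNReal.rpow_mul, ← ENNReal.rpow_mul, ← ENNReal.rpow_add_of_nonneg _ _ (by positivity) (by positivity)]
    congr 1; field_simp; ring
  simp_rw [e] at h
  refine (ENNReal.rpow_le_rpow h (by positivity)).trans (le_of_eq ?_)
  rw [ENNReal.mul_rpow_of_nonneg _ _ (by positivity), ← ENNReal.rpow_mul, ← ENNReal.rpow_mul, ← ENNReal.rpow_mul, ← ENNReal.rpow_mul]
  congr 2 <;> field_simp

theorem shell_vol (d : ℕ) (hd : 1 ≤ d) : ∃ C : ℝ, 0 < C ∧ ∀ δ, 0 < δ → δ ≤ 1/2 → volume {ξ : Rd d | |‖ξ‖ - 1| ≤ δ} ≤ ENNReal.ofReal (C * δ) := by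
  obtain ⟨n, rfl⟩ : ∃ n, d = n+1 := ⟨d-1, by omega⟩
  set c := (volume : Measure (EB (n+1))).toSphere Set.univ with hc
  have hcf : c ≠ ⊤ := measure_ne_top _ _
  refine ⟨(c.toReal + 1) * ((3/2)^n * 2), by positivity, fun δ h0 h1 => ?_⟩
  have hms : MeasurableSet {r : ℝ | |r - 1| ≤ δ} := measurableSet_le (by fun_prop) measurable_const
  have hms' : MeasurableSet {ξ : Rd (n+1) | |‖ξ‖ - 1| ≤ δ} := measurableSet_le (by fun_prop) measurable_const
  have h := lintegral_fun_norm_addHaar' (volume : Measure (EB (n+1))) ({r : ℝ | |r - 1| ≤ δ}.indicator (fun _ => 1)) (measurable_const.indicator hms)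
  simp only [finrank_euclideanSpace, Fintype.card_fin, Nat.add_sub_cancel] at h
  calc volume {ξ : Rd (n+1) | |‖ξ‖ - 1| ≤ δ} = ∫⁻ ξ : EB (n+1), {r : ℝ | |r - 1| ≤ δ}.indicator (fun _ => 1) ‖ξ‖ := by
        rw [← lintegral_indicator_one hms']; rfl
    _ = c * _ := h
    _ ≤ c * ∫⁻ y, {r : ℝ | |r - 1| ≤ δ}.indicator (fun _ => ENNReal.ofReal ((3/2)^n)) y := by
        refine mul_le_mul' le_rfl (le_trans (setLIntegral_mono' (g := {r : ℝ | |r - 1| ≤ δ}.indicator (fun _ => ENNReal.ofReal ((3/2)^n))) measurableSet_Ioi fun y hy => ?_) (setLIntegral_le_lintegral _ _))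
        have hy : 0 < y := hy
        by_cases h : y ∈ {r : ℝ | |r - 1| ≤ δ}
        · rw [Set.indicator_of_mem h, Set.indicator_of_mem h, mul_one]
          have h : |y - 1| ≤ δ := h
          rw [abs_le] at h
          exact ENNReal.ofReal_le_ofReal (pow_le_pow_left₀ hy.le (by linarith [h.2]) n)
        · simp [h]
    _ = c * (ENNReal.ofReal ((3/2)^n) * ENNReal.ofReal (2*δ)) := by
        rw [lintegral_indicator hms, setLIntegral_const]
        congr 2
        rw [show {r : ℝ | |r - 1| ≤ δ} = Set.Icc (1-δ) (1+δ) by ext r; simp only [Set.mem_ofPred_eq, abs_le, Set.mem_Icc]; constructor <;> rintro ⟨h1, h2⟩ <;> constructor <;> linarith, Real.volume_Icc]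
        congr 1; ring
    _ ≤ _ := by
        rw [← ENNReal.ofReal_mul (by positivity)]
        nth_rewrite 1 [← ENNReal.ofReal_toReal hcf]
        rw [← ENNReal.ofReal_mul (by positivity)]
        apply ENNReal.ofReal_le_ofReal
        have : 0 ≤ (3/2)^n * (2*δ) := by positivity
        nlinarith

/-- Cauchy-Schwarz on a set of finite measure -/
theorem l1_le {X : Type*} [MeasurableSpace X] {μ : Measure X} (f : X → ℂ) (hf : Measurable f) (S : Set X) (hS : MeasurableSet S) (h : ∀ x, f x ≠ 0 → x ∈ S) :
    ∫⁻ x, ‖f x‖ₑ ∂μ ≤ (μ S)^(1/2:ℝ) * eLpNorm f 2 μ := by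
  rw [e2_eq]
  calc ∫⁻ x, ‖f x‖ₑ ∂μ = ∫⁻ x, ((S.indicator fun _ => (1:ℝ≥0∞)) * (fun x => ‖f x‖ₑ)) x ∂μ := by
        apply lintegral_congr; intro x
        simp only [Pi.mul_apply]
        by_cases hx : x ∈ S
        · simp [hx]
        · have : f x = 0 := by by_contra hc; exact hx (h x hc)
          simp [this]
    _ ≤ (∫⁻ x, ((S.indicator fun _ => (1:ℝ≥0∞)) x)^(2:ℝ) ∂μ)^(1/2:ℝ) * (∫⁻ x, ‖f x‖ₑ^(2:ℝ) ∂μ)^(1/2:ℝ) :=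
        ENNReal.lintegral_mul_le_Lp_mul_Lq _ Real.HolderConjugate.two_two ((measurable_const.indicator hS).aemeasurable) (by fun_prop)
    _ = _ := by
        congr 2
        rw [← lintegral_indicator_one hS]
        apply lintegral_congr; intro x
        by_cases hx : x ∈ S <;> simp [hx]

theorem finv_sup {d : ℕ} (U : Rd d → ℂ) (x) : ‖𝓕⁻ U x‖ₑ ≤ ∫⁻ ξ, ‖U ξ‖ₑ := by
  rw [fourierInv_ee]
  refine (enorm_integral_le_lintegral_enorm _).trans (lintegral_mono fun ξ => ?_)
  rw [enorm_mul, ← ofReal_norm (ee _), norm_ee]; simp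
end


open MeasureTheory Real Filter
open scoped ENNReal FourierTransform RealInnerProductSpace Topology

noncomputable section


theorem finv_cont {d : ℕ} (U : Rd d → ℂ) (hi : Integrable U volume) : Continuous (𝓕⁻ U) := by
  have : 𝓕⁻ U = fun x => 𝓕 U (-x) := by funext x; rw [Real.fourierInv_eq_fourier_neg]
  rw [this]
  have hc : Continuous (𝓕 U) := VectorFourier.fourierIntegral_continuous Real.continuous_fourierChar
      (by exact continuous_inner) hi
  exact hc.comp continuous_neg

theorem finv_add {d : ℕ} (U V : Rd d → ℂ) (hU : Integrable U volume) (hV : Integrable V volume) : 𝓕⁻ (U + V) = 𝓕⁻ U + 𝓕⁻ V := by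
  funext x
  simp only [Pi.add_apply, fourierInv_ee]
  have hb : ∀ W : Rd d → ℂ, Integrable W volume → Integrable (fun ξ => W ξ * ee ⟪ξ, x⟫) volume := by
    intro W hW
    refine hW.mul_bdd (c := 1) ?_ (ae_of_all _ fun ξ => by rw [norm_ee])
    exact (ee_cont.comp (by fun_prop)).aestronglyMeasurable
  rw [← integral_add (hb U hU) (hb V hV)]
  congr 1; funext ξ; ring

theorem shell_side {d n b : ℕ} (B : Blk d (n+1) b) (hb : 1 ≤ b) (p : ℝ) (hp : 2 < p)
    (hs : 2*((n:ℝ)*(1/2-1/p)) + b*(1/2-1/p) = 2/p) :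
    ∃ C : ℝ, 0 < C ∧ ∀ δ, 0 < δ → δ ≤ 1/2 → ∀ U : Rd d → ℂ, Measurable U →
      (∀ ξ, U ξ ≠ 0 → 1/4 ≤ ‖(B.e ξ).1‖ ∧ |‖ξ‖ - 1| ≤ δ) → BSym B U → MemLp U 2 volume →
      eLpNorm (𝓕⁻ U) (ENNReal.ofReal p) volume ≤ ENNReal.ofReal (C*√δ) * eLpNorm U 2 volume := by
  obtain ⟨C, hC, h⟩ := CT n b hb p hp hs
  refine ⟨C, hC, fun δ h0 h1 U hm hsup hsym hL => ?_⟩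
  set e0 : EB (n+1) := EuclideanSpace.single 0 1 with he0
  have ne0 : ‖e0‖ = 1 := by simp [he0]
  set U0 : ℝ × EB b → ℂ := fun z => if 1/4 ≤ z.1 then U (B.e.symm (z.1 • e0, z.2)) else 0 with hU0
  have hU0m : Measurable U0 := by
    refine Measurable.ite (measurableSet_le measurable_const measurable_fst) ?_ measurable_const
    exact hm.comp (B.e.symm.measurable.comp (by fun_prop))
  have hlift : lft (a := n+1) U0 = U ∘ B.e.symm := by
    funext z
    simp only [lft, hU0, Function.comp]
    split_ifs with hz
    · apply hsym
      · simp [norm_smul, ne0]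
      · simp
    · by_contra hne
      have := (hsup _ (Ne.symm hne)).1
      simp at this
      exact hz (by norm_num; linarith)
  have hS : Supp δ U0 := by
    intro z hz
    simp only [hU0] at hz
    split_ifs at hz with h4
    · refine ⟨h4, ?_⟩
      have := (hsup _ hz).2
      have hn := B.nsq (B.e.symm (z.1 • e0, z.2))
      simp [norm_smul, ne0] at hn
      rw [← hn, Real.sqrt_sq (norm_nonneg _)]
      exact this
    · exact absurd rfl hz
  have mps : MeasurePreserving B.e.symm volume volume := B.mp.symm
  have hnorm : eLpNorm (U ∘ B.e.symm) 2 volume = eLpNorm U 2 volume :=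
    eLpNorm_comp_measurePreserving hm.aestronglyMeasurable mps
  have hmem : MemLp (U ∘ B.e.symm) 2 volume := hL.comp_measurePreserving mps
  have h2 := h δ h0 h1 U0 hU0m hS (by rw [hlift]; exact hmem)
  rw [hlift, hnorm] at h2
  have hF : 𝓕⁻ U = uAB (U ∘ B.e.symm) ∘ B.e := by
    funext x
    rw [fourierInv_ee]
    simp only [uAB, Function.comp]
    rw [← B.mp.integral_comp B.e.measurableEmbedding]
    congr 1; funext ξ
    simp only [MeasurableEquiv.symm_apply_apply]
    rw [real_inner_comm, B.inn]
  have hu : AEStronglyMeasurable (uAB (U ∘ B.e.symm)) volume := by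
    have : uAB (U ∘ B.e.symm) = (𝓕⁻ U) ∘ B.e.symm := by
      rw [hF]; funext x; simp
    rw [this]
    have hi : Integrable U volume := by
      have := h2.1
      exact (mps.integrable_comp_emb B.e.symm.measurableEmbedding).1 this
    have hc := finv_cont U hi
    exact (hc.measurable.comp B.e.symm.measurable).aestronglyMeasurable
  rw [hF, eLpNorm_comp_measurePreserving hu B.mp]
  exact h2.2

theorem shell_l1 (d : ℕ) (hd : 1 ≤ d) : ∃ C : ℝ, 0 < C ∧ ∀ δ, 0 < δ → δ ≤ 1/2 → ∀ U : Rd d → ℂ, Measurable U →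
      (∀ ξ, U ξ ≠ 0 → |‖ξ‖ - 1| ≤ δ) → ∫⁻ ξ, ‖U ξ‖ₑ ≤ ENNReal.ofReal (C*√δ) * eLpNorm U 2 volume := by
  obtain ⟨C, hC, h⟩ := shell_vol d hd
  refine ⟨√C, by positivity, fun δ h0 h1 U hm hs => ?_⟩
  have := l1_le (μ := volume) U hm {ξ : Rd d | |‖ξ‖ - 1| ≤ δ} (measurableSet_le (by fun_prop) measurable_const) hs
  refine this.trans (mul_le_mul' ?_ le_rfl)
  refine (ENNReal.rpow_le_rpow (h δ h0 h1) (by norm_num)).trans (le_of_eq ?_)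
  rw [ENNReal.ofReal_rpow_of_nonneg (by positivity) (by norm_num), ← Real.sqrt_eq_rpow, Real.sqrt_mul hC.le]

theorem int_of_l1 {d : ℕ} {U : Rd d → ℂ} (hm : Measurable U) (hL : MemLp U 2 volume) {c : ℝ} (h : ∫⁻ ξ, ‖U ξ‖ₑ ≤ ENNReal.ofReal c * eLpNorm U 2 volume) : Integrable U volume :=
  ⟨hm.aestronglyMeasurable, lt_of_le_of_lt h (ENNReal.mul_lt_top ENNReal.ofReal_lt_top hL.eLpNorm_lt_top)⟩

theorem shell_side_q {d a b : ℕ} (B : Blk d a b) (ha : 1 ≤ a) (hb : 1 ≤ b) (hd : d = a + b) (q : ℝ)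
    (hq : 2*((d:ℝ)+a)/((d:ℝ)-2+a) ≤ q) :
    ∃ C : ℝ, 0 < C ∧ ∀ δ, 0 < δ → δ ≤ 1/2 → ∀ U : Rd d → ℂ, Measurable U →
      (∀ ξ, U ξ ≠ 0 → 1/4 ≤ ‖(B.e ξ).1‖ ∧ |‖ξ‖ - 1| ≤ δ) → BSym B U → MemLp U 2 volume →
      eLpNorm (𝓕⁻ U) (ENNReal.ofReal q) volume ≤ ENNReal.ofReal (C*√δ) * eLpNorm U 2 volume := by
  obtain ⟨n, rfl⟩ : ∃ n, a = n+1 := ⟨a-1, by omega⟩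
  have hb' : (1:ℝ) ≤ b := by exact_mod_cast hb
  have hdr : (d:ℝ) = n + 1 + b := by rw [hd]; push_cast; ring
  push_cast at hq
  set p : ℝ := 2*((d:ℝ)+(n+1))/((d:ℝ)-2+(n+1)) with hp
  have hpos : 0 < (d:ℝ)-2+(n+1) := by rw [hdr]; have : (0:ℝ) ≤ n := by positivity
                                      linarith
  have hp2 : 2 < p := by rw [hp, lt_div_iff₀ hpos]; linarith
  have h1p : 1/p = ((d:ℝ)-2+(n+1))/(2*((d:ℝ)+(n+1))) := by rw [hp, one_div_div]
  have hs : 2*((n:ℝ)*(1/2-1/p)) + b*(1/2-1/p) = 2/p := by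
    have h2 : 2/p = 2*(1/p) := by ring
    rw [h2, h1p, hdr]
    have : (0:ℝ) < (n:ℝ) + 1 + b + (n+1) := by positivity
    field_simp; ring
  obtain ⟨C1, hC1, h1⟩ := shell_side B hb p hp2 hs
  obtain ⟨C2, hC2, h2⟩ := shell_l1 d (by omega)
  refine ⟨max C1 C2, lt_max_of_lt_left hC1, fun δ hδ hδ' U hm hsup hsym hL => ?_⟩
  apply interp_inf _ q p (by linarith) hq _ (ENNReal.mul_lt_top ENNReal.ofReal_lt_top hL.eLpNorm_lt_top).ne
  · intro x
    refine (finv_sup U x).trans ((h2 δ hδ hδ' U hm (fun ξ hξ => (hsup ξ hξ).2)).trans ?_)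
    gcongr; exact le_max_right _ _
  · refine (h1 δ hδ hδ' U hm hsup hsym hL).trans ?_
    gcongr; exact le_max_left _ _

theorem shell_star {d a b : ℕ} (B : Blk d a b) (ha : 1 ≤ a) (hb : 1 ≤ b) (hd : d = a + b) (q : ℝ)
    (hqa : 2*((d:ℝ)+a)/((d:ℝ)-2+a) ≤ q) (hqb : 2*((d:ℝ)+b)/((d:ℝ)-2+b) ≤ q) (hq : 1 ≤ q) :
    ∃ C : ℝ, 0 < C ∧ ∀ δ, 0 < δ → δ ≤ 1/2 → ∀ U : Rd d → ℂ, Measurable U →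
      (∀ ξ, U ξ ≠ 0 → |‖ξ‖ - 1| ≤ δ) → BSym B U → MemLp U 2 volume →
      eLpNorm (𝓕⁻ U) (ENNReal.ofReal q) volume ≤ ENNReal.ofReal (C*√δ) * eLpNorm U 2 volume := by
  obtain ⟨C1, hC1, h1⟩ := shell_side_q B ha hb hd q hqa
  obtain ⟨C2, hC2, h2⟩ := shell_side_q B.swap hb ha (by omega) q hqb
  obtain ⟨C3, hC3, h3⟩ := shell_l1 d (by omega)
  refine ⟨C1 + C2, by positivity, fun δ hδ hδ' U hm hsup hsym hL => ?_⟩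
  set S : Set (Rd d) := {ξ | 1/4 ≤ ‖(B.e ξ).1‖} with hS
  have hSm : MeasurableSet S := measurableSet_le measurable_const (B.e.measurable.fst.norm)
  have hU : U = S.indicator U + Sᶜ.indicator U := (Set.indicator_self_add_compl S U).symm
  have m1 : Measurable (S.indicator U) := hm.indicator hSm
  have m2 : Measurable (Sᶜ.indicator U) := hm.indicator hSm.compl
  have L1 : MemLp (S.indicator U) 2 volume := hL.indicator hSm
  have L2 : MemLp (Sᶜ.indicator U) 2 volume := hL.indicator hSm.compl
  have sup1 : ∀ ξ, S.indicator U ξ ≠ 0 → 1/4 ≤ ‖(B.e ξ).1‖ ∧ |‖ξ‖ - 1| ≤ δ := by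
    intro ξ hξ
    have hm := Set.mem_of_indicator_ne_zero hξ
    rw [Set.indicator_of_mem hm] at hξ
    exact ⟨hm, hsup ξ hξ⟩
  have sup2 : ∀ ξ, Sᶜ.indicator U ξ ≠ 0 → 1/4 ≤ ‖(B.swap.e ξ).1‖ ∧ |‖ξ‖ - 1| ≤ δ := by
    intro ξ hξ
    have hm := Set.mem_of_indicator_ne_zero hξ
    rw [Set.indicator_of_mem hm] at hξ
    have h5 := hsup ξ hξ
    refine ⟨?_, h5⟩
    have hm' : ‖(B.e ξ).1‖ < 1/4 := not_le.1 hm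
    have hn := B.nsq ξ
    change 1/4 ≤ ‖(B.e ξ).2‖
    rw [abs_le] at h5
    by_contra hc
    push Not at hc
    nlinarith [norm_nonneg (B.e ξ).1, norm_nonneg (B.e ξ).2, norm_nonneg ξ]
  have sy1 : BSym B (S.indicator U) := by
    intro x y e1 e2
    have : x ∈ S ↔ y ∈ S := by simp only [hS, Set.mem_ofPred_eq, e1]
    by_cases hx : x ∈ S
    · rw [Set.indicator_of_mem hx, Set.indicator_of_mem (this.1 hx), hsym x y e1 e2]
    · rw [Set.indicator_of_notMem hx, Set.indicator_of_notMem (fun h => hx (this.2 h))]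
  have sy2 : BSym B (Sᶜ.indicator U) := by
    intro x y e1 e2
    have h6 := sy1 x y e1 e2
    have h7 := hsym x y e1 e2
    have e : Sᶜ.indicator U = U - S.indicator U := by rw [Set.indicator_compl]
    rw [e]; simp only [Pi.sub_apply, h6, h7]
  have i1 : Integrable (S.indicator U) volume := int_of_l1 m1 L1 (h3 δ hδ hδ' _ m1 fun ξ hξ => (sup1 ξ hξ).2)
  have i2 : Integrable (Sᶜ.indicator U) volume := int_of_l1 m2 L2 (h3 δ hδ hδ' _ m2 fun ξ hξ => (sup2 ξ hξ).2)
  have hF := finv_add _ _ i1 i2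
  rw [← hU] at hF
  rw [hF]
  refine (eLpNorm_add_le (finv_cont _ i1).aestronglyMeasurable (finv_cont _ i2).aestronglyMeasurable (by rw [← ENNReal.ofReal_one]; exact ENNReal.ofReal_le_ofReal hq)).trans ?_
  have b1 := h1 δ hδ hδ' _ m1 sup1 sy1 L1
  have b2 := h2 δ hδ hδ' _ m2 sup2 sy2.swap L2
  rw [add_mul, ENNReal.ofReal_add (by positivity) (by positivity), add_mul]
  refine add_le_add (b1.trans (mul_le_mul' le_rfl (eLpNorm_indicator_le _))) (b2.trans (mul_le_mul' le_rfl (eLpNorm_indicator_le _)))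

theorem alpha_eq (d k : ℕ) (hk1 : 1 ≤ k) (hkd : k + 1 ≤ d) (p : ℝ) : alphaK d k p = (1/2-1/p)*((d:ℝ) + (min k (d-k) : ℕ)) := by
  have hm : (1:ℝ) ≤ (min k (d-k) : ℕ) := by exact_mod_cast (by omega : 1 ≤ min k (d-k))
  have hd : (2:ℝ) ≤ d := by exact_mod_cast (by omega : 2 ≤ d)
  unfold alphaK twoStarK
  generalize ((min k (d-k) : ℕ):ℝ) = m at *
  have h1 : (0:ℝ) < d - 2 + m := by linarith
  have h2 : (0:ℝ) < d + m := by linarith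
  have : (1/2 - 1/(2*((d:ℝ)+m)/((d:ℝ)-2+m))) = 1/((d:ℝ)+m) := by
    rw [one_div_div]; field_simp; ring
  rw [this]; field_simp

theorem shell_all (d k : ℕ) (hk1 : 1 ≤ k) (hkd : k + 1 ≤ d) (p : ℝ) (hp : 2 < p) :
    ∃ C : ℝ, 0 < C ∧ ∀ δ, 0 < δ → δ ≤ 1/2 → ∀ U : Rd d → ℂ, Measurable U →
      (∀ ξ, U ξ ≠ 0 → |‖ξ‖ - 1| ≤ δ) → BSym (stdB d k (by omega)) U → MemLp U 2 volume →
      eLpNorm (𝓕⁻ U) (ENNReal.ofReal p) volume ≤ ENNReal.ofReal (C*δ^(min 1 (alphaK d k p)/2)) * eLpNorm U 2 volume := by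
  set m := min k (d-k) with hm
  have hm1 : (1:ℝ) ≤ m := by exact_mod_cast (by omega : 1 ≤ m)
  have hd2 : (2:ℝ) ≤ d := by exact_mod_cast (by omega : 2 ≤ d)
  have hpm : (0:ℝ) < (d:ℝ) - 2 + m := by linarith
  set q := twoStarK d k with hq
  have hq' : q = 2*((d:ℝ)+m)/((d:ℝ)-2+m) := rfl
  have hmono : ∀ t : ℝ, (m:ℝ) ≤ t → 2*((d:ℝ)+t)/((d:ℝ)-2+t) ≤ q := by
    intro t ht
    rw [hq', div_le_div_iff₀ (by linarith) hpm]; nlinarith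
  have hq2 : 2 < q := by rw [hq', lt_div_iff₀ hpm]; linarith
  have hma : (m:ℝ) ≤ ((d-k : ℕ):ℝ) := by exact_mod_cast (min_le_right _ _)
  have hmb : (m:ℝ) ≤ ((k : ℕ):ℝ) := by exact_mod_cast (min_le_left _ _)
  have key := fun q' (h : q ≤ q') => shell_star (stdB d k (by omega)) (by omega) hk1 (by omega) q' ((hmono _ hma).trans h) ((hmono _ hmb).trans h) (by linarith)
  have hα := alpha_eq d k hk1 hkd p
  have h1q : 1/q = 1/2 - 1/((d:ℝ)+m) := by
    rw [hq', one_div_div]; field_simp; ring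
  rcases le_or_gt q p with hqp | hqp
  · have : 1 ≤ alphaK d k p := by
      have h3 : 1/p ≤ 1/q := one_div_le_one_div_of_le (by linarith) hqp
      rw [hα]
      have h4 : 1/((d:ℝ)+m) ≤ 1/2-1/p := by linarith
      rw [div_le_iff₀ (by linarith)] at h4
      exact h4
    rw [min_eq_left this]
    obtain ⟨C, hC, h⟩ := key p hqp
    refine ⟨C, hC, fun δ hδ hδ' U hm hsup hsym hL => ?_⟩
    rw [← Real.sqrt_eq_rpow]
    exact h δ hδ hδ' U hm hsup hsym hL
  · set α := alphaK d k p with hαd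
    have hα1 : α < 1 := by
      have h3 : 1/q < 1/p := one_div_lt_one_div_of_lt (by linarith) hqp
      rw [hα]
      have h4 : 1/2-1/p < 1/((d:ℝ)+m) := by linarith
      rw [lt_div_iff₀ (by linarith)] at h4
      exact h4
    have hα0 : 0 ≤ α := by
      rw [hα]
      have h3 : 1/p ≤ 1/2 := one_div_le_one_div_of_le (by norm_num) hp.le
      apply mul_nonneg (by linarith); positivity
    rw [min_eq_right hα1.le]
    obtain ⟨C, hC, h⟩ := key q le_rfl
    obtain ⟨C3, hC3, h3⟩ := shell_l1 d (by omega)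
    refine ⟨C^α, by positivity, fun δ hδ hδ' U hm hsup hsym hL => ?_⟩
    have hU := h δ hδ hδ' U hm hsup hsym hL
    have hi : Integrable U volume := int_of_l1 hm hL (h3 δ hδ hδ' U hm hsup)
    have hin := interp_two (μ := volume) (𝓕⁻ U) (finv_cont U hi).measurable.aemeasurable p q α (by linarith) (by linarith) hα0 hα1.le (by
      have h5 : α/q = α*(1/q) := by ring
      have h6 : ((d:ℝ)+m) ≠ 0 := by linarith
      rw [h5, h1q, hα]; field_simp; ring)
    rw [(planch_inv_L1L2 U hi hL).2] at hin
    refine hin.trans ?_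
    calc eLpNorm U 2 volume^(1-α) * eLpNorm (𝓕⁻ U) (ENNReal.ofReal q) volume^α ≤ eLpNorm U 2 volume^(1-α) * (ENNReal.ofReal (C*√δ) * eLpNorm U 2 volume)^α := by gcongr
      _ = ENNReal.ofReal (C*√δ)^α * (eLpNorm U 2 volume^(1-α) * eLpNorm U 2 volume^α) := by
          rw [ENNReal.mul_rpow_of_nonneg _ _ hα0]; ring
      _ = _ := by
          rw [← ENNReal.rpow_add_of_nonneg _ _ (by linarith) hα0, show 1-α+α = 1 by ring, ENNReal.rpow_one, ENNReal.ofReal_rpow_of_nonneg (by positivity) hα0, Real.mul_rpow hC.le (by positivity), Real.sqrt_eq_rpow, ← Real.rpow_mul hδ.le]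
          congr 4; ring
end


open MeasureTheory Real Filter
open scoped ENNReal FourierTransform RealInnerProductSpace Topology

noncomputable section


def QQ {d : ℕ} (g : ℝ → ℝ) (U : Rd d → ℂ) : ℝ≥0∞ := ∫⁻ ξ, ‖U ξ‖ₑ^(2:ℝ) * ENNReal.ofReal (g ‖ξ‖)

def cut {d : ℕ} (E : Set ℝ) (U : Rd d → ℂ) : Rd d → ℂ := Set.indicator {ξ | ‖ξ‖ ∈ E} U

theorem cut_meas {d : ℕ} {E : Set ℝ} (hE : MeasurableSet E) {U : Rd d → ℂ} (hU : Measurable U) : Measurable (cut E U) :=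
  hU.indicator (measurable_norm hE)

theorem cut_mem {d : ℕ} {E : Set ℝ} (hE : MeasurableSet E) {U : Rd d → ℂ} (hU : MemLp U 2 volume) : MemLp (cut E U) 2 volume :=
  hU.indicator (measurable_norm hE)

theorem cut_sym {d a b : ℕ} (B : Blk d a b) (E : Set ℝ) {U : Rd d → ℂ} (hU : BSym B U) : BSym B (cut E U) := by
  intro x y e1 e2
  have h : ‖x‖ = ‖y‖ := by
    rw [← sq_eq_sq₀ (norm_nonneg _) (norm_nonneg _), B.nsq x, B.nsq y, e1, e2]
  unfold cut
  have hm : x ∈ {ξ : Rd d | ‖ξ‖ ∈ E} ↔ y ∈ {ξ : Rd d | ‖ξ‖ ∈ E} := by simp only [Set.mem_ofPred_eq, h]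
  by_cases hx : x ∈ {ξ : Rd d | ‖ξ‖ ∈ E}
  · rw [Set.indicator_of_mem hx, Set.indicator_of_mem (hm.1 hx), hU x y e1 e2]
  · rw [Set.indicator_of_notMem hx, Set.indicator_of_notMem (fun h => hx (hm.2 h))]

theorem cut_ne {d : ℕ} {E : Set ℝ} {U : Rd d → ℂ} {ξ} (h : cut E U ξ ≠ 0) : ‖ξ‖ ∈ E ∧ U ξ ≠ 0 := by
  have hm := Set.mem_of_indicator_ne_zero h
  exact ⟨hm, by rwa [cut, Set.indicator_of_mem hm] at h⟩

theorem cut_split {d : ℕ} (E F G : Set ℝ) (U : Rd d → ℂ) (h : G = E ∪ F) (hd : Disjoint E F) : cut G U = cut E U + cut F U := by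
  unfold cut
  have hd' : Disjoint {ξ : Rd d | ‖ξ‖ ∈ E} {ξ : Rd d | ‖ξ‖ ∈ F} := by
    rw [Set.disjoint_left] at *
    intro ξ h1 h2; exact hd h1 h2
  have := Set.indicator_union_of_disjoint hd' U
  rw [h]
  exact this

theorem l2_w {d : ℕ} (g : ℝ → ℝ) (U : Rd d → ℂ) (E : Set ℝ) (w : ℝ) (hw : 0 < w) (h : ∀ r ∈ E, 0 ≤ r → w ≤ g r) :
    eLpNorm (cut E U) 2 volume ≤ ENNReal.ofReal (w^(-(1/2):ℝ)) * (QQ g U)^(1/2:ℝ) := by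
  rw [e2_eq]
  have h1 : ENNReal.ofReal w * ∫⁻ ξ, ‖cut E U ξ‖ₑ^(2:ℝ) ≤ QQ g U := by
    rw [← lintegral_const_mul' _ _ ENNReal.ofReal_ne_top]
    apply lintegral_mono; intro ξ
    simp only
    by_cases hξ : cut E U ξ = 0
    · simp [hξ]
    · have := cut_ne hξ
      have e : cut E U ξ = U ξ := Set.indicator_of_mem (s := {ξ : Rd d | ‖ξ‖ ∈ E}) this.1 U
      rw [e, mul_comm]
      gcongr
      exact h _ this.1 (norm_nonneg _)
  have h2 : ∫⁻ ξ, ‖cut E U ξ‖ₑ^(2:ℝ) ≤ ENNReal.ofReal (w⁻¹) * QQ g U := by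
    calc ∫⁻ ξ, ‖cut E U ξ‖ₑ^(2:ℝ) = ENNReal.ofReal (w⁻¹) * (ENNReal.ofReal w * ∫⁻ ξ, ‖cut E U ξ‖ₑ^(2:ℝ)) := by
          rw [← mul_assoc, ← ENNReal.ofReal_mul (by positivity), inv_mul_cancel₀ hw.ne', ENNReal.ofReal_one, one_mul]
      _ ≤ _ := by gcongr
  refine (ENNReal.rpow_le_rpow h2 (by norm_num)).trans (le_of_eq ?_)
  rw [ENNReal.mul_rpow_of_nonneg _ _ (by norm_num), ENNReal.ofReal_rpow_of_nonneg (by positivity) (by norm_num), Real.inv_rpow hw.le, Real.rpow_neg hw.le]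

/-- dyadic telescoping -/
theorem tele {d : ℕ} (p : ℝ) (hp : 1 ≤ p) (U : Rd d → ℂ) (E : ℕ → Set ℝ) (hE : Monotone E)
    (hi : ∀ j, Integrable (cut (E j) U) volume) (hi' : ∀ j, Integrable (cut (E (j+1) \ E j) U) volume) (b : ℕ → ℝ≥0∞)
    (h0 : eLpNorm (𝓕⁻ (cut (E 0) U)) (ENNReal.ofReal p) volume ≤ b 0)
    (h1 : ∀ j, eLpNorm (𝓕⁻ (cut (E (j+1) \ E j) U)) (ENNReal.ofReal p) volume ≤ b (j+1)) (n : ℕ) :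
    eLpNorm (𝓕⁻ (cut (E n) U)) (ENNReal.ofReal p) volume ≤ ∑ j ∈ Finset.range (n+1), b j := by
  induction n with
  | zero => simpa using h0
  | succ n ih =>
    rw [Finset.sum_range_succ]
    rw [cut_split (E n) (E (n+1) \ E n) (E (n+1)) U (by rw [Set.union_sdiff_cancel (hE (Nat.le_succ n))]) Set.disjoint_sdiff_right]
    rw [finv_add _ _ (hi n) (hi' n)]
    refine (eLpNorm_add_le (finv_cont _ (hi n)).aestronglyMeasurable (finv_cont _ (hi' n)).aestronglyMeasurable (by rw [← ENNReal.ofReal_one]; exact ENNReal.ofReal_le_ofReal hp)).trans ?_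
    exact add_le_add ih (h1 n)

theorem geomQ_le (K r : ℝ) (hK : 0 ≤ K) (h0 : 0 ≤ r) (h1 : r < 1) (n : ℕ) (Q : ℝ≥0∞) :
    ∑ j ∈ Finset.range n, ENNReal.ofReal (K * r^j) * Q ≤ ENNReal.ofReal (K * (1-r)⁻¹) * Q := by
  rw [← Finset.sum_mul, ← ENNReal.ofReal_sum_of_nonneg (fun i _ => by positivity), ← Finset.mul_sum]
  gcongr
  rw [← tsum_geometric_of_lt_one h0 h1]
  exact (summable_geometric_of_lt_one h0 h1).sum_le_tsum _ (fun i _ => by positivity)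

theorem int_bdd {d : ℕ} {U : Rd d → ℂ} (hm : Measurable U) (hL : MemLp U 2 volume) (R : ℝ) (h : ∀ ξ, U ξ ≠ 0 → ‖ξ‖ ≤ R) : Integrable U volume := by
  have := l1_le (μ := volume) U hm (Metric.closedBall 0 R) Metric.isClosed_closedBall.measurableSet (fun x hx => by simpa using h x hx)
  refine ⟨hm.aestronglyMeasurable, lt_of_le_of_lt this (ENNReal.mul_lt_top ?_ hL.eLpNorm_lt_top)⟩
  exact ENNReal.rpow_lt_top_of_nonneg (by norm_num) (isCompact_closedBall _ _).measure_lt_top.ne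

/-- near part -/
theorem near_part (d k : ℕ) (hk1 : 1 ≤ k) (hkd : k + 1 ≤ d) (p γ c : ℝ) (hp : 2 < p) (hγ : 1 < γ) (hc : 0 < c) :
    ∃ C : ℝ, 0 < C ∧ ∀ ε, 0 < ε → ε < 1 → ∀ g : ℝ → ℝ, (∀ r : ℝ, |r - 1| ≤ 1/2 → c * (ε + |r - 1| ^ γ) ≤ g r) →
      ∀ U : Rd d → ℂ, Measurable U → BSym (stdB d k (by omega)) U → MemLp U 2 volume →
      eLpNorm (𝓕⁻ (cut {r | |r-1| ≤ 1/2} U)) (ENNReal.ofReal p) volume ≤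
        ENNReal.ofReal (C*ε^(min 1 (alphaK d k p)/2/γ - 1/2)) * (QQ g U)^(1/2:ℝ) := by
  obtain ⟨C0, hC0, h⟩ := shell_all d k hk1 hkd p hp
  set β := min 1 (alphaK d k p)/2 with hβ
  have hβ1 : β ≤ 1/2 := by
    have : min 1 (alphaK d k p) ≤ 1 := min_le_left _ _
    rw [hβ]; linarith
  have hβ0 : 0 ≤ β := by
    have : 0 ≤ alphaK d k p := by
      rw [alpha_eq d k hk1 hkd]
      have h3 : 1/p ≤ 1/2 := one_div_le_one_div_of_le (by norm_num) hp.le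
      apply mul_nonneg (by linarith); positivity
    have : 0 ≤ min 1 (alphaK d k p) := le_min zero_le_one this
    rw [hβ]; linarith
  set r : ℝ := 2^(β - γ/2) with hr
  have hr0 : 0 < r := by positivity
  have hr1 : r < 1 := Real.rpow_lt_one_of_one_lt_of_neg (by norm_num) (by linarith)
  set K1 := C0 * (c*2^(-γ))^(-(1/2):ℝ) with hK1
  have hK1p : 0 < K1 := by positivity
  refine ⟨K1 * (1-r)⁻¹, mul_pos hK1p (inv_pos.2 (by linarith)), fun ε h0 h1 g hg U hm hsym hL => ?_⟩
  set δ := ε^(1/γ) with hδ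
  have hδ0 : 0 < δ := by positivity
  have hδγ : δ^γ = ε := by rw [hδ, ← Real.rpow_mul h0.le, one_div_mul_cancel (by linarith), Real.rpow_one]
  set E : ℕ → Set ℝ := fun j => {r | |r-1| ≤ min (2^j*δ) (1/2)} with hE
  have hEm : Monotone E := by
    intro i j hij x hx
    have : (2:ℝ)^i ≤ 2^j := pow_le_pow_right₀ (by norm_num) hij
    have hx : |x-1| ≤ min (2^i*δ) (1/2) := hx
    refine hx.trans (min_le_min (by gcongr) le_rfl)
  have hEms : ∀ j, MeasurableSet (E j) := fun j => measurableSet_le (by fun_prop) measurable_const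
  have hsupp : ∀ F : Set ℝ, (∀ r ∈ F, |r-1| ≤ 1/2) → ∀ ξ : Rd d, cut F U ξ ≠ 0 → ‖ξ‖ ≤ 2 := by
    intro F hF ξ hξ
    have := hF _ (cut_ne hξ).1
    rw [abs_le] at this; linarith
  have hle : ∀ j, ∀ r ∈ E j, |r-1| ≤ 1/2 := fun j r hr => le_trans (show _ ≤ _ from hr) (min_le_right _ _)
  set b : ℕ → ℝ≥0∞ := fun j => ENNReal.ofReal (K1*ε^(β/γ-1/2) * r^j) * (QQ g U)^(1/2:ℝ) with hb
  have piece : ∀ j : ℕ, ∀ F : Set ℝ, MeasurableSet F → F ⊆ E j → (∀ r ∈ F, 0 ≤ r → c*2^(-γ)*(ε*2^((j:ℝ)*γ)) ≤ g r) → eLpNorm (𝓕⁻ (cut F U)) (ENNReal.ofReal p) volume ≤ b j := by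
    intro j F hF hFE hw
    have hd : 0 < min (2^j*δ) (1/2) := lt_min (by positivity) (by norm_num)
    refine (h _ hd (min_le_right _ _) (cut F U) (cut_meas hF hm) (fun ξ hξ => hFE (cut_ne hξ).1) (cut_sym _ _ hsym) (cut_mem hF hL)).trans ?_
    refine (mul_le_mul' le_rfl (l2_w g U F _ (by positivity) hw)).trans ?_
    rw [← mul_assoc, ← ENNReal.ofReal_mul (by positivity)]
    simp only [hb]
    refine mul_le_mul' (ENNReal.ofReal_le_ofReal ?_) le_rfl
    calc C0 * (min (2^j*δ) (1/2))^β * (c*2^(-γ)*(ε*2^((j:ℝ)*γ)))^(-(1/2):ℝ) ≤ C0 * (2^j*δ)^β * (c*2^(-γ)*(ε*2^((j:ℝ)*γ)))^(-(1/2):ℝ) := by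
          gcongr; exact min_le_left _ _
      _ = _ := by
          rw [Real.mul_rpow (by positivity) (by positivity) (x := c*2^(-γ)), Real.mul_rpow h0.le (by positivity), Real.mul_rpow (by positivity) hδ0.le, hK1, hr, hδ, ← Real.rpow_mul h0.le, ← Real.rpow_natCast, ← Real.rpow_natCast, ← Real.rpow_mul (by norm_num), ← Real.rpow_mul (by norm_num), ← Real.rpow_mul (by norm_num), show β/γ - 1/2 = 1/γ*β + -(1/2) by ring, Real.rpow_add h0, show (β-γ/2)*(j:ℝ) = j*β + j*γ * -(1/2) by ring, Real.rpow_add (by norm_num)]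
          ring
  have base := piece 0 (E 0) (hEms 0) subset_rfl (by
    intro r hr hr0
    refine le_trans ?_ (hg r (hle 0 r hr))
    have h2 : (2:ℝ)^(-γ) ≤ 1 := Real.rpow_le_one_of_one_le_of_nonpos (by norm_num) (by linarith)
    have h3 : 0 ≤ |r-1|^γ := by positivity
    simp only [Nat.cast_zero, zero_mul, Real.rpow_zero, mul_one]
    rw [mul_assoc]
    gcongr
    nlinarith)
  have step : ∀ j, eLpNorm (𝓕⁻ (cut (E (j+1) \ E j) U)) (ENNReal.ofReal p) volume ≤ b (j+1) := by
    intro j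
    refine piece (j+1) _ ((hEms (j+1)).diff (hEms j)) Set.sdiff_subset ?_
    intro r hr hr0
    refine le_trans ?_ (hg r (hle _ r hr.1))
    have h2 : min (2^j*δ) (1/2) < |r-1| := not_le.1 hr.2
    have h3 := hle _ r hr.1
    have h4 : 2^j*δ < |r-1| := by
      rcases min_lt_iff.1 h2 with h | h
      · exact h
      · linarith
    have h5 : (2^j*δ)^γ ≤ |r-1|^γ := Real.rpow_le_rpow (by positivity) h4.le (by linarith)
    rw [Real.mul_rpow (by positivity) hδ0.le, hδγ, ← Real.rpow_natCast, ← Real.rpow_mul (by norm_num)] at h5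
    rw [mul_assoc]
    gcongr
    calc (2:ℝ)^(-γ)*(ε*2^(((j+1:ℕ):ℝ)*γ)) = 2^((j:ℝ)*γ) * ε := by
          push_cast
          rw [show ((j:ℝ)+1)*γ = (j:ℝ)*γ + γ by ring, Real.rpow_add (by norm_num), Real.rpow_neg (by norm_num)]
          have : (2:ℝ)^γ ≠ 0 := by positivity
          field_simp
      _ ≤ _ := by linarith
  have hi : ∀ j, Integrable (cut (E j) U) volume := fun j => int_bdd (cut_meas (hEms j) hm) (cut_mem (hEms j) hL) 2 (hsupp _ (hle j))
  have hi' : ∀ j, Integrable (cut (E (j+1) \ E j) U) volume := fun j => int_bdd (cut_meas ((hEms _).diff (hEms _)) hm) (cut_mem ((hEms _).diff (hEms _)) hL) 2 (hsupp _ (fun r hr => hle _ r hr.1))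
  obtain ⟨n, hn⟩ := pow_unbounded_of_one_lt (1/δ) (by norm_num : (1:ℝ) < 2)
  have hEn : {r : ℝ | |r-1| ≤ 1/2} = E n := by
    have : min (2^n*δ) (1/2) = 1/2 := by
      apply min_eq_right
      rw [div_lt_iff₀ hδ0] at hn; linarith
    simp only [hE, this]
  rw [hEn]
  refine (tele p (by linarith) U E hEm hi hi' b base step n).trans ?_
  refine (geomQ_le _ r (by positivity) hr0.le hr1 _ _).trans (le_of_eq ?_)
  congr 2; ring
end


open MeasureTheory Real Filter
open scoped ENNReal FourierTransform RealInnerProductSpace Topology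

noncomputable section


theorem interp_2inf {X : Type*} [MeasurableSpace X] {μ : Measure X} (f : X → ℂ) (p : ℝ) (hp : 2 < p) (A N : ℝ≥0∞) (hA : A ≠ ⊤) (hN : N ≠ ⊤)
    (h1 : ∀ x, ‖f x‖ₑ ≤ A * N) (h2 : eLpNorm f 2 μ ≤ N) : eLpNorm f (ENNReal.ofReal p) μ ≤ A^(1-2/p) * N := by
  have hp0 : 0 < p := by linarith
  have hM : A * N ≠ ⊤ := ENNReal.mul_ne_top hA hN
  rw [e2_eq] at h2
  rw [ep_eq f p hp0]
  have h3 : ∫⁻ x, ‖f x‖ₑ^(2:ℝ) ∂μ ≤ N^(2:ℝ) := by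
    have := ENNReal.rpow_le_rpow h2 (by norm_num : (0:ℝ) ≤ 2)
    rwa [← ENNReal.rpow_mul, one_div_mul_cancel (by norm_num), ENNReal.rpow_one] at this
  have h4 : ∫⁻ x, ‖f x‖ₑ^p ∂μ ≤ A^(p-2) * N^p := by
    calc ∫⁻ x, ‖f x‖ₑ^p ∂μ ≤ ∫⁻ x, (A*N)^(p-2) * ‖f x‖ₑ^(2:ℝ) ∂μ := by
          apply lintegral_mono; intro x
          have : ‖f x‖ₑ^p = ‖f x‖ₑ^(p-2) * ‖f x‖ₑ^(2:ℝ) := by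
            rw [← ENNReal.rpow_add_of_nonneg _ _ (by linarith) (by norm_num)]; congr 1; ring
          simp only
          rw [this]
          exact mul_le_mul' (ENNReal.rpow_le_rpow (h1 x) (by linarith)) le_rfl
      _ = (A*N)^(p-2) * ∫⁻ x, ‖f x‖ₑ^(2:ℝ) ∂μ := lintegral_const_mul' _ _ (ENNReal.rpow_ne_top_of_nonneg (by linarith) hM)
      _ ≤ (A*N)^(p-2) * N^(2:ℝ) := mul_le_mul' le_rfl h3
      _ = A^(p-2) * N^p := by
          rw [ENNReal.mul_rpow_of_nonneg _ _ (by linarith), mul_assoc, ← ENNReal.rpow_add_of_nonneg _ _ (by linarith) (by norm_num)]; congr 2; ring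
  refine (ENNReal.rpow_le_rpow h4 (by positivity : 0 ≤ 1/p)).trans (le_of_eq ?_)
  rw [ENNReal.mul_rpow_of_nonneg _ _ (by positivity), ← ENNReal.rpow_mul, ← ENNReal.rpow_mul, mul_one_div_cancel hp0.ne', ENNReal.rpow_one]
  congr 2; field_simp

theorem ball_piece (d : ℕ) (hd : 1 ≤ d) (p : ℝ) (hp : 2 < p) : ∃ C : ℝ, 0 < C ∧ ∀ R : ℝ, 0 < R → ∀ U : Rd d → ℂ, Measurable U →
    (∀ ξ, U ξ ≠ 0 → ‖ξ‖ ≤ R) → MemLp U 2 volume →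
    eLpNorm (𝓕⁻ U) (ENNReal.ofReal p) volume ≤ ENNReal.ofReal (C*R^((d:ℝ)*(1/2-1/p))) * eLpNorm U 2 volume := by
  set V := (volume (Metric.ball (0 : Rd d) 1)) with hV
  have hVt : V ≠ ⊤ := measure_ball_lt_top.ne
  have hV0 : 0 < V.toReal := ENNReal.toReal_pos (Metric.measure_ball_pos _ _ (by norm_num)).ne' hVt
  refine ⟨V.toReal^(1/2-1/p), by positivity, fun R hR U hm hs hL => ?_⟩
  have hi := int_bdd hm hL R hs
  have h1 := l1_le (μ := volume) U hm (Metric.closedBall 0 R) Metric.isClosed_closedBall.measurableSet (fun x hx => by simpa using hs x hx)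
  have h2 := (planch_inv_L1L2 U hi hL).2
  have hvol : volume (Metric.closedBall (0:Rd d) R) = ENNReal.ofReal (R^d * V.toReal) := by
    rw [Measure.addHaar_closedBall _ _ hR.le, finrank_euclideanSpace, Fintype.card_fin, ← hV, ENNReal.ofReal_mul (by positivity), ENNReal.ofReal_toReal hVt]
  rw [hvol] at h1
  have := interp_2inf (μ := volume) (𝓕⁻ U) p hp _ _ (ENNReal.rpow_ne_top_of_nonneg (by norm_num) ENNReal.ofReal_ne_top) hL.eLpNorm_lt_top.ne (fun x => (finv_sup U x).trans h1) h2.le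
  refine this.trans (le_of_eq ?_)
  congr 1
  rw [← ENNReal.rpow_mul]
  have hnn : 0 ≤ 1/2 * (1-2/p) := by
    have : 2/p ≤ 1 := by rw [div_le_one (by linarith)]; exact hp.le
    linarith
  rw [ENNReal.ofReal_rpow_of_nonneg (by positivity) hnn, Real.mul_rpow (by positivity) hV0.le, ← Real.rpow_natCast, ← Real.rpow_mul hR.le, mul_comm]
  congr 3
  · ring
  · ring

theorem far_ms (j : ℕ) : MeasurableSet {r : ℝ | 1/2 < |r-1| ∧ r ≤ 2^(j+1)} := by
  have h1 : MeasurableSet {r : ℝ | 1/2 < |r-1|} := measurableSet_lt measurable_const (by fun_prop)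
  have h2 : MeasurableSet {r : ℝ | r ≤ 2^(j+1)} := measurableSet_le (by fun_prop) measurable_const
  exact h1.inter h2

theorem far_part (d : ℕ) (hd : 1 ≤ d) (p s c : ℝ) (hp : 2 < p) (hs0 : 0 < s) (hs : (d:ℝ)*(1/2-1/p) < s) (hc : 0 < c) :
    ∃ C : ℝ, 0 < C ∧ ∀ g : ℝ → ℝ, (∀ r : ℝ, 1/2 ≤ |r - 1| → c * (1 + |r| ^ (2*s)) ≤ g r) →
      ∀ U : Rd d → ℂ, Measurable U → MemLp U 2 volume → ∀ n : ℕ,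
      eLpNorm (𝓕⁻ (cut {r | 1/2 < |r-1| ∧ r ≤ 2^(n+1)} U)) (ENNReal.ofReal p) volume ≤
        ENNReal.ofReal C * (QQ g U)^(1/2:ℝ) := by
  obtain ⟨C0, hC0, h⟩ := ball_piece d hd p hp
  set σ := (d:ℝ)*(1/2-1/p) with hσ
  set r : ℝ := 2^(σ - s) with hr
  have hr0 : 0 < r := by positivity
  have hr1 : r < 1 := Real.rpow_lt_one_of_one_lt_of_neg (by norm_num) (by linarith)
  set K1 := C0 * 2^σ * c^(-(1/2):ℝ) with hK1
  have hK1p : 0 < K1 := by positivity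
  refine ⟨K1 * (1-r)⁻¹, mul_pos hK1p (inv_pos.2 (by linarith)), fun g hg U hm hL n => ?_⟩
  set E : ℕ → Set ℝ := fun j => {r | 1/2 < |r-1| ∧ r ≤ 2^(j+1)} with hE
  have hEm : Monotone E := by
    intro i j hij x hx
    have : (2:ℝ)^(i+1) ≤ 2^(j+1) := pow_le_pow_right₀ (by norm_num) (by omega)
    exact ⟨hx.1, hx.2.trans this⟩
  have hEms : ∀ j, MeasurableSet (E j) := fun j => far_ms j
  set b : ℕ → ℝ≥0∞ := fun j => ENNReal.ofReal (K1 * r^j) * (QQ g U)^(1/2:ℝ) with hb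
  have piece : ∀ j : ℕ, ∀ F : Set ℝ, MeasurableSet F → F ⊆ E j → (∀ r ∈ F, 0 ≤ r → c*2^((j:ℝ)*(2*s)) ≤ g r) → eLpNorm (𝓕⁻ (cut F U)) (ENNReal.ofReal p) volume ≤ b j := by
    intro j F hF hFE hw
    refine (h (2^(j+1)) (by positivity) (cut F U) (cut_meas hF hm) (fun ξ hξ => (hFE (cut_ne hξ).1).2) (cut_mem hF hL)).trans ?_
    refine (mul_le_mul' le_rfl (l2_w g U F _ (by positivity) hw)).trans ?_
    rw [← mul_assoc, ← ENNReal.ofReal_mul (by positivity)]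
    simp only [hb]
    refine mul_le_mul' (ENNReal.ofReal_le_ofReal (le_of_eq ?_)) le_rfl
    rw [Real.mul_rpow hc.le (by positivity), hK1, hr, ← Real.rpow_natCast, ← Real.rpow_natCast, ← Real.rpow_mul (by norm_num), ← Real.rpow_mul (by norm_num), ← Real.rpow_mul (by norm_num)]
    push_cast
    rw [show (σ-s)*(j:ℝ) = j*σ + j*(2*s) * -(1/2) by ring, Real.rpow_add (by norm_num), show ((j:ℝ)+1)*σ = j*σ+σ by ring, Real.rpow_add (by norm_num)]
    ring
  have base := piece 0 (E 0) (hEms 0) subset_rfl (by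
    intro r hr hr0
    refine le_trans ?_ (hg r hr.1.le)
    have h3 : 0 ≤ |r|^(2*s) := by positivity
    simp only [Nat.cast_zero, zero_mul, Real.rpow_zero]
    gcongr
    linarith)
  have step : ∀ j, eLpNorm (𝓕⁻ (cut (E (j+1) \ E j) U)) (ENNReal.ofReal p) volume ≤ b (j+1) := by
    intro j
    refine piece (j+1) _ ((hEms (j+1)).diff (hEms j)) Set.sdiff_subset ?_
    intro r hr hr0
    refine le_trans ?_ (hg r hr.1.1.le)
    have h2 : 2^(j+1) < r := by
      by_contra hcon
      exact hr.2 ⟨hr.1.1, not_lt.1 hcon⟩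
    have h5 : (2^(j+1))^(2*s) ≤ |r|^(2*s) := Real.rpow_le_rpow (by positivity) (by rw [abs_of_nonneg hr0]; exact h2.le) (by linarith)
    rw [← Real.rpow_natCast, ← Real.rpow_mul (by norm_num)] at h5
    gcongr
    linarith
  have hi : ∀ j, Integrable (cut (E j) U) volume := fun j => int_bdd (cut_meas (hEms j) hm) (cut_mem (hEms j) hL) (2^(j+1)) (fun ξ hξ => (cut_ne hξ).1.2)
  have hi' : ∀ j, Integrable (cut (E (j+1) \ E j) U) volume := fun j => int_bdd (cut_meas ((hEms _).diff (hEms _)) hm) (cut_mem ((hEms _).diff (hEms _)) hL) (2^(j+1+1)) (fun ξ hξ => (cut_ne hξ).1.1.2)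
  refine (tele p (by linarith) U E hEm hi hi' b base step n).trans ?_
  exact (geomQ_le _ r hK1p.le hr0.le hr1 _ _)

theorem lower_core (d k : ℕ) (hk1 : 1 ≤ k) (hkd : k + 1 ≤ d) (p γ s c : ℝ) (hp : 2 < p) (hγ : 1 < γ) (hs0 : 0 < s) (hs : (d:ℝ)*(1/2-1/p) < s) (hc : 0 < c) :
    ∃ C : ℝ, 0 < C ∧ ∀ ε, 0 < ε → ε < 1 → ∀ g : ℝ → ℝ, (∀ r : ℝ, |r - 1| ≤ 1/2 → c * (ε + |r - 1| ^ γ) ≤ g r) →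
      (∀ r : ℝ, 1/2 ≤ |r - 1| → c * (1 + |r| ^ (2*s)) ≤ g r) →
      ∀ U : Rd d → ℂ, Measurable U → BSym (stdB d k (by omega)) U → MemLp U 2 volume → ∀ n : ℕ,
      eLpNorm (𝓕⁻ (cut {r | r ≤ 2^(n+1)} U)) (ENNReal.ofReal p) volume ≤
        ENNReal.ofReal (C*ε^(min 1 (alphaK d k p)/2/γ - 1/2)) * (QQ g U)^(1/2:ℝ) := by
  obtain ⟨C1, hC1, h1⟩ := near_part d k hk1 hkd p γ c hp hγ hc
  obtain ⟨C2, hC2, h2⟩ := far_part d (by omega) p s c hp hs0 hs hc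
  refine ⟨C1 + C2, by positivity, fun ε h0 hε g hg1 hg2 U hm hsym hL n => ?_⟩
  have hpw : 1 ≤ ε^(min 1 (alphaK d k p)/2/γ - 1/2) := by
    apply Real.one_le_rpow_of_pos_of_le_one_of_nonpos h0 hε.le
    have : min 1 (alphaK d k p) ≤ 1 := min_le_left _ _
    have : min 1 (alphaK d k p)/2/γ ≤ 1/2 := by
      rw [div_le_iff₀ (by linarith)]; linarith
    linarith
  have m1 : MeasurableSet {r : ℝ | |r-1| ≤ 1/2} := measurableSet_le (by fun_prop) measurable_const
  have m2 : MeasurableSet {r : ℝ | 1/2 < |r-1| ∧ r ≤ 2^(n+1)} := far_ms _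
  have hp2 : (2:ℝ) ≤ 2^(n+1) := by rw [pow_succ]; have : (1:ℝ) ≤ 2^n := one_le_pow₀ (by norm_num)
                                   linarith
  rw [cut_split {r : ℝ | |r-1| ≤ 1/2} {r : ℝ | 1/2 < |r-1| ∧ r ≤ 2^(n+1)} _ U ?_ ?_]
  · have i1 : Integrable (cut {r : ℝ | |r-1| ≤ 1/2} U) volume := int_bdd (cut_meas m1 hm) (cut_mem m1 hL) 2 (by
      intro ξ hξ
      have := (cut_ne hξ).1
      simp only [Set.mem_ofPred_eq, abs_le] at this; linarith)
    have i2 : Integrable (cut {r : ℝ | 1/2 < |r-1| ∧ r ≤ 2^(n+1)} U) volume := int_bdd (cut_meas m2 hm) (cut_mem m2 hL) (2^(n+1)) (fun ξ hξ => (cut_ne hξ).1.2)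
    rw [finv_add _ _ i1 i2]
    refine (eLpNorm_add_le (finv_cont _ i1).aestronglyMeasurable (finv_cont _ i2).aestronglyMeasurable (by rw [← ENNReal.ofReal_one]; exact ENNReal.ofReal_le_ofReal (by linarith))).trans ?_
    rw [add_mul C1, ENNReal.ofReal_add (by positivity) (by positivity), add_mul]
    refine add_le_add (h1 ε h0 hε g hg1 U hm hsym hL) ((h2 g hg2 U hm hL n).trans ?_)
    gcongr
    nlinarith
  · ext r; simp only [Set.mem_ofPred_eq, Set.mem_union]
    constructor
    · intro h
      rcases le_or_gt |r-1| (1/2) with h' | h'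
      · exact Or.inl h'
      · exact Or.inr ⟨h', h⟩
    · rintro (h | h)
      · rw [abs_le] at h; linarith
      · exact h.2
  · rw [Set.disjoint_left]
    intro r hr hr'
    exact absurd hr'.1 (not_lt.2 hr)
end


open MeasureTheory Real Filter
open scoped ENNReal FourierTransform RealInnerProductSpace Topology

noncomputable section


/-- block isometries act transitively on the level sets -/
theorem blk_move {d a b : ℕ} (B : Blk d a b) (x y : Rd d) (h1 : ‖(B.e x).1‖ = ‖(B.e y).1‖) (h2 : ‖(B.e x).2‖ = ‖(B.e y).2‖) :
    ∃ T : Rd d ≃ᵐ Rd d, MeasurePreserving T volume volume ∧ T x = y ∧ (∀ z w, ⟪T z, T w⟫ = ⟪z, w⟫) ∧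
      ∀ z, ‖(B.e (T z)).1‖ = ‖(B.e z).1‖ ∧ ‖(B.e (T z)).2‖ = ‖(B.e z).2‖ := by
  obtain ⟨R1, hR1⟩ := exists_isometry_map _ _ h1
  obtain ⟨R2, hR2⟩ := exists_isometry_map _ _ h2
  set P : EB a × EB b ≃ᵐ EB a × EB b := R1.toMeasurableEquiv.prodCongr R2.toMeasurableEquiv with hP
  have hPa : ∀ z, P z = (R1 z.1, R2 z.2) := fun z => rfl
  have hPm : MeasurePreserving P volume volume := R1.measurePreserving.prod R2.measurePreserving
  have hT : ∀ z, B.e ((B.e.trans (P.trans B.e.symm)) z) = (R1 (B.e z).1, R2 (B.e z).2) := by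
    intro z; simp [hPa]
  refine ⟨B.e.trans (P.trans B.e.symm), B.mp.trans (hPm.trans B.mp.symm), ?_, ?_, ?_⟩
  · apply B.e.injective
    rw [hT, hR1, hR2]
  · intro z w
    rw [B.inn, hT, hT, B.inn z w]
    simp
  · intro z
    rw [hT]; simp

theorem bsym_fourierInv {d a b : ℕ} (B : Blk d a b) (f : Rd d → ℂ) (hf : BSym B f) : BSym B (𝓕⁻ f) := by
  intro x y h1 h2
  obtain ⟨T, hm, hxy, hin, hn⟩ := blk_move B x y h1 h2
  rw [fourierInv_ee, fourierInv_ee, ← hm.integral_comp T.measurableEmbedding (g := fun ξ => f ξ * ee ⟪ξ, y⟫)]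
  congr 1; funext ξ
  rw [← hxy, hin, hf (T ξ) ξ (hn ξ).1 (hn ξ).2]

theorem bsym_fourier {d a b : ℕ} (B : Blk d a b) (f : Rd d → ℂ) (hf : BSym B f) : BSym B (𝓕 f) := by
  intro x y h1 h2
  obtain ⟨T, hm, hxy, hin, hn⟩ := blk_move B x y h1 h2
  rw [fourier_ee, fourier_ee, ← hm.integral_comp T.measurableEmbedding (g := fun ξ => f ξ * ee (-⟪ξ, y⟫))]
  congr 1; funext ξ
  rw [← hxy, hin, hf (T ξ) ξ (hn ξ).1 (hn ξ).2]

theorem l2_trunc {X : Type*} [MeasurableSpace X] {μ : Measure X} (u : X → ℂ) (hu : MemLp u 2 μ) (S : ℕ → Set X) (hS : ∀ n, MeasurableSet (S n))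
    (h : ∀ x, ∀ᶠ n in atTop, x ∈ S n) : Tendsto (fun n => eLpNorm ((S n).indicator u - u) 2 μ) atTop (𝓝 0) := by
  simp_rw [e2_eq]
  have hfin : ∫⁻ x, ‖u x‖ₑ^(2:ℝ) ∂μ ≠ ⊤ := by
    have := hu.eLpNorm_lt_top
    rw [e2_eq] at this
    intro hc; rw [hc] at this; simp at this
  have key : Tendsto (fun n => ∫⁻ x, ‖((S n).indicator u - u) x‖ₑ^(2:ℝ) ∂μ) atTop (𝓝 (∫⁻ x, 0 ∂μ)) := by
    refine tendsto_lintegral_of_dominated_convergence' (fun x => ‖u x‖ₑ^(2:ℝ)) ?_ ?_ hfin ?_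
    · intro n
      exact ((((hu.1.indicator (hS n)).sub hu.1).enorm).pow_const _)
    · intro n
      refine Eventually.of_forall fun x => ?_
      simp only [Pi.sub_apply]
      by_cases hx : x ∈ S n
      · simp [hx]
      · simp [hx]
    · refine Eventually.of_forall fun x => ?_
      refine tendsto_const_nhds.congr' ?_
      filter_upwards [h x] with n hn
      simp [hn]
  rw [lintegral_zero] at key
  have := key.ennrpow_const (1/2)
  simpa using this

/-- a pointwise symmetric representative of the Fourier transform -/
theorem sym_rep {d a b : ℕ} (B : Blk d a b) (u U : Rd d → ℂ) (hu : MemLp u 2 volume) (hU : MemLp U 2 volume) (hFT : IsFT U u) (hs : BSym B u) :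
    ∃ W : Rd d → ℂ, Measurable W ∧ BSym B W ∧ W =ᵐ[volume] U := by
  set S : ℕ → Set (Rd d) := fun n => Metric.closedBall 0 n with hS
  have hSm : ∀ n, MeasurableSet (S n) := fun n => Metric.isClosed_closedBall.measurableSet
  have hSx : ∀ x, ∀ᶠ n in atTop, x ∈ S n := by
    intro x
    obtain ⟨N, hN⟩ := exists_nat_ge ‖x‖
    filter_upwards [eventually_ge_atTop N] with n hn
    have : (N:ℝ) ≤ n := by exact_mod_cast hn
    simp only [hS, Metric.mem_closedBall, dist_zero_right]; linarith
  set f : ℕ → Rd d → ℂ := fun n => (S n).indicator u with hf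
  have hf2 : ∀ n, MemLp (f n) 2 volume := fun n => hu.indicator (hSm n)
  have hf1 : ∀ n, Integrable (f n) volume := by
    intro n
    have h1 : IntegrableOn u (S n) volume := (memLp_locInt u hu).integrableOn_isCompact (isCompact_closedBall _ _)
    exact h1.integrable_indicator (hSm n)
  have hfs : ∀ n, BSym B (f n) := by
    intro n x y e1 e2
    have h : ‖x‖ = ‖y‖ := by
      rw [← sq_eq_sq₀ (norm_nonneg _) (norm_nonneg _), B.nsq x, B.nsq y, e1, e2]
    have hm : x ∈ S n ↔ y ∈ S n := by simp only [hS, Metric.mem_closedBall, dist_zero_right, h]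
    simp only [hf]
    by_cases hx : x ∈ S n
    · rw [Set.indicator_of_mem hx, Set.indicator_of_mem (hm.1 hx), hs x y e1 e2]
    · rw [Set.indicator_of_notMem hx, Set.indicator_of_notMem (fun h => hx (hm.2 h))]
  have hFc : ∀ n, Continuous (𝓕 (f n)) := fun n => VectorFourier.fourierIntegral_continuous Real.continuous_fourierChar
      (by exact continuous_inner) (hf1 n)
  have hpl : ∀ n, eLpNorm (𝓕 (f n) - U) 2 volume = eLpNorm (f n - u) 2 volume := by
    intro n
    refine planch_pair _ _ ((planch_L1L2 _ (hf1 n) (hf2 n)).1.sub hU) ((hf2 n).sub hu) ?_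
    intro φ
    have mφ : MemLp (⇑φ) 2 volume := φ.memLp 2 volume
    have mφ' : MemLp (𝓕 (⇑φ)) 2 volume := by
      rw [← SchwartzMap.fourier_coe]; exact (𝓕 φ).memLp 2 volume
    have I : ∀ f g : Rd d → ℂ, MemLp f 2 volume → MemLp g 2 volume → Integrable (fun x => f x * g x) volume := fun f g hf hg => hf.integrable_mul hg
    simp only [Pi.sub_apply, sub_mul]
    rw [integral_sub (I _ _ (planch_L1L2 _ (hf1 n) (hf2 n)).1 mφ) (I _ _ hU mφ), integral_sub (I _ _ (hf2 n) mφ') (I _ _ hu mφ'), fourier_pair (f n) (hf1 n), hFT φ]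
  have ht : Tendsto (fun n => eLpNorm (𝓕 (f n) - U) 2 volume) atTop (𝓝 0) := by
    simp_rw [hpl]; exact l2_trunc u hu S hSm hSx
  have hmeas := tendstoInMeasure_of_tendsto_eLpNorm_of_ne_top (by norm_num) (by norm_num) (fun n => (hFc n).aestronglyMeasurable) hU.1 ht
  obtain ⟨ns, -, hns⟩ := hmeas.exists_seq_tendsto_ae
  set G : Set (Rd d) := {ξ | ∃ l, Tendsto (fun i => 𝓕 (f (ns i)) ξ) atTop (𝓝 l)} with hG
  have hGm : MeasurableSet G := measurableSet_exists_tendsto (fun i => (hFc _).measurable)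
  set V : ℕ → Rd d → ℂ := fun i => G.indicator (𝓕 (f (ns i))) with hV
  have hVm : ∀ i, Measurable (V i) := fun i => (hFc _).measurable.indicator hGm
  have hVs : ∀ x y, ‖(B.e x).1‖ = ‖(B.e y).1‖ → ‖(B.e x).2‖ = ‖(B.e y).2‖ → (fun i => V i x) = fun i => V i y := by
    intro x y e1 e2
    have hp : ∀ i, 𝓕 (f (ns i)) x = 𝓕 (f (ns i)) y := fun i => bsym_fourier B _ (hfs _) x y e1 e2
    have hm : x ∈ G ↔ y ∈ G := by simp only [hG, Set.mem_ofPred_eq, hp]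
    funext i
    simp only [hV]
    by_cases hx : x ∈ G
    · rw [Set.indicator_of_mem hx, Set.indicator_of_mem (hm.1 hx), hp]
    · rw [Set.indicator_of_notMem hx, Set.indicator_of_notMem (fun h => hx (hm.2 h))]
  have hVt : ∀ ξ, ∃ l, Tendsto (fun i => V i ξ) atTop (𝓝 l) := by
    intro ξ
    by_cases hx : ξ ∈ G
    · obtain ⟨l, hl⟩ := id hx
      exact ⟨l, by simpa [hV, hx] using hl⟩
    · exact ⟨0, by simp [hV, hx]⟩
  refine ⟨fun ξ => limUnder atTop (fun i => V i ξ), ?_, ?_, ?_⟩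
  · exact measurable_of_tendsto_metrizable hVm (tendsto_pi_nhds.2 fun ξ => tendsto_nhds_limUnder (hVt ξ))
  · intro x y e1 e2
    simp only
    rw [hVs x y e1 e2]
  · filter_upwards [hns] with ξ hξ
    have hx : ξ ∈ G := ⟨_, hξ⟩
    apply Tendsto.limUnder_eq
    simpa [hV, hx] using hξ

/-- Fatou: it suffices to bound the frequency truncations -/
theorem fatou_trunc {d : ℕ} (u W : Rd d → ℂ) (hu : MemLp u 2 volume) (hm : Measurable W) (hW : MemLp W 2 volume) (hFT : IsFT W u) (p : ℝ) (M : ℝ≥0∞)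
    (h : ∀ n : ℕ, eLpNorm (𝓕⁻ (cut {r | r ≤ 2^(n+1)} W)) (ENNReal.ofReal p) volume ≤ M) : eLpNorm u (ENNReal.ofReal p) volume ≤ M := by
  set f : ℕ → Rd d → ℂ := fun n => cut {r | r ≤ 2^(n+1)} W with hf
  have hSm : ∀ n : ℕ, MeasurableSet {r : ℝ | r ≤ 2^(n+1)} := fun n => measurableSet_le (by fun_prop) measurable_const
  have hf2 : ∀ n, MemLp (f n) 2 volume := fun n => cut_mem (hSm n) hW
  have hf1 : ∀ n, Integrable (f n) volume := fun n => int_bdd (cut_meas (hSm n) hm) (hf2 n) (2^(n+1)) (fun ξ hξ => (cut_ne hξ).1)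
  have hpl : ∀ n, eLpNorm (𝓕⁻ (f n) - u) 2 volume = eLpNorm (f n - W) 2 volume := by
    intro n
    symm
    refine planch_pair _ _ ((hf2 n).sub hW) ((planch_inv_L1L2 _ (hf1 n) (hf2 n)).1.sub hu) ?_
    intro φ
    have mφ : MemLp (⇑φ) 2 volume := φ.memLp 2 volume
    have mφ' : MemLp (𝓕 (⇑φ)) 2 volume := by
      rw [← SchwartzMap.fourier_coe]; exact (𝓕 φ).memLp 2 volume
    have I : ∀ f g : Rd d → ℂ, MemLp f 2 volume → MemLp g 2 volume → Integrable (fun x => f x * g x) volume := fun f g hf hg => hf.integrable_mul hg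
    simp only [Pi.sub_apply, sub_mul]
    rw [integral_sub (I _ _ (hf2 n) mφ) (I _ _ hW mφ), integral_sub (I _ _ (planch_inv_L1L2 _ (hf1 n) (hf2 n)).1 mφ') (I _ _ hu mφ'), fourierInv_pair (f n) (hf1 n), hFT φ]
  have ht : Tendsto (fun n => eLpNorm (𝓕⁻ (f n) - u) 2 volume) atTop (𝓝 0) := by
    simp_rw [hpl]
    refine l2_trunc W hW (fun n => {ξ | ‖ξ‖ ∈ {r : ℝ | r ≤ 2^(n+1)}}) (fun n => measurable_norm (hSm n)) ?_
    intro x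
    obtain ⟨N, hN⟩ := pow_unbounded_of_one_lt ‖x‖ (by norm_num : (1:ℝ) < 2)
    filter_upwards [eventually_ge_atTop N] with n hn
    have : (2:ℝ)^N ≤ 2^(n+1) := pow_le_pow_right₀ (by norm_num) (by omega)
    change ‖x‖ ≤ 2^(n+1)
    linarith
  have hmeas := tendstoInMeasure_of_tendsto_eLpNorm_of_ne_top (by norm_num) (by norm_num) (fun n => (finv_cont _ (hf1 n)).aestronglyMeasurable) hu.1 ht
  obtain ⟨ns, -, hns⟩ := hmeas.exists_seq_tendsto_ae
  refine (Lp.eLpNorm_lim_le_liminf_eLpNorm (f := fun i => 𝓕⁻ (f (ns i))) (fun i => (finv_cont _ (hf1 _)).aestronglyMeasurable) u hns).trans ?_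
  refine (liminf_le_liminf (Eventually.of_forall fun i => h (ns i))).trans ?_
  simp
end


open MeasureTheory Real Filter
open scoped ENNReal FourierTransform RealInnerProductSpace Topology

noncomputable section


theorem g_upper (s γ c C : ℝ) (hs : 0 < s) (hγ : 1 < γ) (hc : 0 < c) (hcC : c ≤ C) (g : ℝ → ℝ → ℝ) (hg : IsAdmissible s γ c C g) (ε : ℝ) (h0 : 0 < ε) (h1 : ε < 1)
    (r : ℝ) (hr : 0 ≤ r) : g ε r ≤ 2*C*(1+r^2)^s := by
  have hC : 0 < C := lt_of_lt_of_le hc hcC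
  have hb : (1:ℝ) ≤ (1+r^2)^s := Real.one_le_rpow (by nlinarith) hs.le
  obtain ⟨-, -, h2, h3⟩ := hg
  rcases le_total |r-1| (1/2) with h | h
  · refine (h3 ε ⟨h0, h1⟩ r h).2.trans ?_
    have : |r-1|^γ ≤ 1 := Real.rpow_le_one (abs_nonneg _) (by linarith) (by linarith)
    have h5 : C*(ε+|r-1|^γ) ≤ C*2 := mul_le_mul_of_nonneg_left (by linarith) hC.le
    nlinarith
  · refine (h2 ε ⟨h0, h1⟩ r h).2.trans ?_
    have : |r|^(2*s) ≤ (1+r^2)^s := by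
      rw [Real.rpow_mul (abs_nonneg _), abs_of_nonneg hr]
      apply Real.rpow_le_rpow (by positivity) _ hs.le
      norm_cast; linarith
    have h5 : C*(1+|r|^(2*s)) ≤ C*(2*(1+r^2)^s) := mul_le_mul_of_nonneg_left (by linarith) hC.le
    linarith

theorem q_int {d : ℕ} (s γ c C : ℝ) (hs : 0 < s) (hγ : 1 < γ) (hc : 0 < c) (hcC : c ≤ C) (g : ℝ → ℝ → ℝ) (hg : IsAdmissible s γ c C g) (ε : ℝ) (h0 : 0 < ε) (h1 : ε < 1)
    (u : HsFn d s) : Integrable (fun ξ : Rd d => ‖u.ft ξ‖^2 * g ε ‖ξ‖) volume := by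
  refine Integrable.mono' (u.memHs.const_mul (2*C)) ?_ ?_
  · have hm : Measurable (g ε) := hg.1 ε ⟨h0, h1⟩
    have := u.ft_memL2.1.norm.pow 2
    exact this.mul (hm.comp measurable_norm).aestronglyMeasurable
  · refine Eventually.of_forall fun ξ => ?_
    have hp := hg.2.1 ε ⟨h0, h1⟩ ‖ξ‖
    rw [Real.norm_of_nonneg (by positivity)]
    have := g_upper s γ c C hs hγ hc hcC g hg ε h0 h1 ‖ξ‖ (norm_nonneg _)
    have h5 : ‖u.ft ξ‖^2 * g ε ‖ξ‖ ≤ ‖u.ft ξ‖^2 * (2*C*(1+‖ξ‖^2)^s) := mul_le_mul_of_nonneg_left this (by positivity)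
    refine h5.trans (le_of_eq ?_); ring

theorem lower_bound (d k : ℕ) (hk1 : 1 ≤ k) (hkd : k + 1 ≤ d) (p γ s c C : ℝ) (hp : 2 < p) (hγ : 1 < γ) (hs0 : 0 < s) (hs : (d:ℝ)*(1/2-1/p) < s) (hc : 0 < c) (hcC : c ≤ C) :
    ∃ c' : ℝ, 0 < c' ∧ ∀ g : ℝ → ℝ → ℝ, IsAdmissible s γ c C g → ∀ ε, 0 < ε → ε < 1 →
      ∀ t ∈ RayleighSet d s p (g ε) (GkSymmetric d k), c' * ε^(1 - min 1 (alphaK d k p)/γ) ≤ t := by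
  obtain ⟨K, hK, h⟩ := lower_core d k hk1 hkd p γ s c hp hγ hs0 hs hc
  refine ⟨(K^2)⁻¹, by positivity, fun g hg ε h0 h1 t ht => ?_⟩
  obtain ⟨u, hsym, hne, hLp, rfl⟩ := ht
  rw [gk_iff d k (by omega)] at hsym
  obtain ⟨W, hWm, hWs, hWU⟩ := sym_rep _ u.toFun u.ft u.memL2 u.ft_memL2 u.isFT hsym
  have hW2 : MemLp W 2 volume := (memLp_congr_ae hWU).2 u.ft_memL2
  have hWFT : IsFT W u.toFun := by
    intro φ
    rw [← u.isFT φ]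
    apply integral_congr_ae
    filter_upwards [hWU] with x hx
    rw [hx]
  have hcore := fatou_trunc u.toFun W u.memL2 hWm hW2 hWFT p _ (fun n => h ε h0 h1 (g ε) (fun r hr => (hg.2.2.2 ε ⟨h0, h1⟩ r hr).1) (fun r hr => (hg.2.2.1 ε ⟨h0, h1⟩ r hr).1) W hWm hWs hW2 n)
  have hqi := q_int s γ c C hs0 hγ hc hcC g hg ε h0 h1 u
  have hgp : ∀ ξ : Rd d, 0 ≤ ‖u.ft ξ‖^2 * g ε ‖ξ‖ := fun ξ => mul_nonneg (by positivity) (hg.2.1 ε ⟨h0, h1⟩ _).le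
  have hQ : QQ (g ε) W = ENNReal.ofReal (qeps (g ε) u) := by
    unfold QQ qeps
    rw [ofReal_integral_eq_lintegral_ofReal hqi (Eventually.of_forall hgp)]
    apply lintegral_congr_ae
    filter_upwards [hWU] with ξ hξ
    rw [hξ, ENNReal.ofReal_mul (by positivity), ← ofReal_norm, ENNReal.ofReal_rpow_of_nonneg (norm_nonneg _) (by norm_num)]
    congr 2; norm_cast
  have hq0 : 0 ≤ qeps (g ε) u := integral_nonneg hgp
  set A := K*ε^(min 1 (alphaK d k p)/2/γ - 1/2) with hA
  have hA0 : 0 < A := by positivity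
  rw [hQ, ENNReal.ofReal_rpow_of_nonneg hq0 (by norm_num), ← ENNReal.ofReal_mul hA0.le] at hcore
  have hN : LpN p u.toFun ≤ A * (qeps (g ε) u)^(1/2:ℝ) := by
    have := ENNReal.toReal_mono ENNReal.ofReal_ne_top hcore
    rwa [ENNReal.toReal_ofReal (by positivity)] at this
  have hN0 : 0 < LpN p u.toFun := by
    apply ENNReal.toReal_pos _ hLp.eLpNorm_lt_top.ne
    intro hz
    rw [eLpNorm_eq_zero_iff hLp.1 (by simp; linarith)] at hz
    exact hne hz
  have hN2 : LpN p u.toFun^2 ≤ A^2 * qeps (g ε) u := by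
    calc LpN p u.toFun^2 ≤ (A * (qeps (g ε) u)^(1/2:ℝ))^2 := by gcongr
      _ = _ := by rw [mul_pow, ← Real.sqrt_eq_rpow, Real.sq_sqrt hq0]
  rw [le_div_iff₀ (by positivity)]
  have hAe : (K^2)⁻¹ * ε^(1 - min 1 (alphaK d k p)/γ) = (A^2)⁻¹ := by
    rw [hA, mul_pow, mul_inv]
    congr 1
    rw [← Real.rpow_natCast, ← Real.rpow_mul h0.le, ← Real.rpow_neg h0.le]
    congr 1; push_cast; ring
  rw [hAe, inv_mul_le_iff₀ (by positivity)]
  exact hN2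
end


open MeasureTheory Real Filter
open scoped ENNReal FourierTransform RealInnerProductSpace Topology

noncomputable section


theorem gauss1 (n : ℕ) (A : ℝ) (hA : 0 < A) (w : EB n) :
    Integrable (fun v : EB n => Complex.exp (-((π*A^2 : ℝ):ℂ) * ‖v‖^2 + 2*π*Complex.I * ⟪w, v⟫)) volume ∧
    ∫ v : EB n, Complex.exp (-((π*A^2 : ℝ):ℂ) * ‖v‖^2 + 2*π*Complex.I * ⟪w, v⟫) = (((A^n)⁻¹ * Real.exp (-π*(‖w‖^2/A^2)) : ℝ) : ℂ) := by
  have hb : 0 < (((π*A^2 : ℝ):ℂ)).re := by rw [Complex.ofReal_re]; positivity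
  refine ⟨GaussianFourier.integrable_cexp_neg_mul_sq_norm_add hb _ _, ?_⟩
  rw [GaussianFourier.integral_cexp_neg_mul_sq_norm_add hb]
  rw [finrank_euclideanSpace, Fintype.card_fin, Complex.ofReal_mul ((A^n)⁻¹)]
  congr 1
  · rw [← Complex.ofReal_div, show ((n:ℂ)/2) = (((n:ℝ)/2 : ℝ):ℂ) by push_cast; ring, ← Complex.ofReal_cpow (by positivity)]
    congr 1
    rw [show π/(π*A^2) = (A^2)⁻¹ by field_simp, Real.inv_rpow (by positivity), ← Real.rpow_natCast A 2, ← Real.rpow_mul hA.le, ← Real.rpow_natCast A n]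
    congr 2; push_cast; ring
  · rw [Complex.ofReal_exp]
    congr 1
    push_cast
    rw [mul_pow, mul_pow, Complex.I_sq]
    have : (π:ℂ) ≠ 0 := by exact_mod_cast Real.pi_pos.ne'
    have : (A:ℂ) ≠ 0 := by exact_mod_cast hA.ne'
    field_simp; ring

def Ga {d a b : ℕ} (B : Blk d a b) (A D : ℝ) (x : Rd d) : ℝ := Real.exp (-π*(A^2*‖(B.e x).1‖^2 + D^2*‖(B.e x).2‖^2))

theorem ga_ee {d a b : ℕ} (B : Blk d a b) (A D : ℝ) (x η : Rd d) :
    (Ga B A D x : ℂ) * ee ⟪x, η⟫ = Complex.exp (-((π*A^2 : ℝ):ℂ) * ‖(B.e x).1‖^2 + 2*π*Complex.I * ⟪(B.e η).1, (B.e x).1⟫) *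
      Complex.exp (-((π*D^2 : ℝ):ℂ) * ‖(B.e x).2‖^2 + 2*π*Complex.I * ⟪(B.e η).2, (B.e x).2⟫) := by
  rw [Ga, Complex.ofReal_exp, ee, ← Complex.exp_add, ← Complex.exp_add, real_inner_comm, B.inn]
  congr 1
  push_cast; ring

theorem ga_ft {d a b : ℕ} (B : Blk d a b) (A D : ℝ) (hA : 0 < A) (hD : 0 < D) (η : Rd d) :
    Integrable (fun x => (Ga B A D x : ℂ) * ee ⟪x, η⟫) volume ∧
    ∫ x, (Ga B A D x : ℂ) * ee ⟪x, η⟫ = (((A^a*D^b)⁻¹ * Real.exp (-π*(‖(B.e η).1‖^2/A^2 + ‖(B.e η).2‖^2/D^2)) : ℝ) : ℂ) := by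
  simp_rw [ga_ee]
  obtain ⟨i1, e1⟩ := gauss1 a A hA (B.e η).1
  obtain ⟨i2, e2⟩ := gauss1 b D hD (B.e η).2
  have hi := i1.mul_prod i2
  rw [← Measure.volume_eq_prod] at hi
  constructor
  · exact (B.mp.integrable_comp_emb B.e.measurableEmbedding).2 hi
  · rw [B.mp.integral_comp B.e.measurableEmbedding (g := fun z : EB a × EB b => Complex.exp (-((π*A^2 : ℝ):ℂ) * ‖z.1‖^2 + 2*π*Complex.I * ⟪(B.e η).1, z.1⟫) *
      Complex.exp (-((π*D^2 : ℝ):ℂ) * ‖z.2‖^2 + 2*π*Complex.I * ⟪(B.e η).2, z.2⟫))]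
    rw [Measure.volume_eq_prod, integral_prod_mul (fun v : EB a => Complex.exp (-((π*A^2 : ℝ):ℂ) * ‖v‖^2 + 2*π*Complex.I * ⟪(B.e η).1, v⟫)) (fun v : EB b => Complex.exp (-((π*D^2 : ℝ):ℂ) * ‖v‖^2 + 2*π*Complex.I * ⟪(B.e η).2, v⟫)), e1, e2, ← Complex.ofReal_mul]
    congr 1
    rw [mul_add, Real.exp_add, mul_inv]; ring

theorem ga_int {d a b : ℕ} (B : Blk d a b) (A D : ℝ) (hA : 0 < A) (hD : 0 < D) :
    Integrable (Ga B A D) volume ∧ ∫ x, Ga B A D x = (A^a*D^b)⁻¹ := by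
  obtain ⟨h1, h2⟩ := ga_ft B A D hA hD 0
  have hz : B.e 0 = (0 : EB a × EB b) := by
    have := B.nsq 0
    simp only [norm_zero] at this
    have h1 : (B.e 0).1 = 0 := by
      rw [← norm_eq_zero]; nlinarith [norm_nonneg (B.e 0).1, norm_nonneg (B.e 0).2]
    have h2 : (B.e 0).2 = 0 := by
      rw [← norm_eq_zero]; nlinarith [norm_nonneg (B.e 0).1, norm_nonneg (B.e 0).2]
    exact Prod.ext h1 h2
  simp only [inner_zero_right, ee_zero, mul_one, hz] at h1 h2
  refine ⟨by simpa using h1.re, ?_⟩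
  rw [integral_complex_ofReal] at h2
  simpa using Complex.ofReal_injective h2

theorem ga_lint {d a b : ℕ} (B : Blk d a b) (A D : ℝ) (hA : 0 < A) (hD : 0 < D) :
    ∫⁻ x, ENNReal.ofReal (Ga B A D x) = ENNReal.ofReal ((A^a*D^b)⁻¹) := by
  rw [← (ga_int B A D hA hD).2, ofReal_integral_eq_lintegral_ofReal (ga_int B A D hA hD).1]
  exact Eventually.of_forall fun x => (Real.exp_pos _).le

theorem ga_pow {d a b : ℕ} (B : Blk d a b) (A D r : ℝ) (hr : 0 < r) (x : Rd d) : (Ga B A D x)^r = Ga B (√r*A) (√r*D) x := by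
  unfold Ga
  rw [← Real.exp_mul]
  congr 1
  rw [mul_pow, mul_pow, Real.sq_sqrt hr.le]; ring

theorem ga_meas {d a b : ℕ} (B : Blk d a b) (A D : ℝ) : Measurable (Ga B A D) := by
  unfold Ga
  have := B.e.measurable
  fun_prop

/-- Hölder with the Gaussian weight -/
theorem ga_holder {d a b : ℕ} (B : Blk d a b) (A D p : ℝ) (hp : 2 < p) (hA : 0 < A) (hD : 0 < D) (u : Rd d → ℂ) (hu : AEMeasurable u volume) :
    ∫⁻ x, ‖u x‖ₑ^(2:ℝ) * ENNReal.ofReal (Ga B A D x) ≤ eLpNorm u (ENNReal.ofReal p) volume^(2:ℝ) *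
      ENNReal.ofReal (((√(p/(p-2))*A)^a*(√(p/(p-2))*D)^b)⁻¹^(1-2/p)) := by
  set r := p/(p-2) with hr
  have hr0 : 0 < r := div_pos (by linarith) (by linarith)
  have hpq : (p/2).HolderConjugate r := by
    rw [Real.holderConjugate_iff]
    constructor
    · linarith
    · rw [hr]; field_simp; ring
  refine (ENNReal.lintegral_mul_le_Lp_mul_Lq volume hpq (by fun_prop) (ga_meas B A D).ennreal_ofReal.aemeasurable).trans (le_of_eq ?_)
  congr 1
  · rw [ep_eq u p (by linarith), ← ENNReal.rpow_mul]
    simp_rw [← ENNReal.rpow_mul]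
    congr 1
    · congr 1; funext x; congr 1; ring
    · field_simp
  · have : ∀ x, ENNReal.ofReal (Ga B A D x)^r = ENNReal.ofReal (Ga B (√r*A) (√r*D) x) := by
      intro x
      rw [ENNReal.ofReal_rpow_of_nonneg (show 0 ≤ Ga B A D x from (Real.exp_pos _).le) hr0.le, ga_pow B A D r hr0]
    simp_rw [this]
    rw [ga_lint B _ _ (by positivity) (by positivity), ENNReal.ofReal_rpow_of_nonneg (by positivity) (by positivity)]
    congr 2
    rw [hr]; field_simp
end


open MeasureTheory Real Filter
open scoped ENNReal FourierTransform RealInnerProductSpace Topology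

noncomputable section

def chi {d : ℕ} (S : Set (Rd d)) : Rd d → ℂ := S.indicator (fun _ => 1)

theorem chi_meas {d : ℕ} (S : Set (Rd d)) (hS : MeasurableSet S) : Measurable (chi S) := measurable_const.indicator hS

theorem chi_fin {d : ℕ} (S : Set (Rd d)) (hb : ∀ ξ ∈ S, ‖ξ‖ ≤ 2) : volume S ≠ ⊤ :=
  (lt_of_le_of_lt (measure_mono (fun x hx => by simpa using hb x hx : S ⊆ Metric.closedBall 0 2)) (isCompact_closedBall _ _).measure_lt_top).ne

theorem chi_int {d : ℕ} (S : Set (Rd d)) (hS : MeasurableSet S) (hb : ∀ ξ ∈ S, ‖ξ‖ ≤ 2) : Integrable (chi S) volume :=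
  (integrable_indicator_iff hS).2 (integrableOn_const (chi_fin S hb))

theorem chi_L2 {d : ℕ} (S : Set (Rd d)) (hS : MeasurableSet S) (hb : ∀ ξ ∈ S, ‖ξ‖ ≤ 2) : MemLp (chi S) 2 volume :=
  memLp_indicator_const 2 hS 1 (Or.inr (chi_fin S hb))

theorem chi_sq {d : ℕ} (S : Set (Rd d)) (f : Rd d → ℝ) : (fun ξ => ‖chi S ξ‖^2 * f ξ) = S.indicator f := by
  funext ξ
  by_cases h : ξ ∈ S <;> simp [chi, h]

def mkHs {d : ℕ} (s : ℝ) (S : Set (Rd d)) (hS : MeasurableSet S) (hb : ∀ ξ ∈ S, ‖ξ‖ ≤ 2) : HsFn d s where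
  toFun := 𝓕⁻ (chi S)
  ft := chi S
  memL2 := (planch_inv_L1L2 _ (chi_int S hS hb) (chi_L2 S hS hb)).1
  ft_memL2 := chi_L2 S hS hb
  isFT := fourierInv_pair _ (chi_int S hS hb)
  memHs := by
    rw [chi_sq S (fun ξ => (1 + ‖ξ‖ ^ 2) ^ s), integrable_indicator_iff hS]
    refine IntegrableOn.mono_set (t := Metric.closedBall 0 2) (ContinuousOn.integrableOn_compact (isCompact_closedBall _ _) ?_) (fun x hx => by simpa using hb x hx)
    refine Continuous.continuousOn (Continuous.rpow_const (by fun_prop) fun x => Or.inl (by positivity))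

theorem test_upper {d a b : ℕ} (s p : ℝ) (hp : 2 < p) (B : Blk d a b) (S : Set (Rd d)) (hS : MeasurableSet S) (hb : ∀ ξ ∈ S, ‖ξ‖ ≤ 2)
    (hsym : ∀ ξ η, ‖(B.e ξ).1‖ = ‖(B.e η).1‖ → ‖(B.e ξ).2‖ = ‖(B.e η).2‖ → ξ ∈ S → η ∈ S)
    (g : ℝ → ℝ) (hg0 : ∀ r, 0 < g r) (hgm : Measurable g) (M : ℝ) (hM : ∀ ξ ∈ S, g ‖ξ‖ ≤ M) (L : ℝ) (hL0 : 0 < L)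
    (hL : ENNReal.ofReal L ≤ eLpNorm (𝓕⁻ (chi S)) (ENNReal.ofReal p) volume^(2:ℝ)) :
    ∃ t ∈ RayleighSet d s p g (BSym B), t ≤ M * (volume S).toReal / L := by
  set u := mkHs s S hS hb with hu
  have hut : u.toFun = 𝓕⁻ (chi S) := rfl
  have hi := chi_int S hS hb
  have hcont := finv_cont _ hi
  have hpl := planch_inv_L1L2 _ hi (chi_L2 S hS hb)
  have hLp : MemLp u.toFun (ENNReal.ofReal p) volume := by
    rw [hut]
    refine ⟨hcont.aestronglyMeasurable, ?_⟩
    have hI : ∫⁻ ξ, ‖chi S ξ‖ₑ ≠ ⊤ := hi.2.ne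
    have h2 : eLpNorm (𝓕⁻ (chi S)) 2 volume ≠ ⊤ := hpl.1.2.ne
    set N := eLpNorm (𝓕⁻ (chi S)) 2 volume
    refine lt_of_le_of_lt (interp_2inf (μ := volume) (𝓕⁻ (chi S)) p hp (∫⁻ ξ, ‖chi S ξ‖ₑ) (N + 1) hI (by simp [h2]) (fun x => (finv_sup _ x).trans ?_) le_self_add) ?_
    · calc ∫⁻ ξ, ‖chi S ξ‖ₑ = (∫⁻ ξ, ‖chi S ξ‖ₑ) * 1 := (mul_one _).symm
        _ ≤ _ := by gcongr; exact le_add_self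
    · refine ENNReal.mul_lt_top (ENNReal.rpow_lt_top_of_nonneg ?_ hI) (by simp [h2.lt_top])
      rw [sub_nonneg, div_le_one (by linarith)]; exact hp.le
  have hq : L ≤ LpN p u.toFun^2 := by
    unfold LpN
    have h := ENNReal.toReal_mono (ENNReal.rpow_ne_top_of_nonneg (by norm_num) hLp.2.ne) hL
    rw [ENNReal.toReal_ofReal hL0.le, ← ENNReal.toReal_rpow] at h
    exact_mod_cast h
  refine ⟨qeps g u / LpN p u.toFun ^ 2, ⟨u, ?_, ?_, hLp, rfl⟩, ?_⟩
  · refine bsym_fourierInv B _ (fun x y h1 h2 => ?_)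
    by_cases hx : x ∈ S
    · have hy := hsym x y h1 h2 hx
      simp [chi, hx, hy]
    · have hy : y ∉ S := fun hy => hx (hsym y x h1.symm h2.symm hy)
      simp [chi, hx, hy]
  · intro h0
    have : eLpNorm u.toFun (ENNReal.ofReal p) volume = 0 := by
      rw [eLpNorm_congr_ae h0]; exact eLpNorm_zero
    have h : LpN p u.toFun = 0 := by unfold LpN; rw [this]; rfl
    rw [h] at hq; norm_num at hq; linarith
  · have hfin := chi_fin S hb
    have hqq : qeps g u ≤ M * (volume S).toReal := by
      have : qeps g u = ∫ ξ in S, g ‖ξ‖ := by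
        unfold qeps
        rw [show u.ft = chi S from rfl, chi_sq S (fun ξ => g ‖ξ‖), integral_indicator hS]
      rw [this]
      have hc : ∫ ξ in S, M = M * (volume S).toReal := by rw [setIntegral_const, smul_eq_mul, mul_comm]; rfl
      rw [← hc]
      refine setIntegral_mono_on ?_ (integrableOn_const hfin) hS hM
      refine Measure.integrableOn_of_bounded (M := M) hfin ((hgm.comp measurable_norm).aestronglyMeasurable) ?_
      refine (ae_restrict_iff' hS).2 (Eventually.of_forall fun ξ hξ => ?_)
      rw [Real.norm_eq_abs, abs_of_pos (hg0 _)]; exact hM ξ hξ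
    have hq0 : 0 ≤ qeps g u := integral_nonneg fun ξ => mul_nonneg (by positivity) (hg0 _).le
    exact div_le_div₀ (hq0.trans hqq) hqq hL0 hq

/-- lower volume bound for the shell -/
theorem shell_low (d : ℕ) (hd : 1 ≤ d) : ∃ V : ℝ, 0 < V ∧ ∀ δ, 0 < δ → δ ≤ 1/2 → V * δ ≤ (volume {ξ : Rd d | |‖ξ‖ - 1| ≤ δ}).toReal := by
  have hne : Nonempty (Fin d) := ⟨⟨0, hd⟩⟩
  set V := (volume (Metric.closedBall (0 : Rd d) 1)).toReal with hV
  have hV0 : 0 < V := ENNReal.toReal_pos (Metric.measure_closedBall_pos _ _ one_pos).ne' (isCompact_closedBall _ _).measure_lt_top.ne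
  refine ⟨V, hV0, fun δ h0 h1 => ?_⟩
  have hb : ∀ ξ ∈ {ξ : Rd d | |‖ξ‖ - 1| ≤ δ}, ‖ξ‖ ≤ 2 := fun ξ hξ => by
    have : |‖ξ‖ - 1| ≤ δ := hξ
    linarith [(abs_le.1 this).2]
  have hsub : Metric.closedBall (0 : Rd d) (1+δ) \ Metric.closedBall 0 1 ⊆ {ξ : Rd d | |‖ξ‖ - 1| ≤ δ} := by
    rintro ξ ⟨h1, h2⟩
    simp only [Metric.mem_closedBall, dist_zero_right, not_le] at h1 h2
    show |‖ξ‖ - 1| ≤ δ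
    rw [abs_le]; constructor <;> linarith
  refine le_trans ?_ (ENNReal.toReal_mono (chi_fin _ hb) (measure_mono hsub))
  have hfin : volume (Metric.closedBall (0 : Rd d) 1) ≠ ⊤ := (isCompact_closedBall _ _).measure_lt_top.ne
  have hfin2 : volume (Metric.closedBall (0 : Rd d) (1+δ)) ≠ ⊤ := (isCompact_closedBall _ _).measure_lt_top.ne
  have hss : Metric.closedBall (0 : Rd d) 1 ⊆ Metric.closedBall 0 (1+δ) := Metric.closedBall_subset_closedBall (by linarith)
  rw [measure_sdiff hss Metric.isClosed_closedBall.measurableSet.nullMeasurableSet hfin, ENNReal.toReal_sub_of_le (measure_mono hss) hfin2,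
    Measure.addHaar_closedBall' _ _ (by linarith : (0:ℝ) ≤ 1+δ), ENNReal.toReal_mul, ENNReal.toReal_ofReal (by positivity), ← hV, finrank_euclideanSpace, Fintype.card_fin]
  have := one_add_mul_le_pow (by linarith : (-2:ℝ) ≤ δ) d
  have hd' : (1:ℝ) ≤ d := by exact_mod_cast hd
  nlinarith [mul_le_mul_of_nonneg_right hd' h0.le]

/-- near the origin the test function is large -/
theorem near_origin {d : ℕ} (S : Set (Rd d)) (hS : MeasurableSet S) (hb : ∀ ξ ∈ S, ‖ξ‖ ≤ 2) (x : Rd d) (hx : ‖x‖ ≤ 1/20) :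
    (volume S).toReal/4 ≤ ‖𝓕⁻ (chi S) x‖ := by
  refine le_trans ?_ (Complex.re_le_norm _)
  have hi := chi_int S hS hb
  have hIntg : Integrable (fun ξ => chi S ξ * ee ⟪ξ, x⟫) volume := by
    refine hi.mul_bdd (c := 1) (ee_meas.comp (by fun_prop)).aestronglyMeasurable (Eventually.of_forall fun ξ => (norm_ee _).le)
  rw [fourierInv_ee]
  have e := integral_re hIntg
  simp only [RCLike.re_to_complex] at e
  rw [← e]
  have : (fun ξ => (chi S ξ * ee ⟪ξ, x⟫).re) = S.indicator (fun ξ => (ee ⟪ξ, x⟫).re) := by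
    funext ξ; by_cases h : ξ ∈ S <;> simp [chi, h]
  have hre : Integrable (fun ξ => (chi S ξ * ee ⟪ξ, x⟫).re) := hIntg.re
  rw [this] at hre ⊢
  rw [integral_indicator hS]
  have hc : ∫ ξ in S, (1/4:ℝ) = (volume S).toReal/4 := by rw [setIntegral_const, smul_eq_mul]; show (volume S).toReal * (1/4) = _; ring
  rw [← hc]
  refine setIntegral_mono_on (integrableOn_const (chi_fin S hb)) ((integrable_indicator_iff hS).1 hre) hS fun ξ hξ => ?_
  have h1 : |⟪ξ, x⟫| ≤ 1/10 := by
    refine (abs_real_inner_le_norm ξ x).trans ?_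
    nlinarith [hb ξ hξ, norm_nonneg ξ, norm_nonneg x]
  have h2 : (ee ⟪ξ, x⟫).re = Real.cos (2*π*⟪ξ, x⟫) := by
    unfold ee
    rw [show (2 * π * Complex.I * (⟪ξ, x⟫ : ℝ) : ℂ) = ((2*π*⟪ξ, x⟫ : ℝ):ℂ) * Complex.I by push_cast; ring, Complex.exp_ofReal_mul_I_re]
  rw [h2]
  have h3 := Real.one_sub_sq_div_two_le_cos (x := 2*π*⟪ξ, x⟫)
  have h4 : (⟪ξ, x⟫)^2 ≤ (1/10)^2 := by rw [← sq_abs]; exact pow_le_pow_left₀ (abs_nonneg _) h1 2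
  have h5 : π^2 ≤ 10 := by nlinarith [Real.pi_lt_d2, Real.pi_pos]
  have h6 : π^2 * (⟪ξ, x⟫)^2 ≤ 10 * (1/10)^2 := mul_le_mul h5 h4 (sq_nonneg _) (by norm_num)
  have : (2*π*⟪ξ, x⟫)^2/2 = 2 * (π^2 * (⟪ξ, x⟫)^2) := by ring
  linarith

theorem upper_one {d a b : ℕ} (hd : 1 ≤ d) (s γ p C : ℝ) (hγ : 1 < γ) (hp : 2 < p) (hC : 0 < C) (B : Blk d a b) :
    ∃ C' : ℝ, 0 < C' ∧ ∀ ε, 0 < ε → ε ≤ (1/8)^γ → ∀ g : ℝ → ℝ, Measurable g → (∀ r, 0 < g r) → (∀ r, |r-1| ≤ 1/2 → g r ≤ C*(ε + |r-1|^γ)) →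
      ∃ t ∈ RayleighSet d s p g (BSym B), t ≤ C' * ε^(1-1/γ) := by
  obtain ⟨V, hV, hsv⟩ := shell_low d hd
  have hne : Nonempty (Fin d) := ⟨⟨0, hd⟩⟩
  have hp0 : 0 < p := by linarith
  set W := volume (Metric.closedBall (0 : Rd d) (1/20)) with hW
  have hWf : W ≠ ⊤ := (isCompact_closedBall _ _).measure_lt_top.ne
  have hW0 : 0 < W.toReal := ENNReal.toReal_pos (Metric.measure_closedBall_pos _ _ (by norm_num)).ne' hWf
  set w := W.toReal^(1/p) with hw
  have hw0 : 0 < w := Real.rpow_pos_of_pos hW0 _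
  refine ⟨2*C*16/(w^2*V), by positivity, fun ε h0 h1 g hgm hg0 hg => ?_⟩
  set δ := ε^(1/γ) with hδ
  have hδ0 : 0 < δ := Real.rpow_pos_of_pos h0 _
  have hδγ : δ^γ = ε := by rw [hδ, ← Real.rpow_mul h0.le, one_div_mul_cancel (by linarith), Real.rpow_one]
  have hδ1 : δ ≤ 1/8 := by
    have := Real.rpow_le_rpow h0.le h1 (by positivity : (0:ℝ) ≤ 1/γ)
    rwa [← Real.rpow_mul (by norm_num), mul_one_div_cancel (by linarith), Real.rpow_one] at this
  set S := {ξ : Rd d | |‖ξ‖ - 1| ≤ δ} with hSdef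
  have hS : MeasurableSet S := measurableSet_le (by fun_prop) measurable_const
  have hb : ∀ ξ ∈ S, ‖ξ‖ ≤ 2 := fun ξ hξ => by
    have : |‖ξ‖ - 1| ≤ δ := hξ
    linarith [(abs_le.1 this).2]
  have hv := hsv δ hδ0 (by linarith)
  rw [← hSdef] at hv
  set v := (volume S).toReal with hvdef
  have hv0 : 0 < v := lt_of_lt_of_le (by positivity) hv
  have hL : ENNReal.ofReal ((v/4*w)^2) ≤ eLpNorm (𝓕⁻ (chi S)) (ENNReal.ofReal p) volume^(2:ℝ) := by
    rw [show (v/4*w)^2 = (v/4*w)^(2:ℝ) by norm_cast, ← ENNReal.ofReal_rpow_of_nonneg (by positivity) (by norm_num)]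
    refine ENNReal.rpow_le_rpow ?_ (by norm_num)
    rw [ep_eq _ p hp0]
    have h := setLIntegral_le_lintegral (μ := volume) (Metric.closedBall (0 : Rd d) (1/20)) (fun x => ‖𝓕⁻ (chi S) x‖ₑ^p)
    have h2 : ENNReal.ofReal (v/4)^p * W ≤ ∫⁻ x in Metric.closedBall (0 : Rd d) (1/20), ‖𝓕⁻ (chi S) x‖ₑ^p := by
      rw [← setLIntegral_const]
      refine setLIntegral_mono' Metric.isClosed_closedBall.measurableSet fun x hx => ENNReal.rpow_le_rpow ?_ hp0.le
      rw [← ofReal_norm]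
      exact ENNReal.ofReal_le_ofReal (near_origin S hS hb x (by simpa using hx))
    refine le_trans (le_of_eq ?_) (ENNReal.rpow_le_rpow (h2.trans h) (by positivity))
    rw [ENNReal.mul_rpow_of_nonneg _ _ (by positivity), ← ENNReal.rpow_mul, mul_one_div_cancel hp0.ne', ENNReal.rpow_one, ENNReal.ofReal_mul (by positivity), hw,
      ← ENNReal.ofReal_rpow_of_nonneg hW0.le (by positivity), ENNReal.ofReal_toReal hWf]
  obtain ⟨t, ht, htl⟩ := test_upper s p hp B S hS hb (fun ξ η h1 h2 h => by
    have hn : ‖ξ‖ = ‖η‖ := by rw [← sq_eq_sq₀ (norm_nonneg _) (norm_nonneg _), B.nsq ξ, B.nsq η, h1, h2]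
    show |‖η‖ - 1| ≤ δ
    rw [← hn]; exact h) g hg0 hgm (C*(2*ε)) (fun ξ hξ => by
      have hξ : |‖ξ‖ - 1| ≤ δ := hξ
      refine (hg _ (by linarith)).trans (mul_le_mul_of_nonneg_left ?_ hC.le)
      have := Real.rpow_le_rpow (abs_nonneg _) hξ (by linarith : 0 ≤ γ)
      rw [hδγ] at this; linarith) ((v/4*w)^2) (by positivity) hL
  refine ⟨t, ht, htl.trans ?_⟩
  rw [Real.rpow_sub h0, Real.rpow_one, ← hδ]
  rw [← hvdef]
  have e1 : C*(2*ε)*v/(v/4*w)^2 = 2*C*16/w^2*ε * v⁻¹ := by field_simp; ring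
  have e2 : 2*C*16/(w^2*V)*(ε/δ) = 2*C*16/w^2*ε * (V*δ)⁻¹ := by field_simp
  rw [e1, e2]
  exact mul_le_mul_of_nonneg_left (inv_anti₀ (by positivity) hv) (by positivity)
end


open MeasureTheory Real Filter
open scoped ENNReal FourierTransform RealInnerProductSpace Topology

noncomputable section

theorem Blk.e_sub {d a b : ℕ} (B : Blk d a b) (x y : Rd d) : (B.e (x - y)).1 = (B.e x).1 - (B.e y).1 ∧ (B.e (x - y)).2 = (B.e x).2 - (B.e y).2 := by
  set z : EB a × EB b := ((B.e (x - y)).1 - ((B.e x).1 - (B.e y).1), (B.e (x - y)).2 - ((B.e x).2 - (B.e y).2)) with hz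
  obtain ⟨w, hw⟩ := B.e.surjective z
  have h : ⟪x - y, w⟫ = ⟪x, w⟫ - ⟪y, w⟫ := inner_sub_left x y w
  rw [B.inn, B.inn x, B.inn y, hw] at h
  have h2 : ⟪z.1, z.1⟫ + ⟪z.2, z.2⟫ = 0 := by
    nth_rewrite 1 [hz]
    nth_rewrite 2 [hz]
    simp only [inner_sub_left]
    linarith
  rw [real_inner_self_eq_norm_sq, real_inner_self_eq_norm_sq] at h2
  have h3 : z.1 = 0 := by rw [← norm_eq_zero]; nlinarith [norm_nonneg z.1, norm_nonneg z.2]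
  have h4 : z.2 = 0 := by rw [← norm_eq_zero]; nlinarith [norm_nonneg z.1, norm_nonneg z.2]
  exact ⟨sub_eq_zero.1 h3, sub_eq_zero.1 h4⟩

theorem f_pair {d : ℕ} (f g : Rd d → ℂ) (hf : Integrable f) (hg : Integrable g) : ∫ ξ, 𝓕 f ξ * g ξ = ∫ x, f x * 𝓕 g x := by
  have := VectorFourier.integral_fourierIntegral_smul_eq_flip (e := Real.fourierChar) (μ := volume)
    (ν := volume) (L := innerₗ (Rd d)) (f := f) (g := g) Real.continuous_fourierChar
    (by exact continuous_inner) hf hg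
  simp only [flip_innerₗ, smul_eq_mul] at this
  exact this

theorem finv_pair {d : ℕ} (f g : Rd d → ℂ) (hf : Integrable f) (hg : Integrable g) : ∫ ξ, 𝓕⁻ f ξ * g ξ = ∫ x, f x * 𝓕⁻ g x := by
  have h := f_pair f (fun x => g (-x)) hf hg.comp_neg
  calc ∫ ξ, 𝓕⁻ f ξ * g ξ = ∫ ξ, 𝓕⁻ f (-ξ) * g (-ξ) := (integral_neg_eq_self (fun ξ => 𝓕⁻ f ξ * g ξ) volume).symm
    _ = ∫ ξ, 𝓕 f ξ * g (-ξ) := by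
        congr 1; funext ξ; rw [Real.fourierInv_eq_fourier_neg, neg_neg]
    _ = _ := h
    _ = _ := by
        congr 1; funext ξ
        rw [fourier_ee, fourierInv_ee, ← integral_neg_eq_self (fun x => g x * ee ⟪x, ξ⟫)]
        simp only [inner_neg_left]

def Hh {d a b : ℕ} (B : Blk d a b) (A D : ℝ) (η : Rd d) : ℝ := (A^a*D^b)⁻¹ * Real.exp (-π*(‖(B.e η).1‖^2/A^2 + ‖(B.e η).2‖^2/D^2))

theorem chi_conj {d : ℕ} (S : Set (Rd d)) (x : Rd d) : (starRingEnd ℂ) (𝓕⁻ (chi S) x) = 𝓕 (chi S) x := by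
  rw [fourierInv_ee, fourier_ee, ← integral_conj]
  congr 1; funext ξ
  rw [map_mul, conj_ee]
  congr 1
  by_cases h : ξ ∈ S <;> simp [chi, h]

theorem ga_form {d a b : ℕ} (B : Blk d a b) (A D : ℝ) (hA : 0 < A) (hD : 0 < D) (S : Set (Rd d)) (hS : MeasurableSet S) (hb : ∀ ξ ∈ S, ‖ξ‖ ≤ 2)
    (κ : ℝ) (hκ : ∀ ξ ∈ S, κ ≤ ∫ η in S, Hh B A D (ξ - η)) :
    ENNReal.ofReal (κ * (volume S).toReal) ≤ ∫⁻ x, ‖𝓕⁻ (chi S) x‖ₑ^(2:ℝ) * ENNReal.ofReal (Ga B A D x) := by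
  have hi := chi_int S hS hb
  have hcont := finv_cont _ hi
  set u := 𝓕⁻ (chi S) with hu
  set K := (∫⁻ ξ, ‖chi S ξ‖ₑ).toReal with hK
  have hub : ∀ x, ‖u x‖ ≤ K := fun x => by
    have := ENNReal.toReal_mono hi.2.ne (finv_sup (chi S) x)
    rwa [toReal_enorm] at this
  obtain ⟨hGi, -⟩ := ga_int B A D hA hD
  have hGc : Integrable (fun x => (Ga B A D x : ℂ)) volume := hGi.ofReal
  set F : Rd d → ℂ := fun x => (starRingEnd ℂ) (u x) * (Ga B A D x : ℂ) with hF
  have hFi : Integrable F volume := by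
    have : F = fun x => (Ga B A D x : ℂ) * (starRingEnd ℂ) (u x) := by funext x; rw [hF, mul_comm]
    rw [this]
    refine hGc.mul_bdd (c := K) (Complex.continuous_conj.comp hcont).aestronglyMeasurable (Eventually.of_forall fun x => ?_)
    rw [RCLike.norm_conj]; exact hub x
  have hI : ∀ ξ, 𝓕⁻ F ξ = ((∫ η in S, Hh B A D (ξ - η) : ℝ) : ℂ) := by
    intro ξ
    obtain ⟨g1, -⟩ := ga_ft B A D hA hD ξ
    have hp := f_pair (chi S) (fun x => (Ga B A D x : ℂ) * ee ⟪x, ξ⟫) hi g1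
    rw [fourierInv_ee]
    have : (fun x => F x * ee ⟪x, ξ⟫) = fun x => 𝓕 (chi S) x * ((Ga B A D x : ℂ) * ee ⟪x, ξ⟫) := by
      funext x; rw [hF, ← chi_conj]; simp only [hu]; ring
    rw [this, hp, ← integral_complex_ofReal, ← integral_indicator hS]
    congr 1; funext η
    have h2 : 𝓕 (fun x => (Ga B A D x : ℂ) * ee ⟪x, ξ⟫) η = (Hh B A D (ξ - η) : ℂ) := by
      rw [fourier_ee, Hh, ← (ga_ft B A D hA hD (ξ - η)).2]
      congr 1; funext x
      rw [inner_sub_right, sub_eq_add_neg, ee_add]; ring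
    rw [h2]
    by_cases h : η ∈ S <;> simp [chi, h]
  have hpair := finv_pair (chi S) F hi hFi
  have hFc := finv_cont F hFi
  have hIntg : Integrable (fun ξ => chi S ξ * 𝓕⁻ F ξ) volume := by
    refine hi.mul_bdd (c := (∫⁻ ξ, ‖F ξ‖ₑ).toReal) hFc.aestronglyMeasurable (Eventually.of_forall fun x => ?_)
    have := ENNReal.toReal_mono hFi.2.ne (finv_sup F x)
    rwa [toReal_enorm] at this
  have hL : ∀ x, u x * F x = ((‖u x‖^2 * Ga B A D x : ℝ) : ℂ) := by
    intro x
    rw [hF]; simp only []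
    rw [← mul_assoc, Complex.mul_conj, Complex.normSq_eq_norm_sq]; push_cast; rfl
  have hR : (fun ξ => chi S ξ * 𝓕⁻ F ξ) = fun ξ => ((S.indicator (fun ξ => ∫ η in S, Hh B A D (ξ - η)) ξ : ℝ) : ℂ) := by
    funext ξ; rw [hI]; by_cases h : ξ ∈ S <;> simp [chi, h]
  rw [hR] at hIntg hpair
  simp_rw [← hu, hL] at hpair
  rw [integral_complex_ofReal, integral_complex_ofReal] at hpair
  have hpair := Complex.ofReal_injective hpair
  have hint2 : Integrable (S.indicator (fun ξ => ∫ η in S, Hh B A D (ξ - η))) volume := by simpa using hIntg.re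
  rw [integral_indicator hS] at hpair
  have hlow : κ * (volume S).toReal ≤ ∫ x, ‖u x‖^2 * Ga B A D x := by
    rw [hpair]
    have hc : ∫ ξ in S, κ = κ * (volume S).toReal := by rw [setIntegral_const, smul_eq_mul, mul_comm]; rfl
    rw [← hc]
    exact setIntegral_mono_on (integrableOn_const (chi_fin S hb)) ((integrable_indicator_iff hS).1 hint2) hS hκ
  refine (ENNReal.ofReal_le_ofReal hlow).trans ?_
  have hui : Integrable (fun x => ‖u x‖^2 * Ga B A D x) volume := by
    refine (hGi.mul_bdd (c := K^2) (g := fun x => ‖u x‖^2) (by fun_prop) (Eventually.of_forall fun x => ?_)).congr (Eventually.of_forall fun x => mul_comm _ _)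
    rw [Real.norm_eq_abs, abs_of_nonneg (by positivity)]
    exact pow_le_pow_left₀ (norm_nonneg _) (hub x) 2
  rw [ofReal_integral_eq_lintegral_ofReal hui (Eventually.of_forall fun x => mul_nonneg (by positivity) (Real.exp_pos _).le)]
  refine le_of_eq (lintegral_congr fun x => ?_)
  rw [ENNReal.ofReal_mul (by positivity), ENNReal.ofReal_pow (norm_nonneg _), ofReal_norm]
  norm_cast

def KS {d a b : ℕ} (B : Blk d a b) (δ : ℝ) : Set (Rd d) := {ξ | |‖(B.e ξ).1‖ - 1| ≤ δ ∧ ‖(B.e ξ).2‖ ≤ √δ}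

theorem ks_meas {d a b : ℕ} (B : Blk d a b) (δ : ℝ) : MeasurableSet (KS B δ) := by
  have := B.e.measurable
  have m1 : Measurable (fun ξ => |‖(B.e ξ).1‖ - 1|) := by
    have : Measurable (fun ξ => ‖(B.e ξ).1‖ - 1) := by fun_prop
    simpa only [Real.norm_eq_abs] using this.norm
  have m2 : Measurable (fun ξ => ‖(B.e ξ).2‖) := by fun_prop
  exact (measurableSet_le m1 measurable_const).inter (measurableSet_le m2 measurable_const)

theorem ks_norm {d a b : ℕ} (B : Blk d a b) (δ : ℝ) (h0 : 0 < δ) (h1 : δ ≤ 1/8) (ξ : Rd d) (h : ξ ∈ KS B δ) : |‖ξ‖ - 1| ≤ 2*δ := by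
  obtain ⟨h2, h3⟩ := h
  have h4 := B.nsq ξ
  have h5 : ‖(B.e ξ).2‖^2 ≤ δ := by
    have := pow_le_pow_left₀ (norm_nonneg _) h3 2
    rwa [Real.sq_sqrt h0.le] at this
  rw [abs_le] at h2 ⊢
  constructor
  · have : ‖(B.e ξ).1‖ ≤ ‖ξ‖ := by
      refine (sq_le_sq₀ (norm_nonneg _) (norm_nonneg _)).1 ?_
      nlinarith [sq_nonneg ‖(B.e ξ).2‖]
    linarith [h2.1]
  · have h6 : ‖(B.e ξ).1‖^2 ≤ (1+δ)^2 := pow_le_pow_left₀ (norm_nonneg _) (by linarith [h2.2]) 2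
    have : ‖ξ‖ ≤ 1 + 2*δ := by
      refine (sq_le_sq₀ (norm_nonneg _) (by linarith)).1 ?_
      nlinarith
    linarith

end


open MeasureTheory Real Filter
open scoped ENNReal FourierTransform RealInnerProductSpace Topology

noncomputable section

def VB (n : ℕ) : ℝ := (volume (Metric.closedBall (0 : EB n) 1)).toReal
theorem VB_pos (n : ℕ) : 0 < VB n :=
  ENNReal.toReal_pos (Metric.measure_closedBall_pos _ _ one_pos).ne' (isCompact_closedBall _ _).measure_lt_top.ne
theorem VB_vol (n : ℕ) (x : EB n) (r : ℝ) (hr : 0 ≤ r) : (volume (Metric.closedBall x r)).toReal = r^n * VB n := by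
  rw [Measure.addHaar_closedBall' _ _ hr, ENNReal.toReal_mul, ENNReal.toReal_ofReal (by positivity), finrank_euclideanSpace, Fintype.card_fin]; rfl

def KB {d a b : ℕ} (B : Blk d a b) (δ : ℝ) (v : EB a) : Set (Rd d) := B.e ⁻¹' (Metric.closedBall v δ ×ˢ Metric.closedBall 0 √δ)

theorem kb_vol {d a b : ℕ} (B : Blk d a b) (δ : ℝ) (h0 : 0 < δ) (v : EB a) : (volume (KB B δ v)).toReal = (δ^a*√δ^b) * (VB a * VB b) := by
  unfold KB
  rw [B.mp.measure_preimage_equiv, Measure.volume_eq_prod, Measure.prod_prod, ENNReal.toReal_mul, VB_vol _ _ _ h0.le, VB_vol _ _ _ (Real.sqrt_nonneg _)]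
  ring

theorem kb_sub {d a b : ℕ} (B : Blk d a b) (δ : ℝ) (v : EB a) (hv : ‖v‖ = 1) : KB B δ v ⊆ KS B δ := by
  rintro ξ ⟨h1, h2⟩
  simp only [Metric.mem_closedBall, dist_eq_norm, sub_zero] at h1 h2
  refine ⟨?_, h2⟩
  rw [← hv]
  exact (abs_norm_sub_norm_le _ _).trans h1

theorem ks_bd {d a b : ℕ} (B : Blk d a b) (δ : ℝ) (h0 : 0 < δ) (h1 : δ ≤ 1/8) : ∀ ξ ∈ KS B δ, ‖ξ‖ ≤ 2 := fun ξ hξ => by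
  have := ks_norm B δ h0 h1 ξ hξ
  linarith [(abs_le.1 this).2]

theorem kb_meas {d a b : ℕ} (B : Blk d a b) (δ : ℝ) (v : EB a) : MeasurableSet (KB B δ v) :=
  B.e.measurable (Metric.isClosed_closedBall.measurableSet.prod Metric.isClosed_closedBall.measurableSet)

theorem ks_pos {d a b : ℕ} (ha : 1 ≤ a) (B : Blk d a b) (δ : ℝ) (h0 : 0 < δ) (h1 : δ ≤ 1/8) : 0 < (volume (KS B δ)).toReal := by
  set v : EB a := EuclideanSpace.single ⟨0, ha⟩ 1 with hv
  have hv1 : ‖v‖ = 1 := by rw [hv]; simp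
  have := ENNReal.toReal_mono (chi_fin _ (ks_bd B δ h0 h1)) (measure_mono (μ := volume) (kb_sub B δ v hv1))
  rw [kb_vol B δ h0] at this
  have h3 := VB_pos a
  have h4 := VB_pos b
  exact lt_of_lt_of_le (by positivity) this

theorem hh_meas {d a b : ℕ} (B : Blk d a b) (A D : ℝ) (ξ : Rd d) : Measurable (fun η => Hh B A D (ξ - η)) := by
  unfold Hh
  have h1 : Measurable (fun η => B.e (ξ - η)) := B.e.measurable.comp (by fun_prop)
  have h2 : Measurable (fun η => ‖(B.e (ξ - η)).1‖) := h1.fst.norm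
  have h3 : Measurable (fun η => ‖(B.e (ξ - η)).2‖) := h1.snd.norm
  fun_prop

theorem ks_kernel {d a b : ℕ} (B : Blk d a b) (δ : ℝ) (h0 : 0 < δ) (h1 : δ ≤ 1/8) (ξ : Rd d) (hξ : ξ ∈ KS B δ) :
    Real.exp (-(8*π)) * (VB a * VB b) ≤ ∫ η in KS B δ, Hh B δ √δ (ξ - η) := by
  have hs0 : 0 < √δ := Real.sqrt_pos.2 h0
  obtain ⟨hx1, hx2⟩ := hξ
  set n := ‖(B.e ξ).1‖ with hn
  have hn0 : 0 < n := by linarith [(abs_le.1 hx1).1]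
  set v : EB a := n⁻¹ • (B.e ξ).1 with hv
  have hv1 : ‖v‖ = 1 := by rw [hv, norm_smul, norm_inv, Real.norm_eq_abs, abs_of_pos hn0, ← hn, inv_mul_cancel₀ hn0.ne']
  have hdist : ‖(B.e ξ).1 - v‖ ≤ δ := by
    have : (B.e ξ).1 - v = (n - 1) • v := by
      rw [hv, smul_smul, sub_mul, mul_inv_cancel₀ hn0.ne', sub_smul, one_smul, one_mul]
    rw [this, norm_smul, hv1, mul_one]; exact hx1
  have hfin := chi_fin _ (ks_bd B δ h0 h1)
  have hpos : ∀ η, 0 ≤ Hh B δ √δ η := fun η => by unfold Hh; positivity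
  have hIntg : IntegrableOn (fun η => Hh B δ √δ (ξ - η)) (KS B δ) volume := by
    refine Measure.integrableOn_of_bounded (M := (δ^a*√δ^b)⁻¹) hfin (hh_meas B δ √δ ξ).aestronglyMeasurable (Eventually.of_forall fun η => ?_)
    rw [Real.norm_eq_abs, abs_of_nonneg (hpos _)]
    unfold Hh
    refine mul_le_of_le_one_right (by positivity) (Real.exp_le_one_iff.2 ?_)
    have : 0 ≤ π * (‖(B.e (ξ - η)).1‖^2/δ^2 + ‖(B.e (ξ - η)).2‖^2/√δ^2) := by positivity
    linarith
  refine le_trans ?_ (setIntegral_mono_set hIntg (Eventually.of_forall fun η => hpos _) (kb_sub B δ v hv1).eventuallyLE)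
  have hc : ∫ η in KB B δ v, (δ^a*√δ^b)⁻¹ * Real.exp (-(8*π)) = Real.exp (-(8*π)) * (VB a * VB b) := by
    rw [setIntegral_const, smul_eq_mul]
    show (volume (KB B δ v)).toReal * _ = _
    rw [kb_vol B δ h0]
    field_simp
  rw [← hc]
  have hfin2 : volume (KB B δ v) ≠ ⊤ := ne_top_of_le_ne_top hfin (measure_mono (kb_sub B δ v hv1))
  refine setIntegral_mono_on (integrableOn_const hfin2) (hIntg.mono_set (kb_sub B δ v hv1)) (kb_meas B δ v) ?_
  rintro η ⟨e1, e2⟩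
  simp only [Metric.mem_closedBall, dist_eq_norm, sub_zero] at e1 e2
  unfold Hh
  refine mul_le_mul_of_nonneg_left (Real.exp_le_exp.2 ?_) (by positivity)
  obtain ⟨s1, s2⟩ := B.e_sub ξ η
  rw [s1, s2]
  have t1 : ‖(B.e ξ).1 - (B.e η).1‖ ≤ 2*δ := by
    have : (B.e ξ).1 - (B.e η).1 = ((B.e ξ).1 - v) - ((B.e η).1 - v) := by abel
    rw [this]; exact (norm_sub_le _ _).trans (by linarith)
  have t2 : ‖(B.e ξ).2 - (B.e η).2‖ ≤ 2*√δ := (norm_sub_le _ _).trans (by linarith)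
  have q1 : ‖(B.e ξ).1 - (B.e η).1‖^2/δ^2 ≤ 4 := by
    rw [div_le_iff₀ (by positivity)]
    have := pow_le_pow_left₀ (norm_nonneg _) t1 2
    linarith
  have q2 : ‖(B.e ξ).2 - (B.e η).2‖^2/√δ^2 ≤ 4 := by
    rw [div_le_iff₀ (by positivity)]
    have := pow_le_pow_left₀ (norm_nonneg _) t2 2
    linarith
  nlinarith [Real.pi_pos]

theorem upper_al {d a b : ℕ} (ha : 1 ≤ a) (s γ p C : ℝ) (hγ : 1 < γ) (hp : 2 < p) (hC : 0 < C) (B : Blk d a b) :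
    ∃ C' : ℝ, 0 < C' ∧ ∀ ε, 0 < ε → ε ≤ (1/8)^γ → ∀ g : ℝ → ℝ, Measurable g → (∀ r, 0 < g r) → (∀ r, |r-1| ≤ 1/2 → g r ≤ C*(ε + |r-1|^γ)) →
      ∃ t ∈ RayleighSet d s p g (BSym B), t ≤ C' * ε^(1-((a:ℝ)+b/2)*(1-2/p)/γ) := by
  have hp0 : 0 < p := by linarith
  set κ := Real.exp (-(8*π)) * (VB a * VB b) with hκ
  have hκ0 : 0 < κ := by have := VB_pos a; have := VB_pos b; positivity
  set r := √(p/(p-2)) with hr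
  have hr0 : 0 < r := Real.sqrt_pos.2 (div_pos hp0 (by linarith))
  set θ := 1 - 2/p with hθ
  set ρ := (r^a*r^b)^θ with hρ
  have hρ0 : 0 < ρ := Real.rpow_pos_of_pos (by positivity) _
  refine ⟨C*(1+2^γ)/(κ*ρ), by positivity, fun ε h0 h1 g hgm hg0 hg => ?_⟩
  set δ := ε^(1/γ) with hδ
  have hδ0 : 0 < δ := Real.rpow_pos_of_pos h0 _
  have hδγ : δ^γ = ε := by rw [hδ, ← Real.rpow_mul h0.le, one_div_mul_cancel (by linarith), Real.rpow_one]
  have hδ1 : δ ≤ 1/8 := by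
    have := Real.rpow_le_rpow h0.le h1 (by positivity : (0:ℝ) ≤ 1/γ)
    rwa [← Real.rpow_mul (by norm_num), mul_one_div_cancel (by linarith), Real.rpow_one] at this
  have hs0 : 0 < √δ := Real.sqrt_pos.2 hδ0
  have hbd := ks_bd B δ hδ0 hδ1
  have hv0 := ks_pos ha B δ hδ0 hδ1
  set v := (volume (KS B δ)).toReal with hv
  set Q := (r*δ)^a*(r*√δ)^b with hQ
  have hQ0 : 0 < Q := by positivity
  have hQθ : Q^θ = ρ * ε^(((a:ℝ)+b/2)*θ/γ) := by
    have : Q = (r^a*r^b) * ε^(((a:ℝ)+b/2)/γ) := by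
      rw [hQ, mul_pow, mul_pow, ← Real.rpow_natCast δ a, ← Real.rpow_natCast √δ b, Real.sqrt_eq_rpow, ← Real.rpow_mul hδ0.le, hδ, ← Real.rpow_mul h0.le, ← Real.rpow_mul h0.le]
      rw [show ((a:ℝ)+b/2)/γ = 1/γ*a + 1/γ*(1/2*b) by ring, Real.rpow_add h0]; ring
    rw [this, Real.mul_rpow (by positivity) (by positivity), ← Real.rpow_mul h0.le]
    congr 2; ring
  have hL : ENNReal.ofReal (κ * v * Q^θ) ≤ eLpNorm (𝓕⁻ (chi (KS B δ))) (ENNReal.ofReal p) volume^(2:ℝ) := by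
    have k1 := ga_form B δ √δ hδ0 hs0 (KS B δ) (ks_meas B δ) hbd κ (ks_kernel B δ hδ0 hδ1)
    have k2 := ga_holder B δ √δ p hp hδ0 hs0 (𝓕⁻ (chi (KS B δ))) (finv_cont _ (chi_int _ (ks_meas B δ) hbd)).measurable.aemeasurable
    rw [← hr, ← hQ, ← hθ] at k2
    rw [← hv] at k1
    clear_value κ
    have k3 := mul_le_mul' (k1.trans k2) (le_refl (ENNReal.ofReal (Q^θ)))
    rw [mul_assoc (_ ^ (2:ℝ)), ← ENNReal.ofReal_mul (by positivity), ← ENNReal.ofReal_mul (by positivity), Real.inv_rpow hQ0.le, inv_mul_cancel₀ (Real.rpow_pos_of_pos hQ0 _).ne', ENNReal.ofReal_one, mul_one] at k3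
    exact k3
  obtain ⟨t, ht, htl⟩ := test_upper s p hp B (KS B δ) (ks_meas B δ) hbd (fun ξ η h1 h2 h => by
    obtain ⟨h3, h4⟩ := h
    exact ⟨h1 ▸ h3, h2 ▸ h4⟩) g hg0 hgm (C*((1+2^γ)*ε)) (fun ξ hξ => by
      have hξ := ks_norm B δ hδ0 hδ1 ξ hξ
      refine (hg _ (by linarith)).trans (mul_le_mul_of_nonneg_left ?_ hC.le)
      have := Real.rpow_le_rpow (abs_nonneg _) hξ (by linarith : 0 ≤ γ)
      rw [Real.mul_rpow (by norm_num) hδ0.le, hδγ] at this; linarith) (κ * v * Q^θ) (by positivity) hL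
  refine ⟨t, ht, htl.trans (le_of_eq ?_)⟩
  rw [← hv, hQθ, Real.rpow_sub h0, Real.rpow_one]
  have : 0 < ε^(((a:ℝ)+b/2)*θ/γ) := Real.rpow_pos_of_pos h0 _
  field_simp

theorem rs_swap {d a b : ℕ} (B : Blk d a b) (s p : ℝ) (g : ℝ → ℝ) (t : ℝ) (h : t ∈ RayleighSet d s p g (BSym B.swap)) : t ∈ RayleighSet d s p g (BSym B) := by
  obtain ⟨u, h1, h2⟩ := h
  exact ⟨u, fun x y e1 e2 => h1 x y e2 e1, h2⟩

theorem upper_all (d k : ℕ) (hk1 : 1 ≤ k) (hkd : k + 1 ≤ d) (s γ p C : ℝ) (hγ : 1 < γ) (hp : 2 < p) (hC : 0 < C) :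
    ∃ C' : ℝ, 0 < C' ∧ ∀ ε, 0 < ε → ε ≤ (1/8)^γ → ∀ g : ℝ → ℝ, Measurable g → (∀ r, 0 < g r) → (∀ r, |r-1| ≤ 1/2 → g r ≤ C*(ε + |r-1|^γ)) →
      ∃ t ∈ RayleighSet d s p g (GkSymmetric d k), t ≤ C' * ε^(1- min 1 (alphaK d k p)/γ) := by
  have hset : ∀ g, RayleighSet d s p g (GkSymmetric d k) = RayleighSet d s p g (BSym (stdB d k (by omega))) := by
    intro g
    unfold RayleighSet
    simp_rw [gk_iff d k (by omega)]
  simp_rw [hset]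
  rcases le_total 1 (alphaK d k p) with h | h
  · rw [min_eq_left h]
    exact upper_one (by omega) s γ p C hγ hp hC _
  · rw [min_eq_right h, alpha_eq d k hk1 hkd]
    have hdk : ((d - k : ℕ):ℝ) = (d:ℝ) - k := by rw [Nat.cast_sub (by omega)]
    rcases le_total k (d-k) with h2 | h2
    · rw [min_eq_left h2]
      obtain ⟨C', h3, h4⟩ := upper_al hk1 s γ p C hγ hp hC (stdB d k (by omega)).swap
      refine ⟨C', h3, fun ε e0 e1 g g1 g2 g3 => ?_⟩
      obtain ⟨t, t1, t2⟩ := h4 ε e0 e1 g g1 g2 g3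
      refine ⟨t, rs_swap _ _ _ _ _ t1, t2.trans (le_of_eq ?_)⟩
      rw [hdk]; congr 3; ring
    · rw [min_eq_right h2]
      obtain ⟨C', h3, h4⟩ := upper_al (by omega) s γ p C hγ hp hC (stdB d k (by omega))
      refine ⟨C', h3, fun ε e0 e1 g g1 g2 g3 => ?_⟩
      obtain ⟨t, t1, t2⟩ := h4 ε e0 e1 g g1 g2 g3
      refine ⟨t, t1, t2.trans (le_of_eq ?_)⟩
      rw [hdk]; congr 3; ring
end

/-- Theorem 1.3, `G_k`-symmetric case: `R^k_ε(p) ≅ ε^{1-min(1,α_k)/γ}`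
as `ε → 0⁺`. -/
theorem stmt2 (d k : ℕ) (hd : 2 ≤ d) (hk1 : 1 ≤ k) (hkd : k ≤ d - 1)
    (s γ p c C : ℝ)
    (hs : (d : ℝ) / ((d : ℝ) + 1) < s) (hγ : 1 < γ)
    (hp : 2 < p) (hps : s < (d : ℝ) / 2 → p < 2 * (d : ℝ) / ((d : ℝ) - 2 * s))
    (hc : 0 < c) (hcC : c ≤ C) :
    ∃ c' C' ε₀ : ℝ, 0 < c' ∧ c' ≤ C' ∧ 0 < ε₀ ∧ ε₀ < 1 ∧
      ∀ g : ℝ → ℝ → ℝ, IsAdmissible s γ c C g →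
        ∀ ε : ℝ, 0 < ε → ε < ε₀ →
          c' * ε ^ (1 - min 1 (alphaK d k p) / γ)
              ≤ Rayleigh d s p (g ε) (GkSymmetric d k) ∧
            Rayleigh d s p (g ε) (GkSymmetric d k)
              ≤ C' * ε ^ (1 - min 1 (alphaK d k p) / γ) := by

  have hd0 : (0:ℝ) < d := by exact_mod_cast (by omega : 0 < d)
  have hs0 : 0 < s := lt_trans (by positivity) hs
  have hC : 0 < C := lt_of_lt_of_le hc hcC
  have hp0 : 0 < p := by linarith
  have hs' : (d:ℝ)*(1/2-1/p) < s := by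
    rcases lt_or_ge s ((d:ℝ)/2) with h | h
    · have h1 := hps h
      rw [lt_div_iff₀ (by linarith)] at h1
      have : (d:ℝ)*(1/2-1/p) = (d * p - 2*d)/(2*p) := by field_simp
      rw [this, div_lt_iff₀ (by positivity)]
      nlinarith
    · have : 0 < (d:ℝ) * (1/p) := by positivity
      linarith
  obtain ⟨c₁, hc₁, hlow⟩ := lower_bound d k hk1 (by omega) p γ s c C hp hγ hs0 hs' hc hcC
  obtain ⟨C₁, hC₁, hup⟩ := upper_all d k hk1 (by omega) s γ p C hγ hp hC
  refine ⟨c₁, max c₁ C₁, (1/8)^γ, hc₁, le_max_left _ _, Real.rpow_pos_of_pos (by norm_num) _, Real.rpow_lt_one (by norm_num) (by norm_num) (by linarith), fun g hg ε h0 h1 => ?_⟩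
  have hε1 : ε < 1 := h1.trans (Real.rpow_lt_one (by norm_num) (by norm_num) (by linarith))
  have hI : ε ∈ Set.Ioo (0:ℝ) 1 := ⟨h0, hε1⟩
  obtain ⟨t, ht, htl⟩ := hup ε h0 h1.le (g ε) (hg.1 ε hI) (hg.2.1 ε hI) (fun r hr => (hg.2.2.2 ε hI r hr).2)
  have hl := hlow g hg ε h0 hε1
  constructor
  · exact le_csInf ⟨t, ht⟩ hl
  · refine (csInf_le ⟨_, hl⟩ ht).trans (htl.trans ?_)
    exact mul_le_mul_of_nonneg_right (le_max_right _ _) (Real.rpow_nonneg h0.le _)
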